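/- Let F be an algebraically closed field of characteristic 0. If Q is a maximal finite abelian subgroup of Aut(𝔢₈) containing an element θ of order 4 whose fixed subalgebra 𝔢₈^θ is semisimple of dimension 66 (equivalently, 𝔢₈^θ ≅ 𝔰𝔩₂(F) ⊕ 𝔰𝔩₈(F), i.e. θ is an order-4 automorphism of type I), then Q is isomorphic to ℤ₄³ × ℤ₂². -/

import Mathlib

open LieAlgebra

/-- The group of automorphisms of a Lie algebra, realized as the subgroup of the group
of linear automorphisms consisting of those preserving the bracket. -/
def lieAut (R L : Type*) [CommRing R] [LieRing L] [LieAlgebra R L] :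
    Subgroup (L ≃ₗ[R] L) where
  carrier := {e | ∀ x y : L, e ⁅x, y⁆ = ⁅e x, e y⁆}
  one_mem' := fun _ _ => rfl
  mul_mem' := by
    intro f g hf hg x y
    show f (g ⁅x, y⁆) = _
    rw [hg]
    exact hf _ _
  inv_mem' := by
    intro f hf x y
    apply f.injective
    show f (f.symm ⁅x, y⁆) = f ⁅f.symm x, f.symm y⁆
    rw [hf (f.symm x) (f.symm y), f.apply_symm_apply, f.apply_symm_apply, f.apply_symm_apply]

/-- The subalgebra of fixed points of an automorphism of a Lie algebra. -/
def fixedSubalgebra {R L : Type*} [CommRing R] [LieRing L] [LieAlgebra R L]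
    (θ : lieAut R L) : LieSubalgebra R L where
  carrier := {x | (θ : L ≃ₗ[R] L) x = x}
  add_mem' := by
    intro a b ha hb
    simp only [Set.mem_setOf_eq] at *
    rw [map_add, ha, hb]
  zero_mem' := map_zero _
  smul_mem' := by
    intro c a ha
    simp only [Set.mem_setOf_eq] at *
    rw [map_smul, ha]
  lie_mem' := by
    intro a b ha hb
    simp only [Set.mem_setOf_eq] at *
    rw [θ.2 a b, ha, hb]

/-- A maximal finite abelian subgroup: a finite abelian subgroup which is maximal among
all abelian subgroups. -/
def IsMaximalFiniteAbelian {G : Type*} [Group G] (Q : Subgroup G) : Prop :=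
  Finite Q ∧ (∀ a b, a ∈ Q → b ∈ Q → a * b = b * a) ∧
    ∀ Q' : Subgroup G, (∀ a b, a ∈ Q' → b ∈ Q' → a * b = b * a) → Q ≤ Q' → Q' = Q

/-- Two subgroups are conjugate. -/
def SubgroupIsConj {G : Type*} [Group G] (Q₁ Q₂ : Subgroup G) : Prop :=
  ∃ g : G, Q₂ = Q₁.map (MulAut.conj g).toMonoidHom
namespace E8P

/-- Integral weights, in coordinates with respect to the simple roots. -/
abbrev V8 := Fin 8 → ℤ

/-- The pairing of a weight with the simple coroots. -/
def ca (n : V8) : V8 := ![2 * n 0 - n 2, 2 * n 1 - n 3, 2 * n 2 - n 0 - n 3,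
  2 * n 3 - n 1 - n 2 - n 4, 2 * n 4 - n 3 - n 5, 2 * n 5 - n 4 - n 6,
  2 * n 6 - n 5 - n 7, 2 * n 7 - n 6]

lemma ca_eq (n : V8) (i : Fin 8) : ca n i = ∑ j, CartanMatrix.E₈ i j * n j := by
  fin_cases i <;> simp [ca, CartanMatrix.E₈, Fin.sum_univ_eight] <;> ring

/-- The symmetric bilinear form. -/
def bf (m n : V8) : ℤ := ∑ i, m i * ca n i

lemma bf_def (m n : V8) : bf m n = m 0 * (2 * n 0 - n 2) + m 1 * (2 * n 1 - n 3) +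
    m 2 * (2 * n 2 - n 0 - n 3) + m 3 * (2 * n 3 - n 1 - n 2 - n 4) +
    m 4 * (2 * n 4 - n 3 - n 5) + m 5 * (2 * n 5 - n 4 - n 6) +
    m 6 * (2 * n 6 - n 5 - n 7) + m 7 * (2 * n 7 - n 6) := by
  simp [bf, ca, Fin.sum_univ_eight]

lemma bf_comm (m n : V8) : bf m n = bf n m := by simp only [bf_def]; ring
lemma bf_add_left (a b n : V8) : bf (a + b) n = bf a n + bf b n := by
  simp only [bf_def, Pi.add_apply]; ring
lemma bf_smul_left (t : ℤ) (a n : V8) : bf (t • a) n = t * bf a n := by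
  simp only [bf_def, Pi.smul_apply, smul_eq_mul]; ring
lemma bf_neg_left (a n : V8) : bf (-a) n = - bf a n := by
  simp only [bf_def, Pi.neg_apply]; ring
lemma bf_add_right (n a b : V8) : bf n (a + b) = bf n a + bf n b := by
  rw [bf_comm, bf_add_left, bf_comm a, bf_comm b]
lemma bf_neg_right (n a : V8) : bf n (-a) = - bf n a := by
  rw [bf_comm, bf_neg_left, bf_comm a]
lemma bf_smul_right (t : ℤ) (n a : V8) : bf n (t • a) = t * bf n a := by
  rw [bf_comm, bf_smul_left, bf_comm a]
lemma bf_sub_left (a b n : V8) : bf (a - b) n = bf a n - bf b n := by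
  rw [sub_eq_add_neg, bf_add_left, bf_neg_left]; ring
lemma bf_sub_right (n a b : V8) : bf n (a - b) = bf n a - bf n b := by
  rw [sub_eq_add_neg, bf_add_right, bf_neg_right]; ring
lemma ca_add (m n : V8) : ca (m + n) = ca m + ca n := by
  ext i; simp only [ca_eq, Pi.add_apply, mul_add, Finset.sum_add_distrib]
lemma ca_neg (n : V8) : ca (-n) = - ca n := by
  ext i; simp only [ca_eq, Pi.neg_apply, mul_neg, Finset.sum_neg_distrib]
lemma ca_zero : ca 0 = 0 := by
  ext i; simp [ca_eq]

/-- simple root -/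
def al (i : Fin 8) : V8 := Pi.single i 1

lemma bf_al_left (i : Fin 8) (n : V8) : bf (al i) n = ca n i := by
  simp [bf, al, Pi.single_apply]
lemma bf_al_right (i : Fin 8) (n : V8) : bf n (al i) = ca n i := by
  rw [bf_comm, bf_al_left]
lemma ca_al (i j : Fin 8) : ca (al i) j = CartanMatrix.E₈ j i := by
  simp [ca_eq, al, Pi.single_apply]
lemma E8_symm (i j : Fin 8) : CartanMatrix.E₈ i j = CartanMatrix.E₈ j i := by
  fin_cases i <;> fin_cases j <;> rfl
lemma E8_diag (i : Fin 8) : CartanMatrix.E₈ i i = 2 := by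
  fin_cases i <;> rfl
lemma bf_al_al (i : Fin 8) : bf (al i) (al i) = 2 := by
  rw [bf_al_left, ca_al, E8_diag]

lemma bf_sos (n : V8) : 60 * bf n n = 30 * (2 * n 7 - n 6) ^ 2 + 10 * (3 * n 6 - 2 * n 5) ^ 2
    + 5 * (4 * n 5 - 3 * n 4) ^ 2 + 3 * (5 * n 4 - 4 * n 3) ^ 2 + 30 * (2 * n 0 - n 2) ^ 2
    + 10 * (3 * n 2 - 2 * n 3) ^ 2 + 30 * (2 * n 1 - n 3) ^ 2 + 2 * (n 3) ^ 2 := by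
  rw [bf_def]; ring

lemma bf_even (n : V8) : ∃ t, bf n n = 2 * t :=
  ⟨n 0 * n 0 + n 1 * n 1 + n 2 * n 2 + n 3 * n 3 + n 4 * n 4 + n 5 * n 5 + n 6 * n 6 + n 7 * n 7
    - n 0 * n 2 - n 1 * n 3 - n 2 * n 3 - n 3 * n 4 - n 4 * n 5 - n 5 * n 6 - n 6 * n 7,
    by rw [bf_def]; ring⟩

lemma bf_pos (n : V8) (hn : n ≠ 0) : 2 ≤ bf n n := by
  obtain ⟨t, ht⟩ := bf_even n
  by_contra hlt
  have h0 : bf n n ≤ 0 := by omega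
  have hs := bf_sos n
  have a1 := sq_nonneg (2 * n 7 - n 6)
  have a2 := sq_nonneg (3 * n 6 - 2 * n 5)
  have a3 := sq_nonneg (4 * n 5 - 3 * n 4)
  have a4 := sq_nonneg (5 * n 4 - 4 * n 3)
  have a5 := sq_nonneg (2 * n 0 - n 2)
  have a6 := sq_nonneg (3 * n 2 - 2 * n 3)
  have a7 := sq_nonneg (2 * n 1 - n 3)
  have a8 := sq_nonneg (n 3)
  have b1 : (2 * n 7 - n 6) ^ 2 = 0 := by linarith
  have b2 : (3 * n 6 - 2 * n 5) ^ 2 = 0 := by linarith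
  have b3 : (4 * n 5 - 3 * n 4) ^ 2 = 0 := by linarith
  have b4 : (5 * n 4 - 4 * n 3) ^ 2 = 0 := by linarith
  have b5 : (2 * n 0 - n 2) ^ 2 = 0 := by linarith
  have b6 : (3 * n 2 - 2 * n 3) ^ 2 = 0 := by linarith
  have b7 : (2 * n 1 - n 3) ^ 2 = 0 := by linarith
  have b8 : (n 3) ^ 2 = 0 := by linarith
  simp only [sq_eq_zero_iff] at b1 b2 b3 b4 b5 b6 b7 b8
  apply hn
  ext i; fin_cases i <;> simp <;> omega

lemma ca_inj {m n : V8} (h : ca m = ca n) : m = n := by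
  by_contra hne
  have := bf_pos (m - n) (sub_ne_zero.mpr hne)
  have h2 : ca (m - n) = 0 := by rw [sub_eq_add_neg, ca_add, ca_neg, h]; simp
  simp [bf, h2] at this

/-- Simple reflection. -/
def sr (i : Fin 8) (n : V8) : V8 := n - ca n i • al i

lemma bf_sr (i : Fin 8) (m n : V8) : bf (sr i m) (sr i n) = bf m n := by
  have h : ca (m - ca m i • al i) i = - ca m i := by
    rw [← bf_al_left, bf_sub_right, bf_smul_right, bf_al_al, bf_al_left]; ring
  simp only [sr, bf_sub_left, bf_sub_right, bf_smul_left, bf_smul_right, bf_al_left, bf_al_right]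
  rw [h]; ring

lemma sr_sr (i : Fin 8) (n : V8) : sr i (sr i n) = n := by
  have h : ca (sr i n) i = - ca n i := by
    rw [← bf_al_left, sr, bf_sub_right, bf_smul_right, bf_al_al, bf_al_left]; ring
  rw [sr, h, sr]; simp

lemma sr_apply_ne {i j : Fin 8} (h : j ≠ i) (n : V8) : sr i n j = n j := by
  simp [sr, al, h]
lemma sr_apply_self (i : Fin 8) (n : V8) : sr i n i = n i - ca n i := by
  simp [sr, al]

lemma sr_neg (i : Fin 8) (n : V8) : sr i (-n) = - sr i n := by
  simp only [sr, ca_neg, Pi.neg_apply, neg_smul]; abel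

lemma exists_step (n : V8) (h0 : 0 ≤ n) (hn : n ≠ 0) : ∃ i, 0 < n i ∧ 0 < ca n i := by
  by_contra hcon
  push Not at hcon
  have := bf_pos n hn
  have h2 : bf n n ≤ 0 := by
    apply Finset.sum_nonpos
    intro i _
    have hi : 0 ≤ n i := h0 i
    rcases hi.lt_or_eq with h | h
    · exact mul_nonpos_of_nonneg_of_nonpos hi (hcon i h)
    · rw [← h]; simp
  omega

/-- Height. -/
def ht (n : V8) : ℤ := ∑ i, n i

lemma ht_sr (i : Fin 8) (n : V8) : ht (sr i n) = ht n - ca n i := by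
  simp only [ht, sr, al, Pi.sub_apply, Finset.sum_sub_distrib]
  simp [Pi.single_apply]

/-- Norm two vectors are positive or negative. -/
lemma root_sign (n : V8) (h : bf n n = 2) : 0 ≤ n ∨ 0 ≤ -n := by
  by_contra hcon
  push Not at hcon
  let p : V8 := fun i => max (n i) 0
  let r : V8 := fun i => max (-n i) 0
  have hnpr : n = p - r := by
    ext i; simp only [p, r, Pi.sub_apply]
    rcases le_total 0 (n i) with h | h
    · rw [max_eq_left h, max_eq_right (by omega)]; omega
    · rw [max_eq_right h, max_eq_left (by omega)]; omega
  have hp : p ≠ 0 := by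
    intro hp; apply hcon.2; intro i
    have := congr_fun hp i
    simp only [p, Pi.zero_apply] at this
    have h2 := le_max_left (n i) 0
    simp only [Pi.zero_apply, Pi.neg_apply]; omega
  have hr : r ≠ 0 := by
    intro hr; apply hcon.1; intro i
    have := congr_fun hr i
    simp only [r, Pi.zero_apply] at this
    have h2 := le_max_left (-n i) 0
    simp only [Pi.zero_apply]; omega
  have hpr : bf p r ≤ 0 := by
    have p0 : ∀ i, 0 ≤ p i := fun i => le_max_right _ _
    have r0 : ∀ i, 0 ≤ r i := fun i => le_max_right _ _
    have z : ∀ i, p i * r i = 0 := by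
      intro i; simp only [p, r]
      rcases le_total 0 (n i) with h | h
      · rw [max_eq_right (a := -n i) (by omega), mul_zero]
      · rw [max_eq_right h, zero_mul]
    have m : ∀ i j, 0 ≤ p i * r j := fun i j => mul_nonneg (p0 i) (r0 j)
    rw [bf_def]
    nlinarith [z 0, z 1, z 2, z 3, z 4, z 5, z 6, z 7, m 0 2, m 2 0, m 1 3, m 3 1, m 2 3, m 3 2,
      m 3 4, m 4 3, m 4 5, m 5 4, m 5 6, m 6 5, m 6 7, m 7 6]
  have e : bf n n = bf p p + bf r r - 2 * bf p r := by
    rw [hnpr, bf_sub_left, bf_sub_right, bf_sub_right, bf_comm r p]; ring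
  have := bf_pos p hp
  have := bf_pos r hr
  omega

/-- Induction principle: properties of roots. -/
lemma root_induction (P : V8 → Prop) (h1 : ∀ i, P (al i)) (hneg : ∀ n, bf n n = 2 → P n → P (-n))
    (hs : ∀ i n, bf n n = 2 → 0 ≤ n → P n → P (sr i n)) : ∀ n, bf n n = 2 → P n := by
  have key : ∀ k : ℕ, ∀ n, bf n n = 2 → 0 ≤ n → ht n ≤ k → P n := by
    intro k
    induction k with
    | zero =>
      intro n hn h0 hk
      exfalso
      have : n = 0 := by
        ext i
        have := Finset.single_le_sum (f := n) (fun j _ => h0 j) (Finset.mem_univ i)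
        have h2 : 0 ≤ n i := h0 i
        simp only [ht] at hk
        simp only [Pi.zero_apply]; push_cast at hk; omega
      rw [this] at hn; simp [bf] at hn
    | succ k ih =>
      intro n hn h0 hk
      have hne : n ≠ 0 := by rintro rfl; simp [bf] at hn
      obtain ⟨i, hi, hc⟩ := exists_step n h0 hne
      have hq : bf (sr i n) (sr i n) = 2 := by rw [bf_sr, hn]
      rcases root_sign _ hq with hp | hp
      · have := hs i _ hq hp (ih _ hq hp (by rw [ht_sr]; push_cast at hk; omega))
        rwa [sr_sr] at this
      · -- then `n` is a multiple of a simple root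
        have hz : ∀ j, j ≠ i → n j = 0 := by
          intro j hj
          have h3 : 0 ≤ -(sr i n) j := hp j
          rw [sr_apply_ne hj] at h3
          have : 0 ≤ n j := h0 j
          omega
        have hn' : n = n i • al i := by
          ext j
          by_cases hj : j = i
          · subst hj; simp [al]
          · simp [al, hj, hz j hj]
        have : bf n n = n i * (n i * 2) := by
          conv_lhs => rw [hn']
          rw [bf_smul_left, bf_smul_right, bf_al_al]
        have h1' : n i = 1 := by nlinarith
        rw [hn', h1', one_smul]; exact h1 i
  have key' : ∀ n, bf n n = 2 → 0 ≤ n → P n := fun n hn h0 =>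
    key (ht n).toNat n hn h0 (Int.self_le_toNat _)
  intro n hn
  rcases root_sign n hn with h | h
  · exact key' n hn h
  · have hb : bf (-n) (-n) = 2 := by rw [bf_neg_left, bf_neg_right, neg_neg, hn]
    have := hneg _ hb (key' _ hb h)
    rwa [neg_neg] at this

end E8P
namespace E8P
open LieAlgebra LieModule
set_option linter.unusedSectionVars false

/-- A system of `E₈` Chevalley generators in a Lie algebra. -/
structure E8D (F L : Type*) [Field F] [LieRing L] [LieAlgebra F L] where
  h : Fin 8 → L
  e : Fin 8 → L
  f : Fin 8 → L
  hh : ∀ i j, ⁅h i, h j⁆ = 0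
  ef : ∀ i, ⁅e i, f i⁆ = h i
  ef_ne : ∀ i j, i ≠ j → ⁅e i, f j⁆ = 0
  he : ∀ i j, ⁅h i, e j⁆ = ((CartanMatrix.E₈ i j : ℤ) : F) • e j
  hf : ∀ i j, ⁅h i, f j⁆ = -(((CartanMatrix.E₈ i j : ℤ) : F) • f j)
  ee : ∀ i j, i ≠ j → ⁅e i, ⁅e i, e j⁆⁆ = 0
  ff : ∀ i j, i ≠ j → ⁅f i, ⁅f i, f j⁆⁆ = 0
  gen : LieSubalgebra.lieSpan F L (Set.range e ∪ Set.range f) = ⊤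

variable {F L : Type*} [Field F] [LieRing L] [LieAlgebra F L]

/-- The opposite system. -/
def E8D.symm (D : E8D F L) : E8D F L where
  h := fun i => - D.h i
  e := D.f
  f := D.e
  hh := by intro i j; simp [D.hh]
  ef := by intro i; rw [← lie_skew, D.ef]
  ef_ne := by intro i j h; rw [← lie_skew, D.ef_ne _ _ h.symm, neg_zero]
  he := by intro i j; rw [neg_lie, D.hf, neg_neg]
  hf := by intro i j; rw [neg_lie, D.he]
  ee := D.ff
  ff := D.ee
  gen := by rw [Set.union_comm, D.gen]

/-- Transport by an automorphism. -/
def E8D.map (D : E8D F L) (g : L ≃ₗ⁅F⁆ L) : E8D F L where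
  h := fun i => g (D.h i)
  e := fun i => g (D.e i)
  f := fun i => g (D.f i)
  hh := by intro i j; rw [← LieEquiv.map_lie, D.hh, map_zero]
  ef := by intro i; rw [← LieEquiv.map_lie, D.ef]
  ef_ne := by intro i j h; rw [← LieEquiv.map_lie, D.ef_ne _ _ h, map_zero]
  he := by intro i j; rw [← LieEquiv.map_lie, D.he, map_smul]
  hf := by intro i j; rw [← LieEquiv.map_lie, D.hf, map_neg, map_smul]
  ee := by intro i j h; rw [← LieEquiv.map_lie, ← LieEquiv.map_lie, D.ee _ _ h, map_zero]
  ff := by intro i j h; rw [← LieEquiv.map_lie, ← LieEquiv.map_lie, D.ff _ _ h, map_zero]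
  gen := by
    have h : LieSubalgebra.lieSpan F L (Set.range D.e ∪ Set.range D.f) ≤
        (LieSubalgebra.lieSpan F L ((Set.range fun i => g (D.e i)) ∪
          Set.range fun i => g (D.f i))).comap (g : L →ₗ⁅F⁆ L) := by
      rw [LieSubalgebra.lieSpan_le]
      rintro _ (⟨i, rfl⟩ | ⟨i, rfl⟩)
      · exact LieSubalgebra.subset_lieSpan (Or.inl ⟨i, rfl⟩)
      · exact LieSubalgebra.subset_lieSpan (Or.inr ⟨i, rfl⟩)
    rw [D.gen] at h
    rw [eq_top_iff]
    intro x _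
    have := h (show g.symm x ∈ ⊤ from trivial)
    change g (g.symm x) ∈ LieSubalgebra.lieSpan F L _ at this
    simpa using this

/-- Weight spaces. -/
def E8D.wsp (D : E8D F L) (n : V8) : Submodule F L where
  carrier := {x | ∀ i, ⁅D.h i, x⁆ = ((ca n i : ℤ) : F) • x}
  add_mem' := by intro a b ha hb i; rw [lie_add, ha i, hb i, smul_add]
  zero_mem' := by intro i; simp
  smul_mem' := by intro c a ha i; rw [lie_smul, ha i, smul_comm]

variable (D : E8D F L)

lemma mem_wsp {n : V8} {x : L} : x ∈ D.wsp n ↔ ∀ i, ⁅D.h i, x⁆ = ((ca n i : ℤ) : F) • x := Iff.rfl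

lemma lie_wsp {m n : V8} {x y : L} (hx : x ∈ D.wsp m) (hy : y ∈ D.wsp n) :
    ⁅x, y⁆ ∈ D.wsp (m + n) := by
  intro i
  rw [leibniz_lie, hx i, hy i, smul_lie, lie_smul, ← add_smul, ca_add, Pi.add_apply]
  push_cast; rfl

lemma e_mem_wsp (i : Fin 8) : D.e i ∈ D.wsp (al i) := by
  intro j; rw [D.he, ca_al]
lemma f_mem_wsp (i : Fin 8) : D.f i ∈ D.wsp (- al i) := by
  intro j; rw [D.hf, ca_neg, Pi.neg_apply, ca_al]; simp
lemma h_mem_wsp (i : Fin 8) : D.h i ∈ D.wsp 0 := by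
  intro j; rw [D.hh, ca_zero]; simp
lemma symm_wsp (n : V8) : D.symm.wsp n = D.wsp (-n) := by
  ext x
  rw [mem_wsp, mem_wsp]
  refine forall_congr' fun i => ?_
  change ⁅-D.h i, x⁆ = _ ↔ _
  rw [neg_lie, ca_neg, neg_eq_iff_eq_neg]; simp

lemma wsp_indep [CharZero F] : iSupIndep D.wsp := by
  have h1 := Module.End.independent_iInf_maxGenEigenspace_of_forall_mapsTo
    (fun i : Fin 8 => ad F L (D.h i)) (by
      intro i j φ
      apply Module.End.mapsTo_maxGenEigenspace_of_comm
      refine LinearMap.ext fun x => ?_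
      simp only [Module.End.mul_apply, ad_apply]
      rw [leibniz_lie, D.hh, zero_lie, zero_add])
  have hinj : Function.Injective (fun n : V8 => fun i => ((ca n i : ℤ) : F)) := by
    intro m n h
    apply ca_inj
    ext i
    have h2 : ((ca m i : ℤ) : F) = ((ca n i : ℤ) : F) := congr_fun h i
    exact_mod_cast h2
  refine (h1.comp hinj).mono ?_
  intro n x hx
  simp only [Function.comp_apply, Submodule.mem_iInf]
  intro i
  apply Module.End.mem_maxGenEigenspace _ _ _ |>.mpr
  refine ⟨1, ?_⟩
  rw [pow_one, LinearMap.sub_apply, ad_apply, hx i]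
  simp

/-- Words in the positive generators. -/
def E8D.wd (D : E8D F L) : List (Fin 8) → Fin 8 → L
  | [], i => D.e i
  | j :: l, i => ⁅D.e j, D.wd l i⁆

/-- Content of a word. -/
def cont : List (Fin 8) → Fin 8 → V8
  | [], i => al i
  | j :: l, i => al j + cont l i

lemma wd_mem (l : List (Fin 8)) (i : Fin 8) : D.wd l i ∈ D.wsp (cont l i) := by
  induction l with
  | nil => exact e_mem_wsp D i
  | cons j l ih => exact lie_wsp D (e_mem_wsp D j) ih

lemma al_nonneg (i : Fin 8) : 0 ≤ al i := by
  intro j; simp only [al, Pi.single_apply, Pi.zero_apply]; split_ifs <;> norm_num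

lemma cont_nonneg (l : List (Fin 8)) (i : Fin 8) : 0 ≤ cont l i := by
  induction l with
  | nil => exact al_nonneg i
  | cons j l ih => exact add_nonneg (al_nonneg j) ih

lemma ht_al (i : Fin 8) : ht (al i) = 1 := by simp [ht, al]

lemma ht_cont (l : List (Fin 8)) (i : Fin 8) : ht (cont l i) = l.length + 1 := by
  induction l with
  | nil => simp [cont, ht_al]
  | cons j l ih =>
    have : ht (al j + cont l i) = ht (al j) + ht (cont l i) := by
      simp [ht, Finset.sum_add_distrib]
    rw [cont, this, ih, ht_al]; simp; ring

/-- The family of spanning elements. -/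
def E8D.gn (D : E8D F L) : Fin 8 ⊕ ((List (Fin 8) × Fin 8) ⊕ (List (Fin 8) × Fin 8)) → L
  | .inl i => D.h i
  | .inr (.inl p) => D.wd p.1 p.2
  | .inr (.inr p) => D.symm.wd p.1 p.2

/-- Their weights. -/
def gw : Fin 8 ⊕ ((List (Fin 8) × Fin 8) ⊕ (List (Fin 8) × Fin 8)) → V8
  | .inl _ => 0
  | .inr (.inl p) => cont p.1 p.2
  | .inr (.inr p) => - cont p.1 p.2

lemma gn_mem (a) : D.gn a ∈ D.wsp (gw a) := by
  rcases a with i | p | p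
  · exact h_mem_wsp D i
  · exact wd_mem D _ _
  · have := wd_mem D.symm p.1 p.2
    rwa [symm_wsp] at this

/-- span of the `h` and positive words -/
def E8D.mp (D : E8D F L) : Submodule F L :=
  Submodule.span F (Set.range D.h ∪ Set.range (fun p : List (Fin 8) × Fin 8 => D.wd p.1 p.2))

lemma mp_wd (l i) : D.wd l i ∈ D.mp := Submodule.subset_span (Or.inr ⟨(l, i), rfl⟩)
lemma mp_h (i) : D.h i ∈ D.mp := Submodule.subset_span (Or.inl ⟨i, rfl⟩)

lemma mp_e (j : Fin 8) {x : L} (hx : x ∈ D.mp) : ⁅D.e j, x⁆ ∈ D.mp := by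
  induction hx using Submodule.span_induction with
  | mem x hx =>
    rcases hx with ⟨i, rfl⟩ | ⟨p, rfl⟩
    · rw [← lie_skew, D.he]
      exact neg_mem (Submodule.smul_mem _ _ (mp_wd D [] j))
    · exact mp_wd D (j :: p.1) p.2
  | zero => simp
  | add x y _ _ hx hy => rw [lie_add]; exact add_mem hx hy
  | smul t x _ hx => rw [lie_smul]; exact Submodule.smul_mem _ _ hx

lemma mp_f_wd (j : Fin 8) (l : List (Fin 8)) (i : Fin 8) : ⁅D.f j, D.wd l i⁆ ∈ D.mp := by
  induction l with
  | nil =>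
    change ⁅D.f j, D.e i⁆ ∈ _
    rw [← lie_skew]
    by_cases h : i = j
    · subst h; rw [D.ef]; exact neg_mem (mp_h D i)
    · rw [D.ef_ne _ _ h]; simp
  | cons k l ih =>
    change ⁅D.f j, ⁅D.e k, D.wd l i⁆⁆ ∈ _
    rw [leibniz_lie]
    refine add_mem ?_ (mp_e D k ih)
    rw [← lie_skew (D.f j)]
    by_cases h : k = j
    · subst h; rw [D.ef, neg_lie, wd_mem D l i k]
      exact neg_mem (Submodule.smul_mem _ _ (mp_wd D l i))
    · rw [D.ef_ne _ _ h]; simp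

lemma gn_e (j : Fin 8) {x : L} (hx : x ∈ Submodule.span F (Set.range D.gn)) :
    ⁅D.e j, x⁆ ∈ Submodule.span F (Set.range D.gn) := by
  have m1 : D.mp ≤ Submodule.span F (Set.range D.gn) := by
    apply Submodule.span_mono
    rintro _ (⟨i, rfl⟩ | ⟨p, rfl⟩)
    · exact ⟨.inl i, rfl⟩
    · exact ⟨.inr (.inl p), rfl⟩
  have m2 : D.symm.mp ≤ Submodule.span F (Set.range D.gn) := by
    apply Submodule.span_le.mpr
    rintro _ (⟨i, rfl⟩ | ⟨p, rfl⟩)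
    · exact neg_mem (Submodule.subset_span ⟨.inl i, rfl⟩)
    · exact Submodule.subset_span ⟨.inr (.inr p), rfl⟩
  induction hx using Submodule.span_induction with
  | mem x hx =>
    obtain ⟨i | p | p, rfl⟩ := hx
    · exact m1 (mp_e D j (mp_h D i))
    · exact m1 (mp_e D j (mp_wd D p.1 p.2))
    · exact m2 (mp_f_wd D.symm j p.1 p.2)
  | zero => simp
  | add x y _ _ hx hy => rw [lie_add]; exact add_mem hx hy
  | smul t x _ hx => rw [lie_smul]; exact Submodule.smul_mem _ _ hx

lemma symm_symm : D.symm.symm = D := by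
  cases D; simp [E8D.symm]

lemma span_gn_symm : Submodule.span F (Set.range D.symm.gn) ≤ Submodule.span F (Set.range D.gn) := by
  apply Submodule.span_le.mpr
  rintro _ ⟨i | p | p, rfl⟩
  · exact neg_mem (Submodule.subset_span ⟨.inl i, rfl⟩)
  · exact Submodule.subset_span ⟨.inr (.inr p), rfl⟩
  · refine Submodule.subset_span ⟨.inr (.inl p), ?_⟩
    change D.wd _ _ = D.symm.symm.wd _ _
    rw [symm_symm]

lemma span_gn : Submodule.span F (Set.range D.gn) = ⊤ := by
  set M := Submodule.span F (Set.range D.gn) with hM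
  have hM' : M = Submodule.span F (Set.range D.symm.gn) := by
    apply le_antisymm _ (span_gn_symm D)
    have := span_gn_symm D.symm
    rwa [symm_symm] at this
  -- everything stabilises M
  have st : ∀ x : L, ∀ m ∈ M, ⁅x, m⁆ ∈ M := by
    intro x
    have hx : x ∈ LieSubalgebra.lieSpan F L (Set.range D.e ∪ Set.range D.f) := by
      rw [D.gen]; trivial
    induction hx using LieSubalgebra.lieSpan_induction with
    | mem x hx =>
      intro m hm
      rcases hx with ⟨i, rfl⟩ | ⟨i, rfl⟩
      · exact gn_e D i hm
      · rw [hM'] at hm ⊢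
        exact gn_e D.symm i hm
    | zero => intro m _; simp
    | add x y _ _ hx hy => intro m hm; rw [add_lie]; exact add_mem (hx m hm) (hy m hm)
    | smul t x _ hx => intro m hm; rw [smul_lie]; exact Submodule.smul_mem _ _ (hx m hm)
    | lie x y _ _ hx hy =>
      intro m hm; rw [lie_lie]; exact sub_mem (hx _ (hy m hm)) (hy _ (hx m hm))
  rw [eq_top_iff]
  intro x _
  have hx : x ∈ LieSubalgebra.lieSpan F L (Set.range D.e ∪ Set.range D.f) := by
    rw [D.gen]; trivial
  induction hx using LieSubalgebra.lieSpan_induction with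
  | mem x hx =>
    rcases hx with ⟨i, rfl⟩ | ⟨i, rfl⟩
    · exact Submodule.subset_span ⟨.inr (.inl ([], i)), rfl⟩
    · exact Submodule.subset_span ⟨.inr (.inr ([], i)), rfl⟩
  | zero => exact zero_mem _
  | add x y _ _ hx hy => exact add_mem (hx trivial) (hy trivial)
  | smul t x _ hx => exact Submodule.smul_mem _ _ (hx trivial)
  | lie x y _ _ hx hy => exact st x _ (hy trivial)

lemma wsp_le [CharZero F] (n : V8) :
    D.wsp n ≤ Submodule.span F (D.gn '' {a | gw a = n}) := by
  intro x hx
  let P : V8 → Submodule F L := fun m => Submodule.span F (D.gn '' {a | gw a = m})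
  have hP : ∀ m, P m ≤ D.wsp m := by
    intro m
    apply Submodule.span_le.mpr
    rintro _ ⟨a, ha, rfl⟩
    have := gn_mem D a
    rwa [show gw a = m from ha] at this
  have htop : x ∈ P n ⊔ ⨆ m, ⨆ (_ : m ≠ n), D.wsp m := by
    have : (⊤ : Submodule F L) ≤ P n ⊔ ⨆ m, ⨆ (_ : m ≠ n), D.wsp m := by
      rw [← span_gn D]
      apply Submodule.span_le.mpr
      rintro _ ⟨a, rfl⟩
      by_cases h : gw a = n
      · exact Submodule.mem_sup_left (Submodule.subset_span ⟨a, h, rfl⟩)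
      · refine Submodule.mem_sup_right ?_
        exact Submodule.mem_iSup_of_mem (gw a) (Submodule.mem_iSup_of_mem h (gn_mem D a))
    exact this trivial
  obtain ⟨a, ha, b, hb, rfl⟩ := Submodule.mem_sup.mp htop
  have h1 : b ∈ D.wsp n := by
    have := sub_mem hx (hP n ha)
    simpa using this
  have := (Submodule.disjoint_def.mp (wsp_indep D n)) b h1 hb
  rw [this, add_zero]; exact ha

lemma wsp_sign [CharZero F] {n : V8} (h : D.wsp n ≠ ⊥) : 0 ≤ n ∨ 0 ≤ -n := by
  by_contra hcon
  push Not at hcon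
  apply h
  rw [eq_bot_iff]
  refine (wsp_le D n).trans ?_
  apply Submodule.span_le.mpr
  rintro _ ⟨i | p | p, ha, rfl⟩
  · exfalso; apply hcon.1; rw [← show (0 : V8) = n from ha]
  · exfalso; apply hcon.1; rw [← show _ = n from ha]; exact cont_nonneg _ _
  · exfalso; apply hcon.2; rw [← show -cont p.1 p.2 = n from ha, neg_neg]; exact cont_nonneg _ _

/-- a word all of whose letters coincide -/
lemma wd_const (l : List (Fin 8)) (i : Fin 8) (k : ℤ) (h : cont l i = k • al i ∨ True)
    (hl : ∀ j ∈ l, j = i) (hne : l ≠ []) : D.wd l i = 0 := by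
  induction l with
  | nil => exact absurd rfl hne
  | cons j l ih =>
    have hj : j = i := hl j (by simp)
    subst hj
    change ⁅D.e j, D.wd l j⁆ = 0
    by_cases h0 : l = []
    · subst h0; simp [E8D.wd]
    · rw [ih (Or.inr trivial) (fun a ha => hl a (by simp [ha])) h0]; simp

lemma cont_pos_of_mem (l : List (Fin 8)) (i : Fin 8) : 0 < cont l i i ∧ ∀ j ∈ l, 0 < cont l i j := by
  induction l with
  | nil => simp [cont, al]
  | cons k l ih =>
    have a0 : ∀ j, 0 ≤ al k j := al_nonneg k
    refine ⟨?_, ?_⟩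
    · have := ih.1; have := a0 i; simp only [cont, Pi.add_apply]; omega
    · intro j hj
      rcases List.mem_cons.mp hj with rfl | hj
      · have h1 : 0 ≤ cont l i j := cont_nonneg l i j
        have h2 : al j j = 1 := by simp [al]
        simp only [cont, Pi.add_apply]; omega
      · have := ih.2 j hj; have := a0 j; simp only [cont, Pi.add_apply]; omega

lemma wsp_mul_al [CharZero F] (i : Fin 8) (k : ℤ) (hk : 0 < k) :
    D.wsp (k • al i) ≤ if k = 1 then Submodule.span F {D.e i} else ⊥ := by
  refine (wsp_le D _).trans ?_
  apply Submodule.span_le.mpr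
  have hi : (k • al i) i = k := by simp [al]
  rintro _ ⟨j | p | p, ha, rfl⟩
  · exfalso
    have := congr_fun (show (0 : V8) = _ from ha) i
    rw [hi] at this; simp at this; omega
  · obtain ⟨l, j⟩ := p
    have ha' : cont l j = k • al i := ha
    have hz : ∀ j', j' ≠ i → (k • al i) j' = 0 := by intro j' h; simp [al, h]
    have hc := cont_pos_of_mem l j
    rw [ha'] at hc
    have hj : j = i := by
      by_contra h
      have := hc.1; rw [hz j h] at this; omega
    subst hj
    have hl : ∀ a ∈ l, a = j := by
      intro a hal
      by_contra h
      have := hc.2 a hal; rw [hz a h] at this; omega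
    by_cases hne : l = []
    · subst hne
      have : k = 1 := by
        have := congr_fun ha' j
        rw [hi] at this; simpa [cont, al] using this.symm
      rw [if_pos this]
      exact Submodule.subset_span rfl
    · have : D.gn (.inr (.inl (l, j))) = 0 := wd_const D l j k (Or.inr trivial) hl hne
      rw [this]; exact zero_mem _
  · exfalso
    have h1 := congr_fun (show -cont p.1 p.2 = _ from ha) i
    rw [hi] at h1
    have : 0 ≤ cont p.1 p.2 i := cont_nonneg _ _ i
    simp only [Pi.neg_apply] at h1
    omega

/-- the span of the `h i` -/
def E8D.H (D : E8D F L) : Submodule F L := Submodule.span F (Set.range D.h)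

lemma wsp_zero [CharZero F] : D.wsp 0 = D.H := by
  apply le_antisymm
  · refine (wsp_le D _).trans ?_
    apply Submodule.span_le.mpr
    rintro _ ⟨j | p | p, ha, rfl⟩
    · exact Submodule.subset_span ⟨j, rfl⟩
    · exfalso
      have h2 := (cont_pos_of_mem p.1 p.2).1
      rw [show cont p.1 p.2 = 0 from ha] at h2; simp at h2
    · exfalso
      have h2 := (cont_pos_of_mem p.1 p.2).1
      rw [neg_eq_zero.mp (show -cont p.1 p.2 = 0 from ha)] at h2; simp at h2
  · apply Submodule.span_le.mpr
    rintro _ ⟨i, rfl⟩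
    exact h_mem_wsp D i

end E8P
namespace E8P
open LieAlgebra LieModule
set_option linter.unusedSectionVars false

variable {F L : Type*} [Field F] [CharZero F] [LieRing L] [LieAlgebra F L] (D : E8D F L)

lemma h_step {i j : Fin 8} (hE : CartanMatrix.E₈ i j ≠ 0) (hi : D.h i = 0) :
    D.e j = 0 ∧ D.f j = 0 ∧ D.h j = 0 := by
  have hE' : ((CartanMatrix.E₈ i j : ℤ) : F) ≠ 0 := by exact_mod_cast hE
  have h1 := D.he i j
  have h2 := D.hf i j
  rw [hi, zero_lie] at h1 h2
  have h1' : D.e j = 0 := (smul_eq_zero.mp h1.symm).resolve_left hE'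
  have h2' : D.f j = 0 := (smul_eq_zero.mp (neg_eq_zero.mp h2.symm)).resolve_left hE'
  refine ⟨h1', h2', ?_⟩
  rw [← D.ef, h1', zero_lie]

lemma h_ne [Nontrivial L] (i : Fin 8) : D.h i ≠ 0 := by
  intro hi
  have st : ∀ i j : Fin 8, CartanMatrix.E₈ i j ≠ 0 → D.h i = 0 → D.h j = 0 :=
    fun i j h1 h2 => (h_step D h1 h2).2.2
  have e02 : CartanMatrix.E₈ 0 2 ≠ 0 := by rw [show CartanMatrix.E₈ 0 2 = -1 from rfl]; norm_num
  have e13 : CartanMatrix.E₈ 1 3 ≠ 0 := by rw [show CartanMatrix.E₈ 1 3 = -1 from rfl]; norm_num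
  have e23 : CartanMatrix.E₈ 2 3 ≠ 0 := by rw [show CartanMatrix.E₈ 2 3 = -1 from rfl]; norm_num
  have e34 : CartanMatrix.E₈ 3 4 ≠ 0 := by rw [show CartanMatrix.E₈ 3 4 = -1 from rfl]; norm_num
  have e45 : CartanMatrix.E₈ 4 5 ≠ 0 := by rw [show CartanMatrix.E₈ 4 5 = -1 from rfl]; norm_num
  have e56 : CartanMatrix.E₈ 5 6 ≠ 0 := by rw [show CartanMatrix.E₈ 5 6 = -1 from rfl]; norm_num
  have e67 : CartanMatrix.E₈ 6 7 ≠ 0 := by rw [show CartanMatrix.E₈ 6 7 = -1 from rfl]; norm_num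
  have sw : ∀ i j, CartanMatrix.E₈ i j ≠ 0 → CartanMatrix.E₈ j i ≠ 0 := fun i j h => by
    rwa [E8_symm]
  have h3 : D.h 3 = 0 := by
    fin_cases i
    · exact st _ _ e23 (st _ _ e02 hi)
    · exact st _ _ e13 hi
    · exact st _ _ e23 hi
    · exact hi
    · exact st _ _ (sw _ _ e34) hi
    · exact st _ _ (sw _ _ e34) (st _ _ (sw _ _ e45) hi)
    · exact st _ _ (sw _ _ e34) (st _ _ (sw _ _ e45) (st _ _ (sw _ _ e56) hi))
    · exact st _ _ (sw _ _ e34) (st _ _ (sw _ _ e45) (st _ _ (sw _ _ e56) (st _ _ (sw _ _ e67) hi)))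
  have h2 := st _ _ (sw _ _ e23) h3
  have h4 := st _ _ e34 h3
  have h5 := st _ _ e45 h4
  have h6 := st _ _ e56 h5
  have hall : ∀ j, D.h j = 0 := by
    intro j
    fin_cases j
    · exact st _ _ (sw _ _ e02) h2
    · exact st _ _ (sw _ _ e13) h3
    · exact h2
    · exact h3
    · exact h4
    · exact h5
    · exact h6
    · exact st _ _ e67 h6
  have hef : ∀ j, D.e j = 0 ∧ D.f j = 0 := fun j => by
    have hd : CartanMatrix.E₈ j j ≠ 0 := by rw [E8_diag]; norm_num
    have := h_step D hd (hall j)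
    exact ⟨this.1, this.2.1⟩
  have hgen := D.gen
  have hle : LieSubalgebra.lieSpan F L (Set.range D.e ∪ Set.range D.f) ≤ ⊥ := by
    rw [LieSubalgebra.lieSpan_le]
    rintro _ (⟨j, rfl⟩ | ⟨j, rfl⟩)
    · rw [(hef j).1]; exact zero_mem _
    · rw [(hef j).2]; exact zero_mem _
  rw [hgen] at hle
  obtain ⟨x, hx⟩ := exists_ne (0 : L)
  have : x ∈ (⊥ : LieSubalgebra F L) := hle trivial
  exact hx (by simpa using this)

lemma sl2t [Nontrivial L] (i : Fin 8) : IsSl2Triple (D.h i) (D.e i) (D.f i) where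
  h_ne_zero := h_ne D i
  lie_e_f := D.ef i
  lie_h_e_nsmul := by rw [D.he, E8_diag]; simp [ofNat_smul_eq_nsmul]
  lie_h_f_nsmul := by rw [D.hf, E8_diag]; simp [ofNat_smul_eq_nsmul]

lemma locnil (i : Fin 8) (x : L) : ∃ k, ((ad F L (D.e i)) ^ k) x = 0 := by
  have h : LieSubalgebra.lieSpan F L (Set.range D.e ∪ Set.range D.f) ≤
      LieSubalgebra.engel F (D.e i) := by
    rw [LieSubalgebra.lieSpan_le]
    rintro _ (⟨j, rfl⟩ | ⟨j, rfl⟩)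
    · rw [SetLike.mem_coe, LieSubalgebra.mem_engel_iff]
      by_cases hj : i = j
      · exact ⟨1, by subst hj; simp⟩
      · exact ⟨2, by simp [pow_two, D.ee i j hj]⟩
    · rw [SetLike.mem_coe, LieSubalgebra.mem_engel_iff]
      by_cases hj : i = j
      · subst hj
        refine ⟨3, ?_⟩
        simp only [pow_succ, pow_zero, one_mul, Module.End.mul_apply, ad_apply, D.ef]
        rw [← lie_skew (D.e i) (D.h i), D.he]; simp
      · exact ⟨1, by simp [D.ef_ne i j hj]⟩
  rw [D.gen] at h
  exact (LieSubalgebra.mem_engel_iff F _ _).mp (h trivial)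

lemma pow_e_mem {n : V8} {x : L} (hx : x ∈ D.wsp n) (i : Fin 8) (k : ℕ) :
    ((ad F L (D.e i)) ^ k) x ∈ D.wsp (n + (k : ℤ) • al i) := by
  induction k with
  | zero => simpa using hx
  | succ k ih =>
    rw [pow_succ', Module.End.mul_apply, ad_apply]
    have := lie_wsp D (e_mem_wsp D i) ih
    convert this using 2
    push_cast; rw [add_smul]; simp; abel

lemma pow_f_mem {n : V8} {x : L} (hx : x ∈ D.wsp n) (i : Fin 8) (k : ℕ) :
    ((ad F L (D.f i)) ^ k) x ∈ D.wsp (n - (k : ℤ) • al i) := by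
  induction k with
  | zero => simpa using hx
  | succ k ih =>
    rw [pow_succ', Module.End.mul_apply, ad_apply]
    have := lie_wsp D (f_mem_wsp D i) ih
    convert this using 2
    push_cast; rw [add_smul]; simp; abel

lemma wsp_sr_ne [Nontrivial L] {n : V8} (i : Fin 8) (hc : 0 ≤ ca n i) (hn : D.wsp n ≠ ⊥) :
    D.wsp (sr i n) ≠ ⊥ := by
  classical
  obtain ⟨x, hx, hx0⟩ := Submodule.exists_mem_ne_zero_of_ne_bot hn
  have hex := locnil D i x
  obtain ⟨k, hk⟩ : ∃ k, Nat.find hex = k + 1 := by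
    refine Nat.exists_eq_succ_of_ne_zero ?_
    intro h0
    have := Nat.find_spec hex
    rw [h0] at this; exact hx0 (by simpa using this)
  have hv0 : ((ad F L (D.e i)) ^ k) x ≠ 0 := Nat.find_min hex (by omega)
  have hv1 : ((ad F L (D.e i)) ^ (k + 1)) x = 0 := by rw [← hk]; exact Nat.find_spec hex
  set v := ((ad F L (D.e i)) ^ k) x with hv
  have hvm := pow_e_mem D hx i k
  rw [← hv] at hvm
  obtain ⟨m, hm⟩ := Int.eq_ofNat_of_zero_le hc
  have hca : ca (n + (k : ℤ) • al i) i = m + 2 * k := by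
    rw [← bf_al_left, bf_add_right, bf_smul_right, bf_al_al, bf_al_left, hm]; ring
  have P : (sl2t D i).HasPrimitiveVectorWith v ((m + 2 * k : ℕ) : F) :=
    { ne_zero := hv0
      lie_h := by rw [hvm i, hca]; push_cast; rfl
      lie_e := by
        rw [pow_succ', Module.End.mul_apply, ad_apply, ← hv] at hv1; exact hv1 }
  have h1 := P.pow_toEnd_f_ne_zero_of_eq_nat (n := m + 2 * k) rfl (i := m + k) (by omega)
  have h2 := pow_f_mem D hvm i (m + k)
  intro hbot
  have hw : n + (k : ℤ) • al i - ((m + k : ℕ) : ℤ) • al i = sr i n := by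
    rw [sr, hm]; push_cast; rw [add_smul]; abel
  rw [hw, hbot, Submodule.mem_bot] at h2
  exact h1 h2

lemma mul_al_of {n : V8} (i : Fin 8) (hz : ∀ j, j ≠ i → n j = 0) : n = n i • al i := by
  ext j
  by_cases hj : j = i
  · subst hj; simp [al]
  · simp [al, hj, hz j hj]

lemma root_of_wsp_pos [Nontrivial L] (k : ℕ) : ∀ n : V8, D.wsp n ≠ ⊥ → 0 ≤ n → n ≠ 0 →
    ht n ≤ k → bf n n = 2 := by
  induction k with
  | zero =>
    intro n _ h0 hne hk
    exfalso; apply hne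
    ext i
    have := Finset.single_le_sum (f := n) (fun j _ => h0 j) (Finset.mem_univ i)
    have h2 : 0 ≤ n i := h0 i
    simp only [ht] at hk
    simp only [Pi.zero_apply]; push_cast at hk; omega
  | succ k ih =>
    intro n hn h0 hne hk
    obtain ⟨i, hi, hc⟩ := exists_step n h0 hne
    have hr := wsp_sr_ne D i hc.le hn
    rcases wsp_sign D hr with hp | hp
    · rw [← bf_sr i]
      refine ih _ hr hp ?_ (by rw [ht_sr]; push_cast at hk; omega)
      intro h
      apply hne
      rw [← sr_sr i n, h]; simp [sr, ca_zero]
    · have hz : ∀ j, j ≠ i → n j = 0 := by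
        intro j hj
        have h3 : 0 ≤ -(sr i n) j := hp j
        rw [sr_apply_ne hj] at h3
        have : 0 ≤ n j := h0 j
        omega
      have hn' := mul_al_of i hz
      have h1 : n i = 1 := by
        by_contra h1
        apply hn
        rw [eq_bot_iff, hn']
        have := wsp_mul_al D i (n i) hi
        rwa [if_neg h1] at this
      rw [hn', h1, one_smul, bf_al_al]

lemma root_of_wsp [Nontrivial L] {n : V8} (hn : D.wsp n ≠ ⊥) (h0 : n ≠ 0) : bf n n = 2 := by
  rcases wsp_sign D hn with h | h
  · exact root_of_wsp_pos D (ht n).toNat n hn h h0 (Int.self_le_toNat _)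
  · have h1 : D.symm.wsp (-n) ≠ ⊥ := by rw [symm_wsp, neg_neg]; exact hn
    have := root_of_wsp_pos D.symm (ht (-n)).toNat (-n) h1 h (neg_ne_zero.mpr h0)
      (Int.self_le_toNat _)
    rwa [bf_neg_left, bf_neg_right, neg_neg] at this

lemma root_bound {n : V8} (h : bf n n = 2) : ∀ i, |n i| ≤ 12 := by
  have hs := bf_sos n
  rw [h] at hs
  have a1 := sq_nonneg (2 * n 7 - n 6)
  have a2 := sq_nonneg (3 * n 6 - 2 * n 5)
  have a3 := sq_nonneg (4 * n 5 - 3 * n 4)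
  have a4 := sq_nonneg (5 * n 4 - 4 * n 3)
  have a5 := sq_nonneg (2 * n 0 - n 2)
  have a6 := sq_nonneg (3 * n 2 - 2 * n 3)
  have a7 := sq_nonneg (2 * n 1 - n 3)
  have a8 := sq_nonneg (n 3)
  have b1 := abs_le_of_sq_le_sq' (show (2 * n 7 - n 6) ^ 2 ≤ 2 ^ 2 by linarith) (by norm_num)
  have b2 := abs_le_of_sq_le_sq' (show (3 * n 6 - 2 * n 5) ^ 2 ≤ 4 ^ 2 by linarith) (by norm_num)
  have b3 := abs_le_of_sq_le_sq' (show (4 * n 5 - 3 * n 4) ^ 2 ≤ 5 ^ 2 by linarith) (by norm_num)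
  have b4 := abs_le_of_sq_le_sq' (show (5 * n 4 - 4 * n 3) ^ 2 ≤ 7 ^ 2 by linarith) (by norm_num)
  have b5 := abs_le_of_sq_le_sq' (show (2 * n 0 - n 2) ^ 2 ≤ 2 ^ 2 by linarith) (by norm_num)
  have b6 := abs_le_of_sq_le_sq' (show (3 * n 2 - 2 * n 3) ^ 2 ≤ 4 ^ 2 by linarith) (by norm_num)
  have b7 := abs_le_of_sq_le_sq' (show (2 * n 1 - n 3) ^ 2 ≤ 2 ^ 2 by linarith) (by norm_num)
  have b8 := abs_le_of_sq_le_sq' (show (n 3) ^ 2 ≤ 8 ^ 2 by linarith) (by norm_num)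
  intro i
  rw [abs_le]
  fin_cases i <;> simp only [Fin.zero_eta, Fin.mk_one, Fin.reduceFinMk] <;> omega

lemma wd_long [Nontrivial L] (l : List (Fin 8)) (i : Fin 8) (h : 100 ≤ l.length) :
    D.wd l i = 0 := by
  by_contra hne
  have hb : D.wsp (cont l i) ≠ ⊥ := by
    intro hb
    have := wd_mem D l i
    rw [hb] at this; exact hne (by simpa using this)
  have h0 : cont l i ≠ 0 := by
    intro h0
    have := (cont_pos_of_mem l i).1
    rw [h0] at this; simp at this
  have hq := root_bound (root_of_wsp D hb h0)
  have hh := ht_cont l i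
  have : ht (cont l i) ≤ ∑ i : Fin 8, (12 : ℤ) :=
    Finset.sum_le_sum fun j _ => (le_abs_self _).trans (hq j)
  simp at this
  omega

lemma finDim [Nontrivial L] (D : E8D F L) : Module.Finite F L := by
  refine ⟨?_⟩
  rw [← span_gn D]
  let S : Set (List (Fin 8) × Fin 8) := {l | l.length ≤ 100} ×ˢ Set.univ
  have hS : S.Finite := (List.finite_length_le _ _).prod Set.finite_univ
  let T : Set L := Set.range D.h ∪ (fun p => D.wd p.1 p.2) '' S ∪ (fun p => D.symm.wd p.1 p.2) '' S
  have hT : T.Finite := ((Set.finite_range _).union (hS.image _)).union (hS.image _)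
  have : Submodule.span F (Set.range D.gn) = Submodule.span F T := by
    apply le_antisymm
    · apply Submodule.span_le.mpr
      rintro _ ⟨i | p | p, rfl⟩
      · exact Submodule.subset_span (Or.inl (Or.inl ⟨i, rfl⟩))
      · by_cases h : p.1.length ≤ 100
        · exact Submodule.subset_span (Or.inl (Or.inr ⟨p, ⟨h, trivial⟩, rfl⟩))
        · have : D.gn (.inr (.inl p)) = 0 := wd_long D p.1 p.2 (by omega)
          rw [this]; exact zero_mem _
      · by_cases h : p.1.length ≤ 100
        · exact Submodule.subset_span (Or.inr ⟨p, ⟨h, trivial⟩, rfl⟩)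
        · have : D.gn (.inr (.inr p)) = 0 := wd_long D.symm p.1 p.2 (by omega)
          rw [this]; exact zero_mem _
    · apply Submodule.span_mono
      rintro _ ((⟨i, rfl⟩ | ⟨p, _, rfl⟩) | ⟨p, _, rfl⟩)
      · exact ⟨.inl i, rfl⟩
      · exact ⟨.inr (.inl p), rfl⟩
      · exact ⟨.inr (.inr p), rfl⟩
  rw [this]
  exact Submodule.fg_span hT

/-- the weight spaces span -/
lemma iSup_wsp : ⨆ n, D.wsp n = ⊤ := by
  rw [eq_top_iff, ← span_gn D]
  apply Submodule.span_le.mpr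
  rintro _ ⟨a, rfl⟩
  exact Submodule.mem_iSup_of_mem _ (gn_mem D a)

end E8P
namespace E8P
open LieAlgebra LieModule
set_option linter.unusedSectionVars false

section general
variable {F L : Type*} [Field F] [CharZero F] [LieRing L] [LieAlgebra F L]

/-- exponential automorphisms -/
lemma exists_exp (x : L) (hx : IsNilpotent (ad F L x)) :
    ∃ g : L ≃ₗ⁅F⁆ L, ∀ (y : L) (k : ℕ), ((ad F L x) ^ k) y = 0 →
      g y = ∑ m ∈ Finset.range k, ((m.factorial : F)⁻¹) • ((ad F L x) ^ m) y := by
  let _i1 : Module ℚ L := Module.compHom L (algebraMap ℚ F)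
  have hsm : ∀ (q : ℚ) (z : L), q • z = ((q : F)) • z := fun q z => rfl
  let _i2 : LieAlgebra ℚ L := { lie_smul := by intro t x y; rw [hsm, hsm, lie_smul] }
  have e0 : (LieDerivation.ad F L x).toLinearMap = ad F L x := by
    ext y; simp
  have hx' : IsNilpotent (LieDerivation.ad F L x).toLinearMap := by rw [e0]; exact hx
  refine ⟨LieDerivation.exp (LieDerivation.ad F L x) hx', fun y k hk => ?_⟩
  rw [LieDerivation.exp_map_apply]
  have := IsNilpotent.exp_smul_eq_sum (a := (LieDerivation.ad F L x).toLinearMap) (m := y) (k := k)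
    (by rw [e0]; exact hk) hx'
  rw [e0] at this ⊢
  rw [Module.End.smul_def] at this
  rw [this]
  refine Finset.sum_congr rfl fun m _ => ?_
  rw [hsm]; simp
end general

variable {F L : Type*} [Field F] [CharZero F] [LieRing L] [LieAlgebra F L] (D : E8D F L)

lemma nil_e [Nontrivial L] (i : Fin 8) : IsNilpotent (ad F L (D.e i)) := by
  have := finDim D
  rw [Module.End.isNilpotent_iff_of_finite]
  exact fun x => locnil D i x
lemma nil_f [Nontrivial L] (i : Fin 8) : IsNilpotent (ad F L (D.f i)) := nil_e D.symm i

lemma lie_e_h (i j : Fin 8) : ⁅D.e i, D.h j⁆ = -(((CartanMatrix.E₈ j i : ℤ) : F) • D.e i) := by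
  rw [← lie_skew, D.he]
lemma lie_f_h (i j : Fin 8) : ⁅D.f i, D.h j⁆ = (((CartanMatrix.E₈ j i : ℤ) : F) • D.f i) := by
  rw [← lie_skew, D.hf, neg_neg]
lemma lie_f_e (i : Fin 8) : ⁅D.f i, D.e i⁆ = - D.h i := by
  rw [← lie_skew, D.ef]

lemma exists_refl [Nontrivial L] (i : Fin 8) : ∃ g : L ≃ₗ⁅F⁆ L,
    ∀ j, g (D.h j) = D.h j - ((CartanMatrix.E₈ j i : ℤ) : F) • D.h i := by
  obtain ⟨g1, h1⟩ := exists_exp (F := F) (D.e i) (nil_e D i)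
  obtain ⟨g2, h2⟩ := exists_exp (F := F) (-D.f i) (by rw [map_neg]; exact (nil_f D i).neg)
  have a1 : ∀ j, g1 (D.h j) = D.h j - ((CartanMatrix.E₈ j i : ℤ) : F) • D.e i := by
    intro j
    rw [h1 _ 2 (by simp [pow_two, lie_e_h])]
    simp [Finset.sum_range_succ, lie_e_h, sub_eq_add_neg]
  have a2 : g1 (D.e i) = D.e i := by
    rw [h1 _ 1 (by simp)]; simp
  have b1 : ∀ j, g2 (D.h j) = D.h j - ((CartanMatrix.E₈ j i : ℤ) : F) • D.f i := by
    intro j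
    rw [h2 _ 2 (by simp [pow_two, lie_f_h])]
    simp [Finset.sum_range_succ, lie_f_h, sub_eq_add_neg]
  have b2 : g2 (D.e i) = D.e i + D.h i - D.f i := by
    rw [h2 _ 3 (by simp [pow_succ, lie_f_h, lie_f_e])]
    simp [Finset.sum_range_succ, lie_f_h, lie_f_e, pow_succ, E8_diag, sub_eq_add_neg, smul_smul]
  refine ⟨(g1.trans g2).trans g1, fun j => ?_⟩
  simp only [LieEquiv.trans_apply, a1, b1, map_sub, map_smul, b2, a2, map_add, E8_diag]
  push_cast
  have : g1 (D.f i) = g1 (D.f i) := rfl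
  module

lemma map_wsp (g : L ≃ₗ⁅F⁆ L) (n : V8) (x : L) : g x ∈ (D.map g).wsp n ↔ x ∈ D.wsp n := by
  rw [mem_wsp, mem_wsp]
  refine forall_congr' fun i => ?_
  change ⁅g (D.h i), g x⁆ = _ ↔ _
  rw [← LieEquiv.map_lie, ← map_smul]
  exact g.injective.eq_iff

lemma ca_sr (i : Fin 8) (n : V8) (j : Fin 8) :
    ca (sr i n) j = ca n j - ca n i * CartanMatrix.E₈ j i := by
  rw [← bf_al_left, sr, bf_sub_right, bf_smul_right, bf_al_left, bf_al_left, ca_al]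

lemma refl_wsp {g : L ≃ₗ⁅F⁆ L} {i : Fin 8}
    (hg : ∀ j, g (D.h j) = D.h j - ((CartanMatrix.E₈ j i : ℤ) : F) • D.h i) (n : V8) :
    (D.map g).wsp n = D.wsp (sr i n) := by
  have key : ∀ n : V8, D.wsp n ≤ (D.map g).wsp (sr i n) := by
    intro n x hx j
    change ⁅g (D.h j), x⁆ = _
    rw [hg, sub_lie, smul_lie, hx, hx, smul_smul, ← sub_smul]
    congr 1
    rw [ca_sr]; push_cast; ring
  apply le_antisymm
  · intro x hx j
    have h1 : ∀ j, D.h j = g (D.h j) - ((CartanMatrix.E₈ j i : ℤ) : F) • g (D.h i) := by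
      intro j; rw [hg, hg, E8_diag]; push_cast; module
    rw [h1, sub_lie, smul_lie]
    have hx' : ∀ j, ⁅g (D.h j), x⁆ = ((ca n j : ℤ) : F) • x := hx
    rw [hx', hx', smul_smul, ← sub_smul]
    congr 1
    rw [ca_sr]; push_cast; ring
  · have := key (sr i n)
    rwa [sr_sr] at this

lemma finrank_map (g : L ≃ₗ⁅F⁆ L) (n : V8) :
    Module.finrank F ((D.map g).wsp n) = Module.finrank F (D.wsp n) := by
  have : (D.map g).wsp n = (D.wsp n).map (g.toLinearEquiv : L →ₗ[F] L) := by
    ext x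
    rw [Submodule.mem_map]
    constructor
    · intro hx
      refine ⟨g.symm x, ?_, by simp⟩
      rw [← map_wsp D g]; simpa using hx
    · rintro ⟨y, hy, rfl⟩
      exact (map_wsp D g n y).mpr hy
  rw [this]
  exact LinearEquiv.finrank_map_eq g.toLinearEquiv _

lemma e_ne [Nontrivial L] (i : Fin 8) : D.e i ≠ 0 := by
  intro h; apply h_ne D i; rw [← D.ef, h, zero_lie]
lemma f_ne [Nontrivial L] (i : Fin 8) : D.f i ≠ 0 := e_ne D.symm i

lemma wsp_al [Nontrivial L] (i : Fin 8) : D.wsp (al i) = Submodule.span F {D.e i} := by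
  apply le_antisymm
  · have := wsp_mul_al D i 1 one_pos
    simpa using this
  · rw [Submodule.span_le, Set.singleton_subset_iff]; exact e_mem_wsp D i
lemma wsp_neg_al [Nontrivial L] (i : Fin 8) : D.wsp (- al i) = Submodule.span F {D.f i} := by
  rw [← symm_wsp, wsp_al]; rfl

lemma finrank_refl [Nontrivial L] (i : Fin 8) (n : V8) :
    Module.finrank F (D.wsp (sr i n)) = Module.finrank F (D.wsp n) := by
  obtain ⟨g, hg⟩ := exists_refl D i
  rw [← refl_wsp D hg, finrank_map]

lemma finrank_wsp_aux [Nontrivial L] (n : V8) (hn : bf n n = 2) :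
    Module.finrank F (D.wsp n) = 1 ∧ Module.finrank F (D.wsp (-n)) = 1 := by
  revert n
  apply root_induction
  · intro i
    rw [wsp_al, wsp_neg_al]
    exact ⟨finrank_span_singleton (e_ne D i), finrank_span_singleton (f_ne D i)⟩
  · intro n _ h
    rw [neg_neg]; exact h.symm
  · intro i n _ _ h
    rw [← sr_neg, finrank_refl, finrank_refl]; exact h

lemma finrank_wsp [Nontrivial L] {n : V8} (hn : bf n n = 2) : Module.finrank F (D.wsp n) = 1 :=
  (finrank_wsp_aux D n hn).1

/-- coroot of a root -/
def E8D.hv (n : V8) : L := ∑ i, ((n i : ℤ) : F) • D.h i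

lemma hv_al (i : Fin 8) : D.hv (al i) = D.h i := by
  rw [E8D.hv, Finset.sum_eq_single i]
  · simp [al]
  · intro j _ hj; simp [al, hj]
  · simp

lemma hv_add (m n : V8) : D.hv (m + n) = D.hv m + D.hv n := by
  simp [E8D.hv, add_smul, Finset.sum_add_distrib]
lemma hv_neg (n : V8) : D.hv (-n) = - D.hv n := by
  simp [E8D.hv]
lemma hv_sub (m n : V8) : D.hv (m - n) = D.hv m - D.hv n := by
  rw [sub_eq_add_neg, hv_add, hv_neg, sub_eq_add_neg]
lemma hv_smul (c : ℤ) (n : V8) : D.hv (c • n) = (c : F) • D.hv n := by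
  simp [E8D.hv, Finset.smul_sum, mul_smul]

lemma hv_lie {m n : V8} {x : L} (hx : x ∈ D.wsp n) : ⁅D.hv m, x⁆ = ((bf m n : ℤ) : F) • x := by
  rw [E8D.hv, sum_lie]
  simp_rw [smul_lie, hx _, smul_smul]
  rw [← Finset.sum_smul, bf]
  push_cast; rfl

lemma hv_mem (n : V8) : D.hv n ∈ D.wsp 0 := by
  refine Submodule.sum_mem _ fun i _ => Submodule.smul_mem _ _ (h_mem_wsp D i)

lemma exists_pair_aux [Nontrivial L] (n : V8) (hn : bf n n = 2) : ∀ D : E8D F L, ∃ x ∈ D.wsp n,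
    ∃ y ∈ D.wsp (-n), ⁅x, y⁆ = D.hv n := by
  revert n
  apply root_induction
  · intro i D
    exact ⟨D.e i, e_mem_wsp D i, D.f i, f_mem_wsp D i, by rw [hv_al, D.ef]⟩
  · intro n _ h D
    obtain ⟨x, hx, y, hy, hxy⟩ := h D
    exact ⟨y, hy, x, by rwa [neg_neg], by rw [hv_neg, ← hxy, lie_skew]⟩
  · intro i n _ _ h D
    obtain ⟨g, hg⟩ := exists_refl D i
    obtain ⟨x, hx, y, hy, hxy⟩ := h (D.map g)
    rw [refl_wsp D hg] at hx hy
    refine ⟨x, hx, y, by rwa [← sr_neg], ?_⟩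
    rw [hxy, sr, hv_sub, hv_smul, hv_al]
    change ∑ j, ((n j : ℤ) : F) • g (D.h j) = _
    simp_rw [hg, smul_sub, smul_smul, Finset.sum_sub_distrib]
    rw [← Finset.sum_smul, ← bf_al_right, bf]
    simp_rw [ca_al]
    push_cast
    rfl

lemma exists_pair [Nontrivial L] {n : V8} (hn : bf n n = 2) : ∃ x ∈ D.wsp n,
    ∃ y ∈ D.wsp (-n), ⁅x, y⁆ = D.hv n := exists_pair_aux n hn D

/-- brackets of root spaces are nonzero -/
lemma lie_ne [Nontrivial L] {m n : V8} (hm : bf m m = 2) (hn : bf n n = 2) (hmn : bf m n = -1)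
    {x y : L} (hx : x ∈ D.wsp m) (hy : y ∈ D.wsp n) (hx0 : x ≠ 0) (hy0 : y ≠ 0) : ⁅x, y⁆ ≠ 0 := by
  obtain ⟨x', hx', z, hz, hxz⟩ := exists_pair D hm
  have h1 := (finrank_eq_one_iff_of_nonzero' (⟨x, hx⟩ : D.wsp m) (by simpa using hx0)).mp
    (finrank_wsp D hm) ⟨x', hx'⟩
  obtain ⟨c, hc⟩ := h1
  have hc' : c • x = x' := congrArg Subtype.val hc
  intro h0
  have h2 : ⁅z, y⁆ = 0 := by
    have h3 := lie_wsp D hz hy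
    by_contra hne
    have h4 : D.wsp (-m + n) ≠ ⊥ := fun hb => hne (by rw [hb] at h3; simpa using h3)
    have hb : bf (-m + n) (-m + n) = 6 := by
      simp only [bf_add_left, bf_add_right, bf_neg_left, bf_neg_right, hm, hn, hmn,
        bf_comm n m]; norm_num
    have h5 := root_of_wsp D h4 (by
      intro h0; rw [h0] at hb
      have : bf (0:V8) 0 = 0 := by simp [bf_def]
      omega)
    omega
  have h6 : ⁅⁅x', z⁆, y⁆ = 0 := by
    rw [lie_lie, h2, lie_zero, ← hc', smul_lie, h0]; simp
  rw [hxz, hv_lie D hy, hmn] at h6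
  simp [hy0] at h6

end E8P
namespace E8P
open LieAlgebra LieModule
set_option linter.unusedSectionVars false

lemma conn (P : Fin 8 → Prop) (st : ∀ i j, CartanMatrix.E₈ i j ≠ 0 → P i → P j)
    {i : Fin 8} (hi : P i) : ∀ j, P j := by
  have e02 : CartanMatrix.E₈ 0 2 ≠ 0 := by rw [show CartanMatrix.E₈ 0 2 = -1 from rfl]; norm_num
  have e13 : CartanMatrix.E₈ 1 3 ≠ 0 := by rw [show CartanMatrix.E₈ 1 3 = -1 from rfl]; norm_num
  have e23 : CartanMatrix.E₈ 2 3 ≠ 0 := by rw [show CartanMatrix.E₈ 2 3 = -1 from rfl]; norm_num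
  have e34 : CartanMatrix.E₈ 3 4 ≠ 0 := by rw [show CartanMatrix.E₈ 3 4 = -1 from rfl]; norm_num
  have e45 : CartanMatrix.E₈ 4 5 ≠ 0 := by rw [show CartanMatrix.E₈ 4 5 = -1 from rfl]; norm_num
  have e56 : CartanMatrix.E₈ 5 6 ≠ 0 := by rw [show CartanMatrix.E₈ 5 6 = -1 from rfl]; norm_num
  have e67 : CartanMatrix.E₈ 6 7 ≠ 0 := by rw [show CartanMatrix.E₈ 6 7 = -1 from rfl]; norm_num
  have sw : ∀ i j, CartanMatrix.E₈ i j ≠ 0 → CartanMatrix.E₈ j i ≠ 0 := fun i j h => by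
    rwa [E8_symm]
  have h3 : P 3 := by
    fin_cases i
    · exact st _ _ e23 (st _ _ e02 hi)
    · exact st _ _ e13 hi
    · exact st _ _ e23 hi
    · exact hi
    · exact st _ _ (sw _ _ e34) hi
    · exact st _ _ (sw _ _ e34) (st _ _ (sw _ _ e45) hi)
    · exact st _ _ (sw _ _ e34) (st _ _ (sw _ _ e45) (st _ _ (sw _ _ e56) hi))
    · exact st _ _ (sw _ _ e34) (st _ _ (sw _ _ e45) (st _ _ (sw _ _ e56) (st _ _ (sw _ _ e67) hi)))
  have h2 := st _ _ (sw _ _ e23) h3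
  have h4 := st _ _ e34 h3
  have h5 := st _ _ e45 h4
  have h6 := st _ _ e56 h5
  intro j
  fin_cases j
  · exact st _ _ (sw _ _ e02) h2
  · exact st _ _ (sw _ _ e13) h3
  · exact h2
  · exact h3
  · exact h4
  · exact h5
  · exact h6
  · exact st _ _ e67 h6

section
variable {F L : Type*} [Field F] [CharZero F] [LieRing L] [LieAlgebra F L]

lemma E8_inj (c : Fin 8 → F) (hc : ∀ i, ∑ j, c j * ((CartanMatrix.E₈ j i : ℤ) : F) = 0) : c = 0 := by
  have hdet : (CartanMatrix.E₈.map (Int.castRingHom F)).det ≠ 0 := by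
    have h1 := RingHom.map_det (Int.castRingHom F) CartanMatrix.E₈
    rw [CartanMatrix.E₈_det] at h1
    rw [← RingHom.mapMatrix_apply, ← h1]; simp
  apply Matrix.eq_zero_of_vecMul_eq_zero hdet
  ext i
  exact hc i

variable (D : E8D F L)

lemma hsum_lie (c : Fin 8 → F) {n : V8} {x : L} (hx : x ∈ D.wsp n) :
    ⁅∑ j, c j • D.h j, x⁆ = (∑ j, c j * ((ca n j : ℤ) : F)) • x := by
  rw [sum_lie, Finset.sum_smul]
  simp_rw [smul_lie, hx _, smul_smul]

lemma mem_H {x : L} : x ∈ D.H ↔ ∃ c : Fin 8 → F, x = ∑ j, c j • D.h j := by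
  rw [E8D.H, Submodule.mem_span_range_iff_exists_fun]
  simp only [eq_comm]

/-- An element of `H` killing all simple root vectors vanishes. -/
lemma hsum_ne [Nontrivial L] (c : Fin 8 → F) (h0 : ∀ i, ⁅∑ j, c j • D.h j, D.e i⁆ = 0) : c = 0 := by
  apply E8_inj
  intro i
  have h1 := h0 i
  rw [hsum_lie D c (e_mem_wsp D i)] at h1
  simpa [ca_al, e_ne D i] using h1

lemma h_indep [Nontrivial L] : LinearIndependent F D.h := by
  rw [Fintype.linearIndependent_iff]
  intro c hc
  have := hsum_ne D c (by simp [hc])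
  intro i; rw [this]; rfl

lemma finrank_H [Nontrivial L] : Module.finrank F D.H = 8 := by
  rw [E8D.H, finrank_span_eq_card (h_indep D)]; rfl

/-- Submodules stable under `H` are graded. -/
lemma graded_aux (W : Submodule F L) (hW : ∀ i, ∀ x ∈ W, ⁅D.h i, x⁆ ∈ W) (s : Finset V8) :
    ∀ x : V8 → L, (∀ n ∈ s, x n ∈ D.wsp n) → ∑ n ∈ s, x n ∈ W → ∀ n ∈ s, x n ∈ W := by
  classical
  induction s using Finset.induction_on with
  | empty => simp
  | insert m s hms ih =>
    intro x hx hs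
    have h1 : ∀ n ∈ s, x n ∈ W := by
      intro n hn
      have hne : ca n ≠ ca m := fun h => hms (ca_inj h ▸ hn)
      obtain ⟨j, hj⟩ := Function.ne_iff.mp hne
      have h2 := W.sub_mem (hW j _ hs) (W.smul_mem ((ca m j : ℤ) : F) hs)
      rw [Finset.sum_insert hms] at h2
      rw [lie_add, hx m (Finset.mem_insert_self _ _) j, lie_sum, smul_add, add_sub_add_left_eq_sub,
        Finset.smul_sum, ← Finset.sum_sub_distrib] at h2
      have h3 : ∀ n ∈ s, ⁅D.h j, x n⁆ - ((ca m j : ℤ) : F) • x n =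
          (((ca n j : ℤ) : F) - ((ca m j : ℤ) : F)) • x n := by
        intro n hn
        rw [hx n (Finset.mem_insert_of_mem hn) j, sub_smul]
      rw [Finset.sum_congr rfl h3] at h2
      have h4 := ih (fun n => (((ca n j : ℤ) : F) - ((ca m j : ℤ) : F)) • x n)
        (fun n hn => Submodule.smul_mem _ _ (hx n (Finset.mem_insert_of_mem hn))) h2 n hn
      have h5 : (((ca n j : ℤ) : F) - ((ca m j : ℤ) : F)) ≠ 0 := by
        rw [sub_ne_zero]; exact_mod_cast hj
      simpa using (Submodule.smul_mem_iff _ h5).mp h4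
    intro n hn
    rcases Finset.mem_insert.mp hn with rfl | hn
    · rw [Finset.sum_insert hms] at hs
      exact (Submodule.add_mem_iff_left _ (Submodule.sum_mem _ h1)).mp hs
    · exact h1 n hn

lemma exists_decomp (D : E8D F L) (x : L) : ∃ (s : Finset V8) (y : V8 → L), (∀ n, y n ∈ D.wsp n) ∧
    x = ∑ n ∈ s, y n := by
  have h : x ∈ ⨆ n, D.wsp n := by rw [iSup_wsp]; trivial
  rw [Submodule.mem_iSup_iff_exists_finsupp] at h
  obtain ⟨f, hf, rfl⟩ := h
  exact ⟨f.support, f, hf, rfl⟩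

lemma gr_exists (W : Submodule F L) (hW : ∀ i, ∀ x ∈ W, ⁅D.h i, x⁆ ∈ W) (h0 : W ≠ ⊥) :
    ∃ n, ∃ x ∈ W, x ∈ D.wsp n ∧ x ≠ 0 := by
  obtain ⟨x, hx, hx0⟩ := Submodule.exists_mem_ne_zero_of_ne_bot h0
  obtain ⟨s, y, hy, rfl⟩ := exists_decomp D x
  have h1 := graded_aux D W hW s y (fun n _ => hy n) hx
  by_contra hcon
  push Not at hcon
  exact hx0 (Finset.sum_eq_zero fun n hn => hcon n _ (h1 n hn) (hy n))

lemma ideal_top [Nontrivial L] (D : E8D F L) (I : LieIdeal F L) (h0 : I ≠ ⊥) : I = ⊤ := by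
  obtain ⟨n, x, hxI, hx, hx0⟩ := gr_exists D I.toSubmodule
    (fun i x hx => lie_mem_right F L I _ _ hx) (by simpa using h0)
  have hH : ∃ z ∈ I, z ∈ D.H ∧ z ≠ 0 := by
    by_cases hn : n = 0
    · subst hn
      rw [wsp_zero] at hx
      exact ⟨x, hxI, hx, hx0⟩
    · have hb : D.wsp n ≠ ⊥ := fun hb => hx0 (by rw [hb] at hx; simpa using hx)
      have hr := root_of_wsp D hb hn
      obtain ⟨x', hx', z, hz, hxz⟩ := exists_pair D hr
      obtain ⟨c, hc⟩ := (finrank_eq_one_iff_of_nonzero' (⟨x, hx⟩ : D.wsp n)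
        (by simpa using hx0)).mp (finrank_wsp D hr) ⟨x', hx'⟩
      have hc' : c • x = x' := congrArg Subtype.val hc
      refine ⟨D.hv n, ?_, ?_, ?_⟩
      · rw [← hxz, ← hc', smul_lie]
        exact I.smul_mem _ (lie_mem_left F L I _ _ hxI)
      · rw [← wsp_zero]; exact hv_mem D n
      · intro h
        have := hv_lie D (m := n) hx
        rw [h, hr, zero_lie] at this
        exact smul_ne_zero (by norm_num) hx0 this.symm
  obtain ⟨z, hzI, hzH, hz0⟩ := hH
  obtain ⟨c, rfl⟩ := (mem_H D).mp hzH
  have h1 : ∃ i, D.h i ∈ I := by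
    by_contra hcon
    push Not at hcon
    apply hz0
    have : c = 0 := by
      apply hsum_ne D
      intro i
      by_contra hne
      apply hcon i
      have h2 : ⁅∑ j, c j • D.h j, D.e i⁆ ∈ I := lie_mem_left F L I _ _ hzI
      rw [hsum_lie D c (e_mem_wsp D i)] at h2 hne
      have h3 := (I.smul_mem_iff (by intro h; rw [h] at hne; simp at hne)).mp h2
      rw [← D.ef]
      exact lie_mem_left F L I _ _ h3
    simp [this]
  obtain ⟨i, hi⟩ := h1
  have st : ∀ i j, CartanMatrix.E₈ i j ≠ 0 → D.h i ∈ I → D.e j ∈ I ∧ D.f j ∈ I := by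
    intro i j hij hi
    have hE : ((CartanMatrix.E₈ i j : ℤ) : F) ≠ 0 := by exact_mod_cast hij
    constructor
    · have h2 : ⁅D.h i, D.e j⁆ ∈ I := lie_mem_left F L I _ _ hi
      rw [D.he] at h2
      exact (I.smul_mem_iff hE).mp h2
    · have h2 : ⁅D.h i, D.f j⁆ ∈ I := lie_mem_left F L I _ _ hi
      rw [D.hf, ← neg_smul] at h2
      exact (I.smul_mem_iff (neg_ne_zero.mpr hE)).mp h2
  have hall : ∀ j, D.h j ∈ I := conn _ (fun i j hij hi => by
    rw [← D.ef]; exact lie_mem_left F L I _ _ (st i j hij hi).1) hi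
  have hall' : ∀ j, D.e j ∈ I ∧ D.f j ∈ I := fun j => st j j (by rw [E8_diag]; norm_num) (hall j)
  have hle : LieSubalgebra.lieSpan F L (Set.range D.e ∪ Set.range D.f) ≤
      LieIdeal.toLieSubalgebra F L I := by
    rw [LieSubalgebra.lieSpan_le]
    rintro _ (⟨j, rfl⟩ | ⟨j, rfl⟩)
    · exact (hall' j).1
    · exact (hall' j).2
  rw [D.gen] at hle
  rw [eq_top_iff]
  intro x _
  exact hle (show x ∈ ⊤ from trivial)

lemma isSimple [Nontrivial L] (D : E8D F L) : LieAlgebra.IsSimple F L where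
  eq_bot_or_eq_top := fun I => or_iff_not_imp_left.mpr (ideal_top D I)
  non_abelian := by
    intro h
    apply h_ne D 0
    rw [← D.ef]
    exact h.trivial _ _

lemma isKilling [Nontrivial L] (D : E8D F L) : LieAlgebra.IsKilling F L := by
  have := finDim D
  have := isSimple D
  infer_instance
end

section serre
variable (F : Type*) [Field F]
open CartanMatrix

lemma E8_off : ∀ i j, i ≠ j → E₈ i j = 0 ∨ E₈ i j = -1 := by
  intro i j h
  fin_cases i <;> fin_cases j <;> first | exact absurd rfl h | exact Or.inl rfl | exact Or.inr rfl

/-- generators in the Serre algebra -/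
noncomputable def gmk : FreeLieAlgebra F (Generators (Fin 8)) →ₗ⁅F⁆ e₈ F :=
  { toFun := fun x => (LieSubmodule.Quotient.mk x :
      FreeLieAlgebra F (Generators (Fin 8)) ⧸ Relations.toIdeal F E₈)
    map_add' := fun _ _ => rfl
    map_smul' := fun _ _ => rfl
    map_lie' := rfl }

lemma gmk_surj : Function.Surjective (gmk F) :=
  LieSubmodule.Quotient.surjective_mk' (Relations.toIdeal F E₈)

lemma gmk_rel {x : FreeLieAlgebra F (Generators (Fin 8))} (hx : x ∈ Relations.toSet F E₈) :
    gmk F x = 0 := by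
  have : x ∈ Relations.toIdeal F E₈ := LieSubmodule.subset_lieSpan hx
  exact (LieSubmodule.Quotient.mk_eq_zero (N := Relations.toIdeal F E₈)).mpr this

lemma free_gen {X : Type*} : LieSubalgebra.lieSpan F (FreeLieAlgebra F X)
    (Set.range (FreeLieAlgebra.of F)) = ⊤ := by
  rw [eq_top_iff]
  intro x _
  let S := LieSubalgebra.lieSpan F (FreeLieAlgebra F X) (Set.range (FreeLieAlgebra.of F))
  let φ : FreeLieAlgebra F X →ₗ⁅F⁆ S := FreeLieAlgebra.lift F
    (fun a => ⟨FreeLieAlgebra.of F a, LieSubalgebra.subset_lieSpan ⟨a, rfl⟩⟩)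
  have h : S.incl.comp φ = LieHom.id := by
    apply FreeLieAlgebra.hom_ext
    intro a
    simp [φ]
  have h1 : S.incl (φ x) = x := DFunLike.congr_fun h x
  rw [← h1]
  exact (φ x).2

noncomputable def serreD : E8D F (e₈ F) where
  h := fun i => gmk F (FreeLieAlgebra.of F (Generators.H i))
  e := fun i => gmk F (FreeLieAlgebra.of F (Generators.E i))
  f := fun i => gmk F (FreeLieAlgebra.of F (Generators.F i))
  hh := by
    intro i j
    rw [← LieHom.map_lie]
    exact gmk_rel F (Or.inl (Or.inl (Or.inl (Or.inl (Or.inl ⟨(i, j), rfl⟩)))))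
  ef := by
    intro i
    rw [← LieHom.map_lie, ← sub_eq_zero, ← map_sub]
    refine gmk_rel F (Or.inl (Or.inl (Or.inl (Or.inl (Or.inr ⟨(i, i), ?_⟩)))))
    simp [Relations.EF]
  ef_ne := by
    intro i j hij
    rw [← LieHom.map_lie]
    refine gmk_rel F (Or.inl (Or.inl (Or.inl (Or.inl (Or.inr ⟨(i, j), ?_⟩)))))
    simp [Relations.EF, hij]
  he := by
    intro i j
    rw [← LieHom.map_lie, ← sub_eq_zero, ← map_smul, ← map_sub]
    refine gmk_rel F (Or.inl (Or.inl (Or.inl (Or.inr ⟨(i, j), ?_⟩))))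
    simp [Relations.HE, Int.cast_smul_eq_zsmul]
  hf := by
    intro i j
    rw [← LieHom.map_lie, eq_neg_iff_add_eq_zero, ← map_smul, ← map_add]
    refine gmk_rel F (Or.inl (Or.inl (Or.inr ⟨(i, j), ?_⟩)))
    simp [Relations.HF, Int.cast_smul_eq_zsmul]
  ee := by
    intro i j hij
    have h1 : gmk F (Relations.adE F E₈ (i, j)) = 0 := gmk_rel F (Or.inl (Or.inr ⟨(i, j), rfl⟩))
    have hE : E₈ i j = 0 ∨ E₈ i j = -1 := by
      exact E8_off i j hij
    rcases hE with hE | hE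
    · simp only [Relations.adE, Function.uncurry, hE] at h1
      simp at h1
      rw [h1, lie_zero]
    · simp only [Relations.adE, Function.uncurry, hE] at h1
      simpa using h1
  ff := by
    intro i j hij
    have h1 : gmk F (Relations.adF F E₈ (i, j)) = 0 := gmk_rel F (Or.inr ⟨(i, j), rfl⟩)
    have hE : E₈ i j = 0 ∨ E₈ i j = -1 := by
      exact E8_off i j hij
    rcases hE with hE | hE
    · simp only [Relations.adF, Function.uncurry, hE] at h1
      simp at h1
      rw [h1, lie_zero]
    · simp only [Relations.adF, Function.uncurry, hE] at h1
      simpa using h1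
  gen := by
    set S := LieSubalgebra.lieSpan F (e₈ F)
      ((Set.range fun i => gmk F (FreeLieAlgebra.of F (Generators.E i))) ∪
        Set.range fun i => gmk F (FreeLieAlgebra.of F (Generators.F i))) with hS
    have hE : ∀ i, gmk F (FreeLieAlgebra.of F (Generators.E i)) ∈ S := fun i =>
      LieSubalgebra.subset_lieSpan (Or.inl ⟨i, rfl⟩)
    have hF : ∀ i, gmk F (FreeLieAlgebra.of F (Generators.F i)) ∈ S := fun i =>
      LieSubalgebra.subset_lieSpan (Or.inr ⟨i, rfl⟩)
    have h : LieSubalgebra.lieSpan F (FreeLieAlgebra F (Generators (Fin 8)))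
        (Set.range (FreeLieAlgebra.of F)) ≤ S.comap (gmk F) := by
      rw [LieSubalgebra.lieSpan_le]
      rintro _ ⟨a, rfl⟩
      change gmk F _ ∈ S
      cases a with
      | H i =>
        have : ⁅gmk F (FreeLieAlgebra.of F (Generators.E i)),
            gmk F (FreeLieAlgebra.of F (Generators.F i))⁆ =
            gmk F (FreeLieAlgebra.of F (Generators.H i)) := by
          rw [← LieHom.map_lie, ← sub_eq_zero, ← map_sub]
          refine gmk_rel F (Or.inl (Or.inl (Or.inl (Or.inl (Or.inr ⟨(i, i), ?_⟩)))))
          simp [Relations.EF]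
        rw [← this]
        exact S.lie_mem (hE i) (hF i)
      | E i => exact hE i
      | F i => exact hF i
    rw [free_gen] at h
    rw [eq_top_iff]
    intro x _
    obtain ⟨y, rfl⟩ := gmk_surj F x
    exact h (show y ∈ ⊤ from trivial)

end serre
end E8P
namespace E8P
open LieAlgebra LieModule MvPolynomial
set_option linter.unusedSectionVars false

universe u v w
open scoped TensorProduct
section poly
variable {F σ : Type*} [Field F] [CharZero F] [Fintype σ] [DecidableEq σ]

lemma chain_rule {R : Type*} [CommRing R] [Algebra F R] (d : Derivation F R R) (g : σ → R)
    (P : MvPolynomial σ F) :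
    d (aeval g P) = ∑ s, aeval g (pderiv s P) * d (g s) := by
  induction P using MvPolynomial.induction_on with
  | C a => simp [MvPolynomial.aeval_C]
  | add p q hp hq => simp [hp, hq, add_mul, Finset.sum_add_distrib]
  | mul_X p i hp =>
    simp only [map_mul, Derivation.leibniz, hp, aeval_X, smul_eq_mul, map_add, add_mul,
      Finset.sum_add_distrib, pderiv_X]
    congr 1
    · rw [Finset.sum_eq_single i]
      · simp
      · intro b _ hb; simp [Pi.single_apply, hb.symm]
      · simp
    · rw [Finset.mul_sum]
      refine Finset.sum_congr rfl fun s _ => by ring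

/-- Jacobian criterion. -/
lemma jac_inj {R : Type*} [CommRing R] [IsDomain R] [Algebra F R] (v : σ → R)
    (d : σ → Derivation F R R)
    (hdet : (Matrix.of fun s j => d j (v s)).det ≠ 0) :
    Function.Injective (aeval v : MvPolynomial σ F →ₐ[F] R) := by
  rw [injective_iff_map_eq_zero]
  have key : ∀ n : ℕ, ∀ P : MvPolynomial σ F, (∀ m, coeff m P ≠ 0 → m.degree ≤ n) →
      aeval v P = 0 → P = 0 := by
    intro n
    induction n with
    | zero =>
      intro P hP h0
      have hC : P = C (coeff 0 P) := by
        ext m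
        rw [coeff_C]
        split_ifs with h
        · rw [h]
        · by_contra hne
          have := hP m hne
          have h3 : m = 0 := (Finsupp.degree_eq_zero_iff m).mp (by omega)
          exact h h3.symm
      rw [hC] at h0 ⊢
      rw [aeval_C] at h0
      have : coeff 0 P = 0 := by
        by_contra hne
        have hu : IsUnit (algebraMap F R (coeff 0 P)) := (IsUnit.mk0 _ hne).map _
        rw [h0] at hu
        exact not_isUnit_zero hu
      rw [this, C_0]
    | succ n ih =>
      intro P hP h0
      have hp : ∀ s, aeval v (pderiv s P) = 0 := by
        have := Matrix.eq_zero_of_vecMul_eq_zero hdet (v := fun s => aeval v (pderiv s P)) (by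
          ext j
          have h1 := chain_rule (d j) v P
          rw [h0, map_zero] at h1
          exact h1.symm)
        exact fun s => congrFun this s
      have hp' : ∀ s, pderiv s P = 0 := by
        intro s
        refine ih _ (fun m hm => ?_) (hp s)
        rw [coeff_pderiv] at hm
        have := hP _ (left_ne_zero_of_mul hm)
        simp at this
        omega
      apply ih P _ h0
      intro m hm
      by_contra hlt
      have h1 : ∃ s, m s ≠ 0 := by
        by_contra hcon
        push Not at hcon
        have : m = 0 := by ext s; simp [hcon s]
        subst this; simp at hlt
      obtain ⟨s, hs⟩ := h1
      have h2 := coeff_pderiv (i := s) P (m - Finsupp.single s 1)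
      rw [hp' s] at h2
      have h3 : m - Finsupp.single s 1 + Finsupp.single s 1 = m := by
        ext k
        by_cases hk : k = s
        · subst hk; simp; omega
        · simp [Finsupp.single_apply, Ne.symm hk]
      rw [h3] at h2
      simp at h2
      rcases h2 with h2 | h2
      · exact hm h2
      · norm_cast at h2
  exact fun P h0 => key P.totalDegree P (fun m hm => by
    have := le_totalDegree (mem_support_iff.mpr hm)
    rwa [Finsupp.sum_fintype _ _ (fun _ => rfl), ← Finsupp.degree_eq_sum] at this) h0

/-- amalgamation of fields -/
lemma amalg_field {K : Type u} {K1 : Type v} {K2 : Type w} [Field K] [Field K1] [Field K2]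
    (a1 : K →+* K1) (a2 : K →+* K2) :
    ∃ (Ω : Type (max v w)) (_ : Field Ω) (e1 : K1 →+* Ω) (e2 : K2 →+* Ω),
      ∀ x, e1 (a1 x) = e2 (a2 x) := by
  let _i1 := a1.toAlgebra
  let _i2 := a2.toAlgebra
  obtain ⟨J, hJ⟩ := Ideal.exists_maximal (TensorProduct K K1 K2)
  let q := Ideal.Quotient.mk J
  refine ⟨TensorProduct K K1 K2 ⧸ J, Ideal.Quotient.field J, q.comp
    (Algebra.TensorProduct.includeLeft (R := K) (S := K) (A := K1) (B := K2)).toRingHom,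
    q.comp (Algebra.TensorProduct.includeRight (R := K) (A := K1) (B := K2)).toRingHom, ?_⟩
  intro x
  change q _ = q _
  congr 1
  change (algebraMap K K1 x) ⊗ₜ[K] (1 : K2) = (1 : K1) ⊗ₜ[K] (algebraMap K K2 x)
  rw [Algebra.algebraMap_eq_smul_one, Algebra.algebraMap_eq_smul_one, TensorProduct.smul_tmul]

/-- amalgamation over domains -/
lemma amalg {B : Type u} {A1 : Type v} {A2 : Type w} [CommRing B] [IsDomain B] [CommRing A1]
    [IsDomain A1] [CommRing A2] [IsDomain A2] (φ1 : B →+* A1) (φ2 : B →+* A2)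
    (h1 : Function.Injective φ1) (h2 : Function.Injective φ2) :
    ∃ (Ω : Type (max v w)) (_ : Field Ω) (f1 : A1 →+* Ω) (f2 : A2 →+* Ω),
      Function.Injective f1 ∧ Function.Injective f2 ∧ ∀ x, f1 (φ1 x) = f2 (φ2 x) := by
  let K := FractionRing B
  let K1 := FractionRing A1
  let K2 := FractionRing A2
  let a1 : K →+* K1 := IsFractionRing.map h1
  let a2 : K →+* K2 := IsFractionRing.map h2
  obtain ⟨Ω, _i3, e1, e2, e⟩ := amalg_field a1 a2
  let f1 : A1 →+* Ω := e1.comp (algebraMap A1 K1)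
  let f2 : A2 →+* Ω := e2.comp (algebraMap A2 K2)
  have hf : ∀ b, f1 (φ1 b) = f2 (φ2 b) := by
    intro b
    have := e (algebraMap B K b)
    have t1 : a1 (algebraMap B K b) = algebraMap A1 K1 (φ1 b) :=
      IsLocalization.map_eq _ _
    have t2 : a2 (algebraMap B K b) = algebraMap A2 K2 (φ2 b) :=
      IsLocalization.map_eq _ _
    rw [t1, t2] at this
    exact this
  exact ⟨Ω, _i3, f1, f2, e1.injective.comp (IsFractionRing.injective A1 K1),
    e2.injective.comp (IsFractionRing.injective A2 K2), hf⟩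

lemma common_point [IsAlgClosed F] (v1 v2 : σ → MvPolynomial σ F) (r1 r2 : MvPolynomial σ F)
    (h1 : Function.Injective (aeval v1 : MvPolynomial σ F →ₐ[F] MvPolynomial σ F))
    (h2 : Function.Injective (aeval v2 : MvPolynomial σ F →ₐ[F] MvPolynomial σ F))
    (hr1 : r1 ≠ 0) (hr2 : r2 ≠ 0) :
    ∃ p1 p2 : σ → F, (∀ s, eval p1 (v1 s) = eval p2 (v2 s)) ∧ eval p1 r1 ≠ 0 ∧ eval p2 r2 ≠ 0 := by
  obtain ⟨Ω, _i, c1, c2, n1, n2, hc⟩ :=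
    amalg (aeval v1 : MvPolynomial σ F →ₐ[F] MvPolynomial σ F).toRingHom
    (aeval v2 : MvPolynomial σ F →ₐ[F] MvPolynomial σ F).toRingHom h1 h2
  let u : F →+* Ω := c1.comp C
  have hu : u = c2.comp C := by
    ext a
    have := hc (C a)
    change c1 (aeval v1 (C a)) = c2 (aeval v2 (C a)) at this
    rw [algHom_C, algHom_C] at this
    exact this
  let f : MvPolynomial (σ ⊕ σ) F →+* Ω :=
    eval₂Hom u (Sum.elim (fun i => c1 (X i)) (fun i => c2 (X i)))
  have hf1 : ∀ P, f (rename Sum.inl P) = c1 P := by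
    intro P
    have : f.comp (rename Sum.inl : MvPolynomial σ F →ₐ[F] _).toRingHom = c1 := by
      apply MvPolynomial.ringHom_ext
      · intro a; simp [f, u]
      · intro i; simp [f]
    exact DFunLike.congr_fun this P
  have hf2 : ∀ P, f (rename Sum.inr P) = c2 P := by
    intro P
    have : f.comp (rename Sum.inr : MvPolynomial σ F →ₐ[F] _).toRingHom = c2 := by
      apply MvPolynomial.ringHom_ext
      · intro a; simp [f, hu]
      · intro i; simp [f]
    exact DFunLike.congr_fun this P
  have hp : (RingHom.ker f).IsPrime := RingHom.ker_isPrime f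
  have hN := IsPrime.vanishingIdeal_zeroLocus (K := F) (RingHom.ker f)
  have hnot : rename Sum.inl r1 * rename Sum.inr r2 ∉ RingHom.ker f := by
    rw [RingHom.mem_ker, map_mul, hf1, hf2]
    refine mul_ne_zero ?_ ?_
    · exact (map_ne_zero_iff _ n1).mpr hr1
    · exact (map_ne_zero_iff _ n2).mpr hr2
  rw [← hN, mem_vanishingIdeal_iff] at hnot
  push Not at hnot
  obtain ⟨x, hx, hne⟩ := hnot
  rw [mem_zeroLocus_iff] at hx
  have ev1 : ∀ P, aeval x (rename Sum.inl P) = eval (fun i => x (Sum.inl i)) P := by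
    intro P; rw [aeval_rename]; rfl
  have ev2 : ∀ P, aeval x (rename Sum.inr P) = eval (fun i => x (Sum.inr i)) P := by
    intro P; rw [aeval_rename]; rfl
  rw [map_mul, ev1, ev2] at hne
  refine ⟨_, _, fun s => ?_, left_ne_zero_of_mul hne, right_ne_zero_of_mul hne⟩
  rw [← ev1, ← ev2, ← sub_eq_zero, ← map_sub]
  apply hx
  rw [RingHom.mem_ker, map_sub, hf1, hf2, sub_eq_zero]
  simpa using hc (X s)

/-- reading partial derivatives off coordinate lines -/
lemma pderiv_line (P : MvPolynomial σ F) (p : σ → F) (j : σ) (a b : F)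
    (h : ∀ s : F, eval (p + s • Pi.single j 1) P = a + s * b) : eval p (pderiv j P) = b := by
  let g : σ → Polynomial F := fun i => Polynomial.C (p i) + if i = j then Polynomial.X else 0
  have hQ : aeval g P = Polynomial.C a + Polynomial.C b * Polynomial.X := by
    apply Polynomial.funext
    intro s
    have e1 : (Polynomial.eval s (aeval g P)) = eval (p + s • Pi.single j 1) P := by
      have : (Polynomial.evalRingHom s).comp (aeval g : MvPolynomial σ F →ₐ[F] _).toRingHom =
          eval (p + s • Pi.single j 1) := by
        apply MvPolynomial.ringHom_ext
        · intro a; simp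
        · intro i
          by_cases hi : i = j
          · subst hi; simp [g]
          · simp [g, hi]
      exact DFunLike.congr_fun this P
    rw [e1, h]
    simp only [Polynomial.eval_add, Polynomial.eval_C, Polynomial.eval_mul, Polynomial.eval_X]
    ring
  have h1 := chain_rule (Polynomial.derivative' (R := F)) g P
  rw [hQ, Finset.sum_eq_single j] at h1
  · have h2 := congrArg (Polynomial.eval 0) h1
    have e1 : (Polynomial.eval 0 (aeval g (pderiv j P))) = eval p (pderiv j P) := by
      have : (Polynomial.evalRingHom 0).comp (aeval g : MvPolynomial σ F →ₐ[F] _).toRingHom =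
          eval p := by
        apply MvPolynomial.ringHom_ext
        · intro a; simp
        · intro i
          by_cases hi : i = j
          · subst hi; simp [g]
          · simp [g, hi]
      exact DFunLike.congr_fun this _
    have e2 : Polynomial.derivative' (g j) = 1 := by
      change Polynomial.derivative (g j) = 1
      simp only [g, if_true, Polynomial.derivative_add, Polynomial.derivative_C,
        Polynomial.derivative_X, zero_add]
    have e3 : Polynomial.derivative' (Polynomial.C a + Polynomial.C b * Polynomial.X) =
        Polynomial.C b := by
      change Polynomial.derivative _ = _
      simp
    rw [e2, e3, mul_one, e1, Polynomial.eval_C] at h2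
    exact h2.symm
  · intro i _ hi
    have : Polynomial.derivative' (g i) = 0 := by
      change Polynomial.derivative (g i) = 0
      simp only [g, if_neg hi, add_zero, Polynomial.derivative_C]
    rw [this, mul_zero]
  · simp
end poly
end E8P
namespace E8P
open LieAlgebra LieModule MvPolynomial
set_option linter.unusedSectionVars false
section chart
variable {F L σ : Type*} [Field F] [CharZero F] [LieRing L] [LieAlgebra F L] [Fintype σ]
  [DecidableEq σ]

open Classical in
/-- exponential of an ad-nilpotent element (identity otherwise) -/
noncomputable def expg (F : Type*) {L : Type*} [Field F] [CharZero F] [LieRing L] [LieAlgebra F L]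
    (x : L) : L ≃ₗ⁅F⁆ L :=
  if h : IsNilpotent (ad F L x) then (exists_exp x h).choose else LieEquiv.refl

lemma expg_spec (x : L) (hx : IsNilpotent (ad F L x)) (y : L) (k : ℕ) (h : ((ad F L x) ^ k) y = 0) :
    expg F x y = ∑ m ∈ Finset.range k, ((m.factorial : F)⁻¹) • ((ad F L x) ^ m) y := by
  rw [expg, dif_pos hx]
  exact (exists_exp x hx).choose_spec y k h

lemma expg_zero (y : L) : expg F (0 : L) y = y := by
  rw [expg_spec 0 (by simp) y 1 (by simp)]; simp

/-- polynomial maps into `L` -/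
def IsPoly (c : Module.Basis σ F L) (f : (σ → F) → L) : Prop :=
  ∃ v : σ → MvPolynomial σ F, ∀ p s, eval p (v s) = c.repr (f p) s

lemma IsPoly.add {c : Module.Basis σ F L} {f g : (σ → F) → L} (hf : IsPoly c f) (hg : IsPoly c g) :
    IsPoly c (fun p => f p + g p) := by
  obtain ⟨v, hv⟩ := hf
  obtain ⟨w, hw⟩ := hg
  exact ⟨fun s => v s + w s, fun p s => by simp [hv, hw]⟩

lemma IsPoly.zero {c : Module.Basis σ F L} : IsPoly c (fun _ => 0) :=
  ⟨fun _ => 0, fun p s => by simp⟩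

lemma IsPoly.const {c : Module.Basis σ F L} (x : L) : IsPoly c (fun _ => x) :=
  ⟨fun s => C (c.repr x s), fun p s => by simp⟩

lemma IsPoly.sum {c : Module.Basis σ F L} {ι : Type*} (S : Finset ι) {f : ι → (σ → F) → L}
    (hf : ∀ i ∈ S, IsPoly c (f i)) : IsPoly c (fun p => ∑ i ∈ S, f i p) := by
  classical
  induction S using Finset.induction_on with
  | empty => simpa using IsPoly.zero
  | insert a S ha ih =>
    simp only [Finset.sum_insert ha]
    exact (hf a (by simp)).add (ih fun i hi => hf i (by simp [hi]))

lemma IsPoly.smul {c : Module.Basis σ F L} {f : (σ → F) → L} (hf : IsPoly c f)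
    (P : MvPolynomial σ F) : IsPoly c (fun p => eval p P • f p) := by
  obtain ⟨v, hv⟩ := hf
  exact ⟨fun s => P * v s, fun p s => by simp [hv]⟩

lemma IsPoly.map {c : Module.Basis σ F L} {f : (σ → F) → L} (hf : IsPoly c f)
    (T : L →ₗ[F] L) : IsPoly c (fun p => T (f p)) := by
  obtain ⟨v, hv⟩ := hf
  refine ⟨fun s => ∑ k, v k * C (c.repr (T (c k)) s), fun p s => ?_⟩
  have : T (f p) = ∑ k, c.repr (f p) k • T (c k) := by
    conv_lhs => rw [← c.sum_repr (f p), map_sum]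
    exact Finset.sum_congr rfl fun k _ => map_smul _ _ _
  beta_reduce
  rw [this]
  simp [hv, Finset.sum_apply']

lemma IsPoly.exp {c : Module.Basis σ F L} {f : (σ → F) → L} (hf : IsPoly c f) (b : L)
    (hb : IsNilpotent (ad F L b)) (j : σ) : IsPoly c (fun p => expg F (p j • b) (f p)) := by
  obtain ⟨k, hk⟩ := hb
  have : (fun p : σ → F => expg F (p j • b) (f p)) = fun p => ∑ m ∈ Finset.range k,
      eval p (C ((m.factorial : F)⁻¹) * X j ^ m) • ((ad F L b) ^ m) (f p) := by
    funext p
    rw [expg_spec (p j • b) ⟨k, by rw [map_smul, smul_pow, hk, smul_zero]⟩ (f p) k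
      (by rw [map_smul, smul_pow, hk, smul_zero]; rfl)]
    refine Finset.sum_congr rfl fun m _ => ?_
    rw [map_smul, smul_pow, LinearMap.smul_apply, smul_smul]
    simp
  rw [this]
  exact IsPoly.sum _ fun m _ => (hf.map _).smul _

/-- A basis adapted to a toral self-centralizing subspace. -/
structure Chart (F L σ : Type*) [Field F] [CharZero F] [LieRing L] [LieAlgebra F L] [Fintype σ]
    [DecidableEq σ] where
  b : Module.Basis σ F L
  T : Finset σ
  α : σ → σ → F
  comm : ∀ i ∈ T, ∀ j ∈ T, ⁅b i, b j⁆ = 0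
  wt : ∀ i ∈ T, ∀ j ∉ T, ⁅b i, b j⁆ = α j i • b j
  nil : ∀ j ∉ T, IsNilpotent (ad F L (b j))
  reg : ∀ j ∉ T, ∃ i ∈ T, α j i ≠ 0

namespace Chart
variable (C : Chart F L σ)

/-- toral point -/
noncomputable def x (p : σ → F) : L := ∑ i ∈ C.T, p i • C.b i

/-- value of a root -/
noncomputable def av (p : σ → F) (j : σ) : F := ∑ i ∈ C.T, p i * C.α j i

/-- toral subspace -/
def z : Submodule F L := Submodule.span F (C.b '' C.T)

lemma mem_z (y : L) : y ∈ C.z ↔ ∀ j ∉ C.T, C.b.repr y j = 0 := by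
  rw [z, Module.Basis.mem_span_image]
  constructor
  · intro h j hj
    by_contra hc
    exact hj (h (by simpa using hc))
  · intro h j hj
    by_contra hc
    exact (by simpa using hj : C.b.repr y j ≠ 0) (h j hc)

lemma x_lie_T (p : σ → F) (j : σ) (hj : j ∈ C.T) : ⁅C.x p, C.b j⁆ = 0 := by
  rw [x, sum_lie]
  exact Finset.sum_eq_zero fun i hi => by rw [smul_lie, C.comm i hi j hj, smul_zero]

lemma x_lie (p : σ → F) (j : σ) (hj : j ∉ C.T) : ⁅C.x p, C.b j⁆ = C.av p j • C.b j := by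
  rw [x, sum_lie, av, Finset.sum_smul]
  exact Finset.sum_congr rfl fun i hi => by rw [smul_lie, C.wt i hi j hj, smul_smul]

lemma repr_x_lie (p : σ → F) (y : L) (j : σ) (hj : j ∉ C.T) :
    C.b.repr ⁅C.x p, y⁆ j = C.av p j * C.b.repr y j := by
  have : ⁅C.x p, y⁆ = ∑ k, C.b.repr y k • ⁅C.x p, C.b k⁆ := by
    conv_lhs => rw [← C.b.sum_repr y, lie_sum]
    exact Finset.sum_congr rfl fun k _ => lie_smul _ _ _
  rw [this, map_sum, Finset.sum_apply', Finset.sum_eq_single j]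
  · rw [C.x_lie p j hj]; simp [mul_comm]
  · intro k _ hk
    by_cases hkT : k ∈ C.T
    · rw [C.x_lie_T p k hkT]; simp
    · rw [C.x_lie p k hkT]; simp [hk]
  · simp

lemma cent (p : σ → F) (hp : ∀ j ∉ C.T, C.av p j ≠ 0) (y : L) :
    ⁅C.x p, y⁆ = 0 ↔ y ∈ C.z := by
  rw [C.mem_z]
  constructor
  · intro h j hj
    have := C.repr_x_lie p y j hj
    rw [h] at this
    simpa [hp j hj] using this.symm
  · intro h
    rw [← C.b.sum_repr y, lie_sum]
    refine Finset.sum_eq_zero fun k _ => ?_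
    by_cases hkT : k ∈ C.T
    · rw [lie_smul, C.x_lie_T p k hkT, smul_zero]
    · rw [h k hkT, zero_smul, lie_zero]

/-- product of all roots -/
noncomputable def r : MvPolynomial σ F :=
  ∏ j ∈ Finset.univ \ C.T, ∑ i ∈ C.T, X i * MvPolynomial.C (C.α j i)

lemma eval_r (p : σ → F) : eval p C.r = ∏ j ∈ Finset.univ \ C.T, C.av p j := by
  simp [r, av]

lemma eval_r_ne (p : σ → F) : eval p C.r ≠ 0 ↔ ∀ j ∉ C.T, C.av p j ≠ 0 := by
  rw [eval_r, Finset.prod_ne_zero_iff]; simp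

lemma r_ne : C.r ≠ 0 := by
  rw [r, Finset.prod_ne_zero_iff]
  intro j hj h
  obtain ⟨i, hi, hne⟩ := C.reg j (by simpa using hj)
  apply hne
  have := congrArg (eval (Pi.single i 1)) h
  simpa [Pi.single_apply, hi] using this

/-- partial products of exponentials -/
noncomputable def G (p : σ → F) : List σ → L ≃ₗ⁅F⁆ L
  | [] => LieEquiv.refl
  | j :: l => (G p l).trans (expg F (p j • C.b j))

lemma G_poly (c : Module.Basis σ F L) (l : List σ) (hl : ∀ j ∈ l, j ∉ C.T) :
    IsPoly c (fun p => C.G p l (C.x p)) := by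
  induction l with
  | nil =>
    have : (fun p => C.G p [] (C.x p)) = fun p => ∑ i ∈ C.T, eval p (X i) • C.b i := by
      funext p; simp [G, x]
    rw [this]
    exact IsPoly.sum _ fun i _ => (IsPoly.const _).smul _
  | cons j l ih =>
    exact (ih fun k hk => hl k (by simp [hk])).exp (C.b j) (C.nil j (hl j (by simp))) j

lemma G_zero (p : σ → F) (l : List σ) (hl : ∀ j ∈ l, p j = 0) (y : L) : C.G p l y = y := by
  induction l with
  | nil => rfl
  | cons j l ih =>
    change expg F (p j • C.b j) (C.G p l y) = y
    rw [ih fun k hk => hl k (by simp [hk]), hl j (by simp), zero_smul, expg_zero]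

lemma G_single (p : σ → F) (l : List σ) (hn : l.Nodup) (j : σ) (hj : j ∈ l)
    (hl : ∀ k ∈ l, k ≠ j → p k = 0) (y : L) : C.G p l y = expg F (p j • C.b j) y := by
  induction l with
  | nil => simp at hj
  | cons k l ih =>
    change expg F (p k • C.b k) (C.G p l y) = _
    rw [List.nodup_cons] at hn
    by_cases hk : j = k
    · subst hk
      rw [C.G_zero p l]
      intro m hm
      exact hl m (by simp [hm]) fun h => hn.1 (h ▸ hm)
    · rw [ih hn.2 (by simpa [hk] using hj) fun m hm => hl m (by simp [hm]),
        hl k (by simp) (Ne.symm hk), zero_smul, expg_zero]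

lemma exists_v (c : Module.Basis σ F L) : ∃ v : σ → MvPolynomial σ F,
    (∀ p s, eval p (v s) = c.repr (C.G p (Finset.univ \ C.T).toList (C.x p)) s) ∧
    Function.Injective (aeval v : MvPolynomial σ F →ₐ[F] MvPolynomial σ F) := by
  obtain ⟨v, hv⟩ := C.G_poly c (Finset.univ \ C.T).toList (by simp)
  refine ⟨v, hv, ?_⟩
  obtain ⟨q, hq⟩ : ∃ q, eval q C.r ≠ 0 := by
    by_contra hc
    push Not at hc
    exact C.r_ne (MvPolynomial.funext fun p => by rw [hc p, map_zero])
  rw [C.eval_r_ne] at hq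
  let p : σ → F := fun i => if i ∈ C.T then q i else 0
  have hpT : ∀ i ∈ C.T, p i = q i := fun i hi => by simp [p, hi]
  have hpN : ∀ i ∉ C.T, p i = 0 := fun i hi => by simp [p, hi]
  have hav : ∀ j, C.av p j = C.av q j := fun j => by
    unfold av; exact Finset.sum_congr rfl fun i hi => by rw [hpT i hi]
  let d : σ → F := fun j => if j ∈ C.T then 1 else - C.av q j
  have hd : ∀ j, d j ≠ 0 := by
    intro j
    by_cases hj : j ∈ C.T
    · simp [d, hj]
    · simpa [d, hj] using hq j hj
  have main : ∀ s j, eval p (pderiv j (v s)) = d j * c.repr (C.b j) s := by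
    intro s j
    refine pderiv_line (v s) p j (c.repr (C.x p) s) _ fun t => ?_
    rw [hv]
    have key : C.G (p + t • Pi.single j 1) (Finset.univ \ C.T).toList
        (C.x (p + t • Pi.single j 1)) = C.x p + (t * d j) • C.b j := by
      by_cases hj : j ∈ C.T
      · rw [C.G_zero]
        · unfold x
          simp only [Pi.add_apply, add_smul, Finset.sum_add_distrib]
          congr 1
          rw [Finset.sum_eq_single j]
          · simp [d, hj]
          · intro i _ hi; simp [hi]
          · intro h; exact absurd hj h
        · intro k hk
          have hk : k ∉ C.T := by simpa using hk
          have : k ≠ j := fun h => hk (h ▸ hj)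
          simp [hpN k hk, this]
      · rw [C.G_single _ _ (Finset.nodup_toList _) j (by simpa using hj)]
        · have e1 : C.x (p + t • Pi.single j 1) = C.x p := by
            unfold x
            refine Finset.sum_congr rfl fun i hi => ?_
            have : i ≠ j := fun h => hj (h ▸ hi)
            simp [this]
          have e2 : (p + t • (Pi.single j (1 : F) : σ → F)) j = t := by simp [hpN j hj]
          have e3 : ⁅C.b j, C.x p⁆ = d j • C.b j := by
            rw [← lie_skew, C.x_lie p j hj, hav]; simp [d, hj]
          have hn : IsNilpotent (ad F L (t • C.b j)) := by
            rw [map_smul]; exact (C.nil j hj).smul _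
          rw [e1, e2, expg_spec _ hn _ 2]
          · simp [Finset.sum_range_succ, e3, smul_smul]
          · simp [pow_two, e3]
        · intro k hk hkj
          have hk : k ∉ C.T := by simpa using hk
          simp [hpN k hk, hkj]
    beta_reduce
    rw [key]
    simp [mul_assoc]
  refine jac_inj v (fun j => pderiv j) fun h0 => ?_
  have h1 := congrArg (eval p) h0
  rw [RingHom.map_det, map_zero] at h1
  have h2 : (eval p).mapMatrix (Matrix.of fun s j => pderiv j (v s)) =
      c.toMatrix C.b * Matrix.diagonal d := by
    ext s j
    rw [Matrix.mul_diagonal, Module.Basis.toMatrix_apply]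
    simp only [RingHom.mapMatrix_apply, Matrix.map_apply, Matrix.of_apply]
    rw [main, mul_comm]
  rw [h2, Matrix.det_mul, Matrix.det_diagonal, mul_eq_zero] at h1
  rcases h1 with h1 | h1
  · have h3 := congrArg Matrix.det (c.toMatrix_mul_toMatrix_flip C.b)
    rw [Matrix.det_mul, h1, zero_mul, Matrix.det_one] at h3
    exact zero_ne_one h3
  · exact Finset.prod_ne_zero_iff.2 (fun j _ => hd j) h1

theorem conj [IsAlgClosed F] (C1 C2 : Chart F L σ) :
    ∃ g : L ≃ₗ⁅F⁆ L, ∀ y, y ∈ C1.z ↔ g y ∈ C2.z := by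
  obtain ⟨v1, h1, i1⟩ := C1.exists_v C1.b
  obtain ⟨v2, h2, i2⟩ := C2.exists_v C1.b
  obtain ⟨p1, p2, h, n1, n2⟩ := common_point v1 v2 C1.r C2.r i1 i2 C1.r_ne C2.r_ne
  rw [eval_r_ne] at n1 n2
  set g1 := C1.G p1 (Finset.univ \ C1.T).toList
  set g2 := C2.G p2 (Finset.univ \ C2.T).toList
  have he : g1 (C1.x p1) = g2 (C2.x p2) := by
    apply C1.b.repr.injective
    ext s
    rw [← h1, ← h2, h]
  refine ⟨g1.trans g2.symm, fun y => ?_⟩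
  rw [← C1.cent p1 n1, ← C2.cent p2 n2]
  have hx : C2.x p2 = (g1.trans g2.symm) (C1.x p1) := by
    change _ = g2.symm (g1 _)
    rw [he, LieEquiv.symm_apply_apply]
  rw [hx, ← LieEquiv.map_lie]
  constructor
  · intro h; rw [h, map_zero]
  · intro h
    exact (g1.trans g2.symm).injective (h.trans (map_zero (g1.trans g2.symm)).symm)
end Chart
end chart
end E8P
namespace E8P
open LieAlgebra LieModule
set_option linter.unusedSectionVars false
section csa
variable {F L : Type*} [Field F] [CharZero F] [IsAlgClosed F] [LieRing L] [LieAlgebra F L]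

lemma exists_chart [Module.Finite F L] [IsKilling F L] (H : LieSubalgebra F L)
    [H.IsCartanSubalgebra] :
    ∃ C : Chart F L (Fin (Module.finrank F L)), C.z = H.toSubmodule := by
  classical
  let A : Weight F H L → Submodule F L := fun χ => (rootSpace H χ).toSubmodule
  have hInt : DirectSum.IsInternal A := by
    apply DirectSum.isInternal_submodule_of_iSupIndep_of_iSup_eq_top
    · exact LieSubmodule.iSupIndep_toSubmodule.mpr (iSupIndep_genWeightSpace' F H L)
    · have := iSup_genWeightSpace_eq_top' F H L
      rw [← LieSubmodule.toSubmodule_inj] at this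
      simpa [A] using this
  let v : ∀ χ, Module.Basis (Fin (Module.finrank F (A χ))) F (A χ) := fun χ => Module.finBasis F _
  let b0 := hInt.collectedBasis v
  let e : (Σ χ : Weight F H L, Fin (Module.finrank F (A χ))) ≃ Fin (Module.finrank F L) :=
    Fintype.equivFinOfCardEq (by rw [Module.finrank_eq_card_basis b0])
  let b := b0.reindex e
  let w : Fin (Module.finrank F L) → Weight F H L := fun i => (e.symm i).1
  have hb : ∀ i, b i ∈ rootSpace H (w i) := by
    intro i
    rw [Module.Basis.reindex_apply]
    exact hInt.collectedBasis_mem v (e.symm i)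
  let T : Finset (Fin (Module.finrank F L)) := Finset.univ.filter fun i => (w i).IsZero
  have hT0 : ∀ i ∈ T, b i ∈ H := by
    intro i hi
    have h0 : (w i).IsZero := by simpa [T] using hi
    have := hb i
    rw [h0.eq, rootSpace_zero_eq] at this
    exact this
  have hwt : ∀ (x : L) (hx : x ∈ H) j, ⁅x, b j⁆ = w j ⟨x, hx⟩ • b j := fun x hx j =>
    IsKilling.lie_eq_smul_of_mem_rootSpace (hb j) ⟨x, hx⟩
  have hrep : ∀ y ∈ H, ∀ j ∉ T, b.repr y j = 0 := by
    intro y hy j hj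
    have h0 : ¬ (w j).IsZero := by simpa [T] using hj
    rw [Module.Basis.repr_reindex_apply]
    by_cases hy0 : y = 0
    · simp [hy0]
    have hy' : y ∈ rootSpace H (0 : H → F) := by rw [rootSpace_zero_eq]; exact hy
    let χ0 : Weight F H L := ⟨0, fun h => hy0 (by
      have h2 : y ∈ genWeightSpace L (0 : H → F) := hy'
      rw [h] at h2; simpa using h2)⟩
    refine hInt.collectedBasis_repr_of_mem_ne v (i := χ0) (j := w j) ?_ hy'
    intro h
    apply h0
    rw [← h]
    rfl
  have hspan : Submodule.span F (b '' T) = H.toSubmodule := by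
    apply le_antisymm
    · rw [Submodule.span_le]
      rintro _ ⟨i, hi, rfl⟩
      exact hT0 i hi
    · intro y hy
      rw [Module.Basis.mem_span_image]
      intro j hj
      by_contra hc
      exact (by simpa using hj : b.repr y j ≠ 0) (hrep y hy j hc)
  refine ⟨{ b := b, T := T, α := fun j i => if h : b i ∈ H then w j ⟨b i, h⟩ else 0,
            comm := ?_, wt := ?_, nil := ?_, reg := ?_ }, hspan⟩
  · intro i hi j hj
    rw [hwt (b i) (hT0 i hi) j]
    have h0 : (w j).IsZero := by simpa [T] using hj
    rw [h0.eq]; simp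
  · intro i hi j hj
    rw [hwt (b i) (hT0 i hi) j, dif_pos (hT0 i hi)]
  · intro j hj
    have h0 : ¬ (w j).IsZero := by simpa [T] using hj
    exact isNilpotent_ad_of_mem_rootSpace (H := H) (fun h => h0 h) (hb j)
  · intro j hj
    by_contra hc
    push Not at hc
    have h0 : ¬ (w j).IsZero := by simpa [T] using hj
    apply h0
    have key : ∀ y, ∀ hy : y ∈ Submodule.span F (b '' T), ⁅y, b j⁆ = 0 := by
      intro y hy
      induction hy using Submodule.span_induction with
      | mem x hx =>
        obtain ⟨i, hi, rfl⟩ := hx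
        have := hc i hi
        rw [dif_pos (hT0 i hi)] at this
        rw [hwt _ (hT0 i hi), this, zero_smul]
      | zero => simp
      | add x y _ _ hx hy => rw [add_lie, hx, hy, add_zero]
      | smul c x _ hx => rw [smul_lie, hx, smul_zero]
    change ⇑(w j) = 0
    ext ⟨y, hy⟩
    have h1 := key y (by rw [hspan]; exact hy)
    rw [hwt y hy, smul_eq_zero] at h1
    exact h1.resolve_right (b.ne_zero j)

/-- the standard Cartan subalgebra -/
def E8D.Hs (D : E8D F L) : LieSubalgebra F L :=
  { D.H with
    lie_mem' := by
      intro x y hx hy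
      change _ ∈ D.H
      have hx : x ∈ D.H := hx
      have hy : y ∈ D.H := hy
      rw [← wsp_zero] at *
      simpa using lie_wsp D hx hy }

lemma mem_Hs (D : E8D F L) (x : L) : x ∈ D.Hs ↔ x ∈ D.H := Iff.rfl

lemma H_comm (D : E8D F L) {x y : L} (hx : x ∈ D.H) (hy : y ∈ D.H) : ⁅x, y⁆ = 0 := by
  obtain ⟨c, rfl⟩ := (mem_H D).mp hx
  rw [← wsp_zero] at hy
  rw [hsum_lie D c hy, ca_zero]; simp

lemma Hs_cartan (D : E8D F L) : D.Hs.IsCartanSubalgebra where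
  nilpotent := by
    have : IsLieAbelian D.Hs := ⟨fun x y => Subtype.ext (H_comm D x.2 y.2)⟩
    infer_instance
  self_normalizing := by
    apply le_antisymm _ D.Hs.le_normalizer
    intro x hx
    let W : Submodule F L :=
      { carrier := {x | ∀ i, ⁅D.h i, x⁆ ∈ D.H}
        add_mem' := fun ha hb i => by rw [lie_add]; exact add_mem (ha i) (hb i)
        zero_mem' := fun i => by rw [lie_zero]; exact zero_mem _
        smul_mem' := fun c x hx i => by rw [lie_smul]; exact Submodule.smul_mem _ _ (hx i) }
    have hh : ∀ i, D.h i ∈ D.H := fun i => Submodule.subset_span ⟨i, rfl⟩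
    have hxW : x ∈ W := by
      intro i
      have := (LieSubalgebra.mem_normalizer_iff' D.Hs x).mp hx (D.h i) (hh i)
      exact this
    obtain ⟨s, y, hy, rfl⟩ := exists_decomp D x
    have h1 := graded_aux D W (fun i x hx j => by
      rw [H_comm D (hh j) (hx i)]; exact zero_mem _) s y (fun n _ => hy n) hxW
    change _ ∈ D.H
    refine Submodule.sum_mem _ fun n hn => ?_
    by_cases hn0 : n = 0
    · rw [← wsp_zero, ← hn0]; exact hy n
    · obtain ⟨i, hi⟩ : ∃ i, ca n i ≠ 0 := by
        by_contra hc
        push Not at hc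
        exact hn0 (ca_inj (by rw [ca_zero]; exact funext hc))
      have h2 := h1 n hn i
      rw [hy n i] at h2
      have h3 := Submodule.smul_mem _ (((ca n i : ℤ) : F)⁻¹) h2
      rwa [smul_smul, inv_mul_cancel₀ (by exact_mod_cast hi), one_smul] at h3

theorem conj_csa [Nontrivial L] (D : E8D F L) (H : LieSubalgebra F L) [H.IsCartanSubalgebra] :
    ∃ D' : E8D F L, D'.H = H.toSubmodule := by
  have := finDim D
  have := isKilling D
  have := Hs_cartan D
  obtain ⟨C1, h1⟩ := exists_chart D.Hs
  obtain ⟨C2, h2⟩ := exists_chart H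
  obtain ⟨g, hg⟩ := Chart.conj C1 C2
  refine ⟨D.map g, ?_⟩
  have e1 : (D.map g).H = D.H.map (g : L →ₗ[F] L) := by
    rw [E8D.H, E8D.H, Submodule.map_span, ← Set.range_comp]; rfl
  rw [e1, ← h2]
  have h1' : C1.z = D.H := h1
  ext y
  constructor
  · rintro ⟨x, hx, rfl⟩
    rw [← h1'] at hx
    exact (hg x).mp hx
  · intro hy
    refine ⟨g.symm y, ?_, g.apply_symm_apply y⟩
    rw [← h1']
    refine (hg _).mpr ?_
    rw [LieEquiv.apply_symm_apply]; exact hy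
end csa
end E8P
namespace E8P
open LieAlgebra LieModule
set_option linter.unusedSectionVars false
section gen
variable {F V : Type*} [Field F] [IsAlgClosed F] [AddCommGroup V] [Module F V] [Module.Finite F V]

lemma gb (f : Module.End F V) : ∃ (b : Module.Basis (Fin (Module.finrank F V)) F V)
    (w : Fin (Module.finrank F V) → F), (∀ i, b i ∈ f.maxGenEigenspace (w i)) ∧
    ∀ μ, ∀ y ∈ f.maxGenEigenspace μ, ∀ i, w i ≠ μ → b.repr y i = 0 := by
  classical
  have hInt : DirectSum.IsInternal f.maxGenEigenspace :=
    DirectSum.isInternal_submodule_of_iSupIndep_of_iSup_eq_top f.independent_maxGenEigenspace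
      f.iSup_maxGenEigenspace_eq_top
  let v : ∀ μ, Module.Basis (Fin (Module.finrank F (f.maxGenEigenspace μ))) F
    (f.maxGenEigenspace μ) := fun μ => Module.finBasis F _
  let b0 := hInt.collectedBasis v
  have : Finite (Σ μ : F, Fin (Module.finrank F (f.maxGenEigenspace μ))) :=
    Module.Finite.finite_basis b0
  have := Fintype.ofFinite (Σ μ : F, Fin (Module.finrank F (f.maxGenEigenspace μ)))
  let e : (Σ μ : F, Fin (Module.finrank F (f.maxGenEigenspace μ))) ≃ Fin (Module.finrank F V) :=
    Fintype.equivFinOfCardEq (by rw [Module.finrank_eq_card_basis b0])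
  refine ⟨b0.reindex e, fun i => (e.symm i).1, fun i => ?_, fun μ y hy i hi => ?_⟩
  · rw [Module.Basis.reindex_apply]
    exact hInt.collectedBasis_mem v (e.symm i)
  · rw [Module.Basis.repr_reindex_apply]
    exact hInt.collectedBasis_repr_of_mem_ne v (Ne.symm hi) hy

/-- basis of generalized eigenvectors -/
noncomputable def gbb (f : Module.End F V) := (gb f).choose
/-- its eigenvalues -/
noncomputable def gbw (f : Module.End F V) := (gb f).choose_spec.choose
lemma gbb_mem (f : Module.End F V) (i) : gbb f i ∈ f.maxGenEigenspace (gbw f i) :=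
  (gb f).choose_spec.choose_spec.1 i
lemma gbb_repr (f : Module.End F V) {μ : F} {y : V} (hy : y ∈ f.maxGenEigenspace μ) (i)
    (hi : gbw f i ≠ μ) : (gbb f).repr y i = 0 :=
  (gb f).choose_spec.choose_spec.2 μ y hy i hi

/-- the operator acting by `c μ` on the generalized `μ`-eigenspace -/
noncomputable def opc (f : Module.End F V) (c : F → F) : Module.End F V :=
  (gbb f).constr F (fun i => c (gbw f i) • gbb f i)

lemma opc_gbb (f : Module.End F V) (c : F → F) (i) : opc f c (gbb f i) = c (gbw f i) • gbb f i := by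
  rw [opc, Module.Basis.constr_basis]

lemma opc_apply (f : Module.End F V) (c : F → F) {μ : F} {y : V} (hy : y ∈ f.maxGenEigenspace μ) :
    opc f c y = c μ • y := by
  conv_lhs => rw [← (gbb f).sum_repr y]
  conv_rhs => rw [← (gbb f).sum_repr y]
  rw [map_sum, Finset.smul_sum]
  refine Finset.sum_congr rfl fun i _ => ?_
  rw [map_smul, opc_gbb]
  by_cases h : gbw f i = μ
  · rw [h, smul_comm]
  · rw [gbb_repr f hy i h]; simp

lemma gen_ext (f : Module.End F V) {W : Type*} [AddCommGroup W] [Module F W] {S T : V →ₗ[F] W}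
    (h : ∀ μ, ∀ y ∈ f.maxGenEigenspace μ, S y = T y) : S = T :=
  (gbb f).ext fun i => h _ _ (gbb_mem f i)

lemma trace_opc (f : Module.End F V) (c : F → F) :
    LinearMap.trace F V (opc f c) = ∑ i, c (gbw f i) := by
  classical
  rw [LinearMap.trace_eq_matrix_trace F (gbb f), Matrix.trace]
  refine Finset.sum_congr rfl fun i _ => ?_
  rw [Matrix.diag_apply, LinearMap.toMatrix_apply, opc_gbb]
  simp

lemma opc_mul (f : Module.End F V) (c d : F → F) :
    opc f c * opc f d = opc f (fun μ => c μ * d μ) := by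
  refine (gbb f).ext fun i => ?_
  rw [Module.End.mul_apply, opc_gbb, map_smul, opc_gbb, opc_gbb, smul_smul, mul_comm]

lemma gen_stable (f : Module.End F V) {μ : F} {y : V} (hy : y ∈ f.maxGenEigenspace μ) :
    f y ∈ f.maxGenEigenspace μ :=
  Module.End.mapsTo_maxGenEigenspace_of_comm (Commute.refl f) μ hy

lemma opc_comm (f : Module.End F V) (c : F → F) : Commute f (opc f c) := by
  apply gen_ext f
  intro μ y hy
  rw [Module.End.mul_apply, Module.End.mul_apply, opc_apply f c hy, opc_apply f c (gen_stable f hy),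
    map_smul]

lemma sub_nil (f : Module.End F V) : IsNilpotent (f - opc f id) := by
  have key : ∀ μ, ∀ k : ℕ, ∀ y ∈ f.maxGenEigenspace μ,
      ((f - opc f id) ^ k) y = ((f - μ • (1 : Module.End F V)) ^ k) y ∧
      ((f - opc f id) ^ k) y ∈ f.maxGenEigenspace μ := by
    intro μ k
    induction k with
    | zero => intro y hy; simpa using hy
    | succ k ih =>
      intro y hy
      have h1 : (f - opc f id) y = (f - μ • (1 : Module.End F V)) y := by
        simp [opc_apply f id hy]
      have h2 : (f - opc f id) y ∈ f.maxGenEigenspace μ := by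
        rw [h1]
        simp only [LinearMap.sub_apply, LinearMap.smul_apply, Module.End.one_apply]
        exact sub_mem (gen_stable f hy) (Submodule.smul_mem _ _ hy)
      rw [pow_succ, pow_succ, Module.End.mul_apply, Module.End.mul_apply, ← h1]
      exact ih _ h2
  rw [Module.End.isNilpotent_iff_of_finite]
  intro m
  rw [← (gbb f).sum_repr m]
  have h1 : ∀ i, ∃ k, ((f - opc f id) ^ k) (gbb f i) = 0 := by
    intro i
    obtain ⟨k, hk⟩ := (Module.End.mem_maxGenEigenspace f _ _).mp (gbb_mem f i)
    exact ⟨k, by rw [(key _ k _ (gbb_mem f i)).1, hk]⟩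
  choose k hk using h1
  refine ⟨∑ i, k i, ?_⟩
  rw [map_sum]
  refine Finset.sum_eq_zero fun i _ => ?_
  rw [map_smul]
  have : k i ≤ ∑ i, k i := Finset.single_le_sum (fun _ _ => Nat.zero_le _) (Finset.mem_univ i)
  rw [Module.End.pow_map_zero_of_le this (hk i), smul_zero]

lemma trace_mul_opc (f : Module.End F V) (c : F → F) :
    LinearMap.trace F V (f * opc f c) = ∑ i, gbw f i * c (gbw f i) := by
  have h1 : f * opc f c = (f - opc f id) * opc f c + opc f (fun μ => μ * c μ) := by
    rw [sub_mul, opc_mul]; simp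
  have hc : Commute (f - opc f id) (opc f c) := by
    refine (opc_comm f c).sub_left ?_
    rw [Commute, SemiconjBy, opc_mul, opc_mul]
    simp only [mul_comm]
  have h2 : IsNilpotent ((f - opc f id) * opc f c) := hc.isNilpotent_mul_right (sub_nil f)
  have h3 := LinearMap.isNilpotent_trace_of_isNilpotent h2
  rw [h1, map_add, trace_opc, h3.eq_zero, zero_add]

lemma nil_of_gbw (f : Module.End F V) (h : ∀ i, gbw f i = 0) : IsNilpotent f := by
  have h1 := sub_nil f
  have : opc f id = 0 := (gbb f).ext fun i => by rw [opc_gbb, h]; simp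
  rwa [this, sub_zero] at h1
end gen

section lie
variable {F L : Type*} [Field F] [CharZero F] [IsAlgClosed F] [LieRing L] [LieAlgebra F L]
  [Module.Finite F L]

lemma lie_gen (x : L) {μ ν : F} {y z : L} (hy : y ∈ (ad F L x).maxGenEigenspace μ)
    (hz : z ∈ (ad F L x).maxGenEigenspace ν) : ⁅y, z⁆ ∈ (ad F L x).maxGenEigenspace (μ + ν) :=
  lie_mem_maxGenEigenspace_toEnd hy hz

lemma exists_s [IsKilling F L] (x : L) (c : F →+ F) :
    ∃ s : L, ∀ y, ⁅s, y⁆ = opc (ad F L x) c y := by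
  have key : ∀ y z, opc (ad F L x) c ⁅y, z⁆ =
      ⁅opc (ad F L x) c y, z⁆ + ⁅y, opc (ad F L x) c z⁆ := by
    intro y z
    set T := opc (ad F L x) c with hT
    have k1 : ∀ μ, ∀ y ∈ (ad F L x).maxGenEigenspace μ, ∀ z, T ⁅y, z⁆ = ⁅T y, z⁆ + ⁅y, T z⁆ := by
      intro μ y hy z
      have : T ∘ₗ ad F L y = ad F L (T y) + ad F L y ∘ₗ T := by
        apply gen_ext (ad F L x)
        intro ν z hz
        simp only [LinearMap.comp_apply, LinearMap.add_apply, ad_apply]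
        rw [hT, opc_apply _ _ hy, opc_apply _ _ hz, opc_apply _ _ (lie_gen x hy hz), map_add,
          add_smul, smul_lie, lie_smul]
      simpa using LinearMap.congr_fun this z
    have : T ∘ₗ ad F L z = ad F L z ∘ₗ T + ad F L (T z) := by
      apply gen_ext (ad F L x)
      intro μ y hy
      have h1 := k1 μ y hy z
      simp only [LinearMap.comp_apply, LinearMap.add_apply, ad_apply]
      rw [← lie_skew z y, map_neg, h1, ← lie_skew z (T y), ← lie_skew (T z) y]
      abel
    have h2 := LinearMap.congr_fun this y
    simp only [LinearMap.comp_apply, LinearMap.add_apply, ad_apply] at h2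
    rw [← lie_skew z y, ← lie_skew z, ← lie_skew (T z), map_neg] at h2
    rw [← neg_inj, h2]
    abel
  let D : LieDerivation F L L := ⟨opc (ad F L x) c, fun a b => by
    rw [key, ← lie_skew b, sub_neg_eq_add, add_comm]⟩
  obtain ⟨s, hs⟩ := LieDerivation.IsKilling.exists_eq_ad D
  refine ⟨s, fun y => ?_⟩
  have := congrArg (fun E : LieDerivation F L L => E y) hs
  have h2 : LieDerivation.ad F L s y = opc (ad F L x) c y := this
  simpa using h2

lemma s_eq [IsKilling F L] {s t : L} (h : ∀ y : L, ⁅s, y⁆ = ⁅t, y⁆) : s = t := by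
  rw [← sub_eq_zero]
  refine (LieDerivation.IsKilling.ad_apply_eq_zero_iff F L _).mp ?_
  ext y
  simp [h y]

lemma map_gen (x : L) (g : L ≃ₗ⁅F⁆ L) (t : F) (ht : t * t = 1) (hg : g x = t • x) {μ : F} {y : L}
    (hy : y ∈ (ad F L x).maxGenEigenspace μ) : g y ∈ (ad F L x).maxGenEigenspace (t * μ) := by
  rw [Module.End.mem_maxGenEigenspace] at *
  obtain ⟨k, hk⟩ := hy
  refine ⟨k, ?_⟩
  have key : ∀ z, (ad F L x - (t * μ) • (1 : Module.End F L)) (g z) =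
      t • g ((ad F L x - μ • (1 : Module.End F L)) z) := by
    intro z
    have h1 : ⁅x, g z⁆ = t • g ⁅x, z⁆ := by
      rw [LieEquiv.map_lie, hg, smul_lie, smul_smul, ht, one_smul]
    simp [h1, mul_smul, smul_sub]
  have key2 : ∀ k : ℕ, ∀ z, ((ad F L x - (t * μ) • (1 : Module.End F L)) ^ k) (g z) =
      t ^ k • g (((ad F L x - μ • (1 : Module.End F L)) ^ k) z) := by
    intro k
    induction k with
    | zero => intro z; simp
    | succ k ih =>
      intro z
      rw [pow_succ, Module.End.mul_apply, key, map_smul, ih, smul_smul, pow_succ' t]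
      congr 2
  rw [key2, hk, map_zero, smul_zero]

lemma map_s [IsKilling F L] (x : L) (c : F →+ F) {s : L} (hs : ∀ y, ⁅s, y⁆ = opc (ad F L x) c y)
    (g : L ≃ₗ⁅F⁆ L) (t : F) (ht : t = 1 ∨ t = -1) (hg : g x = t • x) : g s = t • s := by
  have htt : t * t = 1 := by rcases ht with rfl | rfl <;> simp
  have hc : ∀ μ, c (t * μ) = t * c μ := by rcases ht with rfl | rfl <;> simp
  apply s_eq (F := F)
  intro y
  have key : ∀ y, ⁅g s, g y⁆ = ⁅t • s, g y⁆ := by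
    intro y
    have : (g : L →ₗ[F] L) ∘ₗ ad F L s = (t • ad F L s) ∘ₗ (g : L →ₗ[F] L) := by
      apply gen_ext (ad F L x)
      intro μ y hy
      have h1 : g ⁅s, y⁆ = t • ⁅s, g y⁆ := by
        rw [hs, hs, opc_apply _ _ hy, opc_apply _ _ (map_gen x g t htt hg hy), hc, smul_smul,
          ← mul_assoc, htt, one_mul, map_smul]
      simpa using h1
    have := LinearMap.congr_fun this y
    rw [← LieEquiv.map_lie, smul_lie]
    simpa using this
  have := key (g.symm y)
  rwa [LieEquiv.apply_symm_apply] at this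

/-- element killed by `x` is killed by `s` -/
lemma s_lie (x : L) (c : F →+ F) {s : L} (hs : ∀ y, ⁅s, y⁆ = opc (ad F L x) c y) {y : L}
    (k : ℕ) (hy : ((ad F L x) ^ k) y = 0) : ⁅s, y⁆ = 0 := by
  have : y ∈ (ad F L x).maxGenEigenspace 0 := by
    rw [Module.End.mem_maxGenEigenspace]
    exact ⟨k, by simpa using hy⟩
  rw [hs, opc_apply _ _ this, map_zero, zero_smul]
end lie
end E8P
namespace E8P
open LieAlgebra LieModule
set_option linter.unusedSectionVars false
section
variable {F L : Type*} [Field F] [CharZero F] [IsAlgClosed F] [LieRing L] [LieAlgebra F L]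
  [Module.Finite F L]

lemma exists_A [IsKilling F L] (g : L ≃ₗ⁅F⁆ L) (g0 : LieSubalgebra F L)
    (hg0 : ∀ x, x ∈ g0 ↔ g x = x) [IsKilling F g0] :
    ∃ A : LieSubalgebra F L, (∀ x ∈ A, g x = x) ∧ (∀ x ∈ A, ∀ y ∈ A, ⁅x, y⁆ = 0) ∧
      (∀ x, g x = x → (∀ y ∈ A, ⁅y, x⁆ = 0) → x ∈ A) ∧
      (∀ x ∈ A, ∀ (y : L) (k : ℕ), ((ad F L x) ^ k) y = 0 → ⁅x, y⁆ = 0) := by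
  have : Infinite F := CharZero.infinite F
  obtain ⟨x0, hH⟩ := exists_isCartanSubalgebra_engel F g0
  set H := LieSubalgebra.engel F x0 with hHd
  have hab : ∀ x y : H, ⁅x, y⁆ = 0 := fun x y => trivial_lie_zero _ _ x y
  have memA : ∀ x : L, x ∈ H.map g0.incl ↔ ∃ h : x ∈ g0, (⟨x, h⟩ : g0) ∈ H := by
    intro x
    rw [LieSubalgebra.mem_map]
    constructor
    · rintro ⟨y, hy, rfl⟩
      exact ⟨y.2, hy⟩
    · rintro ⟨h, hx⟩
      exact ⟨⟨x, h⟩, hx, rfl⟩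
  have a1 : ∀ x ∈ H.map g0.incl, g x = x := fun x hx => by
    obtain ⟨h, -⟩ := (memA x).mp hx
    exact (hg0 x).mp h
  have a2 : ∀ x ∈ H.map g0.incl, ∀ y ∈ H.map g0.incl, ⁅x, y⁆ = 0 := by
    intro x hx y hy
    obtain ⟨h, hx⟩ := (memA x).mp hx
    obtain ⟨h', hy⟩ := (memA y).mp hy
    have := hab ⟨_, hx⟩ ⟨_, hy⟩
    have h3 := congrArg (fun z : H => ((z : g0) : L)) this
    simpa using h3
  have a3 : ∀ x, g x = x → (∀ y ∈ H.map g0.incl, ⁅y, x⁆ = 0) → x ∈ H.map g0.incl := by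
    intro x hx h
    refine (memA x).mpr ⟨(hg0 x).mpr hx, ?_⟩
    rw [← hH.self_normalizing, LieSubalgebra.mem_normalizer_iff']
    intro y hy
    have : ⁅y, (⟨x, (hg0 x).mpr hx⟩ : g0)⁆ = 0 := by
      apply Subtype.ext
      have := h y ((memA _).mpr ⟨y.2, hy⟩)
      simpa using this
    rw [this]
    exact H.zero_mem
  refine ⟨H.map g0.incl, a1, a2, a3, ?_⟩
  intro x hx y k hk
  obtain ⟨s, hs⟩ := exists_s (F := F) x (AddMonoidHom.id F)
  have hgs : g s = s := by
    have := map_s x _ hs g 1 (Or.inl rfl) (by rw [a1 x hx, one_smul])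
    rwa [one_smul] at this
  have hsA : s ∈ H.map g0.incl := by
    refine a3 s hgs fun y hy => ?_
    rw [← lie_skew, s_lie x _ hs 1 (by simpa using a2 x hx y hy), neg_zero]
  obtain ⟨h, hd⟩ := (memA _).mp (sub_mem hx hsA)
  have hn : IsNilpotent (ad F L (x - s)) := by
    have : ad F L (x - s) = ad F L x - opc (ad F L x) id := by
      ext y
      simp [hs]
    rw [this]
    exact sub_nil _
  have hn' : IsNilpotent (ad F g0 ⟨x - s, h⟩) :=
    LieSubalgebra.isNilpotent_ad_of_isNilpotent_ad g0 hn
  have h0 := IsKilling.eq_zero_of_isNilpotent_ad_of_mem_isCartanSubalgebra F g0 H hd hn'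
  have h1 : x - s = 0 := congrArg Subtype.val h0
  rw [sub_eq_zero.mp h1]
  exact s_lie x _ hs k hk

lemma exists_I : ∃ I : F, I * I = -1 := by
  obtain ⟨z, hz⟩ := IsAlgClosed.exists_pow_nat_eq (-1 : F) (n := 2) (by norm_num)
  exact ⟨z, by rw [← hz, sq]⟩

/-- eigencomponents of an automorphism of order 4 -/
lemma eig_decomp {I : F} (hI : I * I = -1) (g : L ≃ₗ⁅F⁆ L) (h4 : ∀ x, g (g (g (g x))) = x)
    (Z : Submodule F L) (hZ : ∀ x ∈ Z, g x ∈ Z) (y : L) (hy : y ∈ Z) :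
    ∃ y0 ∈ Z, ∃ y1 ∈ Z, ∃ y2 ∈ Z, ∃ y3 ∈ Z, g y0 = (1 : F) • y0 ∧ g y1 = I • y1 ∧
      g y2 = (-1 : F) • y2 ∧ g y3 = (-I) • y3 ∧ y = y0 + y1 + y2 + y3 := by
  have h1 := hZ _ hy
  have h2 := hZ _ h1
  have h3 := hZ _ h2
  have hc : ∀ a b c d : F, a • y + b • g y + c • g (g y) + d • g (g (g y)) ∈ Z :=
    fun a b c d => Z.add_mem (Z.add_mem (Z.add_mem (Z.smul_mem _ hy) (Z.smul_mem _ h1))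
      (Z.smul_mem _ h2)) (Z.smul_mem _ h3)
  have q : (4 : F) ≠ 0 := by norm_num
  refine ⟨_, hc (1/4) (1/4) (1/4) (1/4), _, hc (1/4) (-I/4) (-1/4) (I/4), _,
    hc (1/4) (-1/4) (1/4) (-1/4), _, hc (1/4) (I/4) (-1/4) (-I/4), ?_, ?_, ?_, ?_, ?_⟩
  · simp only [map_add, map_smul, h4]
    module
  · simp only [map_add, map_smul, h4, smul_add, smul_smul]
    have e1 : I * (-I / 4) = 1 / 4 := by linear_combination (-1/4) * hI
    have e2 : I * (I / 4) = -1 / 4 := by linear_combination (1/4) * hI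
    rw [e1, e2]
    module
  · simp only [map_add, map_smul, h4]
    module
  · simp only [map_add, map_smul, h4, smul_add, smul_smul]
    have e1 : -I * (-I / 4) = -1 / 4 := by linear_combination (1/4) * hI
    have e2 : -I * (I / 4) = 1 / 4 := by linear_combination (-1/4) * hI
    rw [e1, e2]
    module
  · have e : y = (1 : F) • y := (one_smul _ _).symm
    nth_rewrite 1 [e]
    module

/-- `κ(d, s) = 0` for all rational modifications forces nilpotency -/
lemma nil_of_kill [IsKilling F L] (d : L) (h : ∀ (c : F →+ F) (s : L),
    (∀ y, ⁅s, y⁆ = opc (ad F L d) c y) → killingForm F L d s = 0) : IsNilpotent (ad F L d) := by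
  apply nil_of_gbw
  intro i
  by_contra hi
  obtain ⟨f, hf⟩ : ∃ f : F →ₗ[ℚ] ℚ, f (gbw (ad F L d) i) ≠ 0 := by
    by_contra hn
    push Not at hn
    exact hi ((Module.forall_dual_apply_eq_zero_iff ℚ _).mp hn)
  let c : F →+ F := (algebraMap ℚ F).toAddMonoidHom.comp f.toAddMonoidHom
  obtain ⟨s, hs⟩ := exists_s (F := F) d c
  have h1 := h c s hs
  have h2 : ad F L s = opc (ad F L d) c := LinearMap.ext fun y => by simpa using hs y
  rw [killingForm_apply_apply, h2] at h1
  have h3 : LinearMap.trace F L (ad F L d * opc (ad F L d) c) = 0 := h1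
  rw [trace_mul_opc] at h3
  have h4 := congrArg f h3
  rw [map_sum, map_zero] at h4
  have h5 : ∀ j, f (gbw (ad F L d) j * c (gbw (ad F L d) j)) = f (gbw (ad F L d) j) ^ 2 := by
    intro j
    have : gbw (ad F L d) j * c (gbw (ad F L d) j) =
      (f (gbw (ad F L d) j)) • (gbw (ad F L d) j) := by
      rw [Algebra.smul_def, mul_comm]; rfl
    rw [this, map_smul, smul_eq_mul, sq]
  simp only [h5] at h4
  rw [Finset.sum_eq_zero_iff_of_nonneg (fun j _ => sq_nonneg _)] at h4
  exact hf (pow_eq_zero_iff (two_ne_zero) |>.mp (h4 i (Finset.mem_univ i)))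

theorem exists_theta_csa [IsKilling F L] (g : L ≃ₗ⁅F⁆ L) (h4 : ∀ x, g (g (g (g x))) = x)
    (g0 : LieSubalgebra F L) (hg0 : ∀ x, x ∈ g0 ↔ g x = x) [IsKilling F g0] :
    ∃ Z : LieSubalgebra F L, Z.IsCartanSubalgebra ∧ (∀ x ∈ Z, g x ∈ Z) ∧
      ∀ x, (∀ y ∈ Z, g y = y → ⁅y, x⁆ = 0) → x ∈ Z := by
  obtain ⟨A, a1, a2, a3, a4⟩ := exists_A g g0 hg0
  obtain ⟨I, hI⟩ := exists_I (F := F)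
  have : IsLieAbelian A := ⟨fun x y => Subtype.ext (a2 x x.2 y y.2)⟩
  let Z := zeroRootSubalgebra F L A
  have hZ : ∀ x, x ∈ Z ↔ ∀ y ∈ A, ⁅y, x⁆ = 0 := by
    intro x
    change x ∈ zeroRootSubalgebra F L A ↔ _
    rw [mem_zeroRootSubalgebra]
    constructor
    · intro h y hy
      obtain ⟨k, hk⟩ := h ⟨y, hy⟩
      exact a4 y hy x k hk
    · intro h y
      exact ⟨1, by rw [pow_one]; exact h y y.2⟩
  have gZ : ∀ x ∈ Z, g x ∈ Z := by
    intro x hx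
    rw [hZ] at hx ⊢
    intro y hy
    rw [← a1 y hy, ← LieEquiv.map_lie, hx y hy, map_zero]
  have hAZ : ∀ x ∈ A, x ∈ Z := fun x hx => (hZ x).mpr fun y hy => a2 y hy x hx
  have nd0 : ∀ x ∈ Z, (∀ y ∈ Z, killingForm F L x y = 0) → x = 0 := by
    intro x hx h
    have hk : x ∈ LinearMap.ker (killingForm F L) := by
      rw [LinearMap.mem_ker]
      ext y
      have hy : y ∈ ⨆ β, rootSpace A β := by simp [iSup_genWeightSpace_eq_top F A L]
      induction hy using LieSubmodule.iSup_induction' with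
      | mem β y hy =>
        by_cases hβ : β = 0
        · subst hβ
          exact h y hy
        · obtain ⟨z, hz⟩ := Function.ne_iff.mp hβ
          obtain ⟨k, hk⟩ := (mem_genWeightSpace _ _ _).mp hy z
          have h1 : ∀ k : ℕ, ∀ y, killingForm F L x
              (((toEnd F A L z - β z • (1 : Module.End F L)) ^ k) y) =
              (-β z) ^ k * killingForm F L x y := by
            intro k
            induction k with
            | zero => intro y; simp
            | succ k ih =>
              intro y
              rw [pow_succ, Module.End.mul_apply, ih]
              have h2 : killingForm F L x ⁅(z : L), y⁆ = 0 := by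
                have h3 : killingForm F L ⁅(z : L), x⁆ y = - killingForm F L x ⁅(z : L), y⁆ :=
                  traceForm_apply_lie_apply' F L L z x y
                rw [(hZ x).mp hx z z.2, map_zero, LinearMap.zero_apply] at h3
                exact neg_eq_zero.mp h3.symm
              have h4 : killingForm F L x ((toEnd F A L z - β z • (1 : Module.End F L)) y) =
                  killingForm F L x (⁅(z : L), y⁆ - β z • y) := rfl
              rw [h4, map_sub, h2, map_smul, smul_eq_mul]
              ring
          have h5 := h1 k y
          rw [hk, map_zero] at h5
          rcases mul_eq_zero.mp h5.symm with h6 | h6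
          · exact absurd (neg_eq_zero.mp (eq_zero_of_pow_eq_zero h6)) hz
          · exact h6
      | zero => simp
      | add => simp_all
    rwa [IsKilling.ker_killingForm_eq_bot] at hk
  have eig : ∀ a b : F, ∀ x y : L, g x = a • x → g y = b • y → g ⁅x, y⁆ = (a * b) • ⁅x, y⁆ := by
    intro a b x y hx hy
    rw [LieEquiv.map_lie, hx, hy, smul_lie, lie_smul, smul_smul]
  have orth : ∀ a b : F, ∀ x y : L, g x = a • x → g y = b • y → a * b ≠ 1 →
      killingForm F L x y = 0 := by
    intro a b x y hx hy hab
    have h1 := killingForm_of_equiv_apply (R := F) g x y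
    rw [hx, hy, map_smul, map_smul, LinearMap.smul_apply, smul_eq_mul, smul_eq_mul,
      ← mul_assoc, mul_comm b] at h1
    by_contra hne
    exact hab (mul_right_cancel₀ hne (by rw [h1, one_mul]))
  have hI0 : I ≠ 0 := by rintro rfl; simp at hI
  have h20 : (1 : F) ≠ -1 := by
    intro h
    have : (2 : F) = 0 := by linear_combination h
    norm_num at this
  let S : F → Prop := fun a => a = 1 ∨ a = I ∨ a = -1 ∨ a = -I
  have nd : ∀ a, ∀ d ∈ Z, g d = a • d → (∀ b, ∀ y ∈ Z, g y = b • y → S b → a * b = 1 →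
      killingForm F L d y = 0) → d = 0 := by
    intro a d hd hgd h
    have h' : ∀ b, ∀ y ∈ Z, g y = b • y → S b → killingForm F L d y = 0 := by
      intro b y hy hgy hb
      by_cases hab : a * b = 1
      · exact h b y hy hgy hb hab
      · exact orth a b d y hgd hgy hab
    refine nd0 d hd fun y hy => ?_
    obtain ⟨y0, m0, y1, m1, y2, m2, y3, m3, k0, k1, k2, k3, rfl⟩ :=
      eig_decomp hI g h4 Z.toSubmodule gZ y hy
    rw [map_add, map_add, map_add, h' _ y0 m0 k0 (Or.inl rfl), h' _ y1 m1 k1 (Or.inr (Or.inl rfl)),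
      h' _ y2 m2 k2 (Or.inr (Or.inr (Or.inl rfl))), h' _ y3 m3 k3 (Or.inr (Or.inr (Or.inr rfl)))]
    simp
  have inA : ∀ x ∈ Z, g x = (1 : F) • x → x ∈ A := by
    intro x hx hgx
    rw [one_smul] at hgx
    exact a3 x hgx ((hZ x).mp hx)
  have inv : ∀ x y z : L, killingForm F L ⁅x, y⁆ z = killingForm F L x ⁅y, z⁆ := fun x y z =>
    traceForm_apply_lie_apply F L L x y z
  have i1 : ∀ a b : F, ∀ x ∈ Z, ∀ y ∈ Z, g x = a • x → g y = b • y → a * b = 1 → ⁅x, y⁆ = 0 := by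
    intro a b x hx y hy hgx hgy hab
    refine nd 1 _ (Z.lie_mem hx hy) (by rw [eig a b x y hgx hgy, hab]) ?_
    intro b z hz hgz _ hb
    rw [one_mul] at hb
    subst hb
    have h1 := (hZ y).mp hy z (inA z hz hgz)
    rw [inv, ← lie_skew, h1, neg_zero, map_zero]
  have i2 : ∀ a : F, (a * a = -1) → ∀ x ∈ Z, ∀ y ∈ Z, g x = a • x → g y = a • y → ⁅x, y⁆ = 0 := by
    intro a ha x hx y hy hgx hgy
    have hdZ : ⁅x, y⁆ ∈ Z := Z.lie_mem hx hy
    have hgd : g ⁅x, y⁆ = (-1 : F) • ⁅x, y⁆ := by rw [eig a a x y hgx hgy, ha]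
    have ha' : a * -a = 1 := by rw [mul_neg, ha, neg_neg]
    have kk : ∀ z ∈ Z, g z = (-a) • z → ⁅⁅x, y⁆, z⁆ = 0 := by
      intro z hz hgz
      rw [lie_lie, i1 _ _ y hy z hz hgy hgz ha', i1 _ _ x hx z hz hgx hgz ha', lie_zero, lie_zero,
        sub_zero]
    have kk' : ∀ z ∈ Z, g z = a • z → ⁅⁅x, y⁆, ⁅⁅x, y⁆, z⁆⁆ = 0 := by
      intro z hz hgz
      refine kk _ (Z.lie_mem hdZ hz) ?_
      rw [eig _ _ _ _ hgd hgz, neg_one_mul]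
    have haI : a = I ∨ a = -I := by
      have : (a - I) * (a + I) = 0 := by linear_combination ha - hI
      rcases mul_eq_zero.mp this with h | h
      · left; linear_combination h
      · right; linear_combination h
    have hsq : ∀ z ∈ Z, ((ad F L ⁅x, y⁆) ^ 2) z = 0 := by
      intro z hz
      rw [sq, Module.End.mul_apply, ad_apply, ad_apply]
      obtain ⟨y0, m0, y1, m1, y2, m2, y3, m3, k0, k1, k2, k3, rfl⟩ :=
        eig_decomp hI g h4 Z.toSubmodule gZ z hz
      have e0 : ⁅⁅x, y⁆, y0⁆ = 0 := by
        rw [← lie_skew, (hZ _).mp hdZ y0 (inA y0 m0 k0), neg_zero]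
      have e2 : ⁅⁅x, y⁆, y2⁆ = 0 := i1 _ _ _ hdZ _ m2 hgd k2 (by norm_num)
      simp only [lie_add, e0, e2, lie_zero, zero_add, add_zero]
      rcases haI with rfl | rfl
      · rw [kk' y1 m1 k1, kk y3 m3 k3, lie_zero, add_zero]
      · rw [kk' y3 m3 k3, kk y1 m1 (by rw [neg_neg]; exact k1), lie_zero, add_zero]
    have hnil : IsNilpotent (ad F L ⁅x, y⁆) := by
      refine nil_of_kill _ fun c s hs => ?_
      rw [inv, ← lie_skew, s_lie _ c hs 2 (hsq y hy), neg_zero, map_zero]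
    refine nd (-1) _ hdZ hgd ?_
    intro b z hz hgz _ hb
    have hdz : ⁅⁅x, y⁆, z⁆ = 0 := i1 _ _ _ hdZ _ hz hgd hgz hb
    have hcm : Commute (ad F L ⁅x, y⁆) (ad F L z) := by
      refine LinearMap.ext fun w => ?_
      have h1 := leibniz_lie ⁅x, y⁆ z w
      rw [hdz, zero_lie, zero_add] at h1
      exact h1
    rw [killingForm_apply_apply]
    exact (LinearMap.isNilpotent_trace_of_isNilpotent (hcm.isNilpotent_mul_right hnil)).eq_zero
  have i3 : ∀ a : F, (a * a = -1) → ∀ x ∈ Z, ∀ y ∈ Z, g x = a • x → g y = (-1 : F) • y →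
      ⁅x, y⁆ = 0 := by
    intro a ha x hx y hy hgx hgy
    refine nd (-a) _ (Z.lie_mem hx hy) (by rw [eig _ _ _ _ hgx hgy, mul_neg_one]) ?_
    intro b z hz hgz _ hb
    have hab : b = a := by linear_combination a * hb + b * ha
    subst hab
    have h1 := i2 b ha x hx z hz hgx hgz
    rw [← lie_skew, map_neg, LinearMap.neg_apply, inv, h1, map_zero, neg_zero]
  have hI' : -I * -I = -1 := by rw [neg_mul_neg, hI]
  have flip : ∀ x y : L, ⁅x, y⁆ = 0 → ⁅y, x⁆ = 0 := fun x y h => by rw [← lie_skew, h, neg_zero]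
  have key : ∀ a b, S a → S b → ∀ x ∈ Z, ∀ y ∈ Z, g x = a • x → g y = b • y → ⁅x, y⁆ = 0 := by
    intro a b ha hb x hx y hy hgx hgy
    have t1 : a = 1 → ⁅x, y⁆ = 0 := by
      rintro rfl
      exact (hZ y).mp hy x (inA x hx hgx)
    have t2 : b = 1 → ⁅x, y⁆ = 0 := by
      rintro rfl
      exact flip _ _ ((hZ x).mp hx y (inA y hy hgy))
    rcases ha with h | rfl | rfl | rfl
    · exact t1 h
    · rcases hb with h | rfl | rfl | rfl
      · exact t2 h
      · exact i2 _ hI _ hx _ hy hgx hgy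
      · exact i3 _ hI _ hx _ hy hgx hgy
      · exact i1 _ _ _ hx _ hy hgx hgy (by rw [mul_neg, hI, neg_neg])
    · rcases hb with h | rfl | rfl | rfl
      · exact t2 h
      · exact flip _ _ (i3 _ hI _ hy _ hx hgy hgx)
      · exact i1 _ _ _ hx _ hy hgx hgy (by norm_num)
      · exact flip _ _ (i3 _ hI' _ hy _ hx hgy hgx)
    · rcases hb with h | rfl | rfl | rfl
      · exact t2 h
      · exact i1 _ _ _ hx _ hy hgx hgy (by rw [neg_mul, hI, neg_neg])
      · exact i3 _ hI' _ hx _ hy hgx hgy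
      · exact i2 _ hI' _ hx _ hy hgx hgy
  have ab : ∀ x ∈ Z, ∀ y ∈ Z, ⁅x, y⁆ = 0 := by
    have key' : ∀ a, S a → ∀ x ∈ Z, g x = a • x → ∀ y ∈ Z, ⁅x, y⁆ = 0 := by
      intro a ha x hx hgx y hy
      obtain ⟨y0, m0, y1, m1, y2, m2, y3, m3, k0, k1, k2, k3, rfl⟩ :=
        eig_decomp hI g h4 Z.toSubmodule gZ y hy
      rw [lie_add, lie_add, lie_add, key a _ ha (Or.inl rfl) x hx y0 m0 hgx k0,
        key a _ ha (Or.inr (Or.inl rfl)) x hx y1 m1 hgx k1,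
        key a _ ha (Or.inr (Or.inr (Or.inl rfl))) x hx y2 m2 hgx k2,
        key a _ ha (Or.inr (Or.inr (Or.inr rfl))) x hx y3 m3 hgx k3]
      simp
    intro x hx y hy
    obtain ⟨y0, m0, y1, m1, y2, m2, y3, m3, k0, k1, k2, k3, rfl⟩ :=
      eig_decomp hI g h4 Z.toSubmodule gZ x hx
    rw [add_lie, add_lie, add_lie, key' _ (Or.inl rfl) y0 m0 k0 y hy,
      key' _ (Or.inr (Or.inl rfl)) y1 m1 k1 y hy,
      key' _ (Or.inr (Or.inr (Or.inl rfl))) y2 m2 k2 y hy,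
      key' _ (Or.inr (Or.inr (Or.inr rfl))) y3 m3 k3 y hy]
    simp
  have : IsLieAbelian Z := ⟨fun x y => Subtype.ext (ab x x.2 y y.2)⟩
  refine ⟨Z, ⟨inferInstance, zeroRootSubalgebra_normalizer_eq_self F L A⟩, gZ, ?_⟩
  intro x h
  rw [hZ]
  intro y hy
  exact h y (hAZ y hy) (a1 y hy)

end
end E8P
namespace E8P
open LieAlgebra LieModule
set_option linter.unusedSectionVars false

def c8 (i j : Fin 8) : ℤ := CartanMatrix.E₈ i j

set_option synthInstance.maxSize 2000 in
set_option synthInstance.maxHeartbeats 2000000 in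
lemma diag_rigid (σ : Fin 8 → Fin 8)
    (h : ∀ k l, c8 (σ k) (σ l) = c8 k l) : ∀ k, σ k = k := by
  have k1 : ∀ c b d e : Fin 8, c8 b c = -1 → c8 c d = -1 →
      c8 b d = 0 → c8 c e = -1 → c8 b e = 0 →
      c8 d e = 0 → c = 3 := by decide +kernel
  have k2 : ∀ e f g : Fin 8, c8 3 e = -1 → c8 e f = -1 →
      c8 3 f = 0 → c8 f g = -1 → c8 e g = 0 →
      e = 4 ∧ f = 5 ∧ g = 6 := by decide +kernel
  have k3 : ∀ g : Fin 8, c8 6 g = -1 → c8 5 g = 0 → g = 7 := by decide +kernel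
  have k4 : ∀ b a : Fin 8, c8 3 b = -1 → c8 4 b = 0 →
      c8 b a = -1 → c8 3 a = 0 → b = 2 ∧ a = 0 := by decide +kernel
  have k5 : ∀ d : Fin 8, c8 3 d = -1 → c8 4 d = 0 → c8 2 d = 0 →
      d = 1 := by decide +kernel
  have h3 := k1 (σ 3) (σ 2) (σ 1) (σ 4) (by rw [h]; decide) (by rw [h]; decide)
    (by rw [h]; decide) (by rw [h]; decide) (by rw [h]; decide) (by rw [h]; decide)
  obtain ⟨h4, h5, h6⟩ := k2 (σ 4) (σ 5) (σ 6) (by rw [← h3, h]; decide)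
    (by rw [h]; decide) (by rw [← h3, h]; decide) (by rw [h]; decide) (by rw [h]; decide)
  have h7 := k3 (σ 7) (by rw [← h6, h]; decide) (by rw [← h5, h]; decide)
  obtain ⟨h2, h0⟩ := k4 (σ 2) (σ 0) (by rw [← h3, h]; decide) (by rw [← h4, h]; decide)
    (by rw [h]; decide) (by rw [← h3, h]; decide)
  have h1 := k5 (σ 1) (by rw [← h3, h]; decide) (by rw [← h4, h]; decide)
    (by rw [← h2, h]; decide)
  intro k
  fin_cases k <;> assumption

/-- linear extension of values on the simple roots -/
def qv (q : Fin 8 → ℚ) (n : V8) : ℚ := ∑ i, (n i : ℚ) * q i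

lemma qv_add (q) (m n : V8) : qv q (m + n) = qv q m + qv q n := by
  simp [qv, add_mul, Finset.sum_add_distrib]
lemma qv_smul (q) (c : ℤ) (n : V8) : qv q (c • n) = c * qv q n := by
  simp [qv, Finset.mul_sum, mul_assoc]
lemma qv_neg (q) (n : V8) : qv q (-n) = - qv q n := by simp [qv]
lemma qv_sub (q) (m n : V8) : qv q (m - n) = qv q m - qv q n := by
  rw [sub_eq_add_neg, qv_add, qv_neg, sub_eq_add_neg]
lemma qv_al (q) (i) : qv q (al i) = q i := by
  rw [qv, Finset.sum_eq_single i]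
  · simp [al]
  · intro j _ hj; simp [al, hj]
  · simp
lemma v8_eq (n : V8) : n = ∑ i, n i • al i := by
  ext j
  simp [al, Finset.sum_apply, Pi.single_apply]
lemma qv_zero (q) : qv q 0 = 0 := by simp [qv]
lemma qv_sum (q) {ι : Type*} (s : Finset ι) (f : ι → V8) :
    qv q (∑ i ∈ s, f i) = ∑ i ∈ s, qv q (f i) := by
  classical
  induction s using Finset.induction_on with
  | empty => simp [qv_zero]
  | insert a s h ih => rw [Finset.sum_insert h, Finset.sum_insert h, qv_add, ih]
lemma ca_sum {ι : Type*} (s : Finset ι) (f : ι → V8) :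
    ca (∑ i ∈ s, f i) = ∑ i ∈ s, ca (f i) := by
  classical
  induction s using Finset.induction_on with
  | empty => simp [ca_zero]
  | insert a s h ih => rw [Finset.sum_insert h, Finset.sum_insert h, ca_add, ih]
lemma ca_zsmul (c : ℤ) (n : V8) : ca (c • n) = c • ca n := by
  ext i
  rw [← bf_al_left, bf_smul_right, bf_al_left]; rfl

lemma qv_sr (q) (i) (n : V8) : qv (fun j => qv q (sr i (al j))) n = qv q (sr i n) := by
  have h1 : sr i n = ∑ j, n j • sr i (al j) := by
    have h2 : ca n i = ∑ j, n j * ca (al j) i := by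
      conv_lhs => rw [v8_eq n]
      rw [ca_sum, Finset.sum_apply]
      simp only [ca_zsmul, Pi.smul_apply, smul_eq_mul]
    simp only [sr, smul_sub, Finset.sum_sub_distrib, ← v8_eq n]
    rw [h2, Finset.sum_smul]
    simp [mul_smul]
  rw [h1, qv_sum]
  simp [qv, Finset.mul_sum, mul_assoc]

/-- Weyl vector -/
def rho : V8 := ![46, 68, 91, 135, 110, 84, 57, 29]
lemma ca_rho (i) : ca rho i = 1 := by
  revert i; decide
lemma sr_rho (i) : sr i rho = rho - al i := by rw [sr, ca_rho, one_smul]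

lemma roots_finite : {n : V8 | bf n n = 2}.Finite := by
  refine (Set.finite_Icc (fun _ => -12 : V8) (fun _ => 12)).subset fun n hn => ?_
  exact ⟨fun i => (abs_le.mp (root_bound hn i)).1, fun i => (abs_le.mp (root_bound hn i)).2⟩

section
variable {F L : Type*} [Field F] [CharZero F] [LieRing L] [LieAlgebra F L] [Nontrivial L]

lemma root_vec (D : E8D F L) {n : V8} (hn : bf n n = 2) : ∃ x ∈ D.wsp n, x ≠ 0 := by
  have h := finrank_wsp D hn
  have : D.wsp n ≠ ⊥ := by
    intro hb
    rw [hb, finrank_bot] at h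
    norm_num at h
  exact Submodule.exists_mem_ne_zero_of_ne_bot this

lemma wsp_uniq (D : E8D F L) {m n : V8} {x : L} (hm : x ∈ D.wsp m) (hn : x ∈ D.wsp n)
    (hx : x ≠ 0) : m = n := by
  apply ca_inj
  ext i
  have h1 : ((ca m i : ℤ) : F) • x = ((ca n i : ℤ) : F) • x := by rw [← hm i, ← hn i]
  have h2 := smul_left_injective F hx h1
  exact_mod_cast h2

lemma wsp_common (D1 D2 : E8D F L) (hH : D1.H = D2.H) {n : V8} {x : L} (hx : x ∈ D1.wsp n) :
    ∃ m, x ∈ D2.wsp m := by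
  by_cases h0 : x = 0
  · exact ⟨0, by rw [h0]; exact zero_mem _⟩
  obtain ⟨s, y, hy, hxy⟩ := exists_decomp D2 x
  have hW : ∀ i, ∀ z ∈ F ∙ x, ⁅D2.h i, z⁆ ∈ F ∙ x := by
    intro i z hz
    obtain ⟨c, rfl⟩ := Submodule.mem_span_singleton.mp hz
    have h1 : D2.h i ∈ D1.H := by rw [hH]; exact Submodule.subset_span ⟨i, rfl⟩
    obtain ⟨b, hb⟩ := (mem_H D1).mp h1
    rw [hb, lie_smul, hsum_lie D1 b hx]
    exact Submodule.smul_mem _ _ (Submodule.smul_mem _ _ (Submodule.mem_span_singleton_self x))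
  have h1 := graded_aux D2 (F ∙ x) hW s y (fun n _ => hy n)
    (by rw [← hxy]; exact Submodule.mem_span_singleton_self x)
  have h2 : ∃ m ∈ s, y m ≠ 0 := by
    by_contra hcon
    push Not at hcon
    exact h0 (by rw [hxy]; exact Finset.sum_eq_zero hcon)
  obtain ⟨m, hm, hne⟩ := h2
  obtain ⟨c, hc⟩ := Submodule.mem_span_singleton.mp (h1 m hm)
  have hc0 : c ≠ 0 := by rintro rfl; rw [zero_smul] at hc; exact hne hc.symm
  refine ⟨m, ?_⟩
  have : x = c⁻¹ • y m := by rw [← hc, smul_smul, inv_mul_cancel₀ hc0, one_smul]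
  rw [this]
  exact Submodule.smul_mem _ _ (hy m)

lemma same_h (D1 D2 : E8D F L) (hH : D1.H = D2.H) (s : L) (q : Fin 8 → ℚ) (hq : ∀ i, 0 < q i)
    (h1 : ∀ n, ∀ x ∈ D1.wsp n, ⁅s, x⁆ = (qv q n : F) • x)
    (h2 : ∀ n, ∀ x ∈ D2.wsp n, ⁅s, x⁆ = (qv q n : F) • x) : ∀ i, D2.h i = D1.h i := by
  have step : ∀ D1 D2 : E8D F L, D1.H = D2.H →
      (∀ n, ∀ x ∈ D1.wsp n, ⁅s, x⁆ = (qv q n : F) • x) →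
      (∀ n, ∀ x ∈ D2.wsp n, ⁅s, x⁆ = (qv q n : F) • x) →
      ∀ i, ∃ m, D2.e i ∈ D1.wsp m ∧ 0 ≤ m ∧ bf m m = 2 := by
    intro D1 D2 hH h1 h2 i
    obtain ⟨m, hm⟩ := wsp_common D2 D1 hH.symm (e_mem_wsp D2 i)
    have e0 := e_ne D2 i
    have k1 := h1 m _ hm
    rw [h2 _ _ (e_mem_wsp D2 i), qv_al] at k1
    have k2 : q i = qv q m := by exact_mod_cast smul_left_injective F e0 k1
    have hm0 : m ≠ 0 := by
      rintro rfl
      rw [qv_zero] at k2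
      exact (hq i).ne' k2
    have hr := root_of_wsp D1 (n := m) (fun hb => e0 (by rw [hb] at hm; exact hm)) hm0
    refine ⟨m, hm, ?_, hr⟩
    rcases root_sign m hr with h | h
    · exact h
    · exfalso
      have : qv q (-m) = ∑ i, ((-m) i : ℚ) * q i := by simp [qv]
      have h3 : 0 ≤ qv q (-m) := by
        rw [this]
        exact Finset.sum_nonneg fun i _ => mul_nonneg (by exact_mod_cast h i) (hq i).le
      rw [qv_neg, ← k2] at h3
      have := hq i
      linarith
  have m1 := step D1 D2 hH h1 h2
  have p1 := step D2 D1 hH.symm h2 h1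
  choose m hm m0 mr using m1
  choose p hp p0 pr using p1
  have tr : ∀ n, ∀ x ∈ D2.wsp n, x ∈ D1.wsp (∑ i, n i • m i) := by
    intro n x hx j
    have hj : D1.h j ∈ D2.H := by rw [← hH]; exact Submodule.subset_span ⟨j, rfl⟩
    obtain ⟨c, hc⟩ := (mem_H D2).mp hj
    have a1 : ∀ i, ∑ l, c l * ((ca (al i) l : ℤ) : F) = ((ca (m i) j : ℤ) : F) := by
      intro i
      have k1 := hm i j
      rw [hc, hsum_lie D2 c (e_mem_wsp D2 i)] at k1
      exact smul_left_injective F (e_ne D2 i) k1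
    rw [hc, hsum_lie D2 c hx]
    congr 1
    rw [ca_sum, Finset.sum_apply]
    have a2 : ∀ l, ca n l = ∑ i, n i * ca (al i) l := by
      intro l
      conv_lhs => rw [v8_eq n]
      rw [ca_sum, Finset.sum_apply]
      simp only [ca_zsmul, Pi.smul_apply, smul_eq_mul]
    simp only [a2, ca_zsmul, Pi.smul_apply, smul_eq_mul, Int.cast_sum, Int.cast_mul, ← a1,
      Finset.mul_sum]
    rw [Finset.sum_comm]
    refine Finset.sum_congr rfl fun i _ => Finset.sum_congr rfl fun l _ => by ring
  have hht : ∀ i, 1 ≤ ht (m i) := by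
    intro i
    by_contra hcon
    have h3 : ht (m i) = 0 := by
      have : 0 ≤ ht (m i) := Finset.sum_nonneg fun j _ => m0 i j
      omega
    rw [ht, Finset.sum_eq_zero_iff_of_nonneg (fun j _ => m0 i j)] at h3
    have h4 : m i = 0 := by ext j; exact h3 j (Finset.mem_univ j)
    have := mr i
    rw [h4] at this
    simp [bf] at this
  have hsur : ∀ k, ∃ i, m i = al k := by
    intro k
    have h3 : al k = ∑ i, p k i • m i :=
      wsp_uniq D1 (e_mem_wsp D1 k) (tr _ _ (hp k)) (e_ne D1 k)
    have hta : ht (al k) = 1 := by simp [ht, al]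
    have h4 : (1 : ℤ) = ∑ i, p k i * ht (m i) := by
      rw [← hta, h3]
      simp only [ht, Finset.sum_apply, Pi.smul_apply, smul_eq_mul]
      rw [Finset.sum_comm]
      simp only [Finset.mul_sum]
    have h5 : ∃ i, p k i ≠ 0 := by
      by_contra hcon
      push Not at hcon
      simp [hcon] at h4
    obtain ⟨i, hi⟩ := h5
    have hpi : 1 ≤ p k i := by have : 0 ≤ p k i := p0 k i; omega
    rw [← Finset.add_sum_erase _ _ (Finset.mem_univ i)] at h4
    have hrest : ∀ j ∈ Finset.univ.erase i, 0 ≤ p k j * ht (m j) := fun j _ =>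
      mul_nonneg (p0 k j) (by have := hht j; omega)
    have h6 := Finset.sum_nonneg hrest
    have h7 := hht i
    have h8 : 1 ≤ p k i * ht (m i) := by nlinarith
    have h9 : ∑ j ∈ Finset.univ.erase i, p k j * ht (m j) = 0 := by omega
    have h10 : p k i = 1 := by nlinarith
    rw [Finset.sum_eq_zero_iff_of_nonneg hrest] at h9
    refine ⟨i, ?_⟩
    rw [h3, ← Finset.add_sum_erase _ _ (Finset.mem_univ i), h10, one_smul,
      Finset.sum_eq_zero, add_zero]
    intro j hj
    have := h9 j hj
    have h11 := hht j
    rcases mul_eq_zero.mp this with h | h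
    · rw [h, zero_smul]
    · omega
  choose σ hσ using hsur
  have hσi : Function.Injective σ := by
    intro a b hab
    have : al a = al b := by rw [← hσ a, ← hσ b, hab]
    by_contra hne
    have h3 := congrFun this a
    simp [al, hne] at h3
  have hhk : ∀ k, D2.h (σ k) = D1.h k := by
    intro k
    set i := σ k with hi
    have he : D2.e i ∈ D1.wsp (al k) := by rw [← hσ k]; exact hm i
    obtain ⟨m', hf⟩ := wsp_common D2 D1 hH.symm (f_mem_wsp D2 i)
    have hl := lie_wsp D1 he hf
    rw [D2.ef] at hl
    have hl0 : D2.h i ∈ D1.wsp 0 := by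
      rw [wsp_zero, hH]; exact Submodule.subset_span ⟨i, rfl⟩
    have h3 := wsp_uniq D1 hl hl0 (h_ne D2 i)
    have h4 : m' = - al k := by
      rw [eq_neg_iff_add_eq_zero, add_comm]; exact h3
    subst h4
    have fr : ∀ n, bf n n = 2 → ∀ x ∈ D1.wsp n, ∀ y ∈ D1.wsp n, x ≠ 0 → ∃ c : F, c • x = y := by
      intro n hn x hx y hy hx0
      obtain ⟨c, hc⟩ := (finrank_eq_one_iff_of_nonzero' (⟨x, hx⟩ : D1.wsp n)
        (by simpa using hx0)).mp (finrank_wsp D1 hn) ⟨y, hy⟩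
      exact ⟨c, congrArg Subtype.val hc⟩
    have ral : bf (al k) (al k) = 2 := by rw [bf_al_al]
    obtain ⟨c, hc⟩ := fr _ ral _ (e_mem_wsp D1 k) _ he (e_ne D1 k)
    obtain ⟨d, hd⟩ := fr _ (by rw [bf_neg_left, bf_neg_right, neg_neg]; exact ral) _
      (f_mem_wsp D1 k) _ hf (f_ne D1 k)
    have h5 : D2.h i = (c * d) • D1.h k := by
      rw [← D2.ef, ← hc, ← hd, smul_lie, lie_smul, D1.ef, smul_smul]
    have h6 := D2.he i i
    rw [h5, smul_lie, he k, E8_diag, ca_al, E8_diag, smul_smul] at h6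
    have h7 := smul_left_injective F (e_ne D2 i) h6
    have h8 : c * d = 1 := by
      have : ((2 : ℤ) : F) ≠ 0 := by norm_num
      exact mul_right_cancel₀ this (by rw [h7, one_mul])
    rw [h5, h8, one_smul]
  have hσ1 := diag_rigid σ (by
    intro k l
    have he : D2.e (σ l) ∈ D1.wsp (al l) := by rw [← hσ l]; exact hm _
    have h3 := D2.he (σ k) (σ l)
    rw [hhk, he k, ca_al] at h3
    have h4 := smul_left_injective F (e_ne D2 _) h3
    exact_mod_cast h4.symm)
  intro i
  have := hhk i
  rwa [hσ1] at this
end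
end E8P
namespace E8P
open LieAlgebra LieModule
set_option linter.unusedSectionVars false

lemma sr_zero (i) : sr i 0 = 0 := by rw [sr, ca_zero]; simp

section
variable {F L : Type*} [Field F] [CharZero F] [LieRing L] [LieAlgebra F L] [Nontrivial L]

lemma refl_D (D : E8D F L) (i : Fin 8) :
    ∃ D' : E8D F L, D'.H = D.H ∧ ∀ n, D'.wsp n = D.wsp (sr i n) := by
  obtain ⟨g, hg⟩ := exists_refl D i
  refine ⟨D.map g, ?_, refl_wsp D hg⟩
  rw [← wsp_zero, ← wsp_zero, refl_wsp D hg, sr_zero]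

lemma map_H (D : E8D F L) (g : L ≃ₗ⁅F⁆ L) (hg : ∀ x ∈ D.H, g x ∈ D.H) : (D.map g).H = D.H := by
  have hle : (D.map g).H ≤ D.H := by
    refine Submodule.span_le.mpr ?_
    rintro _ ⟨i, rfl⟩
    exact hg _ (Submodule.subset_span ⟨i, rfl⟩)
  haveI := finDim D
  exact Submodule.eq_of_le_of_finrank_eq hle (by rw [finrank_H, finrank_H])

lemma exists_fix [IsAlgClosed F] (D : E8D F L) (g : L ≃ₗ⁅F⁆ L) (hgH : ∀ x ∈ D.H, g x ∈ D.H)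
    (hc : ∀ x, (∀ y ∈ D.H, g y = y → ⁅y, x⁆ = 0) → x ∈ D.H) : ∀ x ∈ D.H, g x = x := by
  haveI := finDim D
  haveI := isKilling D
  haveI : Finite {n : V8 // bf n n = 2} := roots_finite
  haveI : Infinite F := IsAlgClosed.instInfinite
  let T : (Fin 8 → F) →ₗ[F] L := ∑ j, (LinearMap.proj j).smulRight (D.h j)
  have hT : ∀ c, T c = ∑ j, c j • D.h j := fun c => by simp [T]
  let p : Submodule F (Fin 8 → F) := LinearMap.ker ((g : L →ₗ[F] L).comp T - T)
  have hp : ∀ c, c ∈ p ↔ g (T c) = T c := by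
    intro c
    rw [LinearMap.mem_ker, LinearMap.sub_apply, sub_eq_zero]; rfl
  let f : V8 → Module.Dual F (Fin 8 → F) := fun n =>
    ∑ j, ((ca n j : ℤ) : F) • LinearMap.proj j
  have hf : ∀ n c, f n c = ∑ j, c j * ((ca n j : ℤ) : F) := by
    intro n c; simp [f, LinearMap.sum_apply, mul_comm]
  obtain ⟨c, hcp, hc0⟩ := Module.Dual.exists_forall_mem_ne_zero_of_forall_exists p
    (fun n : {n : V8 // bf n n = 2} => f n.1) (by
      rintro ⟨n, hn⟩
      by_contra hcon
      push Not at hcon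
      obtain ⟨x, hx, hx0⟩ := root_vec D hn
      have h1 := hc x (by
        intro y hy hgy
        obtain ⟨c, rfl⟩ := (mem_H D).mp hy
        rw [hsum_lie D c hx, ← hf]
        simp only at hcon
        rw [hcon c ((hp c).mpr (by rw [hT]; exact hgy)), zero_smul])
      rw [← wsp_zero] at h1
      have := wsp_uniq D h1 hx hx0
      subst this
      simp [bf] at hn)
  obtain ⟨ℓ, hℓ⟩ := Module.exists_dual_forall_apply_ne_zero (K := ℚ)
    (fun n : {n : V8 // bf n n = 2} => f n.1 c) hc0
  let a : F →+ F := ((algebraMap ℚ F : ℚ →+* F) : ℚ →+ F).comp ℓ.toAddMonoidHom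
  obtain ⟨s, hs⟩ := exists_s (T c) a
  have hgs : g s = s := by
    have := map_s (T c) a hs g 1 (Or.inl rfl) (by rw [one_smul]; exact (hp c).mp hcp)
    rwa [one_smul] at this
  let q : Fin 8 → ℚ := fun i => ℓ (f (al i) c)
  have hq : ∀ n, ℓ (f n c) = qv q n := by
    intro n
    have h1 : f n c = ∑ i, n i • f (al i) c := by
      simp only [hf]
      have a2 : ∀ l, ca n l = ∑ i, n i * ca (al i) l := by
        intro l
        conv_lhs => rw [v8_eq n]
        rw [ca_sum, Finset.sum_apply]
        simp only [ca_zsmul, Pi.smul_apply, smul_eq_mul]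
      simp only [a2, Int.cast_sum, Int.cast_mul, Finset.mul_sum, zsmul_eq_mul]
      rw [Finset.sum_comm]
      refine Finset.sum_congr rfl fun i _ => Finset.sum_congr rfl fun l _ => by ring
    rw [h1, map_sum, qv]
    refine Finset.sum_congr rfl fun i _ => ?_
    rw [map_zsmul, zsmul_eq_mul]
  have hact : ∀ n, ∀ x ∈ D.wsp n, ⁅s, x⁆ = (qv q n : F) • x := by
    intro n x hx
    have h1 : ⁅T c, x⁆ = f n c • x := by rw [hT, hsum_lie D c hx, hf]
    rw [hs, opc_apply _ _ (μ := f n c)]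
    · rw [← hq]; rfl
    · apply Module.End.mem_maxGenEigenspace _ _ _ |>.mpr
      refine ⟨1, ?_⟩
      rw [pow_one, LinearMap.sub_apply, ad_apply, h1, LinearMap.smul_apply]
      simp
  let A : Set ℚ := (qv q) '' {n | bf n n = 2}
  have hA : A.Finite := roots_finite.image _
  have hA0 : ∀ z ∈ A, z ≠ 0 := by
    rintro _ ⟨n, hn, rfl⟩
    rw [← hq]
    exact hℓ ⟨n, hn⟩
  let S : Set (Fin 8 → ℚ) := {q' | (∀ n, bf n n = 2 → qv q' n ∈ A) ∧ ∃ D' : E8D F L, D'.H = D.H ∧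
    ∀ n, ∀ x ∈ D'.wsp n, ⁅s, x⁆ = (qv q' n : F) • x}
  have ral : ∀ k, bf (al k) (al k) = 2 := fun k => by rw [bf_al_al]
  have hSf : S.Finite := by
    refine (Set.Finite.pi (fun _ : Fin 8 => hA)).subset ?_
    rintro q' ⟨h1, -⟩ i -
    rw [← qv_al q' i]
    exact h1 _ (ral i)
  obtain ⟨q', ⟨hq1, D', hD', hact'⟩, hmax⟩ := Set.exists_max_image S (fun q' => qv q' rho) hSf
    ⟨q, fun n hn => ⟨n, hn, rfl⟩, D, rfl, hact⟩
  have hpos : ∀ i, 0 < q' i := by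
    intro i
    have h0 := hA0 _ (hq1 _ (ral i))
    rw [qv_al] at h0
    rcases lt_or_gt_of_ne h0 with hneg | h
    · exfalso
      obtain ⟨D2, h2, h3⟩ := refl_D D' i
      have := hmax (fun j => qv q' (sr i (al j))) ⟨fun n hn => by
          rw [qv_sr]
          exact hq1 _ (by rw [bf_sr]; exact hn), D2, h2.trans hD', fun n x hx => by
          rw [qv_sr]
          rw [h3] at hx
          exact hact' _ _ hx⟩
      rw [qv_sr, sr_rho, qv_sub, qv_al] at this
      linarith
    · exact h
  have hfin := same_h D' (D'.map g) (map_H D' g (by rw [hD']; exact hgH)).symm s q' hpos hact' (by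
    intro n x hx
    have h1 : g.symm x ∈ D'.wsp n := by
      rw [← map_wsp D' g]; simpa using hx
    have h2 := congrArg g (hact' n _ h1)
    rw [LieEquiv.map_lie, hgs, map_smul] at h2
    simpa using h2)
  intro x hx
  rw [← hD'] at hx
  obtain ⟨b, rfl⟩ := (mem_H D').mp hx
  rw [map_sum]
  refine Finset.sum_congr rfl fun i _ => ?_
  rw [map_smul]
  congr 1
  exact hfin i
end
end E8P
namespace E8P
open LieAlgebra LieModule
set_option linter.unusedSectionVars false

/-- fundamental weights -/
def om : Fin 8 → V8 := ![![4, 5, 7, 10, 8, 6, 4, 2], ![5, 8, 10, 15, 12, 9, 6, 3],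
  ![7, 10, 14, 20, 16, 12, 8, 4], ![10, 15, 20, 30, 24, 18, 12, 6], ![8, 12, 16, 24, 20, 15, 10, 5],
  ![6, 9, 12, 18, 15, 12, 8, 4], ![4, 6, 8, 12, 10, 8, 6, 3], ![2, 3, 4, 6, 5, 4, 3, 2]]
lemma ca_om (i j : Fin 8) : ca (om i) j = if i = j then 1 else 0 := by
  revert i j; decide +kernel

lemma bf_le (m n : V8) (hm : bf m m = 2) (hn : bf n n = 2) :
    bf m n = 2 ∧ m = n ∨ bf m n = -2 ∧ m = -n ∨ (-1 ≤ bf m n ∧ bf m n ≤ 1) := by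
  by_cases h1 : m = n
  · left; subst h1; exact ⟨hm, rfl⟩
  by_cases h2 : m = -n
  · right; left; subst h2; rw [bf_neg_left, hn]; exact ⟨rfl, rfl⟩
  right; right
  have h3 := bf_pos (m - n) (sub_ne_zero.mpr h1)
  have h4 := bf_pos (m + n) (fun h => h2 (eq_neg_of_add_eq_zero_left h))
  simp only [bf_sub_left, bf_sub_right, bf_add_left, bf_add_right, hm, hn, bf_comm n m] at h3 h4
  omega

/-- root induction by adding roots -/
lemma root_add_induction (P : V8 → Prop) (h1 : ∀ i, P (al i)) (hneg : ∀ n, bf n n = 2 → P n → P (-n))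
    (hs : ∀ m n, bf m m = 2 → bf n n = 2 → bf m n = -1 → P m → P n → P (m + n)) :
    ∀ n, bf n n = 2 → P n := by
  refine root_induction P h1 hneg fun i n hn _ hP => ?_
  have ha := bf_al_al i
  rw [sr, ← bf_al_left]
  rcases bf_le (al i) n ha hn with ⟨h, h'⟩ | ⟨h, h'⟩ | ⟨h, h'⟩
  · rw [h, h']
    have : n - (2 : ℤ) • n = -n := by rw [two_smul]; abel
    rw [this]; exact hneg n hn hP
  · have : n = - al i := by rw [h', neg_neg]
    rw [h, this]
    have : - al i - (-2 : ℤ) • al i = al i := by rw [neg_smul, two_smul]; abel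
    rw [this]; exact h1 i
  · have : bf (al i) n = -1 ∨ bf (al i) n = 0 ∨ bf (al i) n = 1 := by omega
    rcases this with h | h | h
    · rw [h, neg_smul, one_smul, sub_neg_eq_add]
      exact hs _ _ hn ha (by rw [bf_comm]; exact h) hP (h1 i)
    · rw [h, zero_smul, sub_zero]; exact hP
    · rw [h, one_smul, sub_eq_add_neg]
      exact hs _ _ hn (by rw [bf_neg_left, bf_neg_right, neg_neg]; exact ha)
        (by rw [bf_neg_right, bf_comm, h]) hP (hneg _ ha (h1 i))

lemma bf_neg_neg (n : V8) : bf (-n) (-n) = bf n n := by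
  rw [bf_neg_left, bf_neg_right, neg_neg]

section
variable {F L : Type*} [Field F] [CharZero F] [LieRing L] [LieAlgebra F L] [Nontrivial L]

lemma wsp_one (D : E8D F L) {n : V8} (hn : bf n n = 2) {x y : L} (hx : x ∈ D.wsp n)
    (hx0 : x ≠ 0) (hy : y ∈ D.wsp n) : ∃ c : F, y = c • x := by
  obtain ⟨c, hc⟩ := (finrank_eq_one_iff_of_nonzero' (⟨x, hx⟩ : D.wsp n)
    (by simpa using hx0)).mp (finrank_wsp D hn) ⟨y, hy⟩
  exact ⟨c, (congrArg Subtype.val hc).symm⟩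

lemma hv_ne (D : E8D F L) {n : V8} (hn : bf n n = 2) : D.hv n ≠ 0 := by
  intro h
  obtain ⟨x, hx, hx0⟩ := root_vec D hn
  have := hv_lie D (m := n) hx
  rw [h, zero_lie, hn] at this
  rcases smul_eq_zero.mp this.symm with h1 | h1
  · norm_num at h1
  · exact hx0 h1

lemma fix_stable (D : E8D F L) (g : L ≃ₗ⁅F⁆ L) (hfix : ∀ i, g (D.h i) = D.h i) {n : V8} {x : L}
    (hx : x ∈ D.wsp n) : g x ∈ D.wsp n := by
  intro i
  have := congrArg g (hx i)
  rwa [LieEquiv.map_lie, hfix, map_smul] at this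

lemma exists_v (D : E8D F L) (g : L ≃ₗ⁅F⁆ L) (hfix : ∀ i, g (D.h i) = D.h i)
    (h4 : ∀ x, g (g (g (g x))) = x) {I : F} (hI : I * I = -1) :
    ∃ v : V8, ∀ n, ∀ x ∈ D.wsp n, g x = I ^ (bf v n) • x := by
  have hI0 : I ≠ 0 := by rintro rfl; simp at hI
  have hH : ∀ x ∈ D.wsp 0, g x = x := by
    intro x hx
    rw [wsp_zero] at hx
    obtain ⟨c, rfl⟩ := (mem_H D).mp hx
    rw [map_sum]
    exact Finset.sum_congr rfl fun i _ => by rw [map_smul, hfix]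
  have hk : ∀ i, ∃ k : ℤ, g (D.e i) = I ^ k • D.e i := by
    intro i
    obtain ⟨t, ht⟩ := wsp_one D (bf_al_al i) (e_mem_wsp D i) (e_ne D i)
      (fix_stable D g hfix (e_mem_wsp D i))
    have h1 := h4 (D.e i)
    simp only [ht, map_smul, smul_smul] at h1
    have h2 : t * t * t * t = 1 := by
      have : (t * t * t * t) • D.e i = (1 : F) • D.e i := by
        rw [one_smul]; simpa [mul_assoc] using h1
      exact smul_left_injective F (e_ne D i) this
    have h3 : (t - 1) * ((t + 1) * ((t - I) * (t + I))) = 0 := by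
      linear_combination h2 - (t * t - 1) * hI
    rcases mul_eq_zero.mp h3 with h | h
    · exact ⟨0, by rw [ht, sub_eq_zero.mp h]; simp⟩
    rcases mul_eq_zero.mp h with h | h
    · refine ⟨2, ?_⟩
      rw [ht, eq_neg_of_add_eq_zero_left h]
      congr 1
      rw [zpow_ofNat, pow_two, hI]
    rcases mul_eq_zero.mp h with h | h
    · exact ⟨1, by rw [ht, sub_eq_zero.mp h]; simp⟩
    · refine ⟨3, ?_⟩
      rw [ht, eq_neg_of_add_eq_zero_left h]
      congr 1
      rw [zpow_ofNat, pow_succ, pow_two, hI]; ring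
  choose k hk using hk
  refine ⟨∑ i, k i • om i, ?_⟩
  set v := ∑ i, k i • om i with hv
  have hvk : ∀ i, bf v (al i) = k i := by
    intro i
    rw [bf_al_right, hv, ca_sum, Finset.sum_apply]
    simp only [ca_zsmul, Pi.smul_apply, ca_om]
    simp
  have key : ∀ n, bf n n = 2 → ∀ x ∈ D.wsp n, g x = I ^ (bf v n) • x := by
    apply root_add_induction
    · intro i x hx
      obtain ⟨c, rfl⟩ := wsp_one D (bf_al_al i) (e_mem_wsp D i) (e_ne D i) hx
      rw [map_smul, hk, hvk, smul_comm]
    · intro n hn ih x hx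
      obtain ⟨a, ha, b, hb, hab⟩ := exists_pair D hn
      have hn' : bf (-n) (-n) = 2 := by rw [bf_neg_neg, hn]
      have hb0 : b ≠ 0 := by
        rintro rfl; rw [lie_zero] at hab; exact hv_ne D hn hab.symm
      obtain ⟨t, ht⟩ := wsp_one D hn' hb hb0 (fix_stable D g hfix hb)
      have h1 := congrArg g hab
      rw [LieEquiv.map_lie, ih a ha, ht, smul_lie, lie_smul, smul_smul, hab, hH _ (hv_mem D n)] at h1
      have h2 : I ^ (bf v n) * t = 1 :=
        smul_left_injective F (hv_ne D hn) (by simpa using h1)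
      obtain ⟨c, rfl⟩ := wsp_one D hn' hb hb0 hx
      rw [map_smul, ht, bf_neg_right, zpow_neg, smul_comm]
      congr 2
      exact (inv_eq_of_mul_eq_one_right h2).symm
    · intro m n hm hn hmn ihm ihn x hx
      obtain ⟨a, ha, ha0⟩ := root_vec D hm
      obtain ⟨b, hb, hb0⟩ := root_vec D hn
      have h1 := lie_ne D hm hn hmn ha hb ha0 hb0
      have hmn2 : bf (m + n) (m + n) = 2 := by
        simp only [bf_add_left, bf_add_right, hm, hn, hmn, bf_comm n m]; norm_num
      obtain ⟨c, rfl⟩ := wsp_one D hmn2 (lie_wsp D ha hb) h1 hx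
      rw [map_smul, LieEquiv.map_lie, ihm a ha, ihn b hb, smul_lie, lie_smul, smul_smul,
        smul_smul, smul_smul, bf_add_right, zpow_add₀ hI0]
      congr 1; ring
  intro n x hx
  by_cases hx0 : x = 0
  · rw [hx0, map_zero, smul_zero]
  by_cases h0 : n = 0
  · subst h0
    rw [hH x hx]; simp [bf, ca_zero]
  · exact key n (root_of_wsp D (fun h => hx0 (by rw [h] at hx; exact hx)) h0) x hx

/-- highest root -/
def hi : V8 := ![2, 3, 4, 6, 5, 4, 3, 2]

lemma alcove (D : E8D F L) (g : L ≃ₗ⁅F⁆ L) {I : F} (hI : I * I = -1)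
    (v : V8) (hv : ∀ n, ∀ x ∈ D.wsp n, g x = I ^ (bf v n) • x) :
    ∃ D' : E8D F L, D'.H = D.H ∧ ∃ v' : V8, (∀ n, ∀ x ∈ D'.wsp n, g x = I ^ (bf v' n) • x) ∧
      (∀ i, 0 ≤ ca v' i) ∧ bf hi v' ≤ 4 := by
  have hI0 : I ≠ 0 := by rintro rfl; simp at hI
  let N : V8 → ℕ := fun v => (bf ((30 : ℤ) • v - rho) ((30 : ℤ) • v - rho)).toNat
  have hN : ∀ v, (N v : ℤ) = 900 * bf v v - 60 * bf rho v + bf rho rho := by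
    intro v
    have : 0 ≤ bf ((30 : ℤ) • v - rho) ((30 : ℤ) • v - rho) := by
      by_cases h : (30 : ℤ) • v - rho = 0
      · rw [h]; simp [bf]
      · have := bf_pos _ h; omega
    simp only [N]
    rw [Int.toNat_of_nonneg this]
    simp only [bf_sub_left, bf_sub_right, bf_smul_left, bf_smul_right, bf_comm v rho]
    ring
  let S : Set V8 := {v | ∃ D' : E8D F L, D'.H = D.H ∧ ∀ n, ∀ x ∈ D'.wsp n, g x = I ^ (bf v n) • x}
  obtain ⟨v', ⟨D', hD', hv'⟩, hmin⟩ : ∃ v' ∈ S, ∀ w ∈ S, N v' ≤ N w := by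
    have hne : S.Nonempty := ⟨v, D, rfl, hv⟩
    refine ⟨Function.argminOn N S hne, Function.argminOn_mem _ _ _, fun w hw =>
      Function.argminOn_le _ _ hw⟩
  refine ⟨D', hD', v', hv', ?_, ?_⟩
  · intro i
    obtain ⟨D2, h2, h3⟩ := refl_D D' i
    have h4 := hmin (sr i v') ⟨D2, h2.trans hD', fun n x hx => by
      rw [h3] at hx
      rw [hv' _ _ hx, ← bf_sr i v', sr_sr]⟩
    have h5 : (N v' : ℤ) ≤ N (sr i v') := by exact_mod_cast h4
    rw [hN, hN, bf_sr] at h5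
    have h6 : bf rho (sr i v') = bf rho v' - ca v' i := by
      rw [← bf_sr i rho, sr_sr, sr_rho, bf_sub_left, bf_al_left]
    omega
  · have h4 := hmin (v' - (4 : ℤ) • hi) ⟨D', hD', fun n x hx => by
      rw [hv' _ _ hx, bf_sub_left, bf_smul_left, sub_eq_add_neg, zpow_add₀ hI0, zpow_neg, zpow_mul]
      have : I ^ (4 : ℤ) = 1 := by
        rw [zpow_ofNat]
        linear_combination (I * I - 1) * hI
      rw [this]; simp⟩
    have h5 : (N v' : ℤ) ≤ N (v' - (4 : ℤ) • hi) := by exact_mod_cast h4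
    rw [hN, hN] at h5
    have a1 : bf hi hi = 2 := by decide
    have a2 : bf rho hi = 29 := by decide
    simp only [bf_sub_left, bf_sub_right, bf_smul_left, bf_smul_right, a1, a2, bf_comm v' hi] at h5
    omega
end
end E8P
namespace E8P
open LieAlgebra LieModule
set_option linter.unusedSectionVars false

/-- the positive roots, written as decimal numbers -/
def codes : List ℕ := [1, 10, 100, 101, 1000, 1010, 1100, 1101, 1110,
  1111, 10000, 11000, 11010, 11100, 11101, 11110, 11111, 12110,
  12111, 12211, 100000, 110000, 111000, 111010, 111100, 111101, 111110,
  111111, 112110, 112111, 112211, 122110, 122111, 122211, 123211, 123221,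
  1000000, 1100000, 1110000, 1111000, 1111010, 1111100, 1111101, 1111110, 1111111,
  1112110, 1112111, 1112211, 1122110, 1122111, 1122211, 1123211, 1123221, 1222110,
  1222111, 1222211, 1223211, 1223221, 1233211, 1233221, 1234221, 1234321, 1234322,
  10000000, 11000000, 11100000, 11110000, 11111000, 11111010, 11111100, 11111101, 11111110,
  11111111, 11112110, 11112111, 11112211, 11122110, 11122111, 11122211, 11123211, 11123221,
  11222110, 11222111, 11222211, 11223211, 11223221, 11233211, 11233221, 11234221, 11234321,
  11234322, 12222110, 12222111, 12222211, 12223211, 12223221, 12233211, 12233221, 12234221,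
  12234321, 12234322, 12333211, 12333221, 12334221, 12334321, 12334322, 12344221, 12344321,
  12344322, 12345321, 12345322, 12345331, 12345332, 12345422, 12345432, 12346432, 12356432,
  12456432, 13456432, 23456432]

/-- decoding -/
def dec (c : ℕ) : V8 := fun i => ((c / 10 ^ (i : ℕ) % 10 : ℕ) : ℤ)

/-- number of positive roots killed by `s` modulo 4 -/
def cnt (s : V8) : ℕ := (codes.filter fun c => (∑ j, dec c j * s j) % 4 = 0).length

set_option maxRecDepth 100000 in
lemma codes_step : ∀ c ∈ codes, ∀ i : Fin 8, c = 10 ^ (i : ℕ) ∨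
    (((c : ℤ) - ca (dec c) i * 10 ^ (i : ℕ)).toNat ∈ codes ∧
      ∀ j, dec ((c : ℤ) - ca (dec c) i * 10 ^ (i : ℕ)).toNat j = sr i (dec c) j) := by
  decide +kernel

set_option maxRecDepth 100000 in
lemma codes_root : ∀ c ∈ codes, bf (dec c) (dec c) = 2 := by
  decide +kernel

set_option maxRecDepth 100000 in
lemma codes_enc : ∀ c ∈ codes, ∑ j, dec c j * 10 ^ (j : ℕ) = c ∧ 0 < ∑ j, dec c j := by
  decide +kernel

set_option maxRecDepth 100000 in
lemma codes_nodup : codes.Nodup := by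
  decide +kernel

lemma codes_al : ∀ i : Fin 8, 10 ^ (i : ℕ) ∈ codes ∧ ∀ j, dec (10 ^ (i : ℕ)) j = al i j := by
  decide +kernel

lemma dec_nonneg (c) : 0 ≤ dec c := fun i => Int.natCast_nonneg _

lemma root_table : ∀ n, bf n n = 2 → ∃ c ∈ codes, n = dec c ∨ n = - dec c := by
  apply root_induction
  · intro i
    exact ⟨_, (codes_al i).1, Or.inl (funext fun j => ((codes_al i).2 j).symm)⟩
  · rintro n - ⟨c, hc, rfl | rfl⟩
    · exact ⟨c, hc, Or.inr rfl⟩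
    · exact ⟨c, hc, Or.inl (neg_neg _)⟩
  · rintro i n - - ⟨c, hc, h⟩
    rcases codes_step c hc i with h1 | ⟨h1, h2⟩
    · refine ⟨c, hc, ?_⟩
      have h3 : dec c = al i := by rw [h1]; exact funext (codes_al i).2
      have h4 : sr i (al i) = - al i := by
        rw [sr, ← bf_al_left, bf_al_al, two_smul]; abel
      rcases h with rfl | rfl
      · right; rw [h3, h4]
      · left; rw [sr_neg, h3, h4, neg_neg]
    · refine ⟨_, h1, ?_⟩
      rcases h with rfl | rfl
      · left; exact (funext h2).symm
      · right; rw [sr_neg]; congr 1; exact (funext h2).symm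

lemma root_table_pos (n) (hn : bf n n = 2) (h0 : 0 ≤ n) : ∃ c ∈ codes, n = dec c := by
  obtain ⟨c, hc, h | h⟩ := root_table n hn
  · exact ⟨c, hc, h⟩
  · exfalso
    have h1 := (codes_enc c hc).2
    have h2 : 0 ≤ ∑ j, n j := Finset.sum_nonneg fun j _ => h0 j
    rw [h] at h2
    simp only [Pi.neg_apply, Finset.sum_neg_distrib] at h2
    omega

lemma dec_inj {c d : ℕ} (hc : c ∈ codes) (hd : d ∈ codes) (h : dec c = dec d) : c = d := by
  have h1 := (codes_enc c hc).1
  have h2 := (codes_enc d hd).1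
  rw [h, h2] at h1
  exact_mod_cast h1.symm

lemma cnt_aux : ∀ a f : Fin 3, ∀ b c d e : Fin 2,
    2 * (a : ℕ) + 3 * (b : ℕ) + 4 * (c : ℕ) + 4 * (d : ℕ) + 3 * (e : ℕ) + 2 * (f : ℕ) ≤ 4 →
    cnt ![((a : ℕ) : ℤ), ((b : ℕ) : ℤ), ((c : ℕ) : ℤ), 0, 0, ((d : ℕ) : ℤ), ((e : ℕ) : ℤ),
      ((f : ℕ) : ℤ)] = 29 → (a : ℕ) = 0 ∧ (b : ℕ) = 0 ∧ (c : ℕ) = 1 ∧ (d : ℕ) = 0 ∧ (e : ℕ) = 0 ∧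
      (f : ℕ) = 0 := by
  decide +kernel

lemma cnt_eq (s : V8) (h0 : ∀ i, 0 ≤ s i) (h1 : ∑ i, hi i * s i ≤ 4) (hc : cnt s = 29) :
    s = al 2 := by
  have h1 : 2 * s 0 + 3 * s 1 + 4 * s 2 + 6 * s 3 + 5 * s 4 + 4 * s 5 + 3 * s 6 + 2 * s 7 ≤ 4 := by
    rw [Fin.sum_univ_eight] at h1
    exact h1
  have g0 := h0 0
  have g1 := h0 1
  have g2 := h0 2
  have g3 := h0 3
  have g4 := h0 4
  have g5 := h0 5
  have g6 := h0 6
  have g7 := h0 7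
  have e3 : s 3 = 0 := by omega
  have e4 : s 4 = 0 := by omega
  have hs : s = ![s 0, s 1, s 2, 0, 0, s 5, s 6, s 7] := by
    funext i; fin_cases i <;> simp [e3, e4]
  have k0 : (((s 0).toNat : ℕ) : ℤ) = s 0 := Int.toNat_of_nonneg g0
  have k1 : (((s 1).toNat : ℕ) : ℤ) = s 1 := Int.toNat_of_nonneg g1
  have k2 : (((s 2).toNat : ℕ) : ℤ) = s 2 := Int.toNat_of_nonneg g2
  have k5 : (((s 5).toNat : ℕ) : ℤ) = s 5 := Int.toNat_of_nonneg g5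
  have k6 : (((s 6).toNat : ℕ) : ℤ) = s 6 := Int.toNat_of_nonneg g6
  have k7 : (((s 7).toNat : ℕ) : ℤ) = s 7 := Int.toNat_of_nonneg g7
  have := cnt_aux ⟨(s 0).toNat, by omega⟩ ⟨(s 7).toNat, by omega⟩ ⟨(s 1).toNat, by omega⟩
    ⟨(s 2).toNat, by omega⟩ ⟨(s 5).toNat, by omega⟩ ⟨(s 6).toNat, by omega⟩
  simp only [k0, k1, k2, k5, k6, k7, ← hs] at this
  obtain ⟨a0, a1, a2, a5, a6, a7⟩ := this (by omega) hc
  have b2 : s 2 = 1 := by omega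
  have b0 : s 0 = 0 := by omega
  have b1 : s 1 = 0 := by omega
  have b5 : s 5 = 0 := by omega
  have b6 : s 6 = 0 := by omega
  have b7 : s 7 = 0 := by omega
  rw [hs, b0, b1, b2, b5, b6, b7]
  decide

section
variable {F L : Type*} [Field F] [CharZero F] [LieRing L] [LieAlgebra F L] [Nontrivial L]

lemma finrank_biSup (D : E8D F L) (s : Finset V8) :
    Module.finrank F ↥(⨆ n ∈ s, D.wsp n) = ∑ n ∈ s, Module.finrank F (D.wsp n) := by
  classical
  haveI := finDim D
  induction s using Finset.induction_on with
  | empty => simp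
  | insert a s ha ih =>
    rw [Finset.sum_insert ha, ← ih, Finset.iSup_insert]
    have h1 := Submodule.finrank_sup_add_finrank_inf_eq (D.wsp a) (⨆ n ∈ s, D.wsp n)
    have h2 : Disjoint (D.wsp a) (⨆ n ∈ s, D.wsp n) :=
      (wsp_indep D).disjoint_biSup (by simpa using ha)
    rw [h2.eq_bot, finrank_bot] at h1
    exact h1

lemma zpow_I {I : F} (hI : I * I = -1) (k : ℤ) (h : I ^ k = 1) : k % 4 = 0 := by
  have hI0 : I ≠ 0 := by rintro rfl; simp at hI
  have h4 : I ^ (4 : ℤ) = 1 := by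
    rw [zpow_ofNat]
    linear_combination (I * I - 1) * hI
  rw [← Int.emod_add_mul_ediv k 4, zpow_add₀ hI0, zpow_mul, h4, one_zpow, mul_one] at h
  have h2 : (2 : F) ≠ 0 := two_ne_zero
  have : k % 4 = 0 ∨ k % 4 = 1 ∨ k % 4 = 2 ∨ k % 4 = 3 := by omega
  rcases this with e | e | e | e
  · exact e
  · exfalso; rw [e, zpow_one] at h; subst h
    apply h2; linear_combination hI
  · exfalso; rw [e, zpow_ofNat, pow_two, hI] at h
    apply h2; linear_combination -h
  · exfalso; rw [e, zpow_ofNat, pow_succ, pow_two, hI] at h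
    have : I = -1 := by linear_combination -h
    subst this
    apply h2; linear_combination hI

lemma dim_fix (D : E8D F L) (g : L ≃ₗ⁅F⁆ L) {I : F} (hI : I * I = -1)
    (v : V8) (hv : ∀ n, ∀ x ∈ D.wsp n, g x = I ^ (bf v n) • x) (W : Submodule F L)
    (hW : ∀ x, x ∈ W ↔ g x = x) : Module.finrank F W = 8 + 2 * cnt (ca v) := by
  classical
  have hI0 : I ≠ 0 := by rintro rfl; simp at hI
  have h4 : I ^ (4 : ℤ) = 1 := by
    rw [zpow_ofNat]
    linear_combination (I * I - 1) * hI
  let Cl := codes.filter fun c => (∑ j, dec c j * ca v j) % 4 = 0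
  have hbf : ∀ c, bf v (dec c) = ∑ j, dec c j * ca v j := fun c => by rw [bf_comm]; rfl
  have hnd : Cl.Nodup := codes_nodup.filter _
  let C : Finset ℕ := Cl.toFinset
  have hC : ∀ c, c ∈ C ↔ c ∈ codes ∧ (bf v (dec c)) % 4 = 0 := by
    intro c; simp [C, Cl, hbf]
  have hcard : C.card = cnt (ca v) := List.toFinset_card_of_nodup hnd
  let T1 := C.image dec
  let T2 := C.image fun c => - dec c
  have i1 : T1.card = cnt (ca v) := by
    rw [← hcard]
    exact Finset.card_image_of_injOn fun a ha b hb hab =>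
      dec_inj ((hC a).mp ha).1 ((hC b).mp hb).1 hab
  have i2 : T2.card = cnt (ca v) := by
    rw [← hcard]
    exact Finset.card_image_of_injOn fun a ha b hb hab =>
      dec_inj ((hC a).mp ha).1 ((hC b).mp hb).1 (neg_injective hab)
  have hd : Disjoint T1 T2 := by
    rw [Finset.disjoint_left]
    intro n h1 h2
    obtain ⟨c, hc, rfl⟩ := Finset.mem_image.mp h1
    obtain ⟨d, hd, h3⟩ := Finset.mem_image.mp h2
    have a1 := (codes_enc c ((hC c).mp hc).1).2
    have a2 := (codes_enc d ((hC d).mp hd).1).2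
    rw [← h3] at a1
    simp only [Pi.neg_apply, Finset.sum_neg_distrib] at a1
    omega
  have hroot : ∀ n ∈ T1 ∪ T2, bf n n = 2 := by
    intro n hn
    rcases Finset.mem_union.mp hn with h | h
    · obtain ⟨c, hc, rfl⟩ := Finset.mem_image.mp h
      exact codes_root c ((hC c).mp hc).1
    · obtain ⟨c, hc, rfl⟩ := Finset.mem_image.mp h
      rw [bf_neg_neg]
      exact codes_root c ((hC c).mp hc).1
  have h0 : (0 : V8) ∉ T1 ∪ T2 := by
    intro h
    have := hroot 0 h
    simp [bf] at this
  have hWT : W = ⨆ n ∈ insert 0 (T1 ∪ T2), D.wsp n := by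
    apply le_antisymm
    · intro x hx
      have hst : ∀ i, ∀ x ∈ W, ⁅D.h i, x⁆ ∈ W := by
        intro i x hx
        rw [hW] at hx ⊢
        rw [LieEquiv.map_lie, hx, hv 0 _ (h_mem_wsp D i)]
        simp [bf, ca_zero]
      obtain ⟨s, y, hy, hxy⟩ := exists_decomp D x
      have h1 := graded_aux D W hst s y (fun n _ => hy n) (hxy ▸ hx)
      rw [hxy]
      refine Submodule.sum_mem _ fun n hn => ?_
      by_cases hy0 : y n = 0
      · rw [hy0]; exact zero_mem _
      have h2 := (hW _).mp (h1 n hn)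
      rw [hv n _ (hy n)] at h2
      have h3 : I ^ (bf v n) = 1 := smul_left_injective F hy0 (by simpa using h2)
      have h5 := zpow_I hI _ h3
      refine Submodule.mem_iSup_of_mem n (Submodule.mem_iSup_of_mem ?_ (hy n))
      rw [Finset.mem_insert]
      by_cases hn0 : n = 0
      · exact Or.inl hn0
      right
      have hr := root_of_wsp D (n := n) (fun h => hy0 (by have := hy n; rw [h] at this; exact this)) hn0
      obtain ⟨c, hc, rfl | rfl⟩ := root_table n hr
      · exact Finset.mem_union_left _ (Finset.mem_image.mpr ⟨c, (hC c).mpr ⟨hc, h5⟩, rfl⟩)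
      · rw [bf_neg_right] at h5
        exact Finset.mem_union_right _ (Finset.mem_image.mpr ⟨c, (hC c).mpr ⟨hc, by omega⟩, rfl⟩)
    · refine iSup₂_le fun n hn x hx => ?_
      rw [hW, hv n x hx]
      have : (bf v n) % 4 = 0 := by
        rcases Finset.mem_insert.mp hn with rfl | h
        · simp [bf, ca_zero]
        rcases Finset.mem_union.mp h with h | h
        · obtain ⟨c, hc, rfl⟩ := Finset.mem_image.mp h
          exact ((hC c).mp hc).2
        · obtain ⟨c, hc, rfl⟩ := Finset.mem_image.mp h
          rw [bf_neg_right]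
          have := ((hC c).mp hc).2
          omega
      obtain ⟨k, hk⟩ := Int.dvd_of_emod_eq_zero this
      rw [hk, zpow_mul, h4, one_zpow, one_smul]
  rw [hWT, finrank_biSup, Finset.sum_insert h0, wsp_zero, finrank_H,
    Finset.sum_congr rfl fun n hn => finrank_wsp D (hroot n hn), Finset.sum_const,
    Finset.card_union_of_disjoint hd, i1, i2]
  simp; omega
end
end E8P
namespace E8P
open LieAlgebra LieModule
set_option linter.unusedSectionVars false
section
variable {F L : Type*} [Field F] [CharZero F] [IsAlgClosed F] [LieRing L] [LieAlgebra F L]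
  [Nontrivial L]

theorem kac (D0 : E8D F L) (g : L ≃ₗ⁅F⁆ L) (h4 : ∀ x, g (g (g (g x))) = x)
    (g0 : LieSubalgebra F L) (hg0 : ∀ x, x ∈ g0 ↔ g x = x) (hss : LieAlgebra.IsSemisimple F g0)
    (hdim : Module.finrank F g0 = 66) {I : F} (hI : I * I = -1) :
    ∃ D : E8D F L, ∀ n, ∀ x ∈ D.wsp n, g x = I ^ (n 2) • x := by
  haveI := finDim D0
  haveI := isKilling D0
  haveI : IsKilling F g0 := inferInstance
  obtain ⟨Z, hZ, hZg, hZc⟩ := exists_theta_csa g h4 g0 hg0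
  obtain ⟨D1, hD1⟩ := conj_csa D0 Z
  have hfix := exists_fix D1 g (by rw [hD1]; exact hZg) (by rw [hD1]; exact hZc)
  obtain ⟨v, hv⟩ := exists_v D1 g (fun i => hfix _ (Submodule.subset_span ⟨i, rfl⟩)) h4 hI
  obtain ⟨D, -, v', hv', h0, hle⟩ := alcove D1 g hI v hv
  refine ⟨D, ?_⟩
  have hd := dim_fix D g hI v' hv' g0.toSubmodule hg0
  have h1 : ca v' = al 2 := cnt_eq _ h0 hle (by
    have : Module.finrank F g0.toSubmodule = 66 := hdim
    omega)
  intro n x hx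
  rw [hv' n x hx, bf_comm, bf, h1]
  congr 2
  simp [al, Pi.single_apply]
end
end E8P
namespace E8P
open LieAlgebra LieModule
set_option linter.unusedSectionVars false

/-- index set with 8 elements -/
abbrev Ix := Option (Fin 7)

/-- weights for the chain `A₇` (the chain is `-hi, α₇, α₆, α₅, α₄, α₃, α₁`) -/
def Gs : Fin 7 → V8 := ![hi, hi - al 7, hi - al 7 - al 6, hi - al 7 - al 6 - al 5,
  hi - al 7 - al 6 - al 5 - al 4, hi - al 7 - al 6 - al 5 - al 4 - al 3,
  hi - al 7 - al 6 - al 5 - al 4 - al 3 - al 1]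

/-- base weight of `g₁` -/
def Bw : V8 := al 2 + al 0 - Gs 5 - Gs 6

lemma bf_Gs : ∀ p q : Fin 7, bf (Gs p) (Gs q) = if p = q then 2 else 1 := by decide +kernel
lemma bf_Bw_Gs : ∀ p : Fin 7, bf Bw (Gs p) = -2 := by decide +kernel
lemma bf_Bw_Bw : bf Bw Bw = 4 := by decide +kernel
lemma bf_Bw_al : bf Bw (al 0) = 1 := by decide +kernel
lemma bf_Gs_al : ∀ p : Fin 7, bf (Gs p) (al 0) = 0 := by decide +kernel

section
variable {F L : Type*} [Field F] [CharZero F] [LieRing L] [LieAlgebra F L] [Nontrivial L]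

lemma lie_zero_bf (D : E8D F L) {m n : V8} (hm : bf m m = 2) (hn : bf n n = 2) (h : 0 ≤ bf m n)
    {x y : L} (hx : x ∈ D.wsp m) (hy : y ∈ D.wsp n) : ⁅x, y⁆ = 0 := by
  by_contra h0
  have h1 := lie_wsp D hx hy
  have h3 : bf (m + n) (m + n) = 4 + 2 * bf m n := by
    simp only [bf_add_left, bf_add_right, hm, hn, bf_comm n m]; ring
  have h2 := root_of_wsp D (n := m + n) (fun hb => h0 (by rw [hb] at h1; exact h1)) (by
    intro h2
    rw [h2] at h3
    have h5 : bf (0 : V8) 0 = 0 := by simp [bf]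
    rw [h5] at h3
    omega)
  omega

variable (F L) in
/-- the root vectors used to build the copy of `gl₈` -/
structure A7D where
  D : E8D F L
  x : Fin 7 → L
  y : Fin 7 → L
  hx : ∀ q, x q ∈ D.wsp (- Gs q)
  hy : ∀ q, y q ∈ D.wsp (Gs q)
  hyx : ∀ q, ⁅y q, x q⁆ = D.hv (Gs q)

lemma exists_A7 (D : E8D F L) : ∃ A : A7D F L, A.D = D := by
  have h : ∀ q, ∃ a ∈ D.wsp (Gs q), ∃ b ∈ D.wsp (-Gs q), ⁅a, b⁆ = D.hv (Gs q) := fun q =>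
    exists_pair D (by rw [bf_Gs, if_pos rfl])
  choose y hy x hx hyx using h
  exact ⟨⟨D, x, y, hx, hy, hyx⟩, rfl⟩

namespace A7D
variable (A : A7D F L)

/-- image of `E₀₀` -/
def z : L := (-(1 / 8 : F)) • ∑ q, A.D.hv (Gs q)

lemma z_lie {n : V8} {w : L} (hw : w ∈ A.D.wsp n) :
    ⁅A.z, w⁆ = (-(1 / 8 : F) * ∑ q, ((bf (Gs q) n : ℤ) : F)) • w := by
  rw [z, smul_lie, sum_lie]
  simp only [hv_lie A.D hw]
  rw [← Finset.sum_smul, smul_smul]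

lemma Gs_root (q) : bf (Gs q) (Gs q) = 2 := by rw [bf_Gs, if_pos rfl]
lemma Gs_root_neg (q) : bf (-Gs q) (-Gs q) = 2 := by rw [bf_neg_neg, Gs_root]

lemma x_ne (q) : A.x q ≠ 0 := by
  intro h
  have := A.hyx q
  rw [h, lie_zero] at this
  exact hv_ne A.D (Gs_root q) this.symm
lemma y_ne (q) : A.y q ≠ 0 := by
  intro h
  have := A.hyx q
  rw [h, zero_lie] at this
  exact hv_ne A.D (Gs_root q) this.symm

lemma sum_Gs (r : Fin 7) : ∑ q, ((bf (Gs q) (Gs r) : ℤ) : F) = 8 := by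
  simp only [bf_Gs]
  have : (∑ q : Fin 7, (if q = r then (2 : ℤ) else 1)) = 8 := by
    revert r; decide
  exact_mod_cast this

lemma z_x (q) : ⁅A.z, A.x q⁆ = A.x q := by
  rw [z_lie A (A.hx q)]
  simp only [bf_neg_right, Int.cast_neg, Finset.sum_neg_distrib, sum_Gs]
  norm_num
lemma z_y (q) : ⁅A.z, A.y q⁆ = - A.y q := by
  rw [z_lie A (A.hy q), sum_Gs]
  norm_num

/-- images of the matrix units -/
def Y : Ix → Ix → L
  | none, none => A.z
  | none, some q => A.x q
  | some p, none => A.y p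
  | some p, some q => ⁅A.y p, A.x q⁆ + (if p = q then (1 : F) else 0) • A.z

lemma xx (p q) : ⁅A.x p, A.x q⁆ = 0 := by
  refine lie_zero_bf A.D (Gs_root_neg p) (Gs_root_neg q) ?_ (A.hx p) (A.hx q)
  rw [bf_neg_left, bf_neg_right, neg_neg, bf_Gs]; split_ifs <;> norm_num
lemma yy (p q) : ⁅A.y p, A.y q⁆ = 0 := by
  refine lie_zero_bf A.D (Gs_root p) (Gs_root q) ?_ (A.hy p) (A.hy q)
  rw [bf_Gs]; split_ifs <;> norm_num

lemma yx_root {p r} (h : p ≠ r) : bf (Gs p + -Gs r) (Gs p + -Gs r) = 2 := by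
  simp only [bf_add_left, bf_add_right, bf_neg_left, bf_neg_right, bf_Gs, if_neg h, if_neg h.symm]
  norm_num

lemma Y_x (p r q) : ⁅A.Y (some p) (some r), A.x q⁆ = - ((if q = p then (1 : F) else 0) • A.x r) := by
  have hvx : ∀ p q, ⁅A.D.hv (Gs p), A.x q⁆ = (-(if p = q then (2 : F) else 1)) • A.x q := by
    intro p q
    rw [hv_lie A.D (A.hx q), bf_neg_right, bf_Gs]
    split_ifs <;> norm_num
  simp only [Y, add_lie, smul_lie, z_x]
  by_cases hpr : p = r
  · subst hpr
    rw [A.hyx, hvx]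
    by_cases hq : q = p
    · subst hq; simp; module
    · simp [hq, Ne.symm hq]
  · simp only [if_neg hpr, zero_smul, add_zero]
    by_cases hq : q = p
    · subst hq
      have h1 : ⁅⁅A.y q, A.x r⁆, A.x q⁆ = ⁅A.y q, ⁅A.x r, A.x q⁆⁆ - ⁅A.x r, ⁅A.y q, A.x q⁆⁆ := by
        rw [lie_lie]
      rw [h1, xx, lie_zero, zero_sub, A.hyx, ← lie_skew, hvx, if_neg hpr]
      simp
    · simp only [if_neg hq, zero_smul, neg_zero]
      refine lie_zero_bf A.D (yx_root hpr) (Gs_root_neg q) ?_ (lie_wsp A.D (A.hy p) (A.hx r)) (A.hx q)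
      simp only [bf_add_left, bf_neg_left, bf_neg_right, bf_Gs, if_neg (Ne.symm hq)]
      split_ifs <;> norm_num

lemma Y_y (p r q) : ⁅A.Y (some p) (some r), A.y q⁆ = (if q = r then (1 : F) else 0) • A.y p := by
  have hvy : ∀ p q, ⁅A.D.hv (Gs p), A.y q⁆ = ((if p = q then (2 : F) else 1)) • A.y q := by
    intro p q
    rw [hv_lie A.D (A.hy q), bf_Gs]
    split_ifs <;> norm_num
  simp only [Y, add_lie, smul_lie, z_y]
  by_cases hpr : p = r
  · subst hpr
    rw [A.hyx, hvy]
    by_cases hq : q = p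
    · subst hq; simp; module
    · simp [hq, Ne.symm hq]
  · simp only [if_neg hpr, zero_smul, add_zero]
    by_cases hq : q = r
    · subst hq
      have h1 : ⁅⁅A.y p, A.x q⁆, A.y q⁆ = ⁅A.y p, ⁅A.x q, A.y q⁆⁆ - ⁅A.x q, ⁅A.y p, A.y q⁆⁆ := by
        rw [lie_lie]
      rw [h1, yy, lie_zero, sub_zero, ← lie_skew (A.x q) (A.y q), A.hyx, lie_neg, lie_skew, hvy,
        if_neg (Ne.symm hpr)]
      simp
    · simp only [if_neg hq, zero_smul]
      refine lie_zero_bf A.D (yx_root hpr) (Gs_root q) ?_ (lie_wsp A.D (A.hy p) (A.hx r)) (A.hy q)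
      simp only [bf_add_left, bf_neg_left, bf_Gs, if_neg (Ne.symm hq)]
      split_ifs <;> norm_num

lemma z_Y (p q) : ⁅A.z, A.Y p q⁆ = ((if none = p then (1 : F) else 0) -
    (if none = q then (1 : F) else 0)) • A.Y p q := by
  rcases p with _ | p <;> rcases q with _ | q
  · simp [Y]
  · simp [Y, z_x]
  · simp [Y, z_y]
  · have h1 : ⁅A.z, ⁅A.y p, A.x q⁆⁆ = 0 := by
      rw [leibniz_lie, z_x, z_y, neg_lie, neg_add_cancel]
    by_cases h : p = q
    · subst h; simp [Y, h1, -leibniz_lie]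
    · simp [Y, h1, h, -leibniz_lie]
end A7D
end
end E8P
namespace E8P
open LieAlgebra LieModule
set_option linter.unusedSectionVars false

section
variable {F : Type*} [Field F] [CharZero F]

/-- matrices of size 8 -/
abbrev M8 (F : Type*) := Matrix Ix Ix F

lemma mat_eq_sum (X : M8 F) : X = ∑ p, ∑ q, X p q • Matrix.single p q (1 : F) := by
  conv_lhs => rw [Matrix.matrix_eq_sum_single X]
  simp [Matrix.smul_single]

lemma single_mul (p q r s : Ix) : Matrix.single p q (1 : F) * Matrix.single r s (1 : F) =
    (if q = r then (1 : F) else 0) • Matrix.single p s (1 : F) := by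
  by_cases h : q = r
  · subst h; simp
  · simp [h]

lemma single_lie (p q r s : Ix) : Matrix.single p q (1 : F) * Matrix.single r s (1 : F) - Matrix.single r s (1 : F) * Matrix.single p q (1 : F) =
    (if q = r then (1 : F) else 0) • Matrix.single p s (1 : F) -
    (if s = p then (1 : F) else 0) • Matrix.single r q (1 : F) := by
  rw [single_mul, single_mul]

lemma mat_top (S : Submodule F (M8 F)) (h : ∀ p q, Matrix.single p q (1 : F) ∈ S) : S = ⊤ := by
  rw [eq_top_iff]
  intro X _
  rw [mat_eq_sum X]
  exact S.sum_mem fun p _ => S.sum_mem fun q _ => S.smul_mem _ (h p q)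

lemma gl_induction (S : Submodule F (M8 F)) (hb : ∀ X ∈ S, ∀ Y ∈ S, X * Y - Y * X ∈ S)
    (h00 : Matrix.single none none (1 : F) ∈ S)
    (h0q : ∀ q : Fin 7, Matrix.single none (some q) (1 : F) ∈ S)
    (hq0 : ∀ q : Fin 7, Matrix.single (some q) none (1 : F) ∈ S) : S = ⊤ := by
  apply mat_top
  rintro (_ | p) (_ | q)
  · exact h00
  · exact h0q q
  · exact hq0 p
  · have h1 := hb _ (hq0 p) _ (h0q q)
    rw [single_lie] at h1
    have h2 := S.add_mem h1 (S.smul_mem (if some q = some p then (1 : F) else 0) h00)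
    simpa using h2

/-- a subspace of matrices stable under brackets and not in the scalars contains all off-diagonal
matrix units -/
lemma gl_ideal (J : Submodule F (M8 F)) (hJ : ∀ X : M8 F, ∀ Y ∈ J, X * Y - Y * X ∈ J) (X : M8 F) (hX : X ∈ J)
    (hns : ∀ c : F, X ≠ c • 1) : ∀ p q, p ≠ q → Matrix.single p q (1 : F) ∈ J := by
  -- it suffices to find one
  have key : ∀ p q, p ≠ q → Matrix.single p q (1 : F) ∈ J →
      ∀ r s, r ≠ s → Matrix.single r s (1 : F) ∈ J := by
    have left : ∀ p q, p ≠ q → Matrix.single p q (1 : F) ∈ J → ∀ r, r ≠ q →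
        Matrix.single r q (1 : F) ∈ J := by
      intro p q hpq h r hr
      have := hJ (Matrix.single r p 1) _ h
      rw [single_lie] at this
      simpa [hr.symm] using this
    have right : ∀ p q, p ≠ q → Matrix.single p q (1 : F) ∈ J → ∀ r, r ≠ p →
        Matrix.single p r (1 : F) ∈ J := by
      intro p q hpq h r hr
      have := hJ (Matrix.single q r 1) _ h
      rw [single_lie] at this
      simpa [hr, J.neg_mem_iff] using this
    intro p q hpq h r s hrs
    by_cases h1 : r = q
    · subst h1
      obtain ⟨t, ht1, ht2⟩ : ∃ t : Ix, t ≠ p ∧ t ≠ r := by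
        clear hpq h hrs
        revert p r; decide
      have h2 := right p r hpq h t ht1
      have h3 := left p t ht1.symm h2 r ht2.symm
      exact right r t ht2.symm h3 s hrs.symm
    · have h2 := left p q hpq h r h1
      exact right r q h1 h2 s hrs.symm
  have entry : ∀ (p q : Ix), p ≠ q → ∀ Z ∈ J, Z p q ≠ 0 → Matrix.single q p (1 : F) ∈ J := by
    intro p q hpq Z hZ h
    have h1 := hJ (Matrix.single q p 1) _ (hJ (Matrix.single q p 1) Z hZ)
    have h0 : Matrix.single q p (1 : F) * Matrix.single q p (1 : F) = 0 := by
      rw [single_mul, if_neg hpq, zero_smul]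
    have h2 : Matrix.single q p (1 : F) * (Matrix.single q p (1 : F) * Z - Z * Matrix.single q p (1 : F)) -
        (Matrix.single q p (1 : F) * Z - Z * Matrix.single q p (1 : F)) * Matrix.single q p (1 : F) =
        (-2 * Z p q) • Matrix.single q p (1 : F) := by
      have h3 : Matrix.single q p (1 : F) * Z * Matrix.single q p (1 : F) =
          Z p q • Matrix.single q p (1 : F) := by
        rw [Matrix.single_mul_mul_single]; simp [Matrix.smul_single]
      rw [mul_smul, ← h3]
      have h4 : ∀ a b : M8 F, a * a = 0 → a * (a * b - b * a) - (a * b - b * a) * a =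
          (-2 : F) • (a * b * a) := by
        intro a b ha
        have h5 : a * (a * b - b * a) - (a * b - b * a) * a = a * a * b + b * (a * a) -
          a * b * a - a * b * a := by noncomm_ring
        rw [h5, ha]; simp; module
      exact h4 _ _ h0
    rw [h2] at h1
    exact (J.smul_mem_iff (mul_ne_zero (by norm_num) h)).mp h1
  by_cases hd : ∃ p q, p ≠ q ∧ X p q ≠ 0
  · obtain ⟨p, q, hpq, h⟩ := hd
    exact key q p hpq.symm (entry p q hpq X hX h)
  · push Not at hd
    obtain ⟨p, q, hpq⟩ : ∃ p q, X p p ≠ X q q := by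
      by_contra hc
      push Not at hc
      apply hns (X none none)
      ext i j
      by_cases hij : i = j
      · subst hij; simp [hc i none]
      · simp [hd i j hij, hij]
    have hne : p ≠ q := fun h => hpq (by rw [h])
    have h1 := hJ (Matrix.single p q 1) X hX
    have h2 : Matrix.single p q (1 : F) * X - X * Matrix.single p q (1 : F) = (X q q - X p p) • Matrix.single p q 1 := by
      have hdiag : X = Matrix.diagonal (fun i => X i i) := by
        ext i j
        by_cases hij : i = j
        · subst hij; simp
        · simp [hij, hd i j hij]
      conv_lhs => rw [hdiag]
      ext i j
      simp only [Matrix.sub_apply, Matrix.smul_apply, Matrix.mul_diagonal, Matrix.diagonal_mul,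
        Matrix.single_apply, smul_eq_mul]
      split_ifs with h
      · obtain ⟨rfl, rfl⟩ := h; ring
      · ring
    rw [h2] at h1
    have h3 := (J.smul_mem_iff (sub_ne_zero.mpr hpq.symm)).mp h1
    exact key p q hne h3
end

section
variable {F L : Type*} [Field F] [CharZero F] [LieRing L] [LieAlgebra F L] [Nontrivial L]
namespace A7D
variable (A : A7D F L)

/-- the map `gl₈ → L` with kernel the scalars -/
def psi : M8 F →ₗ[F] L where
  toFun X := ∑ p, ∑ q, X p q • A.Y p q
  map_add' X X' := by simp [add_smul, Finset.sum_add_distrib]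
  map_smul' c X := by simp [mul_smul, Finset.smul_sum]

lemma psi_single (p q) : A.psi (Matrix.single p q 1) = A.Y p q := by
  change ∑ r, ∑ s, Matrix.single p q (1 : F) r s • A.Y r s = _
  rw [Finset.sum_eq_single p, Finset.sum_eq_single q]
  · simp
  · intro b _ hb; simp [Ne.symm hb]
  · simp
  · intro b _ hb
    exact Finset.sum_eq_zero fun s _ => by simp [Ne.symm hb]
  · simp

lemma lin_eq_of_single {W : Type*} [AddCommGroup W] [Module F W] (f g : M8 F →ₗ[F] W)
    (h : ∀ p q, f (Matrix.single p q 1) = g (Matrix.single p q 1)) : f = g := by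
  have h1 := mat_top (LinearMap.eqLocus f g) h
  ext1 X
  have : X ∈ LinearMap.eqLocus f g := by rw [h1]; trivial
  exact this

lemma psi_lie_single (X : M8 F) (p q : Ix) (h : ∀ r s, A.psi (Matrix.single r s (1 : F) *
    Matrix.single p q (1 : F) - Matrix.single p q (1 : F) * Matrix.single r s (1 : F)) = ⁅A.Y r s, A.Y p q⁆) :
    A.psi (X * Matrix.single p q (1 : F) - Matrix.single p q (1 : F) * X) =
      ⁅A.psi X, A.psi (Matrix.single p q 1)⁆ := by
  have := lin_eq_of_single
      (A.psi ∘ₗ (LinearMap.mulRight F (Matrix.single p q (1 : F)) - LinearMap.mulLeft F (Matrix.single p q (1 : F))))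
      (-((ad F L (A.psi (Matrix.single p q 1)) : L →ₗ[F] L) ∘ₗ A.psi)) (by
    intro r s
    simp only [LinearMap.comp_apply, LinearMap.sub_apply, LinearMap.mulRight_apply,
      LinearMap.mulLeft_apply, h, LinearMap.neg_apply, ad_apply, psi_single, lie_skew])
  have h1 := LinearMap.congr_fun this X
  simp only [LinearMap.comp_apply, LinearMap.sub_apply, LinearMap.mulRight_apply,
      LinearMap.mulLeft_apply, LinearMap.neg_apply, ad_apply, lie_skew] at h1
  exact h1

lemma psi_lie (X Z : M8 F) : A.psi (X * Z - Z * X) = ⁅A.psi X, A.psi Z⁆ := by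
  let S : Submodule F (M8 F) :=
    { carrier := {Z | ∀ X : M8 F, A.psi (X * Z - Z * X) = ⁅A.psi X, A.psi Z⁆}
      add_mem' := fun {a b} ha hb X => by
        have : X * (a + b) - (a + b) * X = (X * a - a * X) + (X * b - b * X) := by noncomm_ring
        rw [this, map_add, map_add, lie_add, ha X, hb X]
      zero_mem' := fun X => by simp
      smul_mem' := fun c a ha X => by
        have : X * (c • a) - (c • a) * X = c • (X * a - a * X) := by
          rw [mul_smul_comm, smul_mul_assoc, smul_sub]
        rw [this, map_smul, map_smul, lie_smul, ha X] }
  have hS : S = ⊤ := by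
    apply gl_induction
    · intro P hP R hR X
      have : X * (P * R - R * P) - (P * R - R * P) * X =
        ((X * P - P * X) * R - R * (X * P - P * X)) - ((X * R - R * X) * P - P * (X * R - R * X)) := by
        noncomm_ring
      rw [this, map_sub, hR, hP, hP, hR, hR P, leibniz_lie (A.psi X), ← lie_skew (A.psi P) ⁅A.psi X, A.psi R⁆]
      abel
    · intro X
      apply psi_lie_single
      intro r s
      rw [single_lie, map_sub, map_smul, map_smul, psi_single, psi_single]
      have := A.z_Y r s
      rw [show A.Y none none = A.z from rfl, ← lie_skew, this]
      rcases r with _ | r <;> rcases s with _ | s <;> simp [Y]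
    · intro q X
      apply psi_lie_single
      intro r s
      rw [single_lie, map_sub, map_smul, map_smul, psi_single, psi_single]
      rcases r with _ | r <;> rcases s with _ | s
      · simp [Y, z_x]
      · simp [Y, xx]
      · rw [show A.Y (some r) (some q) = ⁅A.y r, A.x q⁆ + (if r = q then (1 : F) else 0) • A.z from rfl]
        by_cases h : q = r
        · simp [Y, h]
        · have h2 : ¬ r = q := fun hh => h hh.symm
          simp [Y, h, h2]
      · rw [show A.Y none (some q) = A.x q from rfl, Y_x]
        simp [Y]
    · intro q X
      apply psi_lie_single
      intro r s
      rw [single_lie, map_sub, map_smul, map_smul, psi_single, psi_single]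
      rcases r with _ | r <;> rcases s with _ | s
      · simp [Y, z_y]
      · rw [show A.Y (some q) (some s) = ⁅A.y q, A.x s⁆ + (if q = s then (1 : F) else 0) • A.z from rfl]
        by_cases h : s = q
        · subst h; simp [Y]
        · have h2 : ¬ q = s := fun hh => h hh.symm
          simp [Y, h, h2]
      · simp [Y, yy]
      · rw [show A.Y (some q) none = A.y q from rfl, Y_y]
        simp [Y, @eq_comm _ q s]
  have : Z ∈ S := by rw [hS]; trivial
  exact this X
end A7D
end
end E8P
namespace E8P
open LieAlgebra LieModule
set_option linter.unusedSectionVars false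
section
variable {F L : Type*} [Field F] [CharZero F] [LieRing L] [LieAlgebra F L] [Nontrivial L]
lemma bf_Gs_Bw (p) : bf (Gs p) Bw = -2 := by rw [bf_comm, bf_Bw_Gs]

namespace A7D
variable (A : A7D F L)

lemma psi_one : A.psi 1 = 0 := by
  rw [← Matrix.sum_single_one, map_sum]
  simp only [psi_single]
  rw [Fintype.sum_option]
  have h8 : ∀ p : Fin 7, A.Y (some p) (some p) = A.D.hv (Gs p) + A.z := by
    intro p; simp [Y, A.hyx]
  simp only [h8, Finset.sum_add_distrib]
  simp only [Y]
  simp only [Finset.sum_const, Finset.card_univ, Fintype.card_fin]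
  have : ∑ q, A.D.hv (Gs q) = (-8 : F) • A.z := by
    rw [z, smul_smul]; norm_num
  rw [this]
  module

lemma psi_ker (X : M8 F) (h : A.psi X = 0) : ∃ c : F, X = c • 1 := by
  by_contra hc
  push Not at hc
  have h1 := gl_ideal (LinearMap.ker A.psi) (by
    intro X Y hY
    rw [LinearMap.mem_ker] at *
    rw [psi_lie, hY, lie_zero]) X h hc none (some 0) (by simp)
  rw [LinearMap.mem_ker, psi_single] at h1
  exact A.x_ne 0 h1

lemma psi_diff (X : M8 F) (h : A.psi X = 0) (htr : X.trace = 0) : X = 0 := by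
  obtain ⟨c, rfl⟩ := A.psi_ker X h
  rw [Matrix.trace_smul, Matrix.trace_one] at htr
  have : c = 0 := by simpa using htr
  simp [this]
end A7D

variable (F L) in
/-- adding a lowest vector of `g₁` -/
structure B7D extends A7D F L where
  u0 : L
  hu0 : u0 ∈ D.wsp (Bw + Gs 0)
  u0_ne : u0 ≠ 0

lemma Bw_root (r) : bf (Bw + Gs r) (Bw + Gs r) = 2 := by
  simp only [bf_add_left, bf_add_right, bf_Bw_Bw, bf_Bw_Gs, bf_comm (Gs r) Bw, bf_Gs]; norm_num

lemma exists_B7 (D : E8D F L) : ∃ B : B7D F L, B.D = D := by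
  obtain ⟨A, rfl⟩ := exists_A7 D
  obtain ⟨u, hu, hu0⟩ := root_vec A.D (Bw_root 0)
  exact ⟨⟨A, u, hu, hu0⟩, rfl⟩

namespace B7D
variable (B : B7D F L)

/-- weight vectors -/
def u (r : Fin 7) : L := if r = 0 then B.u0 else ⁅B.Y (some r) (some 0), B.u0⁆

lemma Y_wsp {p q : Fin 7} (h : p ≠ q) : B.Y (some p) (some q) ∈ B.D.wsp (Gs p + -Gs q) := by
  simp only [A7D.Y, if_neg h, zero_smul, add_zero]
  exact lie_wsp B.D (B.hy p) (B.hx q)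

lemma hu (r) : B.u r ∈ B.D.wsp (Bw + Gs r) := by
  rw [u]
  split_ifs with h
  · rw [h]; exact B.hu0
  · have := lie_wsp B.D (B.Y_wsp h) B.hu0
    convert this using 1
    congr 1; abel

lemma Y_u_zero {p q r : Fin 7} (h : p ≠ q) (hr : q ≠ r) : ⁅B.Y (some p) (some q), B.u r⁆ = 0 := by
  refine lie_zero_bf B.D (A7D.yx_root h) (Bw_root r) ?_ (B.Y_wsp h) (B.hu r)
  simp only [bf_add_left, bf_add_right, bf_neg_left, bf_Gs_Bw, bf_Bw_Gs, bf_Gs, if_neg hr]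
  split_ifs <;> norm_num

lemma z_u (r) : ⁅B.z, B.u r⁆ = (3 / 4 : F) • B.u r := by
  rw [B.z_lie (B.hu r)]
  simp only [bf_add_right, bf_Gs_Bw, bf_Bw_Gs, Int.cast_add, Finset.sum_add_distrib, A7D.sum_Gs]
  simp; congr 1; norm_num

lemma Ypp_u (p r) : ⁅B.Y (some p) (some p), B.u r⁆ =
    ((if p = r then (1 : F) else 0) - 1 / 4) • B.u r := by
  have : B.Y (some p) (some p) = B.D.hv (Gs p) + B.z := by simp [A7D.Y, B.hyx]
  rw [this, add_lie, z_u, hv_lie B.D (B.hu r), ← add_smul]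
  congr 1
  simp only [bf_add_right, bf_Gs_Bw, bf_Bw_Gs, bf_Gs]
  split_ifs <;> norm_num

lemma Y_u_one {p r : Fin 7} (h : p ≠ r) : ⁅B.Y (some p) (some r), B.u r⁆ = B.u p := by
  by_cases hr : r = 0
  · subst hr; simp [u, h]
  have hu : B.u r = ⁅B.Y (some r) (some 0), B.u 0⁆ := by simp [u, hr]
  rw [hu, leibniz_lie, B.Y_u_zero h hr, lie_zero, add_zero]
  have h1 : ⁅B.Y (some p) (some r), B.Y (some r) (some 0)⁆ = B.Y (some p) (some 0) -
      (if p = 0 then (1 : F) else 0) • B.Y (some r) (some r) := by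
    rw [← B.psi_single, ← B.psi_single (some r) (some 0), ← B.psi_lie, single_lie, map_sub, map_smul,
      map_smul, B.psi_single, B.psi_single]
    simp [@eq_comm _ 0 p]
  rw [h1, sub_lie, smul_lie, Ypp_u]
  by_cases hp : p = 0
  · subst hp
    rw [Ypp_u]; simp [hr]; module
  · simp [hp, u]

lemma x_u (q r) : ⁅B.x q, B.u r⁆ = 0 := by
  refine lie_zero_bf B.D (A7D.Gs_root_neg q) (Bw_root r) ?_ (B.hx q) (B.hu r)
  simp only [bf_add_right, bf_neg_left, bf_Gs_Bw, bf_Bw_Gs, bf_Gs]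
  split_ifs <;> norm_num

lemma w_self (r) : ⁅B.y r, B.u r⁆ = 0 := by
  refine lie_zero_bf B.D (A7D.Gs_root r) (Bw_root r) ?_ (B.hy r) (B.hu r)
  simp [bf_add_right, bf_Gs_Bw, bf_Bw_Gs, bf_Gs]

lemma w_skew (p r) : ⁅B.y p, B.u r⁆ = - ⁅B.y r, B.u p⁆ := by
  by_cases h : p = r
  · subst h; simp [w_self]
  rw [← B.Y_u_one (Ne.symm h), leibniz_lie, w_self, lie_zero, add_zero, ← lie_skew (B.y p), B.Y_y, if_pos rfl,
    one_smul, neg_lie]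

lemma y_w (q p r) : ⁅B.y q, ⁅B.y p, B.u r⁆⁆ = 0 := by
  by_cases h : p = r
  · subst h; simp [w_self]
  refine lie_zero_bf B.D (A7D.Gs_root q) (n := Gs p + (Bw + Gs r)) ?_ ?_ (B.hy q)
    (lie_wsp B.D (B.hy p) (B.hu r))
  · rw [bf_add_left, bf_add_right (Gs p), bf_add_right (Bw + Gs r) (Gs p), Bw_root]
    simp [bf_add_left, bf_add_right, bf_Gs_Bw, bf_Bw_Gs, bf_Gs, h, Ne.symm h]
  · simp only [bf_add_right, bf_Gs_Bw, bf_Bw_Gs, bf_Gs]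
    split_ifs <;> norm_num

lemma Y_u (p q r) : ⁅⁅B.y p, B.x q⁆, B.u r⁆ = (if q = r then (1 : F) else 0) • B.u p -
    (if p = q then (1 : F) else 0) • B.u r := by
  have h0 : ⁅B.y p, B.x q⁆ = B.Y (some p) (some q) - (if p = q then (1 : F) else 0) • B.z := by
    simp [A7D.Y]
  rw [h0, sub_lie, smul_lie, z_u]
  by_cases h : p = q
  · subst h
    rw [Ypp_u]
    by_cases hr : p = r
    · subst hr; simp; module
    · simp [hr]; module
  · by_cases hr : q = r
    · subst hr; rw [Y_u_one B h]; simp [h]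
    · rw [Y_u_zero B h hr]; simp [h, hr]

lemma x_w (q p r) : ⁅B.x q, ⁅B.y p, B.u r⁆⁆ = (if p = q then (1 : F) else 0) • B.u r -
    (if q = r then (1 : F) else 0) • B.u p := by
  rw [leibniz_lie, x_u, lie_zero, add_zero, ← lie_skew (B.x q), neg_lie, Y_u, neg_sub]

lemma z_w (p r) : ⁅B.z, ⁅B.y p, B.u r⁆⁆ = (-(1 / 4) : F) • ⁅B.y p, B.u r⁆ := by
  rw [leibniz_lie, z_u, B.z_y, lie_smul, neg_lie]
  module

/-- images of the matrix units in `g₁` -/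
def W : Ix → Ix → L
  | none, none => 0
  | none, some r => B.u r
  | some r, none => - B.u r
  | some p, some r => ⁅B.y p, B.u r⁆

lemma W_skew (p q) : B.W p q = - B.W q p := by
  rcases p with _ | p <;> rcases q with _ | q 
  · simp [W]
  · simp [W]
  · simp [W]
  · exact B.w_skew p q

/-- the map to `g₁` -/
def Psi0 : M8 F →ₗ[F] L where
  toFun X := ∑ p, ∑ q, X p q • B.W p q
  map_add' X X' := by simp [add_smul, Finset.sum_add_distrib]
  map_smul' c X := by simp [mul_smul, Finset.smul_sum]

lemma Psi0_single (p q) : B.Psi0 (Matrix.single p q 1) = B.W p q := by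
  change ∑ r, ∑ s, Matrix.single p q (1 : F) r s • B.W r s = _
  rw [Finset.sum_eq_single p, Finset.sum_eq_single q]
  · simp
  · intro b _ hb; simp [Ne.symm hb]
  · simp
  · intro b _ hb
    exact Finset.sum_eq_zero fun s _ => by simp [Ne.symm hb]
  · simp

lemma Psi0_transpose (Z : M8 F) : B.Psi0 Z.transpose = - B.Psi0 Z := by
  change ∑ p, ∑ q, Z q p • B.W p q = - ∑ p, ∑ q, Z p q • B.W p q
  rw [Finset.sum_comm, ← Finset.sum_neg_distrib]
  refine Finset.sum_congr rfl fun p _ => ?_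
  rw [← Finset.sum_neg_distrib]
  refine Finset.sum_congr rfl fun q _ => ?_
  rw [W_skew, smul_neg]

/-- the action of `gl₈` on matrices -/
def act (X Z : M8 F) : M8 F := X * Z + Z * X.transpose - (X.trace / 4) • Z

lemma act_single (p q r s : Ix) : act (Matrix.single p q (1 : F)) (Matrix.single r s 1) =
    (if q = r then (1 : F) else 0) • Matrix.single p s 1 + (if s = q then (1 : F) else 0) •
      Matrix.single r p 1 - (if p = q then (1 / 4 : F) else 0) • Matrix.single r s 1 := by
  rw [act, Matrix.transpose_single, single_mul, single_mul]
  by_cases h : p = q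
  · subst h; simp
  · simp [h]

/-- equivariance -/
lemma psi_Psi0 (X Z : M8 F) : ⁅B.psi X, B.Psi0 Z⁆ = B.Psi0 (act X Z) := by
  let S : Submodule F (M8 F) :=
    { carrier := {X | ∀ Z : M8 F, ⁅B.psi X, B.Psi0 Z⁆ = B.Psi0 (act X Z)}
      add_mem' := fun {a b} ha hb X => by
        have : act (a + b) X = act a X + act b X := by
          simp only [act, Matrix.transpose_add, Matrix.trace_add, add_mul, mul_add, add_div, add_smul]
          abel
        rw [this, map_add, map_add, add_lie, ha X, hb X]
      zero_mem' := fun X => by simp [act]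
      smul_mem' := fun c a ha X => by
        have : act (c • a) X = c • act a X := by
          simp only [act, Matrix.transpose_smul, Matrix.trace_smul, smul_mul_assoc, mul_smul_comm,
            smul_sub, smul_add, smul_smul, smul_eq_mul, mul_div_assoc]
        rw [this, map_smul, map_smul, smul_lie, ha X] }
  have hS : S = ⊤ := by
    have hsing : ∀ p q, (∀ r s, ⁅B.Y p q, B.W r s⁆ = B.Psi0 (act (Matrix.single p q 1)
        (Matrix.single r s 1))) → Matrix.single p q (1 : F) ∈ S := by
      intro p q h Z
      have h1 := A7D.lin_eq_of_single ((ad F L (B.psi (Matrix.single p q 1)) : L →ₗ[F] L) ∘ₗ B.Psi0)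
        (B.Psi0 ∘ₗ (LinearMap.mulLeft F (Matrix.single p q (1 : F)) +
          LinearMap.mulRight F (Matrix.single p q (1 : F)).transpose -
          ((Matrix.single p q (1 : F)).trace / 4) • LinearMap.id)) (by
        intro r s
        have := h r s
        rw [← B.Psi0_single, ← B.psi_single] at this
        exact this)
      exact LinearMap.congr_fun h1 Z
    apply gl_induction
    · intro P hP R hR Z
      have : act (P * R - R * P) Z = act P (act R Z) - act R (act P Z) := by
        have ht : (P * R - R * P).trace = 0 := by rw [Matrix.trace_sub, Matrix.trace_mul_comm, sub_self]
        simp only [act, ht, Matrix.transpose_sub, Matrix.transpose_mul, mul_add, add_mul, mul_sub, sub_mul,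
          smul_mul_assoc, mul_smul_comm, zero_div, zero_smul, sub_zero, smul_add, smul_sub, mul_assoc]
        rw [smul_comm (P.trace / 4) (R.trace / 4) Z]
        abel
      rw [this, map_sub B.Psi0, ← hP, ← hR, ← hR, ← hP, B.psi_lie, lie_lie]
    · apply hsing
      intro r s
      rw [act_single, map_sub, map_add, map_smul, map_smul, map_smul, Psi0_single, Psi0_single, Psi0_single]
      rcases r with _ | r <;> rcases s with _ | s 
      · simp [A7D.Y, W]
      · simp [A7D.Y, W, z_u]; module
      · simp [A7D.Y, W, z_u]; module
      · change ⁅B.z, ⁅B.y r, B.u s⁆⁆ = _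
        rw [z_w]; simp [W]
    · intro q
      apply hsing
      intro r s
      rw [act_single, map_sub, map_add, map_smul, map_smul, map_smul, Psi0_single, Psi0_single, Psi0_single]
      rcases r with _ | r <;> rcases s with _ | s 
      · simp [A7D.Y, W]
      · by_cases h : s = q <;> simp [A7D.Y, W, x_u, h]
      · by_cases h : q = r <;> simp [A7D.Y, W, x_u, h]
      · change ⁅B.x q, ⁅B.y r, B.u s⁆⁆ = _
        rw [x_w]
        simp only [Option.some.injEq, @eq_comm _ q r, @eq_comm _ q s]
        split_ifs <;> simp_all [W, sub_eq_add_neg]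
    · intro q
      apply hsing
      intro r s
      rw [act_single, map_sub, map_add, map_smul, map_smul, map_smul, Psi0_single, Psi0_single, Psi0_single]
      rcases r with _ | r <;> rcases s with _ | s 
      · change ⁅B.y q, (0 : L)⁆ = _
        simp [W]
      · change ⁅B.y q, B.u s⁆ = _
        simp [W]
      · change ⁅B.y q, -B.u r⁆ = _
        rw [lie_neg, w_skew]; simp [W]
      · change ⁅B.y q, ⁅B.y r, B.u s⁆⁆ = _
        rw [y_w]; simp
  have : X ∈ S := by rw [hS]; trivial
  exact this Z
end B7D
end
end E8P
namespace E8P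
open LieAlgebra LieModule
set_option linter.unusedSectionVars false
section
variable {F L : Type*} [Field F] [CharZero F] [LieRing L] [LieAlgebra F L] [Nontrivial L]

/-- matrices of size 2 -/
abbrev M2 (F : Type*) := Matrix (Fin 2) (Fin 2) F
/-- the model of `g₁` -/
abbrev MV (F : Type*) := Fin 2 → M8 F

namespace B7D
variable (B : B7D F L)

lemma al_root (i) : bf (al i) (al i) = 2 := bf_al_al i
lemma al_root_neg (i) : bf (-al i) (-al i) = 2 := by rw [bf_neg_neg, bf_al_al]

lemma e_x (q) : ⁅B.D.e 0, B.x q⁆ = 0 :=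
  lie_zero_bf B.D (al_root 0) (A7D.Gs_root_neg q)
    (by rw [bf_neg_right, bf_comm, bf_Gs_al]; norm_num) (e_mem_wsp B.D 0) (B.hx q)
lemma e_y (q) : ⁅B.D.e 0, B.y q⁆ = 0 :=
  lie_zero_bf B.D (al_root 0) (A7D.Gs_root q) (by rw [bf_comm, bf_Gs_al]) (e_mem_wsp B.D 0) (B.hy q)
lemma f_x (q) : ⁅B.D.f 0, B.x q⁆ = 0 :=
  lie_zero_bf B.D (al_root_neg 0) (A7D.Gs_root_neg q)
    (by rw [bf_neg_left, bf_neg_right, bf_comm, bf_Gs_al]; norm_num) (f_mem_wsp B.D 0) (B.hx q)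
lemma f_y (q) : ⁅B.D.f 0, B.y q⁆ = 0 :=
  lie_zero_bf B.D (al_root_neg 0) (A7D.Gs_root q) (by rw [bf_neg_left, bf_comm, bf_Gs_al]; norm_num)
    (f_mem_wsp B.D 0) (B.hy q)

lemma z_e : ⁅B.z, B.D.e 0⁆ = 0 := by
  rw [B.z_lie (e_mem_wsp B.D 0)]; simp [bf_Gs_al]
lemma z_f : ⁅B.z, B.D.f 0⁆ = 0 := by
  rw [B.z_lie (f_mem_wsp B.D 0)]; simp [bf_Gs_al, bf_neg_right]

lemma comm_psi (t : L) (hx : ∀ q, ⁅t, B.x q⁆ = 0) (hy : ∀ q, ⁅t, B.y q⁆ = 0) (hz : ⁅B.z, t⁆ = 0)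
    (X : M8 F) : ⁅t, B.psi X⁆ = 0 := by
  have h := A7D.lin_eq_of_single ((ad F L t : L →ₗ[F] L) ∘ₗ B.psi) 0 (by
    intro p q
    have hz' : ⁅t, B.z⁆ = 0 := by rw [← lie_skew, hz, neg_zero]
    simp only [LinearMap.comp_apply, B.psi_single, ad_apply, LinearMap.zero_apply]
    rcases p with _ | p <;> rcases q with _ | q
    · exact hz'
    · exact hx q
    · exact hy p
    · change ⁅t, ⁅B.y p, B.x q⁆ + (if p = q then (1 : F) else 0) • B.z⁆ = 0
      rw [lie_add, lie_smul, leibniz_lie, hx, hy, hz']; simp)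
  exact LinearMap.congr_fun h X

lemma e_psi (X : M8 F) : ⁅B.D.e 0, B.psi X⁆ = 0 := B.comm_psi _ B.e_x B.e_y B.z_e X
lemma f_psi (X : M8 F) : ⁅B.D.f 0, B.psi X⁆ = 0 := B.comm_psi _ B.f_x B.f_y B.z_f X
lemma h_psi (X : M8 F) : ⁅B.D.h 0, B.psi X⁆ = 0 := by
  rw [← B.D.ef, lie_lie, e_psi, f_psi, lie_zero, lie_zero, sub_zero]

lemma ext_Psi0 (f g : L →ₗ[F] L) (hu : ∀ r, f (B.u r) = g (B.u r))
    (hw : ∀ p r, f ⁅B.y p, B.u r⁆ = g ⁅B.y p, B.u r⁆) (Z : M8 F) : f (B.Psi0 Z) = g (B.Psi0 Z) := by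
  have h := A7D.lin_eq_of_single (f ∘ₗ B.Psi0) (g ∘ₗ B.Psi0) (by
    intro p q
    simp only [LinearMap.comp_apply, Psi0_single]
    rcases p with _ | p <;> rcases q with _ | q
    · simp [W]
    · exact hu q
    · simp [W, hu]
    · exact hw p q)
  exact LinearMap.congr_fun h Z

lemma e_u (r) : ⁅B.D.e 0, B.u r⁆ = 0 :=
  lie_zero_bf B.D (al_root 0) (Bw_root r)
    (by rw [bf_add_right, bf_comm, bf_Bw_al, bf_comm, bf_Gs_al]; norm_num) (e_mem_wsp B.D 0) (B.hu r)

lemma h_u (r) : ⁅B.D.h 0, B.u r⁆ = B.u r := by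
  rw [← hv_al, hv_lie B.D (B.hu r), bf_add_right, bf_comm, bf_Bw_al, bf_comm, bf_Gs_al]; simp

lemma f_root (r) : bf (-al 0 + (Bw + Gs r)) (-al 0 + (Bw + Gs r)) = 2 := by
  simp only [bf_add_left, bf_add_right, bf_neg_left, bf_neg_right, bf_Bw_al, bf_Gs_al, bf_Bw_Bw, bf_Bw_Gs,
    bf_Gs_Bw, bf_comm (al 0), bf_al_al, bf_Gs]
  norm_num

lemma f_f_u (r) : ⁅B.D.f 0, ⁅B.D.f 0, B.u r⁆⁆ = 0 :=
  lie_zero_bf B.D (al_root_neg 0) (f_root r)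
    (by simp [bf_add_right, bf_neg_left, bf_neg_right, bf_comm (al 0), bf_Bw_al, bf_Gs_al, bf_al_al])
    (f_mem_wsp B.D 0) (lie_wsp B.D (f_mem_wsp B.D 0) (B.hu r))

lemma h_y (q) : ⁅B.D.h 0, B.y q⁆ = 0 := by
  rw [← hv_al, hv_lie B.D (B.hy q), bf_comm, bf_Gs_al]; simp

lemma e_Psi0 (Z : M8 F) : ⁅B.D.e 0, B.Psi0 Z⁆ = 0 := by
  refine B.ext_Psi0 (ad F L (B.D.e 0)) 0 (fun r => B.e_u r) (fun p r => ?_) Z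
  rw [ad_apply, leibniz_lie, e_u, e_y]; simp
lemma h_Psi0 (Z : M8 F) : ⁅B.D.h 0, B.Psi0 Z⁆ = B.Psi0 Z := by
  refine B.ext_Psi0 (ad F L (B.D.h 0)) LinearMap.id (fun r => B.h_u r) (fun p r => ?_) Z
  rw [ad_apply, leibniz_lie, h_u, h_y]; simp
lemma f_f_Psi0 (Z : M8 F) : ⁅B.D.f 0, ⁅B.D.f 0, B.Psi0 Z⁆⁆ = 0 := by
  refine B.ext_Psi0 ((ad F L (B.D.f 0) : L →ₗ[F] L) ∘ₗ (ad F L (B.D.f 0) : L →ₗ[F] L)) 0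
    (fun r => B.f_f_u r) (fun p r => ?_) Z
  simp only [LinearMap.comp_apply, ad_apply]
  rw [leibniz_lie (B.D.f 0) (B.y p), f_y, zero_lie, zero_add, leibniz_lie (B.D.f 0) (B.y p), f_y, f_f_u]; simp
lemma e_f_Psi0 (Z : M8 F) : ⁅B.D.e 0, ⁅B.D.f 0, B.Psi0 Z⁆⁆ = B.Psi0 Z := by
  rw [leibniz_lie, e_Psi0, lie_zero, add_zero, B.D.ef, h_Psi0]
lemma h_f : ⁅B.D.h 0, B.D.f 0⁆ = (-2 : F) • B.D.f 0 := by
  rw [B.D.hf, E8_diag]; simp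
lemma h_e : ⁅B.D.h 0, B.D.e 0⁆ = (2 : F) • B.D.e 0 := by
  rw [B.D.he, E8_diag]; simp
lemma h_f_Psi0 (Z : M8 F) : ⁅B.D.h 0, ⁅B.D.f 0, B.Psi0 Z⁆⁆ = - ⁅B.D.f 0, B.Psi0 Z⁆ := by
  rw [leibniz_lie, h_Psi0, h_f, smul_lie]; module

/-- the map from `gl₂` -/
def psi1 : M2 F →ₗ[F] L where
  toFun A := A 0 1 • B.D.e 0 + A 1 0 • B.D.f 0 + ((A 0 0 - A 1 1) / 2) • B.D.h 0
  map_add' X X' := by simp only [Matrix.add_apply]; module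
  map_smul' c X := by simp only [Matrix.smul_apply, smul_eq_mul, RingHom.id_apply]; module

lemma psi1_def (X : M2 F) : B.psi1 X = X 0 1 • B.D.e 0 + X 1 0 • B.D.f 0 + ((X 0 0 - X 1 1) / 2) • B.D.h 0 := rfl

/-- the map onto `g₁` -/
def Psi : MV F →ₗ[F] L where
  toFun Z := B.Psi0 (Z 0) + ⁅B.D.f 0, B.Psi0 (Z 1)⁆
  map_add' X X' := by simp only [Pi.add_apply, map_add, lie_add]; abel
  map_smul' c X := by simp only [Pi.smul_apply, map_smul, lie_smul, smul_add, RingHom.id_apply]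

lemma Psi_def (Z : MV F) : B.Psi Z = B.Psi0 (Z 0) + ⁅B.D.f 0, B.Psi0 (Z 1)⁆ := rfl

lemma psi1_psi (X : M2 F) (Z : M8 F) : ⁅B.psi1 X, B.psi Z⁆ = 0 := by
  simp [psi1_def, e_psi, f_psi, h_psi]

lemma psi1_one : B.psi1 1 = 0 := by simp [psi1_def]

lemma psi1_ker (X : M2 F) (h : B.psi1 X = 0) : ∃ c : F, X = c • 1 := by
  have h1 := congrArg (fun t => ⁅B.D.h 0, t⁆) h
  have h2 := congrArg (fun t => ⁅B.D.h 0, t⁆) h1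
  simp only [psi1_def, lie_add, lie_smul, h_e, h_f, B.D.hh, lie_zero, smul_zero, add_zero, smul_smul] at h h1 h2
  have he := e_ne B.D 0
  have hf := f_ne B.D 0
  have h3 : X 0 1 = 0 := by
    have : (8 * X 0 1) • B.D.e 0 = 0 := by linear_combination (norm := module) (2 : F) • h1 + h2
    simpa [he] using this
  have h4 : X 1 0 = 0 := by
    have : (8 * X 1 0) • B.D.f 0 = 0 := by linear_combination (norm := module) h2 - (2 : F) • h1
    simpa [hf] using this
  have h5 : X 0 0 = X 1 1 := by
    rw [h3, h4] at h
    simpa [h_ne B.D 0, sub_eq_zero] using h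
  refine ⟨X 0 0, ?_⟩
  ext i j
  fin_cases i <;> fin_cases j <;> simp [h3, h4, h5]

lemma psi1_lie (X Z : M2 F) : B.psi1 (X * Z - Z * X) = ⁅B.psi1 X, B.psi1 Z⁆ := by
  have h1 : ⁅B.D.f 0, B.D.e 0⁆ = - B.D.h 0 := by rw [← lie_skew, B.D.ef]
  have h2 : ⁅B.D.e 0, B.D.h 0⁆ = (-2 : F) • B.D.e 0 := by rw [← lie_skew, h_e]; module
  have h3 : ⁅B.D.f 0, B.D.h 0⁆ = (2 : F) • B.D.f 0 := by rw [← lie_skew, h_f]; module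
  simp only [psi1_def, lie_add, add_lie, lie_smul, smul_lie, h_e, h_f, B.D.hh, B.D.ef, h1, h2, h3, lie_self,
    Matrix.sub_apply, Matrix.mul_apply, Fin.sum_univ_two]
  module

lemma psi_Psi (X : M8 F) (Z : MV F) : ⁅B.psi X, B.Psi Z⁆ = B.Psi (fun a => act X (Z a)) := by
  rw [Psi_def, Psi_def, lie_add, psi_Psi0, leibniz_lie, psi_Psi0, ← lie_skew (B.psi X), f_psi]
  simp

lemma psi1_Psi (X : M2 F) (Z : MV F) : ⁅B.psi1 X, B.Psi Z⁆ =
    B.Psi (fun a => (∑ b, X a b • Z b) - (X.trace / 2) • Z a) := by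
  rw [Psi_def, Psi_def, psi1_def]
  simp only [lie_add, add_lie, smul_lie, e_Psi0, e_f_Psi0, f_f_Psi0, h_Psi0, h_f_Psi0, map_sub, map_add,
    map_smul, Fin.sum_univ_two, Matrix.trace_fin_two, lie_sub, lie_smul]
  module

lemma u_ne (r) : B.u r ≠ 0 := by
  intro h
  by_cases hr : r = 0
  · subst hr; exact B.u0_ne h
  · have h1 := B.Y_u_one (p := 0) (r := r) (Ne.symm hr)
    rw [h, lie_zero] at h1
    exact B.u0_ne h1.symm

lemma W_ne {p q} (h : p ≠ q) : B.W p q ≠ 0 := by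
  rcases p with _ | p <;> rcases q with _ | q
  · exact absurd rfl h
  · exact B.u_ne q
  · exact neg_ne_zero.mpr (B.u_ne p)
  · intro h1
    have h2 := B.x_w p p q
    have h3 : p ≠ q := fun hh => h (by rw [hh])
    rw [show ⁅B.y p, B.u q⁆ = 0 from h1, lie_zero] at h2
    simp [h3] at h2
    exact B.u_ne q h2.symm

lemma Psi0_ker (Z : M8 F) (h : B.Psi0 Z = 0) : Z.transpose = Z := by
  have hK : ∀ X Z : M8 F, B.Psi0 Z = 0 → B.Psi0 (X * Z + Z * X.transpose) = 0 := by
    intro X Z hZ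
    have h1 := B.psi_Psi0 X Z
    rw [hZ, lie_zero, act, map_sub, map_smul, hZ, smul_zero, sub_zero] at h1
    exact h1.symm
  ext p q
  rw [Matrix.transpose_apply]
  by_cases hpq : p = q
  · rw [hpq]
  have h1 := hK (Matrix.single q q 1) _ (hK (Matrix.single p p 1) Z h)
  have h2 : Matrix.single q q 1 * (Matrix.single p p 1 * Z + Z * (Matrix.single p p (1 : F)).transpose) +
      (Matrix.single p p 1 * Z + Z * (Matrix.single p p (1 : F)).transpose) * (Matrix.single q q 1).transpose =
      Z q p • Matrix.single q p 1 + Z p q • Matrix.single p q 1 := by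
    simp only [Matrix.transpose_single, mul_add, add_mul]
    rw [← mul_assoc (Matrix.single q q (1 : F)) (Matrix.single p p 1) Z, single_mul, if_neg (Ne.symm hpq),
      mul_assoc Z, single_mul, if_neg hpq, ← mul_assoc, Matrix.single_mul_mul_single,
      Matrix.single_mul_mul_single]
    simp [Matrix.smul_single]
  rw [h2, map_add, map_smul, map_smul, Psi0_single, Psi0_single, W_skew B q p, smul_neg] at h1
  have h3 : (Z p q - Z q p) • B.W p q = 0 := by rw [sub_smul]; linear_combination (norm := module) h1
  have := (smul_eq_zero.mp h3).resolve_right (B.W_ne hpq)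
  exact (sub_eq_zero.mp this).symm

lemma Psi_ker (Z : MV F) (h : B.Psi Z = 0) (a) : (Z a).transpose = Z a := by
  have h1 := congrArg (fun t => ⁅B.D.h 0, t⁆) h
  simp only [Psi_def, lie_add, h_Psi0, h_f_Psi0, lie_zero] at h h1
  have h2 : B.Psi0 (Z 0) = 0 := by
    have : (2 : F) • B.Psi0 (Z 0) = 0 := by linear_combination (norm := module) h + h1
    simpa using this
  have h3 : B.Psi0 (Z 1) = 0 := by
    have h4 := congrArg (fun t => ⁅B.D.e 0, t⁆) h
    simp only [lie_add, e_Psi0, e_f_Psi0, lie_zero, zero_add] at h4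
    exact h4
  fin_cases a
  · exact B.Psi0_ker _ h2
  · exact B.Psi0_ker _ h3

lemma Psi_transpose (Z : MV F) : B.Psi (fun a => (Z a).transpose) = - B.Psi Z := by
  simp only [Psi_def, Psi0_transpose, lie_neg]; abel

end B7D
end
end E8P
namespace E8P
open LieAlgebra LieModule
set_option linter.unusedSectionVars false

set_option maxRecDepth 100000 in
lemma codes_g0 : ∀ c ∈ codes, dec c 2 % 4 = 0 → dec c = al 0 ∨ (∃ p, dec c = Gs p ∨ dec c = - Gs p) ∨
    ∃ p q, p ≠ q ∧ dec c = Gs p - Gs q := by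
  decide +kernel

lemma root_g0 (n) (hn : bf n n = 2) (h : n 2 % 4 = 0) : n = al 0 ∨ n = - al 0 ∨ (∃ p, n = Gs p ∨ n = - Gs p) ∨
    ∃ p q, p ≠ q ∧ n = Gs p - Gs q := by
  obtain ⟨c, hc, rfl | rfl⟩ := root_table n hn
  · rcases codes_g0 c hc h with h1 | h1 | h1
    · exact Or.inl h1
    · exact Or.inr (Or.inr (Or.inl h1))
    · exact Or.inr (Or.inr (Or.inr h1))
  · have h' : dec c 2 % 4 = 0 := by
      simp only [Pi.neg_apply] at h; omega
    rcases codes_g0 c hc h' with h1 | ⟨p, h1⟩ | ⟨p, q, hpq, h1⟩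
    · exact Or.inr (Or.inl (by rw [h1]))
    · refine Or.inr (Or.inr (Or.inl ⟨p, ?_⟩))
      rcases h1 with h1 | h1
      · right; rw [h1]
      · left; rw [h1, neg_neg]
    · exact Or.inr (Or.inr (Or.inr ⟨q, p, hpq.symm, by rw [h1]; abel⟩))

set_option maxRecDepth 100000 in
lemma codes_g1 : ∀ c ∈ codes, dec c 2 % 4 = 1 →
    (∃ p, dec c = Bw + Gs p ∨ dec c = -al 0 + (Bw + Gs p)) ∨
    ∃ p q, p ≠ q ∧ (dec c = Gs p + (Bw + Gs q) ∨ dec c = -al 0 + (Gs p + (Bw + Gs q))) := by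
  decide +kernel
set_option maxRecDepth 100000 in
lemma codes_g3 : ∀ c ∈ codes, dec c 2 % 4 = 3 →
    (∃ p, -dec c = Bw + Gs p ∨ -dec c = -al 0 + (Bw + Gs p)) ∨
    ∃ p q, p ≠ q ∧ (-dec c = Gs p + (Bw + Gs q) ∨ -dec c = -al 0 + (Gs p + (Bw + Gs q))) := by
  decide +kernel

lemma root_g1 (n) (hn : bf n n = 2) (h : n 2 % 4 = 1) :
    (∃ p, n = Bw + Gs p ∨ n = -al 0 + (Bw + Gs p)) ∨
    ∃ p q, p ≠ q ∧ (n = Gs p + (Bw + Gs q) ∨ n = -al 0 + (Gs p + (Bw + Gs q))) := by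
  obtain ⟨c, hc, rfl | rfl⟩ := root_table n hn
  · exact codes_g1 c hc h
  · exact codes_g3 c hc (by simp only [Pi.neg_apply] at h; omega)

lemma Gs_chain : al 7 = Gs 0 - Gs 1 ∧ al 6 = Gs 1 - Gs 2 ∧ al 5 = Gs 2 - Gs 3 ∧ al 4 = Gs 3 - Gs 4 ∧
    al 3 = Gs 4 - Gs 5 ∧ al 1 = Gs 5 - Gs 6 ∧ (4 : ℤ) • al 2 = Gs 0 - (2 : ℤ) • al 0 - (3 : ℤ) • al 1
      - (6 : ℤ) • al 3 - (5 : ℤ) • al 4 - (4 : ℤ) • al 5 - (3 : ℤ) • al 6 - (2 : ℤ) • al 7 := by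
  decide +kernel

section
variable {F L : Type*} [Field F] [CharZero F] [LieRing L] [LieAlgebra F L] [Nontrivial L]
namespace B7D
variable (B : B7D F L)

/-- the model of `g₀` -/
def G0 : Submodule F L := LinearMap.range B.psi1 ⊔ LinearMap.range B.psi

lemma psi_mem (X : M8 F) : B.psi X ∈ B.G0 := Submodule.mem_sup_right ⟨X, rfl⟩
lemma psi1_mem (X : M2 F) : B.psi1 X ∈ B.G0 := Submodule.mem_sup_left ⟨X, rfl⟩
lemma Y_mem (p q) : B.Y p q ∈ B.G0 := by rw [← B.psi_single]; exact B.psi_mem _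
lemma mem_G0 {x : L} : x ∈ B.G0 ↔ ∃ (X : M2 F) (Z : M8 F), x = B.psi1 X + B.psi Z := by
  rw [G0, Submodule.mem_sup]
  constructor
  · rintro ⟨_, ⟨X, rfl⟩, _, ⟨Z, rfl⟩, rfl⟩; exact ⟨X, Z, rfl⟩
  · rintro ⟨X, Z, rfl⟩; exact ⟨_, ⟨X, rfl⟩, _, ⟨Z, rfl⟩, rfl⟩

lemma e_mem : B.D.e 0 ∈ B.G0 := by
  have := B.psi1_mem (Matrix.single 0 1 1)
  simpa [psi1_def] using this
lemma f_mem : B.D.f 0 ∈ B.G0 := by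
  have := B.psi1_mem (Matrix.single 1 0 1)
  simpa [psi1_def] using this
lemma h_mem : B.D.h 0 ∈ B.G0 := by
  have := B.psi1_mem (Matrix.single 0 0 2)
  simpa [psi1_def] using this

lemma hG_mem (p) : B.D.hv (Gs p) ∈ B.G0 := by
  have h1 : B.D.hv (Gs p) = B.Y (some p) (some p) - B.Y none none := by
    simp [A7D.Y, B.hyx]
  rw [h1]; exact Submodule.sub_mem _ (B.Y_mem _ _) (B.Y_mem _ _)

lemma H_mem (i) : B.D.h i ∈ B.G0 := by
  obtain ⟨h7, h6, h5, h4, h3, h1, h2⟩ := Gs_chain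
  have s : ∀ {m} (p q), al m = Gs p - Gs q → B.D.hv (al m) ∈ B.G0 := by
    intro m p q h
    rw [h, hv_sub]; exact Submodule.sub_mem _ (B.hG_mem p) (B.hG_mem q)
  have t0 : B.D.hv (al 0) ∈ B.G0 := by rw [hv_al]; exact B.h_mem
  rw [← hv_al]
  have t2 : B.D.hv (al 2) ∈ B.G0 := by
    have h8 := congrArg B.D.hv h2
    simp only [hv_sub, hv_smul] at h8
    refine (Submodule.smul_mem_iff B.G0 (s := ((4 : ℤ) : F)) (by norm_num)).mp ?_
    rw [h8]
    refine Submodule.sub_mem _ (Submodule.sub_mem _ (Submodule.sub_mem _ (Submodule.sub_mem _ (Submodule.sub_mem _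
      (Submodule.sub_mem _ (Submodule.sub_mem _ (B.hG_mem 0) ?_) ?_) ?_) ?_) ?_) ?_) ?_ <;>
      apply Submodule.smul_mem
    exacts [t0, s _ _ h1, s _ _ h3, s _ _ h4, s _ _ h5, s _ _ h6, s _ _ h7]
  fin_cases i
  exacts [t0, s _ _ h1, t2, s _ _ h3, s _ _ h4, s _ _ h5, s _ _ h6, s _ _ h7]

lemma wsp_in {n} (S : Submodule F L) (hn : bf n n = 2) {x : L} (hx : x ∈ B.D.wsp n) (hx0 : x ≠ 0) (hS : x ∈ S) :
    B.D.wsp n ≤ S := by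
  intro y hy
  obtain ⟨c, rfl⟩ := wsp_one B.D hn hx hx0 hy
  exact S.smul_mem _ hS

lemma wsp_G0 (n) (h : n 2 % 4 = 0) : B.D.wsp n ≤ B.G0 := by
  by_cases hb : B.D.wsp n = ⊥
  · rw [hb]; exact bot_le
  by_cases h0 : n = 0
  · subst h0
    rw [wsp_zero, E8D.H, Submodule.span_le]
    rintro _ ⟨i, rfl⟩
    exact B.H_mem i
  have hn := root_of_wsp B.D hb h0
  rcases root_g0 n hn h with rfl | rfl | ⟨p, rfl | rfl⟩ | ⟨p, q, hpq, rfl⟩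
  · exact B.wsp_in _ hn (e_mem_wsp B.D 0) (e_ne B.D 0) B.e_mem
  · exact B.wsp_in _ hn (f_mem_wsp B.D 0) (f_ne B.D 0) B.f_mem
  · exact B.wsp_in _ hn (B.hy p) (B.y_ne p) (B.Y_mem (some p) none)
  · exact B.wsp_in _ hn (B.hx p) (B.x_ne p) (B.Y_mem none (some p))
  · rw [sub_eq_add_neg] at hn ⊢
    refine B.wsp_in _ hn (B.Y_wsp hpq) ?_ (B.Y_mem _ _)
    intro hz
    have h2 := B.Y_u_one hpq
    rw [hz, zero_lie] at h2
    exact B.u_ne p h2.symm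

lemma W_mem (p q) : B.W p q ∈ LinearMap.range B.Psi := by
  refine ⟨fun a => if a = 0 then Matrix.single p q 1 else 0, ?_⟩
  simp [Psi_def, Psi0_single]
lemma fW_mem (p q) : ⁅B.D.f 0, B.W p q⁆ ∈ LinearMap.range B.Psi := by
  refine ⟨fun a => if a = 0 then 0 else Matrix.single p q 1, ?_⟩
  simp [Psi_def, Psi0_single]
lemma fW_ne {p q} (h : p ≠ q) : ⁅B.D.f 0, B.W p q⁆ ≠ 0 := by
  intro h1
  have h2 := B.e_f_Psi0 (Matrix.single p q 1)
  rw [Psi0_single, h1, lie_zero] at h2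
  exact B.W_ne h h2.symm

lemma wsp_G1 (n) (h : n 2 % 4 = 1) : B.D.wsp n ≤ LinearMap.range B.Psi := by
  by_cases hb : B.D.wsp n = ⊥
  · rw [hb]; exact bot_le
  have h0 : n ≠ 0 := by rintro rfl; simp at h
  have hn := root_of_wsp B.D hb h0
  rcases root_g1 n hn h with ⟨p, rfl | rfl⟩ | ⟨p, q, hpq, rfl | rfl⟩
  · exact B.wsp_in _ hn (B.hu p) (B.u_ne p) (B.W_mem none (some p))
  · exact B.wsp_in _ hn (lie_wsp B.D (f_mem_wsp B.D 0) (B.hu p)) (B.fW_ne (p := none) (q := some p) (by simp))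
      (B.fW_mem none (some p))
  · exact B.wsp_in _ hn (lie_wsp B.D (B.hy p) (B.hu q)) (B.W_ne (p := some p) (q := some q) (by simpa using hpq))
      (B.W_mem (some p) (some q))
  · exact B.wsp_in _ hn (lie_wsp B.D (f_mem_wsp B.D 0) (lie_wsp B.D (B.hy p) (B.hu q)))
      (B.fW_ne (p := some p) (q := some q) (by simpa using hpq)) (B.fW_mem (some p) (some q))

end B7D
end
end E8P
namespace E8P
open LieAlgebra LieModule
set_option linter.unusedSectionVars false

section
variable {F : Type*} [Field F] [CharZero F] {ι : Type*} [Fintype ι] [DecidableEq ι] [Nonempty ι]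

lemma scalar_of_comm (Z : Matrix ι ι F) (h : ∀ X : Matrix ι ι F, X * Z = Z * X) : ∃ c : F, Z = c • 1 := by
  obtain ⟨c, hc⟩ := Matrix.mem_range_scalar_iff_commute_single'.mpr (fun i j => h (Matrix.single i j 1))
  exact ⟨c, by rw [← hc, Matrix.scalar_apply, Matrix.smul_one_eq_diagonal]⟩

lemma lie_scalar_zero (X Z : Matrix ι ι F) (c : F) (h : X * Z - Z * X = c • 1) : X * Z = Z * X := by
  have h1 := congrArg Matrix.trace h
  rw [Matrix.trace_sub, Matrix.trace_mul_comm, sub_self, Matrix.trace_smul, Matrix.trace_one, smul_eq_mul] at h1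
  have h2 : c = 0 := by
    rcases mul_eq_zero.mp h1.symm with h2 | h2
    · exact h2
    · exact absurd h2 (by simp)
  rw [h2, zero_smul] at h
  exact sub_eq_zero.mp h

lemma scalar_of_lie (Z : Matrix ι ι F) (h : ∀ X : Matrix ι ι F, ∃ c : F, X * Z - Z * X = c • 1) :
    ∃ c : F, Z = c • 1 :=
  scalar_of_comm Z fun X => lie_scalar_zero X Z _ (h X).choose_spec

lemma scalar_trace_zero (c : F) (h : (c • (1 : Matrix ι ι F)).trace = 0) : c = 0 := by
  rw [Matrix.trace_smul, Matrix.trace_one, smul_eq_mul] at h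
  rcases mul_eq_zero.mp h with h2 | h2
  · exact h2
  · exact absurd h2 (by simp)
end

lemma Gs_two : ∀ p, Gs p 2 = 4 := by decide +kernel
lemma Bw_two : ∀ p, (Bw + Gs p) 2 = -3 := by decide +kernel

section
variable {F L : Type*} [Field F] [CharZero F] [LieRing L] [LieAlgebra F L] [Nontrivial L]

/-- `g` acts as the diagonal order four automorphism -/
def IsTh (D : E8D F L) (g : L ≃ₗ⁅F⁆ L) (I : F) : Prop := ∀ n, ∀ x ∈ D.wsp n, g x = I ^ (n 2) • x

lemma I_ne {I : F} (hI : I * I = -1) : I ≠ 0 := by rintro rfl; simp at hI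
lemma I_four {I : F} (hI : I * I = -1) : I ^ 4 = 1 := by
  calc I ^ 4 = (I * I) * (I * I) := by ring
    _ = 1 := by rw [hI]; norm_num
lemma I_zpow {I : F} (hI : I * I = -1) (k : ℤ) : I ^ k = I ^ (k % 4) := by
  conv_lhs => rw [← Int.emod_add_mul_ediv k 4, zpow_add₀ (I_ne hI), zpow_mul]
  rw [show (4 : ℤ) = ((4 : ℕ) : ℤ) from rfl, zpow_natCast I 4, I_four hI, one_zpow, mul_one]
lemma I_cases {I : F} (hI : I * I = -1) (k : ℤ) : (k % 4 = 0 ∧ I ^ k = 1) ∨ (k % 4 = 1 ∧ I ^ k = I) ∨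
    (k % 4 = 2 ∧ I ^ k = -1) ∨ (k % 4 = 3 ∧ I ^ k = -I) := by
  have h1 := Int.emod_nonneg k (show (4 : ℤ) ≠ 0 by norm_num)
  have h2 := Int.emod_lt_of_pos k (show (0 : ℤ) < 4 by norm_num)
  have h2' : I ^ (2 : ℤ) = -1 := by rw [show (2 : ℤ) = ((2 : ℕ) : ℤ) from rfl, zpow_natCast, pow_two, hI]
  have h3' : I ^ (3 : ℤ) = -I := by
    rw [show (3 : ℤ) = ((3 : ℕ) : ℤ) from rfl, zpow_natCast, pow_succ, pow_two, hI]; ring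
  rw [I_zpow hI k]
  generalize k % 4 = r at *
  interval_cases r
  · left; simp
  · right; left; simp
  · right; right; left; simpa using h2'
  · right; right; right; simpa using h3'

namespace B7D
variable (B : B7D F L) {g : L ≃ₗ⁅F⁆ L} {I : F} (hI : I * I = -1) (hg : IsTh B.D g I)

lemma th_fix {n} (h : n 2 % 4 = 0) (hI : I * I = -1) (hg : IsTh B.D g I) {x : L} (hx : x ∈ B.D.wsp n) : g x = x := by
  rw [hg n x hx, I_zpow hI, h]; simp

lemma th_psi1 (X : M2 F) (hI : I * I = -1) (hg : IsTh B.D g I) : g (B.psi1 X) = B.psi1 X := by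
  simp only [psi1_def, map_add, map_smul]
  rw [B.th_fix (n := al 0) (by decide) hI hg (e_mem_wsp B.D 0), B.th_fix (n := -al 0) (by decide) hI hg (f_mem_wsp B.D 0),
    B.th_fix (n := 0) (by decide) hI hg (h_mem_wsp B.D 0)]

lemma th_x (q) (hI : I * I = -1) (hg : IsTh B.D g I) : g (B.x q) = B.x q :=
  B.th_fix (n := -Gs q) (by rw [Pi.neg_apply, Gs_two]; rfl) hI hg (B.hx q)
lemma th_y (q) (hI : I * I = -1) (hg : IsTh B.D g I) : g (B.y q) = B.y q :=
  B.th_fix (n := Gs q) (by rw [Gs_two]; rfl) hI hg (B.hy q)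
lemma th_hv (n) (hI : I * I = -1) (hg : IsTh B.D g I) : g (B.D.hv n) = B.D.hv n :=
  B.th_fix (n := 0) (by decide) hI hg (hv_mem B.D n)

lemma th_psi (X : M8 F) (hI : I * I = -1) (hg : IsTh B.D g I) : g (B.psi X) = B.psi X := by
  have hz : g B.z = B.z := by
    simp only [A7D.z, map_smul, map_sum, B.th_hv _ hI hg]
  have h := A7D.lin_eq_of_single ((g : L →ₗ[F] L) ∘ₗ B.psi) B.psi (by
    intro p q
    simp only [LinearMap.comp_apply, A7D.psi_single]
    change g (B.Y p q) = _
    rcases p with _ | p <;> rcases q with _ | q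
    · exact hz
    · exact B.th_x q hI hg
    · exact B.th_y p hI hg
    · simp only [A7D.Y, map_add, map_smul, LieEquiv.map_lie, B.th_x _ hI hg, B.th_y _ hI hg, hz])
  exact LinearMap.congr_fun h X

lemma th_Psi (Z : MV F) (hI : I * I = -1) (hg : IsTh B.D g I) : g (B.Psi Z) = I • B.Psi Z := by
  have hu : ∀ r, g (B.u r) = I • B.u r := fun r => by
    rw [hg _ _ (B.hu r), Bw_two, I_zpow hI, show (-3 : ℤ) % 4 = 1 from rfl, zpow_one]
  have h0 : ∀ Z, g (B.Psi0 Z) = I • B.Psi0 Z := by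
    intro Z
    refine B.ext_Psi0 (g : L →ₗ[F] L) (I • LinearMap.id) (fun r => by simpa using hu r) (fun p r => ?_) Z
    change g ⁅B.y p, B.u r⁆ = I • ⁅B.y p, B.u r⁆
    rw [LieEquiv.map_lie, hu, B.th_y _ hI hg, lie_smul]
  rw [Psi_def, map_add, LieEquiv.map_lie, h0, h0, B.th_fix (n := -al 0) (by decide) hI hg (f_mem_wsp B.D 0), lie_smul, smul_add]

lemma fix_G0 (hI : I * I = -1) (hg : IsTh B.D g I) {x : L} (hx : g x = x) : x ∈ B.G0 := by
  obtain ⟨s, y, hy, rfl⟩ := exists_decomp B.D x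
  have h1 : (4 : F) • ∑ n ∈ s, y n = ∑ n ∈ s, (y n + g (y n) + g (g (y n)) + g (g (g (y n)))) := by
    simp only [Finset.sum_add_distrib, ← map_sum, hx]; module
  refine (Submodule.smul_mem_iff B.G0 (s := (4 : F)) (by norm_num)).mp ?_
  rw [h1]
  refine Submodule.sum_mem _ fun n _ => ?_
  simp only [hg n _ (hy n), map_smul]
  rcases I_cases hI (n 2) with ⟨h, h'⟩ | ⟨h, h'⟩ | ⟨h, h'⟩ | ⟨h, h'⟩ <;> rw [h']
  · have := B.wsp_G0 n h (hy n)
    simpa using Submodule.add_mem _ (Submodule.add_mem _ (Submodule.add_mem _ this this) this) this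
  · convert Submodule.zero_mem _
    simp only [smul_smul, hI]; module
  · convert Submodule.zero_mem _
    module
  · convert Submodule.zero_mem _
    simp only [smul_smul, neg_mul_neg, hI]; module

lemma fix_G1 (hI : I * I = -1) (hg : IsTh B.D g I) {x : L} (hx : g x = I • x) : x ∈ LinearMap.range B.Psi := by
  obtain ⟨s, y, hy, rfl⟩ := exists_decomp B.D x
  have h1 : (4 : F) • ∑ n ∈ s, y n = ∑ n ∈ s, (y n - I • g (y n) - g (g (y n)) + I • g (g (g (y n)))) := by
    simp only [Finset.sum_add_distrib, Finset.sum_sub_distrib, ← Finset.smul_sum, ← map_sum, hx, map_smul, smul_smul]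
    simp only [hI]
    rw [show I * (-1 * I) = 1 by linear_combination -hI]
    module
  refine (Submodule.smul_mem_iff _ (s := (4 : F)) (by norm_num)).mp ?_
  rw [h1]
  refine Submodule.sum_mem _ fun n _ => ?_
  simp only [hg n _ (hy n), map_smul]
  rcases I_cases hI (n 2) with ⟨h, h'⟩ | ⟨h, h'⟩ | ⟨h, h'⟩ | ⟨h, h'⟩ <;> rw [h']
  · convert Submodule.zero_mem _
    module
  · have := B.wsp_G1 n h (hy n)
    have e : y n - I • I • y n - I • I • y n + I • I • I • I • y n = (4 : F) • y n := by
      simp only [smul_smul]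
      simp only [hI]
      rw [show I * (I * -1) = 1 by linear_combination -hI]; module
    rw [e]; exact Submodule.smul_mem _ _ this
  · convert Submodule.zero_mem _
    module
  · convert Submodule.zero_mem _
    simp only [smul_smul, hI]
    rw [show I * -I = 1 by linear_combination -hI, show -I * -I = -1 by linear_combination hI,
      show I * (-I * -1) = -1 by linear_combination hI]
    module

variable {q : L ≃ₗ⁅F⁆ L}

lemma q_G0 (hI : I * I = -1) (hg : IsTh B.D g I) (hq : ∀ x, q (g x) = g (q x)) {x : L} (hx : x ∈ B.G0) : q x ∈ B.G0 := by
  apply B.fix_G0 hI hg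
  rw [← hq]
  obtain ⟨X, Z, rfl⟩ := B.mem_G0.mp hx
  rw [map_add, B.th_psi1 _ hI hg, B.th_psi _ hI hg]

lemma q_G1 (hI : I * I = -1) (hg : IsTh B.D g I) (hq : ∀ x, q (g x) = g (q x)) (Z : MV F) : ∃ Z', q (B.Psi Z) = B.Psi Z' := by
  obtain ⟨Z', h⟩ := B.fix_G1 hI hg (x := q (B.Psi Z)) (by rw [← hq, B.th_Psi _ hI hg, map_smul])
  exact ⟨Z', h.symm⟩

lemma symm_comm (hq : ∀ x, q (g x) = g (q x)) (x : L) : q.symm (g x) = g (q.symm x) := by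
  apply q.injective
  change q (q.symm (g x)) = q (g (q.symm x))
  rw [hq, LieEquiv.apply_symm_apply, LieEquiv.apply_symm_apply]

/-- ideals -/
def Jq (q : L ≃ₗ⁅F⁆ L) : Submodule F (M8 F) := ((LinearMap.range B.psi1).map (q : L →ₗ[F] L)).comap B.psi
lemma mem_Jq {Z : M8 F} : Z ∈ B.Jq q ↔ ∃ A, q (B.psi1 A) = B.psi Z := by
  simp only [Jq, Submodule.mem_comap, Submodule.mem_map, LinearMap.mem_range, exists_exists_eq_and]
  rfl

lemma Jq_lie (hI : I * I = -1) (hg : IsTh B.D g I) (hq : ∀ x, q (g x) = g (q x)) (X : M8 F) (A : M2 F) :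
    ∃ A', ⁅B.psi X, q (B.psi1 A)⁆ = q (B.psi1 A') := by
  have h := B.q_G0 hI hg (symm_comm hq) (B.psi_mem X)
  obtain ⟨A', Z', h⟩ := B.mem_G0.mp h
  have h2 : B.psi X = q (B.psi1 A' + B.psi Z') := by rw [← h, LieEquiv.apply_symm_apply]
  refine ⟨A' * A - A * A', ?_⟩
  rw [h2, ← LieEquiv.map_lie, add_lie, psi1_lie, ← lie_skew (B.psi Z'), psi1_psi, neg_zero, add_zero]

lemma Jq_scalar (hI : I * I = -1) (hg : IsTh B.D g I) (hq : ∀ x, q (g x) = g (q x)) {Z : M8 F} (hZ : Z ∈ B.Jq q) :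
    ∃ c : F, Z = c • 1 := by
  by_contra hc
  push Not at hc
  have h1 := gl_ideal (B.Jq q) (by
    intro X Y hY
    obtain ⟨A, hA⟩ := B.mem_Jq.mp hY
    obtain ⟨A', hA'⟩ := B.Jq_lie hI hg hq X A
    exact B.mem_Jq.mpr ⟨A', by rw [← hA', hA, A7D.psi_lie]⟩) Z hZ hc
  have h2 : ∀ i : Fin 7, ∃ A, q (B.psi1 A) = B.psi (Matrix.single none (some i) 1) := fun i =>
    B.mem_Jq.mp (h1 none (some i) (by simp))
  choose A hA using h2
  let T : (Fin 7 → F) →ₗ[F] M2 F := Fintype.linearCombination F A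
  have hT : Function.Injective T := by
    rw [injective_iff_map_eq_zero]
    intro c hc
    have h3 : ∑ i, c i • A i = 0 := by simpa [T, Fintype.linearCombination_apply] using hc
    have h4 : B.psi (∑ i, c i • Matrix.single none (some i) (1 : F)) = 0 := by
      rw [map_sum]
      simp only [map_smul, ← hA]
      simp only [← map_smul, ← map_sum]
      rw [h3, map_zero, map_zero]
    obtain ⟨d, hd⟩ := B.psi_ker _ h4
    ext j
    have h5 := congrFun (congrFun hd none) (some j)
    simpa [Matrix.sum_apply, Matrix.single_apply] using h5
  have h6 := LinearMap.finrank_le_finrank_of_injective hT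
  rw [Module.finrank_fin_fun, show Module.finrank F (M2 F) = 4 from by
    change Module.finrank F (Matrix (Fin 2) (Fin 2) F) = 4
    simp [Module.finrank_matrix]] at h6
  simp at h6

lemma q_psi1 (hI : I * I = -1) (hg : IsTh B.D g I) (hq : ∀ x, q (g x) = g (q x)) (A : M2 F) :
    ∃ A', q (B.psi1 A) = B.psi1 A' := by
  obtain ⟨A', Z', h⟩ := B.mem_G0.mp (B.q_G0 hI hg hq (B.psi1_mem A))
  obtain ⟨c, rfl⟩ := scalar_of_lie Z' (by
    intro X
    apply B.Jq_scalar hI hg hq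
    rw [mem_Jq, A7D.psi_lie]
    obtain ⟨A'', h2⟩ := B.Jq_lie hI hg hq X A
    refine ⟨A'', ?_⟩
    rw [← h2, h, lie_add, ← lie_skew (B.psi X), psi1_psi, neg_zero, zero_add])
  exact ⟨A', by rw [h, map_smul, A7D.psi_one, smul_zero, add_zero]⟩

lemma q_psi (hI : I * I = -1) (hg : IsTh B.D g I) (hq : ∀ x, q (g x) = g (q x)) (Z : M8 F) :
    ∃ Z', q (B.psi Z) = B.psi Z' := by
  obtain ⟨A', Z', h⟩ := B.mem_G0.mp (B.q_G0 hI hg hq (B.psi_mem Z))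
  obtain ⟨c, rfl⟩ := scalar_of_lie A' (by
    intro X
    apply B.psi1_ker
    obtain ⟨A'', h2⟩ := B.q_psi1 hI hg (symm_comm hq) X
    have h3 : B.psi1 X = q (B.psi1 A'') := by rw [← h2, LieEquiv.apply_symm_apply]
    have h4 : ⁅B.psi1 X, q (B.psi Z)⁆ = 0 := by
      rw [h3, ← LieEquiv.map_lie, psi1_psi, map_zero]
    rw [h, lie_add, psi1_psi, add_zero] at h4
    rw [psi1_lie, h4])
  exact ⟨Z', by rw [h, map_smul, psi1_one, smul_zero, zero_add]⟩

lemma psi1_diff (X : M2 F) (h : B.psi1 X = 0) (htr : X.trace = 0) : X = 0 := by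
  obtain ⟨c, rfl⟩ := B.psi1_ker X h
  rw [scalar_trace_zero c htr, zero_smul]

/-- normalised lift -/
lemma exists_phi (hI : I * I = -1) (hg : IsTh B.D g I) (hq : ∀ x, q (g x) = g (q x)) :
    ∃ φ : M8 F →ₗ[F] M8 F, ∀ Z, q (B.psi Z) = B.psi (φ Z) ∧ (φ Z).trace = Z.trace := by
  have h : ∀ Z : M8 F, ∃ Z', q (B.psi Z) = B.psi Z' ∧ Z'.trace = Z.trace := by
    intro Z
    obtain ⟨Z', h⟩ := B.q_psi hI hg hq Z
    refine ⟨Z' + ((Z.trace - Z'.trace) / 8) • 1, by rw [map_add, map_smul, A7D.psi_one, smul_zero, add_zero, h], ?_⟩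
    rw [Matrix.trace_add, Matrix.trace_smul, Matrix.trace_one]
    simp [Ix]
  choose φ h1 h2 using h
  refine ⟨⟨⟨φ, ?_⟩, ?_⟩, fun Z => ⟨h1 Z, h2 Z⟩⟩
  · intro X Y
    rw [← sub_eq_zero]
    apply B.psi_diff
    · rw [map_sub, map_add, ← h1, ← h1, ← h1, map_add, map_add, sub_self]
    · rw [Matrix.trace_sub, Matrix.trace_add, h2, h2, h2, Matrix.trace_add, sub_self]
  · intro c X
    rw [← sub_eq_zero]
    apply B.psi_diff
    · simp only [map_sub, map_smul, ← h1, RingHom.id_apply, sub_self]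
    · simp only [Matrix.trace_sub, Matrix.trace_smul, h2, RingHom.id_apply, sub_self]

lemma exists_phi1 (hI : I * I = -1) (hg : IsTh B.D g I) (hq : ∀ x, q (g x) = g (q x)) :
    ∃ φ : M2 F →ₗ[F] M2 F, ∀ Z, q (B.psi1 Z) = B.psi1 (φ Z) ∧ (φ Z).trace = Z.trace := by
  have h : ∀ Z : M2 F, ∃ Z', q (B.psi1 Z) = B.psi1 Z' ∧ Z'.trace = Z.trace := by
    intro Z
    obtain ⟨Z', h⟩ := B.q_psi1 hI hg hq Z
    refine ⟨Z' + ((Z.trace - Z'.trace) / 2) • 1, by rw [map_add, map_smul, psi1_one, smul_zero, add_zero, h], ?_⟩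
    rw [Matrix.trace_add, Matrix.trace_smul, Matrix.trace_one]
    simp
  choose φ h1 h2 using h
  refine ⟨⟨⟨φ, ?_⟩, ?_⟩, fun Z => ⟨h1 Z, h2 Z⟩⟩
  · intro X Y
    rw [← sub_eq_zero]
    apply B.psi1_diff
    · rw [map_sub, map_add, ← h1, ← h1, ← h1, map_add, map_add, sub_self]
    · rw [Matrix.trace_sub, Matrix.trace_add, h2, h2, h2, Matrix.trace_add, sub_self]
  · intro c X
    rw [← sub_eq_zero]
    apply B.psi1_diff
    · simp only [map_sub, map_smul, ← h1, RingHom.id_apply, sub_self]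
    · simp only [Matrix.trace_sub, Matrix.trace_smul, h2, RingHom.id_apply, sub_self]

end B7D
end
end E8P
namespace E8P
open LieAlgebra LieModule
set_option linter.unusedSectionVars false

section
variable {F : Type*} [Field F] [CharZero F] {ι : Type*} [Fintype ι] [DecidableEq ι] [Nonempty ι]

/-- two sided multiplication -/
def lr (A B : Matrix ι ι F) : Module.End F (Matrix ι ι F) where
  toFun W := A * W * B.transpose
  map_add' := by intros; simp [mul_add, add_mul]
  map_smul' := by intros; simp

/-- transposition -/
def tp : Module.End F (Matrix ι ι F) where
  toFun W := W.transpose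
  map_add' := by intros; simp
  map_smul' := by intros; simp

lemma lr_apply (A B W : Matrix ι ι F) : lr A B W = A * W * B.transpose := rfl
lemma tp_apply (W : Matrix ι ι F) : tp W = W.transpose := rfl

lemma lr_mul (A B C D : Matrix ι ι F) : lr A B * lr C D = lr (A * C) (B * D) := by
  ext1 W
  simp only [Module.End.mul_apply, lr_apply, Matrix.transpose_mul, Matrix.mul_assoc]

lemma trace_mat (f : Module.End F (Matrix ι ι F)) : LinearMap.trace F _ f =
    ∑ i, ∑ j, f (Matrix.single i j 1) i j := by
  rw [LinearMap.trace_eq_matrix_trace F (Matrix.stdBasis F ι ι), Matrix.trace, Fintype.sum_prod_type]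
  refine Finset.sum_congr rfl fun i _ => Finset.sum_congr rfl fun j _ => ?_
  rw [Matrix.diag_apply, LinearMap.toMatrix_apply, Matrix.stdBasis_eq_single]
  rfl

lemma trace_lr (A B : Matrix ι ι F) : LinearMap.trace F _ (lr A B) = A.trace * B.trace := by
  rw [trace_mat, Matrix.trace, Matrix.trace, Finset.sum_mul_sum]
  refine Finset.sum_congr rfl fun i _ => Finset.sum_congr rfl fun j _ => ?_
  simp [lr_apply, Matrix.mul_apply, Matrix.single_apply, Finset.sum_ite_eq, ite_and]

lemma trace_lr_tp (A B : Matrix ι ι F) : LinearMap.trace F _ (lr A B * tp) = (A * B).trace := by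
  rw [trace_mat, Matrix.trace]
  simp only [Matrix.diag_apply, Matrix.mul_apply (M := A) (N := B)]
  refine Finset.sum_congr rfl fun i _ => Finset.sum_congr rfl fun j _ => ?_
  simp [Module.End.mul_apply, lr_apply, tp_apply, Matrix.mul_apply, Matrix.single_apply, Finset.sum_ite_eq, ite_and]

/-- the adjoint map -/
def adm (X : Matrix ι ι F) : Module.End F (Matrix ι ι F) := lr X 1 - lr 1 X.transpose

lemma adm_apply (X W : Matrix ι ι F) : adm X W = X * W - W * X := by
  simp [adm, lr_apply]

lemma trace_adm (X Y : Matrix ι ι F) (hX : X.trace = 0) :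
    LinearMap.trace F _ (adm X * adm Y) = 2 * Fintype.card ι * (X * Y).trace := by
  simp only [adm, mul_sub, sub_mul, lr_mul, map_sub, trace_lr, mul_one, one_mul, hX, Matrix.trace_transpose,
    Matrix.trace_one]
  rw [← Matrix.transpose_mul, Matrix.trace_transpose, Matrix.trace_mul_comm Y X]
  ring

lemma form_inv (φ : Matrix ι ι F ≃ₗ[F] Matrix ι ι F) (htr : ∀ X, (φ X).trace = X.trace)
    (hc : ∀ X Y, φ (X * Y - Y * X) = φ X * φ Y - φ Y * φ X) (X Y : Matrix ι ι F) (hX : X.trace = 0) :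
    (φ X * φ Y).trace = (X * Y).trace := by
  have h1 : ∀ X, adm (φ X) = φ.conj (adm X) := by
    intro X
    ext1 W
    rw [LinearEquiv.conj_apply_apply, adm_apply, adm_apply, hc, LinearEquiv.apply_symm_apply]
  have h2 := trace_adm (φ X) (φ Y) (by rw [htr, hX])
  have h0 : φ.conj (adm X) * φ.conj (adm Y) = φ.conj (adm X * adm Y) := by
    ext1 W; simp [LinearEquiv.conj_apply_apply]
  rw [h1, h1, h0, LinearMap.trace_conj', trace_adm X Y hX] at h2
  have h3 : (2 * Fintype.card ι : F) ≠ 0 := by simp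
  exact (mul_left_cancel₀ h3 h2).symm

lemma trace_nondeg (D : Matrix ι ι F) (h : ∀ W : Matrix ι ι F, (D * W).trace = 0) : D = 0 := by
  ext i j
  have := h (Matrix.single j i 1)
  rw [Matrix.trace_mul_comm] at this
  simpa [Matrix.trace, Matrix.mul_apply, Matrix.single_apply, ite_and] using this

lemma split_trace (X : Matrix ι ι F) : ∃ (c : F) (X0 : Matrix ι ι F), X0.trace = 0 ∧ X = X0 + c • 1 := by
  refine ⟨X.trace / Fintype.card ι, X - (X.trace / Fintype.card ι) • 1, ?_, by simp⟩
  rw [Matrix.trace_sub, Matrix.trace_smul, Matrix.trace_one, smul_eq_mul, div_mul_cancel₀, sub_self]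
  simp

lemma mult_of (φ : Matrix ι ι F ≃ₗ[F] Matrix ι ι F) (htr : ∀ X, (φ X).trace = X.trace) (h1 : φ 1 = 1)
    (hc : ∀ X Y, φ (X * Y - Y * X) = φ X * φ Y - φ Y * φ X)
    (h3 : ∀ X Y Z : Matrix ι ι F, X.trace = 0 → Y.trace = 0 → Z.trace = 0 →
      (φ X * φ Y * φ Z).trace = (X * Y * Z).trace) (X Y : Matrix ι ι F) : φ (X * Y) = φ X * φ Y := by
  have key : ∀ X Y : Matrix ι ι F, X.trace = 0 → Y.trace = 0 → φ (X * Y) = φ X * φ Y := by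
    intro X Y hX hY
    rw [← sub_eq_zero]
    apply trace_nondeg
    intro W
    obtain ⟨Z, rfl⟩ := φ.surjective W
    obtain ⟨c, Z0, hZ0, rfl⟩ := split_trace Z
    obtain ⟨d, P, hP, hd⟩ := split_trace (X * Y)
    have e1 := h3 X Y Z0 hX hY hZ0
    have e2 := form_inv φ htr hc P Z0 hP
    have e3 : (φ (X * Y)).trace = (φ X * φ Y).trace := by rw [htr, form_inv φ htr hc X Y hX]
    have e4 : (φ (X * Y) * φ Z0).trace = (X * Y * Z0).trace := by
      rw [hd, map_add, map_smul, h1, add_mul, add_mul, Matrix.trace_add, e2, Matrix.trace_add]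
      simp [htr, hZ0]
    rw [map_add, map_smul, h1, mul_add, sub_mul, Matrix.trace_add, Matrix.trace_sub, e4, e1]
    simp [e3]
  obtain ⟨c, X0, hX0, rfl⟩ := split_trace X
  obtain ⟨d, Y0, hY0, rfl⟩ := split_trace Y
  simp only [add_mul, mul_add, map_add, map_smul, h1, smul_mul_assoc, mul_smul_comm, one_mul, mul_one, key X0 Y0 hX0 hY0]

lemma skolem (φ : Matrix ι ι F ≃ₗ[F] Matrix ι ι F) (h1 : φ 1 = 1) (hm : ∀ X Y, φ (X * Y) = φ X * φ Y) :
    ∃ y y' : Matrix ι ι F, y * y' = 1 ∧ y' * y = 1 ∧ ∀ X, φ X = y * X * y' := by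
  let f : Matrix ι ι F ≃ₐ[F] Matrix ι ι F := AlgEquiv.ofLinearEquiv φ h1 hm
  let t : Matrix ι ι F ≃ₐ[F] Module.End F (ι → F) := Matrix.toLinAlgEquiv'
  obtain ⟨T, hT⟩ := ((t.symm.trans f).trans t).eq_linearEquivConjAlgEquiv
  have hT' : ∀ X, t (φ X) = (T : (ι → F) →ₗ[F] (ι → F)) * t X * (T.symm : (ι → F) →ₗ[F] (ι → F)) := by
    intro X
    have := DFunLike.congr_fun hT (t X)
    simpa [f, LinearEquiv.conjAlgEquiv_apply, Module.End.mul_eq_comp, LinearMap.comp_assoc] using this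
  refine ⟨t.symm (T : (ι → F) →ₗ[F] (ι → F)), t.symm (T.symm : (ι → F) →ₗ[F] (ι → F)), ?_, ?_, ?_⟩
  · rw [← map_mul]
    convert map_one t.symm
    refine LinearMap.ext fun v => ?_
    simp
  · rw [← map_mul]
    convert map_one t.symm
    refine LinearMap.ext fun v => ?_
    simp
  · intro X
    apply t.injective
    rw [hT', map_mul, map_mul, AlgEquiv.apply_symm_apply, AlgEquiv.apply_symm_apply]
end

section
variable {F : Type*} [Field F] [CharZero F]

lemma trace3_two (A B C : M2 F) (hA : A.trace = 0) (hB : B.trace = 0) (hC : C.trace = 0) :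
    (A * B * C).trace = (1 / 2 : F) * ((A * B - B * A) * C).trace := by
  simp only [Matrix.trace_fin_two] at hA hB hC
  have a : A 1 1 = - A 0 0 := by linear_combination hA
  have b : B 1 1 = - B 0 0 := by linear_combination hB
  have c : C 1 1 = - C 0 0 := by linear_combination hC
  simp only [Matrix.trace_fin_two, Matrix.mul_apply, Matrix.sub_apply, Fin.sum_univ_two, a, b, c]
  ring

lemma skolem_two (φ : M2 F ≃ₗ[F] M2 F) (htr : ∀ X, (φ X).trace = X.trace) (h1 : φ 1 = 1)
    (hc : ∀ X Y, φ (X * Y - Y * X) = φ X * φ Y - φ Y * φ X) :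
    ∃ y y' : M2 F, y * y' = 1 ∧ y' * y = 1 ∧ ∀ X, φ X = y * X * y' := by
  refine skolem φ h1 (mult_of φ htr h1 hc fun X Y Z hX hY hZ => ?_)
  rw [trace3_two _ _ _ hX hY hZ, trace3_two _ _ _ (by rw [htr, hX]) (by rw [htr, hY]) (by rw [htr, hZ]), ← hc,
    form_inv φ htr hc _ _ (by rw [Matrix.trace_sub, Matrix.trace_mul_comm, sub_self])]

/-- componentwise map -/
def cw (f : Module.End F (M8 F)) : Module.End F (MV F) := LinearMap.pi fun a => f ∘ₗ LinearMap.proj a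

lemma cw_apply (f : Module.End F (M8 F)) (Z : MV F) (a) : cw f Z a = f (Z a) := rfl
lemma cw_mul (f g : Module.End F (M8 F)) : cw f * cw g = cw (f * g) := rfl

lemma trace_cw (f : Module.End F (M8 F)) : LinearMap.trace F _ (cw f) = 2 * LinearMap.trace F _ f := by
  rw [LinearMap.trace_eq_matrix_trace F (Pi.basis fun _ : Fin 2 => Matrix.stdBasis F Ix Ix),
    LinearMap.trace_eq_matrix_trace F (Matrix.stdBasis F Ix Ix), Matrix.trace, Matrix.trace,
    Fintype.sum_sigma, Fin.sum_univ_two, two_mul]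
  congr 1 <;>
  · refine Finset.sum_congr rfl fun i _ => ?_
    rw [Matrix.diag_apply, Matrix.diag_apply, LinearMap.toMatrix_apply, LinearMap.toMatrix_apply, Pi.basis_apply,
      Pi.basis_repr]
    rw [cw_apply, Pi.single_eq_same]

/-- the action as a linear map -/
def actL (X : M8 F) : Module.End F (M8 F) := lr X 1 + lr 1 X - (X.trace / 4) • 1
lemma actL_apply (X Z : M8 F) : actL X Z = B7D.act X Z := by
  simp [actL, B7D.act, lr_apply]

/-- skew projection -/
def skp : Module.End F (M8 F) := (1 / 2 : F) • (1 - tp)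

lemma trace_act3 (X Y Z : M8 F) (hX : X.trace = 0) (hY : Y.trace = 0) (hZ : Z.trace = 0) :
    LinearMap.trace F _ (actL X * actL Y * actL Z * skp) =
      5 * (X * Y * Z).trace - (X * Z * Y).trace := by
  have e : actL X * actL Y * actL Z = lr (X * Y * Z) 1 + lr (X * Y) Z + lr (X * Z) Y + lr (Y * Z) X + lr X (Y * Z) +
      lr Y (X * Z) + lr Z (X * Y) + lr 1 (X * Y * Z) := by
    simp only [actL, hX, hY, hZ, zero_div, zero_smul, sub_zero, mul_add, add_mul, lr_mul, mul_one, one_mul]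
    abel
  rw [e, skp, mul_smul_comm, mul_sub, mul_one]
  simp only [map_smul, map_sub, map_add, add_mul, trace_lr, trace_lr_tp, hX, hY, hZ, Matrix.trace_one, mul_one, one_mul]
  have r1 : (Y * Z * X).trace = (X * Y * Z).trace := by rw [Matrix.mul_assoc X, Matrix.trace_mul_comm X]
  have r2 : (Y * (X * Z)).trace = (X * Z * Y).trace := by rw [Matrix.trace_mul_comm]
  have r3 : (Z * (X * Y)).trace = (X * Y * Z).trace := by rw [Matrix.trace_mul_comm]
  have r4 : (X * (Y * Z)).trace = (X * Y * Z).trace := by rw [Matrix.mul_assoc]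
  rw [r1, r2, r3, r4]
  simp only [Ix, Fintype.card_option, Fintype.card_fin, smul_eq_mul]
  push_cast
  ring
end

section
variable {F L : Type*} [Field F] [CharZero F] [LieRing L] [LieAlgebra F L] [Nontrivial L]

namespace B7D
variable (B : B7D F L) {g q : L ≃ₗ⁅F⁆ L} {I : F}

lemma Psi_inj {Z Z' : MV F} (h : B.Psi Z = B.Psi Z') (hZ : ∀ a, (Z a).transpose = - Z a)
    (hZ' : ∀ a, (Z' a).transpose = - Z' a) : Z = Z' := by
  have h1 := B.Psi_ker (Z - Z') (by rw [map_sub, h, sub_self])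
  ext1 a
  have h2 := h1 a
  rw [Pi.sub_apply, Matrix.transpose_sub, hZ, hZ'] at h2
  have h3 : (2 : F) • (Z a - Z' a) = 0 := by
    have : (2 : F) • (Z a - Z' a) = (Z a - Z' a) - (- Z a - - Z' a) := by module
    rw [this, h2, sub_self]
  have h4 := (smul_eq_zero.mp h3).resolve_left (by norm_num)
  exact sub_eq_zero.mp h4

lemma skp_skew (Z : M8 F) : (skp Z).transpose = - skp Z := by
  simp only [skp, LinearMap.smul_apply, LinearMap.sub_apply, Module.End.one_apply, tp_apply, Matrix.transpose_smul,
    Matrix.transpose_sub, Matrix.transpose_transpose]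
  module

lemma Psi_skp (Z : MV F) : B.Psi (cw skp Z) = B.Psi Z := by
  have h : cw skp Z = (1 / 2 : F) • (Z - fun a => (Z a).transpose) := by
    ext1 a; rfl
  rw [h, map_smul, map_sub, Psi_transpose]; module

lemma exists_lift (f : L →ₗ[F] L) (h : ∀ Z, ∃ Z', f (B.Psi Z) = B.Psi Z') :
    ∃ S : Module.End F (MV F), ∀ Z, f (B.Psi Z) = B.Psi (S Z) ∧ ∀ a, (S Z a).transpose = - S Z a := by
  have h : ∀ Z, ∃ Z', f (B.Psi Z) = B.Psi Z' ∧ ∀ a, (Z' a).transpose = - Z' a := by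
    intro Z
    obtain ⟨Z', h'⟩ := h Z
    exact ⟨cw skp Z', by rw [h', Psi_skp], fun a => skp_skew _⟩
  choose S h1 h2 using h
  refine ⟨⟨⟨S, ?_⟩, ?_⟩, fun Z => ⟨h1 Z, h2 Z⟩⟩
  · intro X Y
    refine B.Psi_inj ?_ (h2 _) ?_
    · rw [map_add, ← h1, ← h1, ← h1, map_add, map_add]
    · intro a; rw [Pi.add_apply, Matrix.transpose_add, h2, h2]; abel
  · intro c X
    refine B.Psi_inj ?_ (h2 _) ?_
    · simp only [map_smul, ← h1, RingHom.id_apply]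
    · intro a; simp only [RingHom.id_apply, Pi.smul_apply, Matrix.transpose_smul, h2]; module

lemma act_skew (X Z : M8 F) (h : Z.transpose = -Z) : (actL X Z).transpose = - actL X Z := by
  simp only [actL_apply, act, Matrix.transpose_sub, Matrix.transpose_add, Matrix.transpose_mul, Matrix.transpose_smul, h,
    Matrix.transpose_transpose, neg_mul, mul_neg, smul_neg]
  abel

lemma psi_Psi' (X : M8 F) (Z : MV F) : ⁅B.psi X, B.Psi Z⁆ = B.Psi (cw (actL X) Z) := by
  rw [psi_Psi]; congr 1; ext1 a; rw [cw_apply, actL_apply]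

lemma trace_inv (hI : I * I = -1) (hg : IsTh B.D g I) (hq : ∀ x, q (g x) = g (q x))
    (φ : M8 F →ₗ[F] M8 F) (hφ : ∀ Z, q (B.psi Z) = B.psi (φ Z)) (X Y Z : M8 F) :
    LinearMap.trace F _ (actL (φ X) * actL (φ Y) * actL (φ Z) * skp) =
      LinearMap.trace F _ (actL X * actL Y * actL Z * skp) := by
  obtain ⟨S, hS⟩ := B.exists_lift (q : L →ₗ[F] L) (fun Z => B.q_G1 hI hg hq Z)
  obtain ⟨S', hS'⟩ := B.exists_lift (q.symm : L →ₗ[F] L) (fun Z => B.q_G1 hI hg (symm_comm hq) Z)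
  have s1 : ∀ Z, q (B.Psi Z) = B.Psi (S Z) := fun Z => (hS Z).1
  have s1' : ∀ Z, q.symm (B.Psi Z) = B.Psi (S' Z) := fun Z => (hS' Z).1
  have e1 : S * S' = cw skp := by
    refine LinearMap.ext fun Z => ?_
    refine B.Psi_inj ?_ (hS _).2 (fun a => skp_skew _)
    rw [Module.End.mul_apply, ← s1, ← s1', LieEquiv.apply_symm_apply, Psi_skp]
  have e2 : S' * S = cw skp := by
    refine LinearMap.ext fun Z => ?_
    refine B.Psi_inj ?_ (hS' _).2 (fun a => skp_skew _)
    rw [Module.End.mul_apply, ← s1', ← s1, LieEquiv.symm_apply_apply, Psi_skp]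
  have e3 : ∀ X, cw (actL (φ X)) * S = S * cw (actL X) := by
    intro X
    refine LinearMap.ext fun Z => ?_
    refine B.Psi_inj ?_ (fun a => act_skew _ _ ((hS _).2 a)) (hS _).2
    rw [Module.End.mul_apply, Module.End.mul_apply, ← psi_Psi', ← s1, ← s1, ← hφ, ← LieEquiv.map_lie, psi_Psi']
  have h2 : (2 : F) ≠ 0 := by norm_num
  apply mul_left_cancel₀ h2
  rw [← trace_cw, ← trace_cw, ← cw_mul, ← cw_mul, ← cw_mul, ← cw_mul, ← cw_mul, ← cw_mul]
  have e4 : cw (actL (φ X)) * cw (actL (φ Y)) * cw (actL (φ Z)) * (S * S') =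
      S * (cw (actL X) * cw (actL Y) * cw (actL Z) * S') := by
    calc _ = cw (actL (φ X)) * (cw (actL (φ Y)) * (cw (actL (φ Z)) * S)) * S' := by simp only [mul_assoc]
      _ = cw (actL (φ X)) * (cw (actL (φ Y)) * S) * cw (actL Z) * S' := by rw [e3]; simp only [mul_assoc]
      _ = (cw (actL (φ X)) * S) * cw (actL Y) * cw (actL Z) * S' := by rw [e3]; simp only [mul_assoc]
      _ = _ := by rw [e3]; simp only [mul_assoc]
  rw [← e1, e4, LinearMap.trace_mul_comm, mul_assoc _ S' S, e2, e1]

theorem exists_y (hI : I * I = -1) (hg : IsTh B.D g I) (hq : ∀ x, q (g x) = g (q x)) :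
    ∃ y y' : M8 F, y * y' = 1 ∧ y' * y = 1 ∧ ∀ X, q (B.psi X) = B.psi (y * X * y') := by
  obtain ⟨φ0, hφ0⟩ := B.exists_phi hI hg hq
  have hinj : Function.Injective φ0 := by
    rw [injective_iff_map_eq_zero]
    intro Z hZ
    refine B.psi_diff Z ?_ ?_
    · apply q.injective
      change q _ = q 0
      rw [(hφ0 Z).1, hZ, map_zero, map_zero]
    · rw [← (hφ0 Z).2, hZ, Matrix.trace_zero]
  let φ : M8 F ≃ₗ[F] M8 F := LinearEquiv.ofInjectiveEndo φ0 hinj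
  have hφ : ∀ Z, q (B.psi Z) = B.psi (φ Z) := fun Z => (hφ0 Z).1
  have htr : ∀ Z, (φ Z).trace = Z.trace := fun Z => (hφ0 Z).2
  have h1 : φ 1 = 1 := by
    rw [← sub_eq_zero]
    refine B.psi_diff _ ?_ ?_
    · rw [map_sub, ← hφ, A7D.psi_one, map_zero, sub_self]
    · rw [Matrix.trace_sub, htr, sub_self]
  have hc : ∀ X Y, φ (X * Y - Y * X) = φ X * φ Y - φ Y * φ X := by
    intro X Y
    rw [← sub_eq_zero]
    refine B.psi_diff _ ?_ ?_
    · rw [map_sub, ← hφ, A7D.psi_lie, A7D.psi_lie, LieEquiv.map_lie, hφ, hφ, sub_self]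
    · rw [Matrix.trace_sub, htr, Matrix.trace_sub, Matrix.trace_mul_comm, sub_self, Matrix.trace_sub,
        Matrix.trace_mul_comm, sub_self, sub_self]
  obtain ⟨y, y', h, h', h''⟩ := skolem φ h1 (mult_of φ htr h1 hc fun X Y Z hX hY hZ => by
    have t := B.trace_inv hI hg hq φ0 (fun Z => (hφ0 Z).1) X Y Z
    change LinearMap.trace F _ (actL (φ X) * actL (φ Y) * actL (φ Z) * skp) = _ at t
    rw [trace_act3 _ _ _ hX hY hZ, trace_act3 _ _ _ (by rw [htr, hX]) (by rw [htr, hY]) (by rw [htr, hZ])] at t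
    have t2 := form_inv φ htr hc X (Y * Z - Z * Y) hX
    rw [hc, mul_sub, mul_sub, Matrix.trace_sub, Matrix.trace_sub] at t2
    simp only [← mul_assoc] at t2
    linear_combination (1 / 4 : F) * t - (1 / 4 : F) * t2)
  exact ⟨y, y', h, h', fun X => by rw [hφ, h'']⟩

theorem exists_x (hI : I * I = -1) (hg : IsTh B.D g I) (hq : ∀ x, q (g x) = g (q x)) :
    ∃ y y' : M2 F, y * y' = 1 ∧ y' * y = 1 ∧ ∀ X, q (B.psi1 X) = B.psi1 (y * X * y') := by
  obtain ⟨φ0, hφ0⟩ := B.exists_phi1 hI hg hq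
  have hinj : Function.Injective φ0 := by
    rw [injective_iff_map_eq_zero]
    intro Z hZ
    refine B.psi1_diff Z ?_ ?_
    · apply q.injective
      change q _ = q 0
      rw [(hφ0 Z).1, hZ, map_zero, map_zero]
    · rw [← (hφ0 Z).2, hZ, Matrix.trace_zero]
  let φ : M2 F ≃ₗ[F] M2 F := LinearEquiv.ofInjectiveEndo φ0 hinj
  have hφ : ∀ Z, q (B.psi1 Z) = B.psi1 (φ Z) := fun Z => (hφ0 Z).1
  have htr : ∀ Z, (φ Z).trace = Z.trace := fun Z => (hφ0 Z).2
  have h1 : φ 1 = 1 := by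
    rw [← sub_eq_zero]
    refine B.psi1_diff _ ?_ ?_
    · rw [map_sub, ← hφ, psi1_one, map_zero, sub_self]
    · rw [Matrix.trace_sub, htr, sub_self]
  have hc : ∀ X Y, φ (X * Y - Y * X) = φ X * φ Y - φ Y * φ X := by
    intro X Y
    rw [← sub_eq_zero]
    refine B.psi1_diff _ ?_ ?_
    · rw [map_sub, ← hφ, psi1_lie, psi1_lie, LieEquiv.map_lie, hφ, hφ, sub_self]
    · rw [Matrix.trace_sub, htr, Matrix.trace_sub, Matrix.trace_mul_comm, sub_self, Matrix.trace_sub,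
        Matrix.trace_mul_comm, sub_self, sub_self]
  obtain ⟨y, y', h, h', h''⟩ := skolem_two φ htr h1 hc
  exact ⟨y, y', h, h', fun X => by rw [hφ, h'']⟩

end B7D
end
end E8P
namespace E8P
open LieAlgebra LieModule
set_option linter.unusedSectionVars false

section
variable {F L : Type*} [Field F] [CharZero F] [LieRing L] [LieAlgebra F L] [Nontrivial L]

/-- twisting of `g₁` -/
def tw (x : M2 F) (y : M8 F) : Module.End F (MV F) where
  toFun W a := ∑ b, x a b • (y * W b * y.transpose)
  map_add' W W' := by
    ext1 a; simp only [Pi.add_apply, mul_add, add_mul, smul_add, Finset.sum_add_distrib]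
  map_smul' c W := by
    ext1 a
    simp only [Pi.smul_apply, RingHom.id_apply, Finset.smul_sum, mul_smul_comm, smul_mul_assoc]
    exact Finset.sum_congr rfl fun b _ => smul_comm _ _ _

lemma tw_apply (x : M2 F) (y : M8 F) (W : MV F) (a) : tw x y W a = ∑ b, x a b • (y * W b * y.transpose) := rfl

lemma tw_mul (x x' : M2 F) (y y' : M8 F) : tw x y * tw x' y' = tw (x * x') (y * y') := by
  refine LinearMap.ext fun W => ?_
  ext1 a
  simp only [Module.End.mul_apply, tw_apply, Matrix.mul_sum, Matrix.sum_mul, Finset.smul_sum, Matrix.mul_apply,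
    Finset.sum_smul, mul_smul_comm, smul_mul_assoc, smul_smul, Matrix.transpose_mul, mul_assoc]
  rw [Finset.sum_comm]

lemma tw_one : tw (1 : M2 F) 1 = 1 := by
  refine LinearMap.ext fun W => ?_
  ext1 a
  simp [tw_apply, Matrix.one_apply]

lemma tw_act (x : M2 F) (y y' X : M8 F) (h : y' * y = 1) (h' : y * y' = 1) (W : MV F) :
    tw x y (cw (actL X) W) = cw (actL (y * X * y')) (tw x y W) := by
  have ht : (y * X * y').trace = X.trace := by
    rw [Matrix.trace_mul_comm, ← mul_assoc, h, one_mul]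
  have h2 : y.transpose * y'.transpose = 1 := by rw [← Matrix.transpose_mul, h, Matrix.transpose_one]
  ext1 a
  rw [cw_apply, tw_apply, tw_apply, map_sum]
  refine Finset.sum_congr rfl fun b _ => ?_
  rw [map_smul]
  congr 1
  rw [cw_apply, actL_apply, actL_apply, B7D.act, B7D.act, ht, mul_sub, sub_mul, mul_add, add_mul]
  congr 2
  · simp only [mul_assoc]; rw [← mul_assoc y' y, h, one_mul]
  · simp only [mul_assoc, Matrix.transpose_mul]; rw [← mul_assoc y.transpose y'.transpose, h2, one_mul]
  · simp only [mul_smul_comm, smul_mul_assoc]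

/-- action of `gl₂` -/
def act1 (X : M2 F) : Module.End F (MV F) := tw X 1 - (X.trace / 2) • 1

lemma tw_act1 (x x' : M2 F) (y : M8 F) (X : M2 F) (h : x' * x = 1) (W : MV F) :
    tw x y (act1 X W) = act1 (x * X * x') (tw x y W) := by
  have ht : (x * X * x').trace = X.trace := by
    rw [Matrix.trace_mul_comm, ← mul_assoc, h, one_mul]
  simp only [act1, LinearMap.sub_apply, LinearMap.smul_apply, Module.End.one_apply, map_sub, map_smul, ht]
  congr 1
  rw [← Module.End.mul_apply, ← Module.End.mul_apply, tw_mul, tw_mul, mul_assoc _ x', h, mul_one, one_mul, mul_one]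

lemma tw_transpose (x : M2 F) (y : M8 F) (W : MV F) (hW : ∀ a, (W a).transpose = W a) (a) :
    (tw x y W a).transpose = tw x y W a := by
  rw [tw_apply, Matrix.transpose_sum]
  refine Finset.sum_congr rfl fun b _ => ?_
  rw [Matrix.transpose_smul, Matrix.transpose_mul, Matrix.transpose_mul, hW, Matrix.transpose_transpose, mul_assoc]

namespace B7D
variable (B : B7D F L) {g q : L ≃ₗ⁅F⁆ L} {I : F}

lemma psi1_Psi' (X : M2 F) (Z : MV F) : ⁅B.psi1 X, B.Psi Z⁆ = B.Psi (act1 X Z) := by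
  rw [psi1_Psi]; congr 1; ext1 a; simp [act1, tw_apply]

lemma Psi_sym (W : MV F) (hW : ∀ a, (W a).transpose = W a) : B.Psi W = 0 := by
  have h := B.Psi_transpose W
  rw [show (fun a => (W a).transpose) = W from funext hW] at h
  have h2 : (2 : F) • B.Psi W = 0 := by rw [two_smul]; nth_rewrite 1 [h]; exact neg_add_cancel _
  exact (smul_eq_zero.mp h2).resolve_left (by norm_num)

/-- an equivariant linear map is determined -/
lemma schur (Φ : MV F →ₗ[F] L) (h8 : ∀ X W, ⁅B.psi X, Φ W⁆ = Φ (cw (actL X) W))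
    (h2 : ∀ X W, ⁅B.psi1 X, Φ W⁆ = Φ (act1 X W)) (hs : ∀ W : MV F, (∀ a, (W a).transpose = W a) → Φ W = 0) :
    ∃ c : F, ∀ W, Φ W = c • B.Psi W := by
  have hk : ∀ W, B.Psi W = 0 → Φ W = 0 := fun W hW => hs W (B.Psi_ker W hW)
  let W0 : MV F := Pi.single 0 (Matrix.single none (some 0) 1)
  have hW0 : B.Psi W0 = B.u 0 := by
    simp [W0, Psi_def, Psi0_single, W]
  have hw : Φ W0 ∈ B.D.wsp (Bw + Gs 0) := by
    rw [mem_wsp]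
    intro i
    obtain ⟨A, Z, hAZ⟩ := B.mem_G0.mp (B.H_mem i)
    have h1 := ((mem_wsp B.D).mp (B.hu 0)) i
    rw [hAZ, ← hW0, add_lie, psi1_Psi', psi_Psi', ← map_smul, ← map_add, ← sub_eq_zero, ← map_sub] at h1
    have h3 := hk _ h1
    rw [map_sub, map_add, map_smul, sub_eq_zero] at h3
    rw [hAZ, add_lie, h8, h2, h3]
  obtain ⟨c, hc⟩ := wsp_one B.D (Bw_root 0) (B.hu 0) (B.u_ne 0) hw
  refine ⟨c, ?_⟩
  let K : Submodule F (MV F) := LinearMap.eqLocus Φ (c • B.Psi)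
  have hK : ∀ W, W ∈ K ↔ Φ W = c • B.Psi W := fun W => Iff.rfl
  have hKs : ∀ W : MV F, (∀ a, (W a).transpose = W a) → W ∈ K := fun W hW => by
    rw [hK, hs W hW, B.Psi_sym W hW, smul_zero]
  have hK8 : ∀ X W, W ∈ K → cw (actL X) W ∈ K := fun X W hW => by
    rw [hK] at hW ⊢
    rw [← h8, hW, ← psi_Psi', lie_smul]
  have hK2 : ∀ X W, W ∈ K → act1 X W ∈ K := fun X W hW => by
    rw [hK] at hW ⊢
    rw [← h2, hW, ← psi1_Psi', lie_smul]
  let K0 : Submodule F (M8 F) := K.comap (LinearMap.single F (fun _ : Fin 2 => M8 F) 0)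
  have hK0 : ∀ Z, Z ∈ K0 ↔ Pi.single (M := fun _ : Fin 2 => M8 F) 0 Z ∈ K := fun Z => Iff.rfl
  have k1 : ∀ X, ∀ Z ∈ K0, act X Z ∈ K0 := by
    intro X Z hZ
    rw [hK0] at hZ ⊢
    have := hK8 X _ hZ
    convert this using 1
    ext1 a
    rw [cw_apply]
    by_cases ha : a = 0
    · subst ha; rw [Pi.single_eq_same, Pi.single_eq_same, actL_apply]
    · rw [Pi.single_eq_of_ne ha, Pi.single_eq_of_ne ha, map_zero]
  have ks : ∀ Z : M8 F, Z.transpose = Z → Z ∈ K0 := by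
    intro Z hZ
    rw [hK0]
    refine hKs _ fun a => ?_
    by_cases ha : a = 0
    · subst ha; rw [Pi.single_eq_same, hZ]
    · rw [Pi.single_eq_of_ne ha, Matrix.transpose_zero]
  have k0 : Matrix.single none (some 0) (1 : F) ∈ K0 := by
    rw [hK0, hK]; change Φ W0 = c • B.Psi W0; rw [hW0, hc]
  have k2 : ∀ p : Fin 7, Matrix.single none (some p) (1 : F) ∈ K0 := by
    intro p
    by_cases hp : p = 0
    · rw [hp]; exact k0
    · have := k1 (Matrix.single (some p) (some 0) 1) _ k0
      rw [act_single] at this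
      simpa [hp] using this
  have k3 : ∀ r p : Fin 7, Matrix.single (some r) (some p) (1 : F) ∈ K0 := by
    intro r p
    have := k1 (Matrix.single (some r) none 1) _ (k2 p)
    rw [act_single] at this
    simpa using this
  have k4 : K0 = ⊤ := by
    refine mat_top _ fun p r => ?_
    rcases p with _ | p <;> rcases r with _ | r
    · exact ks _ (by simp)
    · exact k2 r
    · have h5 := ks (Matrix.single (some p) none (1 : F) + Matrix.single none (some p) 1) (by simp [add_comm])
      simpa using Submodule.sub_mem _ h5 (k2 p)
    · exact k3 p r
  have k5 : ∀ Z : M8 F, Pi.single (M := fun _ : Fin 2 => M8 F) 0 Z ∈ K := fun Z => by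
    rw [← hK0, k4]; trivial
  have k6 : ∀ Z : M8 F, Pi.single (M := fun _ : Fin 2 => M8 F) 1 Z ∈ K := fun Z => by
    have := hK2 (Matrix.single 1 0 1) _ (k5 Z)
    convert this using 1
    ext1 a
    simp only [act1, LinearMap.sub_apply, Pi.sub_apply, tw_apply, LinearMap.smul_apply, Pi.smul_apply,
      Fin.sum_univ_two]
    fin_cases a <;> simp
  intro W
  rw [← hK]
  have : W = Pi.single (M := fun _ : Fin 2 => M8 F) 0 (W 0) + Pi.single (M := fun _ : Fin 2 => M8 F) 1 (W 1) := by
    ext1 a; fin_cases a <;> simp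
  rw [this]
  exact Submodule.add_mem _ (k5 _) (k6 _)

/-- description of an automorphism commuting with `θ` -/
structure QD (q : L ≃ₗ⁅F⁆ L) (x : (M2 F)ˣ) (y : (M8 F)ˣ) (c : F) : Prop where
  h8 : ∀ X, q (B.psi X) = B.psi (y * X * ((y⁻¹ : (M8 F)ˣ) : M8 F))
  h2 : ∀ X, q (B.psi1 X) = B.psi1 (x * X * ((x⁻¹ : (M2 F)ˣ) : M2 F))
  h1 : ∀ W, q (B.Psi W) = c • B.Psi (tw x y W)

theorem exists_QD (hI : I * I = -1) (hg : IsTh B.D g I) (hq : ∀ x, q (g x) = g (q x)) :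
    ∃ x y c, B.QD q x y c := by
  obtain ⟨y0, y0', a1, a2, a3⟩ := B.exists_y hI hg hq
  obtain ⟨x0, x0', b1, b2, b3⟩ := B.exists_x hI hg hq
  obtain ⟨c, hc⟩ := B.schur ((q : L →ₗ[F] L) ∘ₗ B.Psi ∘ₗ tw x0' y0') (by
      intro X W
      change ⁅_, q (B.Psi (tw x0' y0' W))⁆ = q (B.Psi (tw x0' y0' _))
      rw [tw_act x0' y0' y0 X a1 a2, ← psi_Psi', LieEquiv.map_lie, a3]
      congr 2
      simp only [mul_assoc, a1, mul_one]; rw [← mul_assoc, a1, one_mul]) (by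
      intro X W
      change ⁅_, q (B.Psi (tw x0' y0' W))⁆ = q (B.Psi (tw x0' y0' _))
      rw [tw_act1 x0' x0 y0' X b1, ← psi1_Psi', LieEquiv.map_lie, b3]
      congr 2
      simp only [mul_assoc, b1, mul_one]; rw [← mul_assoc, b1, one_mul]) (by
      intro W hW
      change q (B.Psi (tw x0' y0' W)) = 0
      rw [B.Psi_sym _ (tw_transpose x0' y0' W hW), map_zero])
  refine ⟨⟨x0, x0', b1, b2⟩, ⟨y0, y0', a1, a2⟩, c, ⟨fun X => a3 X, fun X => b3 X, fun W => ?_⟩⟩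
  have := hc (tw x0 y0 W)
  change q (B.Psi ((tw x0' y0' * tw x0 y0) W)) = _ at this
  rw [tw_mul, b2, a2, tw_one] at this
  exact this

end B7D
end
end E8P
namespace E8P
open LieAlgebra LieModule
set_option linter.unusedSectionVars false

lemma mem_of_comm {G : Type*} [Group G] {Q : Subgroup G} (hQ : IsMaximalFiniteAbelian Q) {α : G}
    (h : ∀ q ∈ Q, α * q = q * α) : α ∈ Q := by
  have hc : ∀ x ∈ insert α (Q : Set G), ∀ y ∈ insert α (Q : Set G), x * y = y * x := by
    rintro x (rfl | hx) y (rfl | hy)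
    · rfl
    · exact h y hy
    · exact (h x hx).symm
    · exact hQ.2.1 x y hx hy
  have h2 := hQ.2.2 (Subgroup.closure (insert α (Q : Set G))) (by
    intro a b ha hb
    letI := Subgroup.closureCommGroupOfComm hc
    have := mul_comm (⟨a, ha⟩ : Subgroup.closure (insert α (Q : Set G))) ⟨b, hb⟩
    exact congrArg Subtype.val this) (fun x hx => Subgroup.subset_closure (Or.inr hx))
  rw [← h2]
  exact Subgroup.subset_closure (Or.inl rfl)

section
variable {F L : Type*} [Field F] [CharZero F] [IsAlgClosed F] [LieRing L] [LieAlgebra F L]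
  [Module.Finite F L]

/-- an element of `lieAut` as an equivalence of Lie algebras -/
def toLE (q : lieAut F L) : L ≃ₗ⁅F⁆ L :=
  { (q : L ≃ₗ[F] L) with map_lie' := fun {x y} => q.2 x y }
lemma toLE_apply (q : lieAut F L) (x : L) : toLE q x = (q : L ≃ₗ[F] L) x := rfl

lemma exists_aut [IsKilling F L] (z : L) (hz : ¬ IsNilpotent (ad F L z)) : ∃ α : lieAut F L,
    (∀ q : lieAut F L, (q : L ≃ₗ[F] L) z = z → α * q = q * α) ∧ ∀ k : ℕ, 0 < k → α ^ k ≠ 1 := by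
  set a := ad F L z with ha
  obtain ⟨i, hi⟩ : ∃ i, gbw a i ≠ 0 := by
    by_contra hn
    push Not at hn
    exact hz (nil_of_gbw a hn)
  obtain ⟨f, hf⟩ : ∃ f : F →ₗ[ℚ] ℚ, f (gbw a i) ≠ 0 := by
    by_contra hn
    push Not at hn
    exact hi ((Module.forall_dual_apply_eq_zero_iff ℚ _).mp hn)
  set N : ℕ := ∏ j, (f (gbw a j)).den with hN
  have hN0 : (N : ℚ) ≠ 0 := by
    rw [hN, Nat.cast_ne_zero, Finset.prod_ne_zero_iff]
    intro j _; exact (f (gbw a j)).den_nz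
  have hInt : ∀ j, ∃ k : ℤ, (N : ℚ) * f (gbw a j) = k := by
    intro j
    obtain ⟨m, hm⟩ : (f (gbw a j)).den ∣ N := Finset.dvd_prod_of_mem _ (Finset.mem_univ j)
    refine ⟨m * (f (gbw a j)).num, ?_⟩
    rw [hm]; push_cast
    rw [mul_comm ((f (gbw a j)).den : ℚ), mul_assoc, Rat.den_mul_eq_num]
  let l : F → ℤ := fun μ => ⌊(N : ℚ) * f μ⌋
  let c : F → F := fun μ => (2 : F) ^ (l μ)
  have hc : ∀ j j', c (gbw a j + gbw a j') = c (gbw a j) * c (gbw a j') := by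
    intro j j'
    obtain ⟨k, hk⟩ := hInt j
    obtain ⟨k', hk'⟩ := hInt j'
    simp only [c, l, map_add, mul_add, hk, hk']
    rw [← Int.cast_add, Int.floor_intCast, Int.floor_intCast, Int.floor_intCast, zpow_add₀ (by norm_num)]
  have h1 : opc a c * opc a (fun μ => (c μ)⁻¹) = 1 := by
    rw [opc_mul]
    refine (gbb a).ext fun j => ?_
    rw [opc_gbb, mul_inv_cancel₀ (zpow_ne_zero _ (by norm_num)), one_smul]; rfl
  have h2 : opc a (fun μ => (c μ)⁻¹) * opc a c = 1 := by
    rw [opc_mul]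
    refine (gbb a).ext fun j => ?_
    rw [opc_gbb, inv_mul_cancel₀ (zpow_ne_zero _ (by norm_num)), one_smul]; rfl
  let e : L ≃ₗ[F] L := LinearEquiv.ofLinear (opc a c) (opc a fun μ => (c μ)⁻¹) h1 h2
  have he : ∀ x, e x = opc a c x := fun x => rfl
  have hlie : ∀ x y, opc a c ⁅x, y⁆ = ⁅opc a c x, opc a c y⁆ := by
    intro x y
    have t : ∀ j, ∀ y, opc a c ⁅gbb a j, y⁆ = ⁅opc a c (gbb a j), opc a c y⁆ := by
      intro j y
      have := (gbb a).ext (f₁ := opc a c ∘ₗ (ad F L (gbb a j) : L →ₗ[F] L))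
        (f₂ := (ad F L (opc a c (gbb a j)) : L →ₗ[F] L) ∘ₗ opc a c) (fun j' => by
          simp only [LinearMap.comp_apply, ad_apply]
          rw [opc_gbb, opc_gbb, opc_apply a c (lie_gen z (gbb_mem a j) (gbb_mem a j')), hc, smul_lie, lie_smul,
            smul_smul])
      exact LinearMap.congr_fun this y
    have := (gbb a).ext (f₁ := opc a c ∘ₗ (ad F L y : L →ₗ[F] L))
        (f₂ := (ad F L (opc a c y) : L →ₗ[F] L) ∘ₗ opc a c) (fun j => by
          simp only [LinearMap.comp_apply, ad_apply]
          rw [← lie_skew, map_neg, t, lie_skew])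
    have := LinearMap.congr_fun this x
    simp only [LinearMap.comp_apply, ad_apply] at this
    rw [← lie_skew, map_neg, this, lie_skew]
  let α : lieAut F L := ⟨e, fun x y => hlie x y⟩
  refine ⟨α, ?_, ?_⟩
  · intro q hq
    apply Subtype.ext
    apply LinearEquiv.toLinearMap_injective
    refine gen_ext a fun μ y hy => ?_
    change opc a c (toLE q y) = toLE q (opc a c y)
    have h3 := map_gen z (toLE q) 1 (by norm_num) (by rw [one_smul]; exact hq) hy
    rw [one_mul] at h3
    rw [opc_apply a c h3, opc_apply a c hy, map_smul]
  · intro k hk hk1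
    have h4 : ∀ k : ℕ, ((α ^ k : lieAut F L) : L ≃ₗ[F] L) (gbb a i) = (c (gbw a i)) ^ k • gbb a i := by
      intro k
      induction k with
      | zero => simp
      | succ k ih =>
        rw [pow_succ']
        change opc a c (((α ^ k : lieAut F L) : L ≃ₗ[F] L) (gbb a i)) = _
        rw [ih, map_smul, opc_gbb, smul_smul, pow_succ]
    have h5 := h4 k
    rw [hk1] at h5
    change gbb a i = _ at h5
    have h6 : (c (gbw a i)) ^ k = 1 := by
      have : ((c (gbw a i)) ^ k - 1) • gbb a i = 0 := by rw [sub_smul, ← h5, one_smul, sub_self]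
      exact sub_eq_zero.mp ((smul_eq_zero.mp this).resolve_right ((gbb a).ne_zero i))
    simp only [c] at h6
    rw [← zpow_natCast, ← zpow_mul] at h6
    have h7 : (2 : ℚ) ^ (l (gbw a i) * (k : ℤ)) = 1 := by
      have : ((2 ^ (l (gbw a i) * (k : ℤ)) : ℚ) : F) = ((1 : ℚ) : F) := by push_cast; exact h6
      exact_mod_cast this
    have h8 : l (gbw a i) * (k : ℤ) = 0 := by
      rwa [zpow_eq_one_iff_right₀ (by norm_num) (by norm_num)] at h7
    rcases mul_eq_zero.mp h8 with h9 | h9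
    · obtain ⟨m, hm⟩ := hInt i
      simp only [l, hm, Int.floor_intCast] at h9
      rw [h9, Int.cast_zero] at hm
      rcases mul_eq_zero.mp hm with h | h
      · exact hN0 h
      · exact hf h
    · omega

theorem fixQ [IsKilling F L] {Q : Subgroup (lieAut F L)} (hQ : IsMaximalFiniteAbelian Q) (x : L)
    (hx : ∀ q ∈ Q, (q : L ≃ₗ[F] L) x = x) : x = 0 := by
  classical
  by_contra hx0
  haveI := hQ.1
  haveI : Fintype Q := Fintype.ofFinite _
  obtain ⟨y, hy⟩ : ∃ y, killingForm F L x y ≠ 0 := by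
    by_contra hn
    push Not at hn
    have : x ∈ LinearMap.ker (killingForm F L) := by
      rw [LinearMap.mem_ker]; ext y; simpa using hn y
    rw [IsKilling.ker_killingForm_eq_bot] at this
    exact hx0 (by simpa using this)
  let y' : L := ∑ q : Q, ((q : lieAut F L) : L ≃ₗ[F] L) y
  have hy' : ∀ q ∈ Q, (q : L ≃ₗ[F] L) y' = y' := by
    intro q hq
    simp only [y', map_sum]
    exact Fintype.sum_equiv (Equiv.mulLeft (⟨q, hq⟩ : Q)) _ _ (fun r => rfl)
  have hk : killingForm F L x y' ≠ 0 := by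
    have : killingForm F L x y' = Fintype.card Q * killingForm F L x y := by
      simp only [y', map_sum]
      rw [Finset.sum_congr rfl (g := fun _ => killingForm F L x y) (fun q _ => ?_)]
      · simp
      · have h1 := killingForm_of_equiv_apply (R := F) (toLE (q : lieAut F L)) x y
        rw [toLE_apply, toLE_apply, hx _ q.2] at h1
        exact h1
    rw [this]
    exact mul_ne_zero (by simp) hy
  have hz : ∃ z, (∀ q ∈ Q, (q : L ≃ₗ[F] L) z = z) ∧ killingForm F L z z ≠ 0 := by
    by_cases h1 : killingForm F L x x ≠ 0
    · exact ⟨x, hx, h1⟩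
    by_cases h2 : killingForm F L y' y' ≠ 0
    · exact ⟨y', hy', h2⟩
    push Not at h1 h2
    refine ⟨x + y', fun q hq => by rw [map_add, hx q hq, hy' q hq], ?_⟩
    rw [map_add, map_add, LinearMap.add_apply, LinearMap.add_apply, h1, h2, LieModule.traceForm_comm F L L y' x,
      zero_add, add_zero, ← two_mul]
    exact mul_ne_zero (by norm_num) hk
  obtain ⟨z, hz, hzz⟩ := hz
  obtain ⟨α, h1, h2⟩ := exists_aut z (by
    intro hn
    apply hzz
    rw [killingForm_apply_apply]
    have h3 : IsNilpotent (ad F L z ∘ₗ ad F L z) := by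
      change IsNilpotent (ad F L z * ad F L z)
      exact (Commute.refl _).isNilpotent_mul_right hn
    exact (LinearMap.isNilpotent_trace_of_isNilpotent h3).eq_zero)
  have h3 : α ∈ Q := mem_of_comm hQ fun q hq => h1 q (hz q hq)
  obtain ⟨k, hk, hk1⟩ := (isOfFinOrder_iff_pow_eq_one.mp (isOfFinOrder_of_finite (⟨α, h3⟩ : Q)))
  exact h2 k hk (congrArg Subtype.val hk1)
end
end E8P
namespace E8P
open LieAlgebra LieModule
set_option linter.unusedSectionVars false

section
variable {F : Type*} [Field F] [CharZero F] {ι : Type*} [Fintype ι] [DecidableEq ι] [Nonempty ι]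
  {Q : Type*} [CommGroup Q]

/-- an irreducible projective representation of an abelian group -/
structure PF (y : Q → (Matrix ι ι F)ˣ) : Prop where
  mul : ∀ p q (X : Matrix ι ι F), (y (p * q) : Matrix ι ι F) * X * (↑(y (p * q))⁻¹ : Matrix ι ι F) =
    y p * (y q * X * (↑(y q)⁻¹ : Matrix ι ι F)) * (↑(y p)⁻¹ : Matrix ι ι F)
  irr : ∀ X : Matrix ι ι F, (∀ q, (y q : Matrix ι ι F) * X = X * y q) → ∃ c : F, X = c • 1

lemma scal_of_conj {a b : (Matrix ι ι F)ˣ} (h : ∀ X : Matrix ι ι F, (a : Matrix ι ι F) * X * (↑a⁻¹ : Matrix ι ι F) = b * X * (↑b⁻¹ : Matrix ι ι F)) :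
    ∃ s : F, s ≠ 0 ∧ (a : Matrix ι ι F) = s • (b : Matrix ι ι F) := by
  obtain ⟨c, hc⟩ := scalar_of_comm (ι := ι) ((↑b⁻¹ : Matrix ι ι F) * (a : Matrix ι ι F)) (by
    intro X
    have := congrArg (fun Z => (↑b⁻¹ : Matrix ι ι F) * Z * a) (h X)
    simp only [← mul_assoc, Units.inv_mul_cancel_right, Units.inv_mul, one_mul] at this
    rw [this, mul_assoc])
  have h2 : (a : Matrix ι ι F) = c • (b : Matrix ι ι F) := by
    rw [← Units.mul_inv_cancel_left b (a : Matrix ι ι F), hc, mul_smul_comm, mul_one]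
  refine ⟨c, ?_, h2⟩
  rintro rfl
  rw [zero_smul] at h2
  exact a.ne_zero h2

namespace PF
variable {y : Q → (Matrix ι ι F)ˣ}

lemma mul' (P : PF y) (p q : Q) : ∃ s : F, s ≠ 0 ∧ (y (p * q) : Matrix ι ι F) = s • (y p * y q : Matrix ι ι F) := by
  obtain ⟨s, h0, h⟩ := scal_of_conj (a := y (p * q)) (b := y p * y q) (by
    intro X
    rw [P.mul, mul_inv_rev, Units.val_mul, Units.val_mul]
    simp only [mul_assoc])
  exact ⟨s, h0, by rw [h, Units.val_mul]⟩

lemma comm (P : PF y) (p q : Q) : ∃ s : F, s ≠ 0 ∧ (y p * y q : Matrix ι ι F) = s • (y q * y p : Matrix ι ι F) := by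
  obtain ⟨s, h0, h⟩ := P.mul' p q
  obtain ⟨t, k0, k⟩ := P.mul' q p
  refine ⟨s⁻¹ * t, mul_ne_zero (inv_ne_zero h0) k0, ?_⟩
  rw [mul_smul, ← k, mul_comm q p, h, smul_smul, inv_mul_cancel₀ h0, one_smul]

lemma trace_zero (P : PF y) (q : Q) (hq : ¬ ∃ c : F, (y q : Matrix ι ι F) = c • 1) : (y q : Matrix ι ι F).trace = 0 := by
  by_contra h
  refine hq (P.irr _ fun p => ?_)
  obtain ⟨s, h0, hs⟩ := P.comm p q
  have h2 : (y q : Matrix ι ι F).trace = s * (y q : Matrix ι ι F).trace := by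
    have := congrArg (fun Z => (Z * (↑(y p)⁻¹ : Matrix ι ι F)).trace) hs
    rw [Matrix.trace_mul_comm, Units.inv_mul_cancel_left, smul_mul_assoc, Units.mul_inv_cancel_right,
      Matrix.trace_smul, smul_eq_mul] at this
    exact this
  have h3 : s = 1 := by
    have : (s - 1) * (y q : Matrix ι ι F).trace = 0 := by linear_combination -h2
    rcases mul_eq_zero.mp this with h | h'
    · linear_combination h
    · exact absurd h' h
  rw [hs, h3, one_smul]

open Classical in
lemma count (P : PF y) [Fintype Q] : Fintype.card Q = Fintype.card ι ^ 2 *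
    (Finset.univ.filter fun q : Q => ∃ c : F, (y q : Matrix ι ι F) = c • 1).card := by
  let A : Matrix ι ι F → Matrix ι ι F := fun X => ∑ q, (y q : Matrix ι ι F) * X * (↑(y q)⁻¹ : Matrix ι ι F)
  have hA : ∀ X, ∃ c : F, A X = c • 1 := by
    intro X
    refine P.irr _ fun p => ?_
    have h1 : (y p : Matrix ι ι F) * A X * (↑(y p)⁻¹ : Matrix ι ι F) = A X := by
      simp only [A, Finset.mul_sum, Finset.sum_mul]
      rw [← Equiv.sum_comp (Equiv.mulLeft p) (fun q => (y q : Matrix ι ι F) * X * (↑(y q)⁻¹ : Matrix ι ι F))]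
      refine Finset.sum_congr rfl fun q _ => ?_
      rw [Equiv.coe_mulLeft, P.mul]
    conv_rhs => rw [← h1]
    rw [Units.inv_mul_cancel_right]
  have hcard : (Fintype.card ι : F) ≠ 0 := Nat.cast_ne_zero.mpr Fintype.card_ne_zero
  have hA2 : ∀ X, A X = ((Fintype.card Q : F) * X.trace / Fintype.card ι) • 1 := by
    intro X
    obtain ⟨c, hc⟩ := hA X
    have h1 : (A X).trace = Fintype.card Q * X.trace := by
      simp only [A, Matrix.trace_sum]
      rw [Finset.sum_congr rfl (fun q _ => by
        rw [Matrix.trace_mul_comm, Units.inv_mul_cancel_left]), Finset.sum_const, Finset.card_univ, nsmul_eq_mul]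
    rw [← h1, hc, Matrix.trace_smul, Matrix.trace_one, smul_eq_mul, mul_div_cancel_right₀ _ hcard]
  have h1 : ∑ i, ∑ j, A (Matrix.single i j 1) i j = (Fintype.card Q : F) := by
    have : ∀ i j : ι, A (Matrix.single i j 1) i j = if i = j then (Fintype.card Q : F) / Fintype.card ι else 0 := by
      intro i j
      rw [hA2, Matrix.smul_apply, Matrix.one_apply]
      by_cases h : i = j
      · subst h; simp
      · simp [h]
    simp only [this, Finset.sum_ite_eq, Finset.mem_univ, if_true, Finset.sum_const, Finset.card_univ, nsmul_eq_mul]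
    field_simp
  have h2 : ∑ i, ∑ j, A (Matrix.single i j 1) i j =
      ∑ q, (y q : Matrix ι ι F).trace * (↑(y q)⁻¹ : Matrix ι ι F).trace := by
    have h : ∀ i j, A (Matrix.single i j 1) i j = ∑ q, (y q : Matrix ι ι F) i i * (↑(y q)⁻¹ : Matrix ι ι F) j j := by
      intro i j
      simp only [A, Matrix.sum_apply]
      refine Finset.sum_congr rfl fun q _ => ?_
      simp [Matrix.mul_apply, Matrix.single_apply, ite_and]
    simp only [h, Matrix.trace, Matrix.diag_apply, Finset.sum_mul_sum]
    rw [Finset.sum_congr rfl fun i _ => Finset.sum_comm, Finset.sum_comm]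
  have h3 : ∀ q, (y q : Matrix ι ι F).trace * (↑(y q)⁻¹ : Matrix ι ι F).trace =
      if (∃ c : F, (y q : Matrix ι ι F) = c • 1) then (Fintype.card ι : F) ^ 2 else 0 := by
    intro q
    split_ifs with h
    · obtain ⟨c, hc⟩ := h
      have hc0 : c ≠ 0 := by
        rintro rfl
        rw [zero_smul] at hc
        exact (y q).ne_zero hc
      have : (↑(y q)⁻¹ : Matrix ι ι F) = c⁻¹ • 1 := by
        have h := (y q).inv_mul
        rw [hc, mul_smul_comm, mul_one] at h
        rw [← h, smul_smul, inv_mul_cancel₀ hc0, one_smul]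
      rw [hc, this, Matrix.trace_smul, Matrix.trace_smul, Matrix.trace_one, smul_eq_mul, smul_eq_mul]
      field_simp
    · rw [P.trace_zero q h, zero_mul]
  rw [h1] at h2
  simp only [h3] at h2
  rw [← Finset.sum_filter, Finset.sum_const, nsmul_eq_mul, mul_comm] at h2
  exact_mod_cast h2

end PF
end
end E8P
namespace E8P
open LieAlgebra LieModule
set_option linter.unusedSectionVars false

section
variable {F L : Type*} [Field F] [CharZero F] [LieRing L] [LieAlgebra F L] [Nontrivial L]

lemma trace_conj {ι : Type*} [Fintype ι] [DecidableEq ι] (y : (Matrix ι ι F)ˣ) (X : Matrix ι ι F) :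
    ((y : Matrix ι ι F) * X * (↑y⁻¹ : Matrix ι ι F)).trace = X.trace := by
  rw [Matrix.trace_mul_comm, Units.inv_mul_cancel_left]

lemma tw_smul (x : M2 F) (y : M8 F) (a b : F) : tw (a • x) (b • y) = (a * (b * b)) • tw x y := by
  refine LinearMap.ext fun W => ?_
  ext1 i
  rw [LinearMap.smul_apply, Pi.smul_apply, tw_apply, tw_apply, Finset.smul_sum]
  refine Finset.sum_congr rfl fun j _ => ?_
  rw [Matrix.transpose_smul, Matrix.smul_apply, smul_mul_assoc, smul_mul_assoc, mul_smul_comm, smul_smul, smul_smul, smul_smul,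
    smul_eq_mul]
  congr 1; ring

namespace B7D
variable (B : B7D F L)

lemma Psi_exists : ∃ W, B.Psi W ≠ 0 := by
  obtain ⟨x, hx, h0⟩ := root_vec B.D (bf_al_al 2)
  obtain ⟨W, rfl⟩ := B.wsp_G1 (al 2) (by decide) hx
  exact ⟨W, h0⟩

lemma ext_id {a : L ≃ₗ⁅F⁆ L} (h8 : ∀ X, a (B.psi X) = B.psi X) (h2 : ∀ X, a (B.psi1 X) = B.psi1 X)
    (h1 : ∀ W, a (B.Psi W) = B.Psi W) (z : L) : a z = z := by
  have hG0 : ∀ z ∈ B.G0, a z = z := by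
    intro z hz
    obtain ⟨X, Z, rfl⟩ := B.mem_G0.mp hz
    rw [map_add, h8, h2]
  have hh : ∀ i, a (B.D.h i) = B.D.h i := fun i => hG0 _ (B.H_mem i)
  have hw : ∀ n, ∀ x ∈ B.D.wsp n, a x ∈ B.D.wsp n := by
    intro n x hx
    rw [mem_wsp] at hx ⊢
    intro i
    rw [← hh i, ← LieEquiv.map_lie, hx i, map_smul]
  have z2 : ∀ i : Fin 8, i ≠ 2 → al i 2 % 4 = 0 ∧ (- al i) 2 % 4 = 0 := by decide
  have he : ∀ i, a (B.D.e i) = B.D.e i := by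
    intro i
    by_cases hi : i = 2
    · subst hi
      obtain ⟨W, hW⟩ := B.wsp_G1 (al 2) (by decide) (e_mem_wsp B.D 2)
      rw [← hW, h1]
    · exact hG0 _ (B.wsp_G0 _ (z2 i hi).1 (e_mem_wsp B.D i))
  have hf : ∀ i, a (B.D.f i) = B.D.f i := by
    intro i
    have hr : bf (- al i) (- al i) = 2 := by rw [bf_neg_neg, bf_al_al]
    obtain ⟨t, ht⟩ := wsp_one B.D hr (f_mem_wsp B.D i) (f_ne B.D i) (hw _ _ (f_mem_wsp B.D i))
    have := hh i
    rw [← B.D.ef i, LieEquiv.map_lie, he, ht, lie_smul, B.D.ef] at this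
    have h3 : (t - 1) • B.D.h i = 0 := by rw [sub_smul, one_smul, this, sub_self]
    rcases smul_eq_zero.mp h3 with h | h
    · rw [ht, sub_eq_zero.mp h, one_smul]
    · exact absurd h (h_ne B.D i)
  have hz : z ∈ LieSubalgebra.lieSpan F L (Set.range B.D.e ∪ Set.range B.D.f) := by
    rw [B.D.gen]; trivial
  induction hz using LieSubalgebra.lieSpan_induction with
  | mem x hx =>
    rcases hx with ⟨i, rfl⟩ | ⟨i, rfl⟩
    · exact he i
    · exact hf i
  | zero => exact map_zero _
  | add x y _ _ hx hy => rw [map_add, hx, hy]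
  | smul c x _ hx => rw [map_smul, hx]
  | lie x y _ _ hx hy => rw [LieEquiv.map_lie, hx, hy]

/-- the situation -/
structure SD {Q : Type*} [CommGroup Q] (ac : Q → L ≃ₗ⁅F⁆ L) (x : Q → (M2 F)ˣ) (y : Q → (M8 F)ˣ) (c : Q → F) :
    Prop where
  mul : ∀ p q z, ac (p * q) z = ac p (ac q z)
  qd : ∀ q, B.QD (ac q) (x q) (y q) (c q)
  fix : ∀ z, (∀ q, ac q z = z) → z = 0

namespace SD
variable {B} {Q : Type*} [CommGroup Q] {ac : Q → L ≃ₗ⁅F⁆ L} {x : Q → (M2 F)ˣ} {y : Q → (M8 F)ˣ} {c : Q → F}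

lemma py (S : B.SD ac x y c) : PF y where
  mul p q X := by
    rw [← sub_eq_zero]
    apply B.psi_diff
    · rw [map_sub, ← (S.qd (p * q)).h8, ← (S.qd p).h8, ← (S.qd q).h8, S.mul, sub_self]
    · rw [Matrix.trace_sub, trace_conj, trace_conj, trace_conj, sub_self]
  irr X h := by
    refine B.psi_ker X (S.fix _ fun q => ?_)
    rw [(S.qd q).h8, h, Units.mul_inv_cancel_right]

lemma px (S : B.SD ac x y c) : PF x where
  mul p q X := by
    rw [← sub_eq_zero]
    apply B.psi1_diff
    · rw [map_sub, ← (S.qd (p * q)).h2, ← (S.qd p).h2, ← (S.qd q).h2, S.mul, sub_self]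
    · rw [Matrix.trace_sub, trace_conj, trace_conj, trace_conj, sub_self]
  irr X h := by
    refine B.psi1_ker X (S.fix _ fun q => ?_)
    rw [(S.qd q).h2, h, Units.mul_inv_cancel_right]

lemma bb (S : B.SD ac x y c) (p q : Q) {b : F} (hb : (y p * y q : M8 F) = b • (y q * y p : M8 F)) :
    ∃ b1 : F, b1 * b1 = 1 ∧ b1 * (b * b) = 1 ∧ (x p * x q : M2 F) = b1 • (x q * x p : M2 F) := by
  obtain ⟨b1, h0, h1⟩ := S.px.comm p q
  refine ⟨b1, ?_, ?_, h1⟩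
  · have := congrArg Matrix.det h1
    rw [Matrix.det_smul, Fintype.card_fin, Matrix.det_mul, Matrix.det_mul, mul_comm (x q : M2 F).det] at this
    have hd : (x p : M2 F).det * (x q : M2 F).det ≠ 0 :=
      mul_ne_zero ((Matrix.isUnit_iff_isUnit_det _).mp (x p).isUnit).ne_zero
        ((Matrix.isUnit_iff_isUnit_det _).mp (x q).isUnit).ne_zero
    apply mul_right_cancel₀ hd
    linear_combination -this
  · obtain ⟨W, hW⟩ := B.Psi_exists
    have e : ∀ p q W, ac (p * q) (B.Psi W) = (c p * c q) • B.Psi (tw (x p * x q : M2 F) (y p * y q : M8 F) W) := by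
      intro p q W
      rw [S.mul, (S.qd q).h1, map_smul, (S.qd p).h1, smul_smul, mul_comm (c q), ← tw_mul]
      rfl
    have e1 := e p q W
    have e2 := e q p W
    rw [h1, hb, tw_smul, LinearMap.smul_apply, map_smul, mul_comm (c p), smul_comm, ← e2, mul_comm q p] at e1
    have h3 : (b1 * (b * b) - 1) • ac (p * q) (B.Psi W) = 0 := by rw [sub_smul, one_smul, ← e1, sub_self]
    rcases smul_eq_zero.mp h3 with h | h
    · linear_combination h
    · exact absurd ((map_eq_zero_iff _ (ac (p * q)).injective).mp h) hW

lemma val_mul_ne {ι : Type*} [Fintype ι] [DecidableEq ι] [Nonempty ι] (a b : (Matrix ι ι F)ˣ) :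
    (a * b : Matrix ι ι F) ≠ 0 := by
  rw [← Units.val_mul]; exact (a * b).ne_zero

lemma y2 {p q : Q} {b : F} (hb : (y p * y q : M8 F) = b • (y q * y p : M8 F)) :
    (y p * (y q * y q) : M8 F) = (b * b) • (y q * y q * y p : M8 F) := by
  rw [← mul_assoc, hb, smul_mul_assoc, mul_assoc, hb, mul_smul_comm, smul_smul, mul_assoc]

/-- scalar `x` -/
lemma x_iff (S : B.SD ac x y c) (q : Q) : (∃ s : F, (x q : M2 F) = s • 1) ↔ ∃ s : F, (y q * y q : M8 F) = s • 1 := by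
  constructor
  · rintro ⟨s, hs⟩
    refine S.py.irr _ fun p => ?_
    obtain ⟨b, b0, hb⟩ := S.py.comm p q
    obtain ⟨b1, h1, h2, h3⟩ := S.bb p q hb
    have h4 : (x p * x q : M2 F) = x q * x p := by rw [hs, mul_smul_comm, smul_mul_assoc, mul_one, one_mul]
    have h5 : b1 = 1 := by
      rw [h4] at h3
      have : (b1 - 1) • (x q * x p : M2 F) = 0 := by rw [sub_smul, one_smul, ← h3, sub_self]
      rcases smul_eq_zero.mp this with h | h
      · linear_combination h
      · exact absurd h (val_mul_ne _ _)
    rw [h5, one_mul] at h2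
    rw [y2 hb, h2, one_smul]
  · rintro ⟨s, hs⟩
    refine S.px.irr _ fun p => ?_
    obtain ⟨b, b0, hb⟩ := S.py.comm p q
    obtain ⟨b1, h1, h2, h3⟩ := S.bb p q hb
    have h4 : (y p * (y q * y q) : M8 F) = y q * y q * y p := by rw [hs, mul_smul_comm, smul_mul_assoc, mul_one, one_mul]
    have h5 : b * b = 1 := by
      rw [y2 hb] at h4
      have : (b * b - 1) • (y q * y q * y p : M8 F) = 0 := by rw [sub_smul, one_smul, h4, sub_self]
      rcases smul_eq_zero.mp this with h | h
      · linear_combination h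
      · rw [← Units.val_mul] at h
        exact absurd h (val_mul_ne _ _)
    rw [h5, mul_one] at h2
    rw [h3, h2, one_smul]

lemma x_sq (S : B.SD ac x y c) (q : Q) : ∃ s : F, (x q * x q : M2 F) = s • 1 := by
  refine S.px.irr _ fun p => ?_
  obtain ⟨b, b0, hb⟩ := S.py.comm p q
  obtain ⟨b1, h1, h2, h3⟩ := S.bb p q hb
  rw [← mul_assoc, h3, smul_mul_assoc, mul_assoc, h3, mul_smul_comm, smul_smul, h1, one_smul, mul_assoc]

lemma y_four (S : B.SD ac x y c) (q : Q) : ∃ s : F, (y q * y q * (y q * y q) : M8 F) = s • 1 := by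
  refine S.py.irr _ fun p => ?_
  obtain ⟨b, b0, hb⟩ := S.py.comm p q
  obtain ⟨b1, h1, h2, h3⟩ := S.bb p q hb
  have h4 : b * b * (b * b) = 1 := by linear_combination (b1 * (b * b) + 1) * h2 - (b * b * b * b) * h1
  rw [← mul_assoc, y2 hb, smul_mul_assoc, mul_assoc _ (y p : M8 F), y2 hb, mul_smul_comm, smul_smul, h4, one_smul, ← mul_assoc _ _ (y p : M8 F)]

end SD
end B7D
end
end E8P
namespace E8P
open LieAlgebra LieModule
set_option linter.unusedSectionVars false

section
variable {F L : Type*} [Field F] [CharZero F] [IsAlgClosed F] [LieRing L] [LieAlgebra F L] [Nontrivial L]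

lemma kil_lie (z x y : L) : killingForm F L ⁅z, x⁆ y = - killingForm F L x ⁅z, y⁆ := by
  rw [← lie_skew z x, map_neg, LinearMap.neg_apply]
  congr 1
  exact traceForm_apply_lie_apply F L L x z y

lemma kil_wsp (D : E8D F L) {m n : V8} (h : m + n ≠ 0) {x y : L} (hx : x ∈ D.wsp m) (hy : y ∈ D.wsp n) :
    killingForm F L x y = 0 := by
  by_contra h0
  apply h
  apply ca_inj
  rw [ca_zero]
  ext i
  have h1 := kil_lie (F := F) (D.h i) x y
  rw [(mem_wsp D).mp hx i, (mem_wsp D).mp hy i, map_smul, map_smul, LinearMap.smul_apply, smul_eq_mul, smul_eq_mul] at h1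
  have h2 : (((ca m i : ℤ) : F) + ((ca n i : ℤ) : F)) * killingForm F L x y = 0 := by linear_combination h1
  have h3 := (mul_eq_zero.mp h2).resolve_right h0
  rw [ca_add, Pi.add_apply]
  exact_mod_cast h3

lemma kil_ne (D : E8D F L) {m : V8} (hm : bf m m = 2) {x y : L} (hx : x ∈ D.wsp m) (hy : y ∈ D.wsp (-m))
    (hx0 : x ≠ 0) (hy0 : y ≠ 0) : killingForm F L x y ≠ 0 := by
  intro h
  haveI := finDim D
  haveI := isKilling D
  apply hx0
  have hk : x ∈ LinearMap.ker (killingForm F L) := by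
    rw [LinearMap.mem_ker]
    refine LinearMap.ext fun z => ?_
    obtain ⟨s, w, hw, rfl⟩ := exists_decomp D z
    rw [map_sum, LinearMap.zero_apply]
    refine Finset.sum_eq_zero fun n _ => ?_
    by_cases hn : m + n = 0
    · have : n = -m := by rw [← add_eq_zero_iff_neg_eq.mp hn]
      subst this
      obtain ⟨c, hc⟩ := wsp_one D (by rw [bf_neg_neg, hm]) hy hy0 (hw _)
      rw [hc, map_smul, h, smul_zero]
    · exact kil_wsp D hn hx (hw n)
  rw [IsKilling.ker_killingForm_eq_bot] at hk
  simpa using hk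

/-- basis of `g₁` -/
def eb (a : Fin 2) (r s : Ix) : MV F := Pi.single (M := fun _ : Fin 2 => M8 F) a (Matrix.single r s 1)

lemma eb_ind (V V' : M2 F) (U U' : M8 F) (hV : V * V' = 1) (hU : U * U' = 1) (p : MV F → Prop) (h0 : p 0)
    (hadd : ∀ W W', p W → p W' → p (W + W')) (hsm : ∀ (c : F) W, p W → p (c • W))
    (h : ∀ a r s, p (tw V U (eb a r s))) (W : MV F) : p W := by
  have h1 : ∀ W, p (tw V U W) := by
    intro W
    have : W = ∑ a, ∑ r, ∑ s, W a r s • eb a r s := by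
      have h2 : ∀ a, ∑ r, ∑ s, W a r s • eb a r s = Pi.single (M := fun _ : Fin 2 => M8 F) a (W a) := by
        intro a
        conv_rhs => rw [Matrix.matrix_eq_sum_single (W a)]
        rw [← LinearMap.single_apply (R := F), map_sum]
        refine Finset.sum_congr rfl fun r _ => ?_
        rw [map_sum]
        refine Finset.sum_congr rfl fun s _ => ?_
        rw [LinearMap.single_apply, eb, ← Pi.single_smul, Matrix.smul_single, smul_eq_mul, mul_one]
      simp only [h2]
      exact (Finset.univ_sum_single W).symm
    rw [this]
    have hs : ∀ {κ : Type} (S : Finset κ) (f : κ → MV F), (∀ k, p (tw V U (f k))) → p (tw V U (∑ k ∈ S, f k)) := by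
      intro κ S f hf
      rw [map_sum]
      exact Finset.sum_induction _ p hadd h0 fun k _ => hf k
    exact hs _ _ fun a => hs _ _ fun r => hs _ _ fun s => by rw [map_smul]; exact hsm _ _ (h a r s)
  have := h1 (tw V' U' W)
  rwa [← Module.End.mul_apply, tw_mul, hV, hU, tw_one] at this

lemma actL_eb (t : Ix) (a r s) : cw (actL (Matrix.single t t (1 : F))) (eb a r s) =
    ((if r = t then (1 : F) else 0) + (if s = t then (1 : F) else 0) - 1 / 4) • eb a r s := by
  ext1 b
  rw [cw_apply, Pi.smul_apply, eb]
  by_cases hb : b = a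
  · subst hb
    rw [Pi.single_eq_same, actL_apply, B7D.act_single, if_pos rfl, sub_smul, add_smul]
    congr 2
    · by_cases h : t = r
      · subst h; simp
      · rw [if_neg h, if_neg (Ne.symm h), zero_smul, zero_smul]
    · by_cases h : s = t
      · subst h; simp
      · rw [if_neg h, zero_smul, zero_smul]
  · rw [Pi.single_eq_of_ne hb, map_zero, smul_zero]

lemma tw_eb (x : Fin 2 → F) (y : Ix → F) (a r s) : tw (Matrix.diagonal x) (Matrix.diagonal y) (eb a r s) =
    (x a * (y r * y s)) • eb a r s := by
  ext1 b
  rw [tw_apply, Pi.smul_apply, eb, Finset.sum_eq_single a]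
  · rw [Pi.single_eq_same, Matrix.diagonal_transpose]
    have h1 : Matrix.diagonal y * Matrix.single r s 1 * Matrix.diagonal y = (y r * y s) • Matrix.single r s (1 : F) := by
      ext i j
      simp only [Matrix.mul_diagonal, Matrix.diagonal_mul, Matrix.smul_apply, smul_eq_mul, Matrix.single_apply]
      by_cases h : r = i ∧ s = j
      · rw [if_pos h, h.1, h.2]; ring
      · rw [if_neg h]; ring
    rw [h1, smul_smul]
    by_cases hb : b = a
    · subst hb
      rw [Pi.single_eq_same, Matrix.diagonal_apply_eq]
    · rw [Pi.single_eq_of_ne hb, Matrix.diagonal_apply_ne _ hb, zero_mul, zero_smul, smul_zero]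
  · intro c _ hc
    rw [Pi.single_eq_of_ne hc]
    simp
  · intro h; exact absurd (Finset.mem_univ _) h

lemma act1_eb (t : Fin 2) (a r s) : act1 (Matrix.single t t (1 : F)) (eb a r s) =
    ((if a = t then (1 : F) else 0) - 1 / 2) • eb a r s := by
  have h1 : Matrix.single t t (1 : F) = Matrix.diagonal (Pi.single t 1) := by rw [Matrix.diagonal_single]
  have h2 : (1 : M8 F) = Matrix.diagonal (fun _ => 1) := by rw [Matrix.diagonal_one]
  rw [act1, LinearMap.sub_apply, LinearMap.smul_apply, Module.End.one_apply, Matrix.trace_single_eq_same, sub_smul]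
  congr 1
  rw [h1, h2, tw_eb, mul_one, mul_one, Pi.single_apply]

namespace B7D
variable (B : B7D F L)

lemma kil_exists : ∃ w1 w2 w3 w4, killingForm F L ⁅B.Psi w1, B.Psi w2⁆ ⁅B.Psi w3, B.Psi w4⁆ ≠ 0 := by
  let n1 : V8 := ![0, 0, 1, 0, 0, 0, 0, 0]
  let n2 : V8 := ![1, 1, 1, 2, 1, 1, 0, 0]
  let n3 : V8 := ![-1, -2, -3, -4, -3, -2, -1, 0]
  let n4 : V8 := ![0, 1, 1, 2, 2, 1, 1, 0]
  have r1 : bf n1 n1 = 2 := by decide +kernel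
  have r2 : bf n2 n2 = 2 := by decide +kernel
  have r3 : bf n3 n3 = 2 := by decide +kernel
  have r4 : bf n4 n4 = 2 := by decide +kernel
  obtain ⟨x1, m1, k1⟩ := root_vec B.D r1
  obtain ⟨x2, m2, k2⟩ := root_vec B.D r2
  obtain ⟨x3, m3, k3⟩ := root_vec B.D r3
  obtain ⟨x4, m4, k4⟩ := root_vec B.D r4
  have j1 := lie_ne B.D r1 r2 (by decide +kernel) m1 m2 k1 k2
  have j2 := lie_ne B.D r3 r4 (by decide +kernel) m3 m4 k3 k4
  have l1 := lie_wsp B.D m1 m2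
  have l2 := lie_wsp B.D m3 m4
  have e : n3 + n4 = -(n1 + n2) := by decide +kernel
  rw [e] at l2
  have := kil_ne B.D (by decide +kernel) l1 l2 j1 j2
  obtain ⟨w1, rfl⟩ := B.wsp_G1 n1 (by decide +kernel) m1
  obtain ⟨w2, rfl⟩ := B.wsp_G1 n2 (by decide +kernel) m2
  obtain ⟨w3, rfl⟩ := B.wsp_G1 n3 (by decide +kernel) m3
  obtain ⟨w4, rfl⟩ := B.wsp_G1 n4 (by decide +kernel) m4
  exact ⟨w1, w2, w3, w4, this⟩

lemma kil_eb (V V' : M2 F) (U U' : M8 F) (hV : V * V' = 1) (hU : U * U' = 1) :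
    ∃ (a : Fin 4 → Fin 2) (r s : Fin 4 → Ix), killingForm F L
      ⁅B.Psi (tw V U (eb (a 0) (r 0) (s 0))), B.Psi (tw V U (eb (a 1) (r 1) (s 1)))⁆
      ⁅B.Psi (tw V U (eb (a 2) (r 2) (s 2))), B.Psi (tw V U (eb (a 3) (r 3) (s 3)))⁆ ≠ 0 := by
  by_contra hn
  push Not at hn
  obtain ⟨w1, w2, w3, w4, hw⟩ := B.kil_exists
  apply hw
  have E := eb_ind V V' U U' hV hU
  refine E (fun w1 => killingForm F L ⁅B.Psi w1, B.Psi w2⁆ ⁅B.Psi w3, B.Psi w4⁆ = 0) (by simp)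
    (by intro W W' h h'; simp only [map_add, add_lie, LinearMap.add_apply, h, h', add_zero])
    (by intro c W h; simp only [map_smul, smul_lie, LinearMap.smul_apply, h, smul_zero]) (fun a1 r1 s1 => ?_) w1
  refine E (fun w2 => killingForm F L ⁅_, B.Psi w2⁆ ⁅B.Psi w3, B.Psi w4⁆ = 0) (by simp)
    (by intro W W' h h'; simp only [map_add, lie_add, LinearMap.add_apply, h, h', add_zero])
    (by intro c W h; simp only [map_smul, lie_smul, LinearMap.smul_apply, h, smul_zero]) (fun a2 r2 s2 => ?_) w2
  refine E (fun w3 => killingForm F L _ ⁅B.Psi w3, B.Psi w4⁆ = 0) (by simp)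
    (by intro W W' h h'; simp only [map_add, add_lie, h, h', add_zero])
    (by intro c W h; simp only [map_smul, smul_lie, h, smul_zero]) (fun a3 r3 s3 => ?_) w3
  refine E (fun w4 => killingForm F L _ ⁅_, B.Psi w4⁆ = 0) (by simp)
    (by intro W W' h h'; simp only [map_add, lie_add, h, h', add_zero])
    (by intro c W h; simp only [map_smul, lie_smul, h, smul_zero]) (fun a4 r4 s4 => ?_) w4
  exact hn ![a1, a2, a3, a4] ![r1, r2, r3, r4] ![s1, s2, s3, s4]

lemma wt_zero (z : L) (w : Fin 4 → L) (l : Fin 4 → F) (h : ∀ i, ⁅z, w i⁆ = l i • w i)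
    (hk : killingForm F L ⁅w 0, w 1⁆ ⁅w 2, w 3⁆ ≠ 0) : ∑ i, l i = 0 := by
  have h1 := kil_lie (F := F) z ⁅w 0, w 1⁆ ⁅w 2, w 3⁆
  simp only [leibniz_lie z, h, smul_lie, lie_smul, map_add, map_smul, LinearMap.add_apply, LinearMap.smul_apply, smul_eq_mul] at h1
  rw [Fin.sum_univ_four]
  have : (l 0 + l 1 + l 2 + l 3) * killingForm F L ⁅w 0, w 1⁆ ⁅w 2, w 3⁆ = 0 := by linear_combination h1
  exact (mul_eq_zero.mp this).resolve_right hk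

lemma wt_one (q : L ≃ₗ⁅F⁆ L) (w : Fin 4 → L) (l : Fin 4 → F) (h : ∀ i, q (w i) = l i • w i)
    (hk : killingForm F L ⁅w 0, w 1⁆ ⁅w 2, w 3⁆ ≠ 0) : ∏ i, l i = 1 := by
  have h1 := killingForm_of_equiv_apply (R := F) q ⁅w 0, w 1⁆ ⁅w 2, w 3⁆
  simp only [LieEquiv.map_lie, h, smul_lie, lie_smul, map_smul, LinearMap.smul_apply, smul_eq_mul] at h1
  rw [Fin.prod_univ_four]
  apply mul_right_cancel₀ hk
  linear_combination h1

lemma prod_count {κ : Type*} [Fintype κ] [DecidableEq κ] (d : κ → F) (r : κ) :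
    d r = ∏ t, d t ^ (if r = t then 1 else 0) := by
  rw [Finset.prod_eq_single r]
  · simp
  · intro t _ ht; rw [if_neg (Ne.symm ht), pow_zero]
  · intro h; exact absurd (Finset.mem_univ _) h

theorem det_rel {q : L ≃ₗ⁅F⁆ L} {x : (M2 F)ˣ} {y : (M8 F)ˣ} {c : F} (h : B.QD q x y c) (V : (M2 F)ˣ) (U : (M8 F)ˣ)
    (a : Fin 2 → F) (d : Ix → F) (hx : (x * V : M2 F) = V * Matrix.diagonal a)
    (hy : (y * U : M8 F) = U * Matrix.diagonal d) : c ^ 4 * ((∏ i, a i) ^ 2 * ∏ r, d r) = 1 := by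
  obtain ⟨al, r, s, hk⟩ := B.kil_eb V (V⁻¹ : (M2 F)ˣ) U (U⁻¹ : (M8 F)ˣ) V.mul_inv U.mul_inv
  let w : Fin 4 → L := fun i => B.Psi (tw V U (eb (al i) (r i) (s i)))
  have c8 : ∀ t, ∑ i, ((if r i = t then 1 else 0) + (if s i = t then 1 else 0)) = 1 := by
    intro t
    have := wt_zero (B.psi ((U : M8 F) * Matrix.single t t 1 * ((U⁻¹ : (M8 F)ˣ) : M8 F))) w _ (fun i => by
      simp only [w]
      rw [psi_Psi', ← tw_act _ _ _ _ U.inv_mul U.mul_inv, actL_eb, map_smul, map_smul]) hk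
    rw [Finset.sum_sub_distrib, Finset.sum_const, Finset.card_univ, Fintype.card_fin] at this
    have h2 : ((∑ i, ((if r i = t then 1 else 0) + (if s i = t then 1 else 0)) : ℕ) : F) = 1 := by
      push_cast
      rw [nsmul_eq_mul] at this
      push_cast at this
      linear_combination this
    exact_mod_cast h2
  have c2 : ∀ t, ∑ i, (if al i = t then 1 else 0) = 2 := by
    intro t
    have := wt_zero (B.psi1 ((V : M2 F) * Matrix.single t t 1 * ((V⁻¹ : (M2 F)ˣ) : M2 F))) w _ (fun i => by
      simp only [w]
      rw [psi1_Psi', ← tw_act1 _ _ _ _ V.inv_mul, act1_eb, map_smul, map_smul]) hk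
    rw [Finset.sum_sub_distrib, Finset.sum_const, Finset.card_univ, Fintype.card_fin] at this
    have h2 : ((∑ i, (if al i = t then 1 else 0) : ℕ) : F) = 2 := by
      push_cast
      rw [nsmul_eq_mul] at this
      push_cast at this
      linear_combination this
    exact_mod_cast h2
  have := wt_one q w _ (fun i => by
    simp only [w]
    rw [h.h1, ← Module.End.mul_apply, tw_mul, hx, hy, ← tw_mul, Module.End.mul_apply, tw_eb, map_smul, map_smul, smul_smul]) hk
  rw [Finset.prod_mul_distrib, Finset.prod_const, Finset.card_univ, Fintype.card_fin, Finset.prod_mul_distrib] at this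
  rw [← this]
  congr 2
  · rw [Finset.prod_congr rfl fun i _ => prod_count a (al i), Finset.prod_comm, ← Finset.prod_pow]
    refine Finset.prod_congr rfl fun t _ => ?_
    rw [Finset.prod_pow_eq_pow_sum, c2]
  · have e : ∀ i, d (r i) * d (s i) = ∏ t, d t ^ ((if r i = t then 1 else 0) + (if s i = t then 1 else 0)) := by
      intro i
      simp only [pow_add, Finset.prod_mul_distrib]
      rw [← prod_count, ← prod_count]
    rw [Finset.prod_congr rfl fun i _ => e i, Finset.prod_comm]
    refine Finset.prod_congr rfl fun t _ => ?_
    rw [Finset.prod_pow_eq_pow_sum, c8, pow_one]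

end B7D
end
end E8P
namespace E8P
open LieAlgebra LieModule
set_option linter.unusedSectionVars false

section
variable {F : Type*} [Field F] [CharZero F] [IsAlgClosed F]

lemma exists_diag {ι : Type*} [Fintype ι] [DecidableEq ι] (y : Matrix ι ι F) (μ : F) (hμ : μ ≠ 0)
    (h : y ^ 4 = μ • 1) : ∃ (U : (Matrix ι ι F)ˣ) (d : ι → F), y * (U : Matrix ι ι F) = U * Matrix.diagonal d := by
  set f : Module.End F (ι → F) := Matrix.toLin' y with hf
  have hs : f.IsSemisimple := by
    refine Module.End.isSemisimple_of_squarefree_aeval_eq_zero (p := Polynomial.X ^ 4 - Polynomial.C μ)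
      (Polynomial.separable_X_pow_sub_C μ (by norm_num) hμ).squarefree ?_
    rw [map_sub, map_pow, Polynomial.aeval_X, Polynomial.aeval_C, hf]
    change (Matrix.toLinAlgEquiv' y) ^ 4 - _ = 0
    rw [← map_pow, h, map_smul, map_one, Algebra.algebraMap_eq_smul_one, sub_self]
  obtain ⟨b0, hb0⟩ : ∃ b0 : Module.Basis (Fin (Module.finrank F (ι → F))) F (ι → F),
      ∀ i, f (b0 i) = gbw f i • b0 i := by
    refine ⟨gbb f, fun i => ?_⟩
    have := gbb_mem f i
    rw [hs.isFinitelySemisimple.maxGenEigenspace_eq_eigenspace] at this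
    exact Module.End.mem_eigenspace_iff.mp this
  have hc : Module.finrank F (ι → F) = Fintype.card ι := Module.finrank_fintype_fun_eq_card F
  let e : Fin (Module.finrank F (ι → F)) ≃ ι := (finCongr hc).trans (Fintype.equivFin ι).symm
  let b := b0.reindex e
  have hb : ∀ i, f (b i) = gbw f (e.symm i) • b i := by
    intro i
    simp only [b, Module.Basis.reindex_apply]
    exact hb0 _
  refine ⟨⟨(Pi.basisFun F ι).toMatrix b, b.toMatrix (Pi.basisFun F ι), Module.Basis.toMatrix_mul_toMatrix_flip _ _,
    Module.Basis.toMatrix_mul_toMatrix_flip _ _⟩, fun i => gbw f (e.symm i), ?_⟩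
  ext i j
  rw [Matrix.mul_diagonal]
  change _ = b j i * _
  have := congrFun (hb j) i
  rw [hf, Matrix.toLin'_apply, Pi.smul_apply, smul_eq_mul] at this
  rw [mul_comm, ← this, Matrix.mul_apply]
  rfl

lemma int_I {I : F} (hI : I * I = -1) (a b : ℤ) (h : (a : F) + I * b = 0) : a = 0 ∧ b = 0 := by
  have h1 : ((a * a + b * b : ℤ) : F) = 0 := by
    push_cast
    linear_combination (a - I * b : F) * h + b * b * hI
  have h2 : a * a + b * b = 0 := by exact_mod_cast h1
  constructor <;> nlinarith [mul_self_nonneg a, mul_self_nonneg b]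

lemma det_num (d : Ix → F) (μ : F) (hμ : μ ≠ 0) (hd : ∀ r, d r ^ 4 = μ)
    (h1 : (∃ s, ∀ r, d r = s) ∨ ∑ r, d r = 0) (h2 : (∃ s, ∀ r, d r ^ 2 = s) ∨ ∑ r, d r ^ 2 = 0) :
    ∏ r, d r = μ ^ 2 := by
  rcases h1 with ⟨s, h1⟩ | h1
  · rw [Finset.prod_congr rfl fun r _ => h1 r, Finset.prod_const, Finset.card_univ, ← hd none, h1 none, ← pow_mul]
    simp [Ix]
  obtain ⟨I, hI⟩ := exists_I (F := F)
  set s := d none with hs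
  have hs4 : s ^ 4 = μ := hd none
  have s0 : s ≠ 0 := by rintro h; rw [h] at hs4; apply hμ; rw [← hs4]; ring
  have hj : ∀ r, ∃ j : Fin 4, d r = s * I ^ (j : ℕ) := by
    intro r
    have h4 : (d r - s) * ((d r + s) * ((d r - s * I) * (d r + s * I))) = 0 := by
      linear_combination hd r - hs4 + (s ^ 4 - s ^ 2 * d r ^ 2) * hI
    rcases mul_eq_zero.mp h4 with h | h
    · exact ⟨0, by simp; linear_combination h⟩
    rcases mul_eq_zero.mp h with h | h
    · refine ⟨2, ?_⟩
      change d r = s * I ^ 2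
      linear_combination h - s * hI
    rcases mul_eq_zero.mp h with h | h
    · refine ⟨1, ?_⟩
      change d r = s * I ^ 1
      linear_combination h
    · refine ⟨3, ?_⟩
      change d r = s * I ^ 3
      linear_combination h - s * I * hI
  choose j hj using hj
  let n : Fin 4 → ℕ := fun k => (Finset.univ.filter fun r => j r = k).card
  have sumF : ∀ f : Fin 4 → F, ∑ r, f (j r) = n 0 * f 0 + n 1 * f 1 + n 2 * f 2 + n 3 * f 3 := by
    intro f
    rw [← Finset.sum_fiberwise Finset.univ j, Finset.sum_congr rfl (fun k _ => Finset.sum_congr rfl (g := fun _ => f k)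
      (fun r hr => by rw [(Finset.mem_filter.mp hr).2])), Fin.sum_univ_four]
    simp only [Finset.sum_const, nsmul_eq_mul, n]
  have sumN : ∀ f : Fin 4 → ℕ, ∑ r, f (j r) = n 0 * f 0 + n 1 * f 1 + n 2 * f 2 + n 3 * f 3 := by
    intro f
    have := sumF (fun k => (f k : F))
    exact_mod_cast this
  have t0 : n 0 + n 1 + n 2 + n 3 = 8 := by
    have := sumN (fun _ => 1)
    simp [Ix] at this
    omega
  have t1 : (n 0 : ℤ) - n 2 = 0 ∧ (n 1 : ℤ) - n 3 = 0 := by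
    apply int_I hI
    have := sumF (fun k => I ^ (k : ℕ))
    have h3 : s * ∑ r, I ^ (j r : ℕ) = 0 := by
      rw [Finset.mul_sum, ← h1]; exact Finset.sum_congr rfl fun r _ => (hj r).symm
    rw [this] at h3
    have h5 := (mul_eq_zero.mp h3).resolve_left s0
    have e2 : I ^ ((2 : Fin 4) : ℕ) = -1 := by change I ^ 2 = -1; rw [pow_two, hI]
    have e3 : I ^ ((3 : Fin 4) : ℕ) = -I := by change I ^ 3 = -I; linear_combination I * hI
    rw [e2, e3] at h5
    simp at h5
    push_cast
    linear_combination h5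
  have t2 : ((n 0 : ℤ) - n 1 + n 2 - n 3 = 0) ∨ ((n 0 : ℤ) - n 1 + n 2 - n 3 = 8) := by
    have := sumF (fun k => (-1) ^ (k : ℕ))
    have e2 : (-1 : F) ^ ((2 : Fin 4) : ℕ) = 1 := by change (-1 : F) ^ 2 = 1; norm_num
    have e3 : (-1 : F) ^ ((3 : Fin 4) : ℕ) = -1 := by change (-1 : F) ^ 3 = -1; norm_num
    rw [e2, e3] at this
    simp only [Fin.val_zero, Fin.val_one, pow_zero, pow_one, mul_one, mul_neg] at this
    have e : ∀ r, d r ^ 2 = s ^ 2 * (-1) ^ (j r : ℕ) := by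
      intro r
      rw [hj r, mul_pow, ← pow_mul, mul_comm _ 2, pow_mul, pow_two I, hI]
    rcases h2 with ⟨s', h2⟩ | h2
    · right
      have e1 : ∀ r, (-1 : F) ^ (j r : ℕ) = 1 := by
        intro r
        have := e r
        rw [h2 r, ← h2 none] at this
        apply mul_left_cancel₀ (pow_ne_zero 2 s0)
        rw [← this, mul_one]
      rw [Finset.sum_congr rfl fun r _ => e1 r] at this
      simp [Ix] at this
      have h8 : (((n 0 : ℤ) - n 1 + n 2 - n 3 : ℤ) : F) = (8 : ℤ) := by
        push_cast
        linear_combination -this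
      exact_mod_cast h8
    · left
      have h3 : s ^ 2 * ∑ r, (-1) ^ (j r : ℕ) = 0 := by
        rw [Finset.mul_sum, ← h2]; exact Finset.sum_congr rfl fun r _ => (e r).symm
      have h5 := (mul_eq_zero.mp h3).resolve_left (pow_ne_zero 2 s0)
      have h8 : (((n 0 : ℤ) - n 1 + n 2 - n 3 : ℤ) : F) = (0 : ℤ) := by
        push_cast
        linear_combination h5 - this
      exact_mod_cast h8
  have t3 : ∃ k, ∑ r, (j r : ℕ) = 4 * k := by
    have := sumN (fun k => (k : ℕ))
    rw [this]
    change ∃ k, n 0 * 0 + n 1 * 1 + n 2 * 2 + n 3 * 3 = 4 * k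
    rcases t2 with t2 | t2
    · exact ⟨3, by omega⟩
    · exact ⟨2, by omega⟩
  obtain ⟨k, hk⟩ := t3
  rw [Finset.prod_congr rfl fun r _ => hj r, Finset.prod_mul_distrib, Finset.prod_pow_eq_pow_sum, hk, pow_mul,
    show I ^ 4 = 1 by linear_combination (I ^ 2 - 1) * hI, one_pow, mul_one, Finset.prod_const, Finset.card_univ, ← hs4]
  simp [Ix, ← pow_mul]

end
end E8P
namespace E8P
open LieAlgebra LieModule
set_option linter.unusedSectionVars false

section
variable {F L : Type*} [Field F] [CharZero F] [IsAlgClosed F] [LieRing L] [LieAlgebra F L] [Nontrivial L]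

lemma diag_scal {ι : Type*} [Fintype ι] [DecidableEq ι] {d : ι → F} {s : F}
    (h : Matrix.diagonal d = s • (1 : Matrix ι ι F)) (r : ι) : d r = s := by
  have := congrFun (congrFun h r) r
  simpa using this

namespace B7D.SD
variable {B : B7D F L} {Q : Type*} [CommGroup Q] {ac : Q → L ≃ₗ⁅F⁆ L} {x : Q → (M2 F)ˣ} {y : Q → (M8 F)ˣ} {c : Q → F}

lemma scal_ne {ι : Type*} [Fintype ι] [DecidableEq ι] [Nonempty ι] {u : (Matrix ι ι F)ˣ} {s : F}
    (h : (u : Matrix ι ι F) = s • 1) : s ≠ 0 := by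
  rintro rfl
  rw [zero_smul] at h
  exact u.ne_zero h

lemma four_rel (S : B.SD ac x y c) (q : Q) {ν μ : F} (hν : (x q * x q : M2 F) = ν • 1)
    (hμ : (y q * y q * (y q * y q) : M8 F) = μ • 1) : c q ^ 4 * (ν ^ 2 * μ ^ 2) = 1 := by
  have ν0 : ν ≠ 0 := scal_ne (u := x q * x q) (by rw [Units.val_mul, hν])
  have μ0 : μ ≠ 0 := scal_ne (u := y q * y q * (y q * y q)) (by simp only [Units.val_mul, hμ])
  obtain ⟨V, a, hV⟩ := exists_diag (x q : M2 F) (ν ^ 2) (pow_ne_zero 2 ν0) (by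
    rw [show (x q : M2 F) ^ 4 = x q * x q * (x q * x q) by simp only [pow_succ, pow_zero, one_mul, mul_assoc],
      hν, smul_mul_smul_comm, mul_one, pow_two])
  obtain ⟨U, d, hU⟩ := exists_diag (y q : M8 F) μ μ0 (by
    rw [← hμ]; simp only [pow_succ, pow_zero, one_mul, mul_assoc])
  have hrel := B.det_rel (S.qd q) V U a d hV hU
  have ha : (∏ i, a i) ^ 2 = ν ^ 2 := by
    have h1 := congrArg Matrix.det hV
    rw [Matrix.det_mul, Matrix.det_mul, Matrix.det_diagonal, mul_comm] at h1
    have h2 := mul_left_cancel₀ ((Matrix.isUnit_iff_isUnit_det _).mp V.isUnit).ne_zero h1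
    have h3 := congrArg Matrix.det hν
    rw [Matrix.det_mul, Matrix.det_smul, Matrix.det_one, Fintype.card_fin, mul_one] at h3
    rw [← h2, pow_two, h3]
  have conj : Matrix.diagonal d = (↑U⁻¹ : M8 F) * y q * U := by
    rw [mul_assoc, hU, Units.inv_mul_cancel_left]
  have conj2 : Matrix.diagonal (fun r => d r ^ 2) = (↑U⁻¹ : M8 F) * (y q * y q) * U := by
    rw [show (fun r => d r ^ 2) = fun r => d r * d r from funext fun r => pow_two _, ← Matrix.diagonal_mul_diagonal, conj]
    simp only [mul_assoc, Units.mul_inv_cancel_left]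
  have conj4 : Matrix.diagonal (fun r => d r ^ 4) = (↑U⁻¹ : M8 F) * (y q * y q * (y q * y q)) * U := by
    rw [show (fun r => d r ^ 4) = fun r => d r ^ 2 * d r ^ 2 from funext fun r => by ring, ← Matrix.diagonal_mul_diagonal, conj2]
    simp only [mul_assoc, Units.mul_inv_cancel_left]
  have scal : ∀ s : F, (↑U⁻¹ : M8 F) * (s • 1) * U = s • 1 := by
    intro s; rw [mul_smul_comm, mul_one, smul_mul_assoc, Units.inv_mul]
  have trc : ∀ X : M8 F, ((↑U⁻¹ : M8 F) * X * U).trace = X.trace := by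
    intro X; rw [Matrix.trace_mul_comm, Units.mul_inv_cancel_left]
  have hd : ∏ r, d r = μ ^ 2 := by
    refine det_num d μ μ0 (fun r => ?_) ?_ ?_
    · rw [hμ, scal] at conj4
      exact diag_scal conj4 r
    · by_cases h : ∃ s : F, (y q : M8 F) = s • 1
      · left
        obtain ⟨s, h⟩ := h
        rw [h, scal] at conj
        exact ⟨s, diag_scal conj⟩
      · right
        have := congrArg Matrix.trace conj
        rwa [trc, S.py.trace_zero q h, Matrix.trace_diagonal] at this
    · by_cases h : ∃ s : F, (y q * y q : M8 F) = s • 1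
      · left
        obtain ⟨s, h⟩ := h
        rw [h, scal] at conj2
        exact ⟨s, diag_scal conj2⟩
      · right
        have := congrArg Matrix.trace conj2
        obtain ⟨s, s0, hs⟩ := S.py.mul' q q
        have h3 := S.py.trace_zero (q * q) (by
          rintro ⟨t, ht⟩
          apply h
          rw [ht] at hs
          exact ⟨s⁻¹ * t, by rw [mul_smul, hs, smul_smul, inv_mul_cancel₀ s0, one_smul]⟩)
        rw [hs, Matrix.trace_smul, smul_eq_mul] at h3
        rwa [trc, (mul_eq_zero.mp h3).resolve_left s0, Matrix.trace_diagonal] at this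
  rw [← ha, ← hd, hrel]

lemma one_act (S : B.SD ac x y c) (z : L) : ac 1 z = z := by
  have := S.mul 1 1 z
  rw [mul_one] at this
  exact ((ac 1).injective this).symm

lemma ext2 (S : B.SD ac x y c) (hinj : ∀ p q, (∀ z, ac p z = ac q z) → p = q) {p q : Q}
    (h8 : ∀ X, ac p (B.psi X) = ac q (B.psi X)) (h2 : ∀ X, ac p (B.psi1 X) = ac q (B.psi1 X))
    (h1 : ∀ W, ac p (B.Psi W) = ac q (B.Psi W)) : p = q := by
  have e : ∀ z, ac q (ac (q⁻¹ * p) z) = ac p z := fun z => by rw [← S.mul, mul_inv_cancel_left]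
  have k : ∀ z, ac p z = ac q z → ac (q⁻¹ * p) z = z := by
    intro z hz
    rw [← e] at hz
    exact (ac q).injective hz
  have := B.ext_id (a := ac (q⁻¹ * p)) (fun X => k _ (h8 X)) (fun X => k _ (h2 X)) (fun X => k _ (h1 X))
  refine hinj p q fun z => ?_
  rw [← e, this]

lemma pow_four (S : B.SD ac x y c) (hinj : ∀ p q, (∀ z, ac p z = ac q z) → p = q) (q : Q) : q ^ 4 = 1 := by
  have e : ∀ z, ac (q ^ 4) z = ac q (ac q (ac q (ac q z))) := by
    intro z
    rw [← S.mul, ← S.mul, ← S.mul]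
    congr 1
    simp only [pow_succ, pow_zero, one_mul, mul_assoc]
  obtain ⟨ν, hν⟩ := S.x_sq q
  obtain ⟨μ, hμ⟩ := S.y_four q
  have hr := S.four_rel q hν hμ
  have h2 : ∀ z, ac (q ^ 4) z = ac (q * q) (ac (q * q) z) := by
    intro z; rw [e, S.mul, S.mul]
  have hx4 : (x q * x q * (x q * x q) : M2 F) = (ν * ν) • 1 := by
    rw [hν, smul_mul_smul_comm, mul_one]
  refine S.ext2 hinj (fun X => ?_) (fun X => ?_) (fun W => ?_)
  · rw [S.one_act, e, (S.qd q).h8, (S.qd q).h8, (S.qd q).h8, (S.qd q).h8]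
    congr 1
    have : (y q * (y q * (y q * (y q * X * (↑(y q)⁻¹ : M8 F)) * (↑(y q)⁻¹ : M8 F)) * (↑(y q)⁻¹ : M8 F)) * (↑(y q)⁻¹ : M8 F) : M8 F)
        = (y q * y q * (y q * y q) : M8 F) * X * (↑(y q)⁻¹ * ↑(y q)⁻¹ * (↑(y q)⁻¹ * ↑(y q)⁻¹) : M8 F) := by
      simp only [mul_assoc]
    rw [this, hμ, smul_mul_assoc, one_mul, smul_mul_assoc, ← mul_smul_comm, ← one_mul (_ * _ * (_ * _) : M8 F), ← smul_mul_assoc, ← hμ]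
    simp [mul_assoc]
  · rw [S.one_act, e, (S.qd q).h2, (S.qd q).h2, (S.qd q).h2, (S.qd q).h2]
    congr 1
    have : (x q * (x q * (x q * (x q * X * (↑(x q)⁻¹ : M2 F)) * (↑(x q)⁻¹ : M2 F)) * (↑(x q)⁻¹ : M2 F)) * (↑(x q)⁻¹ : M2 F) : M2 F)
        = (x q * x q * (x q * x q) : M2 F) * X * (↑(x q)⁻¹ * ↑(x q)⁻¹ * (↑(x q)⁻¹ * ↑(x q)⁻¹) : M2 F) := by
      simp only [mul_assoc]
    rw [this, hx4, smul_mul_assoc, one_mul, smul_mul_assoc, ← mul_smul_comm, ← one_mul (_ * _ * (_ * _) : M2 F), ← smul_mul_assoc, ← hx4]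
    simp [mul_assoc]
  · have h1 : ∀ a W, ac q (a • B.Psi W) = (a * c q) • B.Psi (tw (x q) (y q) W) := by
      intro a W; rw [map_smul, (S.qd q).h1, smul_smul]
    rw [S.one_act, e, (S.qd q).h1, h1, h1, h1]
    simp only [← Module.End.mul_apply, tw_mul, ← mul_assoc]
    simp only [mul_assoc] at hx4 hμ ⊢
    rw [hx4, hμ, tw_smul, tw_one, LinearMap.smul_apply, Module.End.one_apply, map_smul, smul_smul]
    conv_rhs => rw [← one_smul F (B.Psi W)]
    congr 1
    linear_combination hr

end B7D.SD
end
end E8P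
namespace E8P
open LieAlgebra LieModule
set_option linter.unusedSectionVars false

section
variable {F L : Type*} [Field F] [CharZero F] [IsAlgClosed F] [LieRing L] [LieAlgebra F L] [Nontrivial L]

lemma fourth_root {I s : F} (hI : I * I = -1) (hs : s ^ 4 = 1) : ∃ k : ℕ, s = I ^ k := by
  have h : (s - 1) * ((s + 1) * ((s - I) * (s + I))) = 0 := by linear_combination hs - (s ^ 2 - 1) * hI
  rcases mul_eq_zero.mp h with h | h
  · exact ⟨0, by linear_combination h⟩
  rcases mul_eq_zero.mp h with h | h
  · exact ⟨2, by linear_combination h - hI⟩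
  rcases mul_eq_zero.mp h with h | h
  · exact ⟨1, by linear_combination h⟩
  · exact ⟨3, by linear_combination h - I * hI⟩

namespace B7D.SD
variable {B : B7D F L} {Q : Type*} [CommGroup Q] {ac : Q → L ≃ₗ⁅F⁆ L} {x : Q → (M2 F)ˣ} {y : Q → (M8 F)ˣ} {c : Q → F}
  {g : L ≃ₗ⁅F⁆ L} {I : F} {t : Q}

lemma pow_psi (S : B.SD ac x y c) (hI : I * I = -1) (hg : IsTh B.D g I) (ht : ac t = g) (k : ℕ) (X : M8 F) :
    ac (t ^ k) (B.psi X) = B.psi X := by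
  induction k with
  | zero => rw [pow_zero, S.one_act]
  | succ k ih => rw [pow_succ, S.mul, ht, B.th_psi X hI hg, ih]

lemma pow_psi1 (S : B.SD ac x y c) (hI : I * I = -1) (hg : IsTh B.D g I) (ht : ac t = g) (k : ℕ) (X : M2 F) :
    ac (t ^ k) (B.psi1 X) = B.psi1 X := by
  induction k with
  | zero => rw [pow_zero, S.one_act]
  | succ k ih => rw [pow_succ, S.mul, ht, B.th_psi1 X hI hg, ih]

lemma pow_Psi (S : B.SD ac x y c) (hI : I * I = -1) (hg : IsTh B.D g I) (ht : ac t = g) (k : ℕ) (X : MV F) :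
    ac (t ^ k) (B.Psi X) = I ^ k • B.Psi X := by
  induction k with
  | zero => rw [pow_zero, S.one_act, pow_zero, one_smul]
  | succ k ih => rw [pow_succ, S.mul, ht, B.th_Psi X hI hg, map_smul, ih, smul_smul, pow_succ, mul_comm]

lemma y_scal_iff (S : B.SD ac x y c) (hinj : ∀ p q, (∀ z, ac p z = ac q z) → p = q)
    (hI : I * I = -1) (hg : IsTh B.D g I) (ht : ac t = g) (q : Q) :
    (∃ s : F, (y q : M8 F) = s • 1) ↔ ∃ k : ℕ, t ^ k = q := by
  constructor
  · rintro ⟨η, hη⟩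
    have hyy : (y q * y q : M8 F) = (η * η) • 1 := by rw [hη, smul_mul_smul_comm, mul_one]
    obtain ⟨ξ, hξ⟩ := (S.x_iff q).mpr ⟨_, hyy⟩
    have hr := S.four_rel q (ν := ξ * ξ) (μ := η * η * (η * η)) (by rw [hξ, smul_mul_smul_comm, mul_one])
      (by rw [hyy, smul_mul_smul_comm, mul_one])
    obtain ⟨k, hk⟩ := fourth_root (s := c q * (ξ * (η * η))) hI (by linear_combination hr)
    refine ⟨k, (S.ext2 hinj (fun X => ?_) (fun X => ?_) (fun W => ?_)).symm⟩
    · rw [S.pow_psi hI hg ht, (S.qd q).h8]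
      congr 1
      rw [show (y q * X : M8 F) = X * y q by rw [hη, smul_mul_assoc, mul_smul_comm, one_mul, mul_one], Units.mul_inv_cancel_right]
    · rw [S.pow_psi1 hI hg ht, (S.qd q).h2]
      congr 1
      rw [show (x q * X : M2 F) = X * x q by rw [hξ, smul_mul_assoc, mul_smul_comm, one_mul, mul_one], Units.mul_inv_cancel_right]
    · rw [S.pow_Psi hI hg ht, (S.qd q).h1, hξ, hη, tw_smul, tw_one, LinearMap.smul_apply, Module.End.one_apply, map_smul,
        smul_smul, hk]
  · rintro ⟨k, rfl⟩
    refine scalar_of_comm _ fun X => ?_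
    have h1 := S.pow_psi hI hg ht k X
    rw [(S.qd _).h8, ← sub_eq_zero, ← map_sub] at h1
    have h2 := B.psi_diff _ h1 (by rw [Matrix.trace_sub, trace_conj, sub_self])
    rw [sub_eq_zero] at h2
    conv_lhs => rw [← h2]
    rw [Units.inv_mul_cancel_right]

open Classical in
lemma counts [Fintype Q] (S : B.SD ac x y c) (hinj : ∀ p q, (∀ z, ac p z = ac q z) → p = q)
    (hI : I * I = -1) (hg : IsTh B.D g I) (ht : ac t = g) (ho : orderOf t = 4) :
    Fintype.card Q = 256 ∧ (Finset.univ.filter fun q : Q => q * q = 1).card = 32 := by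
  have hN : (Finset.univ.filter fun q : Q => ∃ s : F, (y q : M8 F) = s • 1).card = 4 := by
    have : (Finset.univ.filter fun q : Q => ∃ s : F, (y q : M8 F) = s • 1) = (Finset.range 4).image (fun k => t ^ k) := by
      ext q
      simp only [Finset.mem_filter, Finset.mem_univ, true_and, Finset.mem_image, Finset.mem_range]
      rw [S.y_scal_iff hinj hI hg ht]
      constructor
      · rintro ⟨k, rfl⟩
        exact ⟨k % 4, Nat.mod_lt _ (by norm_num), by rw [← ho, pow_mod_orderOf]⟩
      · rintro ⟨k, _, h⟩
        exact ⟨k, h⟩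
    rw [this, Finset.card_image_of_injOn, Finset.card_range]
    have := pow_injOn_Iio_orderOf (x := t)
    rw [ho] at this
    intro a ha b hb hab
    exact this (by simpa using ha) (by simpa using hb) hab
  have c1 : Fintype.card Q = 256 := by
    rw [S.py.count, hN]
    have h8 : Fintype.card Ix = 8 := by decide
    rw [h8]; norm_num
  refine ⟨c1, ?_⟩
  have c2 := S.px.count
  rw [c1, Fintype.card_fin] at c2
  have t4 : t ^ 4 = 1 := by rw [← ho, pow_orderOf_eq_one]
  have t2 : t ^ 2 ≠ 1 := by
    intro h
    have := orderOf_dvd_of_pow_eq_one h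
    rw [ho] at this
    norm_num at this
  have hx : ∀ q : Q, (∃ s : F, (x q : M2 F) = s • 1) ↔ q * q = 1 ∨ q * q = t ^ 2 := by
    intro q
    rw [S.x_iff]
    obtain ⟨s, s0, hs⟩ := S.py.mul' q q
    have e : (∃ s : F, (y q * y q : M8 F) = s • 1) ↔ ∃ s : F, (y (q * q) : M8 F) = s • 1 := by
      rw [hs]
      constructor
      · rintro ⟨r, hr⟩
        exact ⟨s * r, by rw [hr, smul_smul]⟩
      · rintro ⟨r, hr⟩
        exact ⟨s⁻¹ * r, by rw [mul_smul, ← hr, smul_smul, inv_mul_cancel₀ s0, one_smul]⟩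
    rw [e, S.y_scal_iff hinj hI hg ht]
    constructor
    · rintro ⟨k, hk⟩
      have h4 := S.pow_four hinj q
      have hk2 : t ^ (k * 2) = 1 := by
        rw [pow_mul, hk, ← h4, ← pow_two, ← pow_mul]
      have h5 := orderOf_dvd_of_pow_eq_one hk2
      rw [ho] at h5
      have h6 : k % 4 = 0 ∨ k % 4 = 2 := by omega
      rw [← hk, ← pow_mod_orderOf, ho]
      rcases h6 with h | h
      · left; rw [h, pow_zero]
      · right; rw [h]
    · rintro (h | h)
      · exact ⟨0, by rw [h, pow_zero]⟩
      · exact ⟨2, h.symm⟩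
  have hsplit : (Finset.univ.filter fun q : Q => ∃ s : F, (x q : M2 F) = s • 1).card
      = (Finset.univ.filter fun q : Q => q * q = 1).card + (Finset.univ.filter fun q : Q => q * q = t ^ 2).card := by
    rw [← Finset.card_union_of_disjoint]
    · congr 1
      ext q
      simp only [Finset.mem_filter, Finset.mem_univ, true_and, Finset.mem_union, hx]
    · rw [Finset.disjoint_filter]
      intro q _ h1 h2
      exact t2 (by rw [← h2, h1])
  have hbij : (Finset.univ.filter fun q : Q => q * q = t ^ 2).card = (Finset.univ.filter fun q : Q => q * q = 1).card := by
    have : (Finset.univ.filter fun q : Q => q * q = t ^ 2) = (Finset.univ.filter fun q : Q => q * q = 1).image (fun q => t * q) := by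
      ext q
      simp only [Finset.mem_filter, Finset.mem_univ, true_and, Finset.mem_image]
      constructor
      · intro h
        refine ⟨t⁻¹ * q, ?_, by rw [mul_inv_cancel_left]⟩
        rw [mul_mul_mul_comm, h, pow_two]; group
      · rintro ⟨p, hp, rfl⟩
        rw [mul_mul_mul_comm, hp, mul_one, pow_two]
    rw [this, Finset.card_image_of_injective _ (mul_right_injective t)]
  rw [hsplit, hbij] at c2
  omega

end B7D.SD
end
end E8P
namespace E8P

lemma tors (n : ℕ) (h : n = 2 ∨ n = 4) : Nat.card {a : ZMod n // a + a = 0} = 2 := by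
  rcases h with rfl | rfl <;> · rw [Nat.card_eq_fintype_card]; decide

theorem grp (G : Type*) [CommGroup G] [Fintype G] [DecidableEq G] (hc : Fintype.card G = 256) (h4 : ∀ q : G, q ^ 4 = 1)
    (h2 : (Finset.univ.filter fun q : G => q * q = 1).card = 32) :
    Nonempty (G ≃* Multiplicative ((Fin 3 → ZMod 4) × (Fin 2 → ZMod 2))) := by
  classical
  obtain ⟨ι, _, n, hn, ⟨e⟩⟩ := CommGroup.equiv_prod_multiplicative_zmod_of_finite G
  have hn4 : ∀ i, n i = 2 ∨ n i = 4 := by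
    intro i
    have h := h4 (e.symm (Pi.mulSingle i (Multiplicative.ofAdd 1)))
    rw [← map_pow, map_eq_one_iff _ e.symm.injective, ← Pi.mulSingle_pow, Pi.mulSingle_eq_one_iff, ← ofAdd_nsmul,
      ofAdd_eq_one, nsmul_one, ZMod.natCast_eq_zero_iff] at h
    have hi := hn i
    have : n i ≤ 4 := Nat.le_of_dvd (by norm_num) h
    interval_cases n i
    · exact Or.inl rfl
    · norm_num at h
    · exact Or.inr rfl
  have cι : Fintype.card ι = 5 := by
    have E : {q : G // q * q = 1} ≃ ((i : ι) → {a : ZMod (n i) // a + a = 0}) :=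
      (e.toEquiv.subtypeEquiv (q := fun f => ∀ i, (f i).toAdd + (f i).toAdd = 0) (by
        intro q
        rw [← map_eq_one_iff _ e.injective, map_mul, funext_iff]
        rfl)).trans (Equiv.subtypePiEquivPi (p := fun {i} (a : Multiplicative (ZMod (n i))) => a.toAdd + a.toAdd = 0))
    have h := Nat.card_congr E
    rw [Nat.card_pi, Finset.prod_congr rfl (fun i _ => tors (n i) (hn4 i)), Finset.prod_const, Nat.card_eq_fintype_card,
      Fintype.card_subtype, h2, Finset.card_univ] at h
    exact (Nat.pow_right_injective (le_refl 2) (h.symm.trans (by norm_num : 32 = 2 ^ 5)))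
  have cG : ∏ i, n i = 256 := by
    have h := Nat.card_congr e.toEquiv
    rw [Nat.card_pi, Nat.card_eq_fintype_card, hc] at h
    rw [h]
    refine Finset.prod_congr rfl fun i _ => ?_
    exact ((Nat.card_congr Multiplicative.toAdd).trans (Nat.card_zmod _)).symm
  have c4 : Fintype.card {i // n i = 4} = 3 := by
    have h : ∀ i, n i = 2 * (if n i = 4 then 2 else 1) := by
      intro i; rcases hn4 i with h | h <;> rw [h] <;> norm_num
    rw [Finset.prod_congr rfl (fun i _ => h i), Finset.prod_mul_distrib, Finset.prod_const, Finset.card_univ, cι,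
      Finset.prod_ite, Finset.prod_const, Finset.prod_const_one, mul_one] at cG
    rw [Fintype.card_subtype]
    refine Nat.pow_right_injective (le_refl 2) ?_
    change 2 ^ _ = 2 ^ 3
    omega
  have c2 : Fintype.card {i // n i = 2} = 2 := by
    have h := Fintype.card_subtype_compl (fun i => n i = 4)
    rw [c4, cι] at h
    rw [Fintype.card_congr (Equiv.subtypeEquivRight (q := fun i => ¬ n i = 4) (by
      intro i; rcases hn4 i with h | h <;> rw [h] <;> norm_num)), h]
  have e4 : Fin 3 ≃ {i // n i = 4} := Fintype.equivOfCardEq (by rw [c4, Fintype.card_fin])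
  have e2 : Fin 2 ≃ {i // n i = 2} := Fintype.equivOfCardEq (by rw [c2, Fintype.card_fin])
  let φ : G →* Multiplicative ((Fin 3 → ZMod 4) × (Fin 2 → ZMod 2)) :=
    { toFun := fun q => Multiplicative.ofAdd (fun j => ZMod.ringEquivCongr (e4 j).2 (e q (e4 j)).toAdd,
        fun j => ZMod.ringEquivCongr (e2 j).2 (e q (e2 j)).toAdd)
      map_one' := by
        rw [ofAdd_eq_one]
        ext j <;> simp
      map_mul' := by
        intro p q
        rw [← ofAdd_add]
        congr 1
        ext j <;> simp }
  have hφ : Function.Injective φ := by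
    rw [injective_iff_map_eq_one]
    intro q hq
    have hq' := ofAdd_eq_one.mp hq
    have k4 := fun j => congrFun (congrArg Prod.fst hq') j
    have k2 := fun j => congrFun (congrArg Prod.snd hq') j
    rw [← map_eq_one_iff _ e.injective]
    funext i
    rcases hn4 i with h | h
    · have := k2 (e2.symm ⟨i, h⟩)
      have := (map_eq_zero_iff _ (ZMod.ringEquivCongr _).injective).mp this
      rw [e2.apply_symm_apply] at this
      exact this
    · have := k4 (e4.symm ⟨i, h⟩)
      have := (map_eq_zero_iff _ (ZMod.ringEquivCongr _).injective).mp this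
      rw [e4.apply_symm_apply] at this
      exact this
  have hb : Function.Bijective φ := by
    rw [Nat.bijective_iff_injective_and_card]
    refine ⟨hφ, ?_⟩
    rw [Nat.card_eq_fintype_card, hc, Nat.card_congr Multiplicative.toAdd, Nat.card_prod, Nat.card_fun, Nat.card_fun]
    simp
  exact ⟨MulEquiv.ofBijective φ hb⟩
end E8P

open LieAlgebra

theorem stmt7 (F : Type) [Field F] [IsAlgClosed F] [CharZero F]
    (Q : Subgroup ↥(lieAut F (LieAlgebra.e₈ F))) (hQ : IsMaximalFiniteAbelian Q)
    (h : ∃ θ ∈ Q, orderOf θ = 4 ∧ LieAlgebra.IsSemisimple F ↥(fixedSubalgebra θ) ∧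
      Module.finrank F ↥(fixedSubalgebra θ) = 66) :
    Nonempty (Q ≃* Multiplicative ((Fin 3 → ZMod 4) × (Fin 2 → ZMod 2))) := by
  classical
  obtain ⟨θ, hθ, ho, hss, hdim⟩ := h
  haveI : Nontrivial (LieAlgebra.e₈ F) := by
    by_contra hn
    rw [not_nontrivial_iff_subsingleton] at hn
    haveI : Subsingleton ↥(fixedSubalgebra θ) := ⟨fun a b => Subtype.ext (Subsingleton.elim _ _)⟩
    rw [Module.finrank_zero_of_subsingleton] at hdim
    norm_num at hdim
  let D0 := E8P.serreD F
  haveI := E8P.finDim D0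
  haveI := E8P.isKilling D0
  haveI := hQ.1
  haveI : Fintype Q := Fintype.ofFinite _
  letI : CommGroup Q := { (inferInstance : Group Q) with
    mul_comm := fun a b => Subtype.ext (hQ.2.1 a b a.2 b.2) }
  obtain ⟨I, hI⟩ := E8P.exists_I (F := F)
  have h4 : ∀ x, E8P.toLE θ (E8P.toLE θ (E8P.toLE θ (E8P.toLE θ x))) = x := by
    intro x
    have h : θ ^ 4 = 1 := by rw [← ho, pow_orderOf_eq_one]
    have h' := congrArg (fun q : lieAut F (LieAlgebra.e₈ F) => (q : LieAlgebra.e₈ F ≃ₗ[F] LieAlgebra.e₈ F) x) h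
    simp only [pow_succ, pow_zero, one_mul] at h'
    exact h'
  obtain ⟨D, hD⟩ := E8P.kac D0 (E8P.toLE θ) h4 (fixedSubalgebra θ) (fun x => Iff.rfl) hss hdim hI
  obtain ⟨B, rfl⟩ := E8P.exists_B7 D
  have hg : E8P.IsTh B.D (E8P.toLE θ) I := hD
  have hex : ∀ q : Q, ∃ x y c, B.QD (E8P.toLE (q : lieAut F (LieAlgebra.e₈ F))) x y c := by
    intro q
    refine B.exists_QD hI hg fun x => ?_
    exact congrArg (fun q : lieAut F (LieAlgebra.e₈ F) => (q : LieAlgebra.e₈ F ≃ₗ[F] LieAlgebra.e₈ F) x)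
      (hQ.2.1 q θ q.2 hθ)
  choose x y c hqd using hex
  have S : B.SD (fun q : Q => E8P.toLE (q : lieAut F (LieAlgebra.e₈ F))) x y c :=
    { mul := fun p q z => rfl
      qd := hqd
      fix := fun z hz => E8P.fixQ hQ z fun q hq => hz ⟨q, hq⟩ }
  have hinj : ∀ p q : Q, (∀ z, E8P.toLE (p : lieAut F (LieAlgebra.e₈ F)) z = E8P.toLE (q : lieAut F (LieAlgebra.e₈ F)) z) →
      p = q := fun p q hpq => Subtype.ext (Subtype.ext (LinearEquiv.ext hpq))
  obtain ⟨k1, k2⟩ := S.counts hinj hI hg (t := ⟨θ, hθ⟩) rfl (by rw [Subgroup.orderOf_mk]; exact ho)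
  exact E8P.grp Q k1 (S.pow_four hinj) (by convert k2)
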